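/- There exists a C^∞ diffeomorphism F : ℝ² → ℝ² with F(x+v) = F(x)+v for all v ∈ ℤ², preserving Lebesgue measure, such that the induced torus diffeomorphism f : 𝕋² → 𝕋² is an irrotational pseudo-rotation (lim_{n→∞}(Fⁿ(x)−x)/n = 0 for all x ∈ ℝ²), f is ergodic with respect to Lebesgue measure on 𝕋², and for Lebesgue-almost every x ∈ ℝ² the forward F-orbit of x accumulates at infinity in every direction: for every unit vector u ∈ S¹ there is a sequence n_k with |F^{n_k}(x)| → ∞ and (F^{n_k}(x) − x)/|F^{n_k}(x) − x| → u. -/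

import Mathlib

open Filter Topology Set Function MeasureTheory

noncomputable section

/-- The torus 𝕋² = ℝ²/ℤ². -/
abbrev T2 : Type := AddCircle (1 : ℝ) × AddCircle (1 : ℝ)

/-- The canonical projection π : ℝ² → 𝕋². -/
def proj : ℝ × ℝ → T2 := fun p => ((p.1 : AddCircle (1 : ℝ)), (p.2 : AddCircle (1 : ℝ)))


/-! ## Part 1 -/
open Filter Topology Set Function MeasureTheory
noncomputable section

/-! ## Basics: unit square, periodic functions -/

/-- Lebesgue measure on the unit interval. -/
abbrev I1 : Measure ℝ := volume.restrict (Ioc 0 1)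

/-- Lebesgue measure on the unit square. -/
abbrev muQ : Measure (ℝ × ℝ) := I1.prod I1

instance I1_prob : IsProbabilityMeasure I1 := ⟨by simp [I1]⟩

lemma muQ_eq : muQ = volume.restrict (Ioc (0:ℝ) 1 ×ˢ Ioc (0:ℝ) 1) := by
  rw [muQ, Measure.prod_restrict]; rfl

/-- ℤ²-periodic functions. -/
structure Per {α : Type*} (u : ℝ × ℝ → α) : Prop where
  l : ∀ x y, u (x + 1, y) = u (x, y)
  r : ∀ x y, u (x, y + 1) = u (x, y)

lemma Per.comp {α β : Type*} {u : ℝ × ℝ → α} (h : Per u) (k : α → β) : Per (fun z => k (u z)) :=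
  ⟨fun x y => by simp only [h.l], fun x y => by simp only [h.r]⟩

lemma Per.comp2 {α β γ : Type*} {u : ℝ × ℝ → α} {w : ℝ × ℝ → β} (h : Per u) (h' : Per w)
    (k : α → β → γ) : Per (fun z => k (u z) (w z)) :=
  ⟨fun x y => by simp only [h.l, h'.l], fun x y => by simp only [h.r, h'.r]⟩

lemma Per.swap {α : Type*} {u : ℝ × ℝ → α} (h : Per u) : Per (fun z => u z.swap) :=
  ⟨fun x y => h.r y x, fun x y => h.l y x⟩

lemma Per.int {α : Type*} {u : ℝ × ℝ → α} (h : Per u) (m n : ℤ) (x y : ℝ) :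
    u (x + m, y + n) = u (x, y) := by
  have hl : ∀ y, Function.Periodic (fun x => u (x, y)) 1 := fun y x => h.l x y
  have hr : ∀ x, Function.Periodic (fun y => u (x, y)) 1 := fun x y => h.r x y
  have h1 := (hl (y + n)).int_mul m x
  have h2 := (hr x).int_mul n y
  simp only [mul_one] at h1 h2
  rw [h1, h2]

lemma Per.fract {α : Type*} {u : ℝ × ℝ → α} (h : Per u) (z : ℝ × ℝ) :
    u z = u (Int.fract z.1, Int.fract z.2) := by
  have := h.int (⌊z.1⌋) (⌊z.2⌋) (Int.fract z.1) (Int.fract z.2)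
  rw [← this, Int.fract_add_floor, Int.fract_add_floor]

/-- continuous periodic functions are bounded -/
lemma Per.bdd {u : ℝ × ℝ → ℝ} (h : Per u) (hc : Continuous u) : ∃ C, 0 < C ∧ ∀ z, |u z| ≤ C := by
  obtain ⟨C, hC⟩ := (isCompact_Icc.prod isCompact_Icc :
    IsCompact (Icc (0:ℝ) 1 ×ˢ Icc (0:ℝ) 1)).exists_bound_of_continuousOn hc.continuousOn
  refine ⟨max C 1, by positivity, fun z => ?_⟩
  rw [h.fract z]
  exact (hC _ ⟨⟨Int.fract_nonneg _, (Int.fract_lt_one _).le⟩,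
    ⟨Int.fract_nonneg _, (Int.fract_lt_one _).le⟩⟩).trans (le_max_left _ _)

lemma lint_shift {u : ℝ → ENNReal} (hu : Function.Periodic u 1) (c : ℝ) :
    ∫⁻ x, u (x + c) ∂I1 = ∫⁻ x, u x ∂I1 := by
  have e1 : ∫⁻ x in Ioc 0 1, u (x + c) = ∫⁻ x in Ioc c (c + 1), u x := by
    have := (measurePreserving_add_right volume c).setLIntegral_comp_emb
      (measurableEmbedding_addRight c) u (Ioc 0 1)
    rw [this]; simp [add_comm]
  rw [e1]
  have := (isAddFundamentalDomain_Ioc (T := 1) one_pos c volume).setLIntegral_eq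
    (isAddFundamentalDomain_Ioc (T := 1) one_pos 0 volume) u (by
      rintro ⟨g, hg⟩ x
      obtain ⟨n, rfl⟩ := AddSubgroup.mem_zmultiples_iff.1 hg
      have := hu.int_mul n x
      simp only [mul_one] at this
      change u (n • (1:ℝ) + x) = u x
      rw [add_comm]; simpa using this)
  simpa using this

/-- The basic twist map. -/
def gm (φ : ℝ → ℝ) (e : ℝ) (p : ℝ × ℝ) : ℝ × ℝ := (p.2, p.1 + e * φ p.2)

/-- Standing assumptions on the twist profile. -/
structure PhiD (φ : ℝ → ℝ) : Prop where
  smooth : ContDiff ℝ (⊤ : ℕ∞) φ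
  half : ∀ y, φ (y + 1/2) = φ y + 1/2
  odd : ∀ y, φ (-y) = - φ y
  nonneg : ∀ y, 0 ≤ deriv φ y
  pos : ∀ y, deriv φ y = 0 → ∃ k : ℤ, y = k / 2

lemma PhiD.one {φ : ℝ → ℝ} (h : PhiD φ) (y : ℝ) : φ (y + 1) = φ y + 1 := by
  have h1 := h.half (y + 1/2)
  have h2 := h.half y
  rw [show y + 1/2 + 1/2 = y + 1 by ring] at h1
  linarith

lemma Per.gm {α : Type*} {u : ℝ × ℝ → α} (h : Per u) {φ : ℝ → ℝ} (hφ : PhiD φ) {e : ℝ}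
    (he : e = 1 ∨ e = -1) : Per (fun z => u (gm φ e z)) := by
  refine ⟨fun x y => ?_, fun x y => ?_⟩
  · simp only [_root_.gm]; rw [show x + 1 + e * φ y = x + e * φ y + 1 by ring, h.r]
  · simp only [_root_.gm]
    rw [hφ.one, h.l]
    rcases he with rfl | rfl
    · rw [show x + 1 * (φ y + 1) = x + 1 * φ y + 1 by ring, h.r]
    · rw [← h.r]; congr 2; ring

lemma gm_cont {φ : ℝ → ℝ} (hφ : Continuous φ) (e : ℝ) : Continuous (gm φ e) := by
  unfold gm; fun_prop

lemma lint_swap {u : ℝ × ℝ → ENNReal} (hu : Measurable u) :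
    ∫⁻ z, u z.swap ∂muQ = ∫⁻ z, u z ∂muQ := by
  exact (Measure.measurePreserving_swap (μ := I1) (ν := I1)).lintegral_comp hu

lemma lint_gm {u : ℝ × ℝ → ENNReal} (hu : Measurable u) (hp : Per u) {φ : ℝ → ℝ} (hφ : Continuous φ)
    (e : ℝ) : ∫⁻ z, u (gm φ e z) ∂muQ = ∫⁻ z, u z ∂muQ := by
  have hm : Measurable (fun z => u (gm φ e z)) := hu.comp (gm_cont hφ e).measurable
  rw [lintegral_prod_symm _ hm.aemeasurable, lintegral_prod _ hu.aemeasurable]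
  congr 1; ext y
  simp only [gm]
  exact lint_shift (u := fun x => u (y, x)) (fun x => hp.r y x) _

lemma lint_trans {u : ℝ × ℝ → ENNReal} (hu : Measurable u) (hp : Per u) (c d : ℝ) :
    ∫⁻ z, u (z.1 + c, z.2 + d) ∂muQ = ∫⁻ z, u z ∂muQ := by
  have hm : Measurable (fun z : ℝ × ℝ => u (z.1 + c, z.2 + d)) := hu.comp (by fun_prop)
  rw [lintegral_prod _ hm.aemeasurable, lintegral_prod _ hu.aemeasurable]
  have : ∀ x, ∫⁻ y, u (x + c, y + d) ∂I1 = ∫⁻ y, u (x + c, y) ∂I1 :=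
    fun x => lint_shift (u := fun y => u (x + c, y)) (fun y => hp.r _ y) _
  simp only [this]
  exact lint_shift (u := fun x => ∫⁻ y, u (x, y) ∂I1) (fun x => by simp only [hp.l]) _

/-- continuous functions are integrable on the square -/
lemma intQ {u : ℝ × ℝ → ℝ} (hu : Continuous u) : Integrable u muQ := by
  rw [muQ_eq]
  exact ((hu.locallyIntegrable.integrableOn_isCompact
    (isCompact_Icc.prod isCompact_Icc : IsCompact (Icc (0:ℝ) 1 ×ˢ Icc (0:ℝ) 1)))).mono_set
      (Set.prod_mono Ioc_subset_Icc_self Ioc_subset_Icc_self)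

/-- partial derivatives -/
def px (u : ℝ × ℝ → ℝ) (p : ℝ × ℝ) : ℝ := fderiv ℝ u p (1, 0)
def py (u : ℝ × ℝ → ℝ) (p : ℝ × ℝ) : ℝ := fderiv ℝ u p (0, 1)

lemma px_hasDeriv {u : ℝ × ℝ → ℝ} (hu : ContDiff ℝ 1 u) (x y : ℝ) :
    HasDerivAt (fun x => u (x, y)) (px u (x, y)) x := by
  have h := (hu.differentiable one_ne_zero (x, y)).hasFDerivAt
  have h2 : HasDerivAt (fun x : ℝ => (x, y)) (1, 0) x := (hasDerivAt_id x).prodMk (hasDerivAt_const x y)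
  exact h.comp_hasDerivAt x h2

lemma py_hasDeriv {u : ℝ × ℝ → ℝ} (hu : ContDiff ℝ 1 u) (x y : ℝ) :
    HasDerivAt (fun y => u (x, y)) (py u (x, y)) y := by
  have h := (hu.differentiable one_ne_zero (x, y)).hasFDerivAt
  have h2 : HasDerivAt (fun y : ℝ => (x, y)) (0, 1) y := (hasDerivAt_const y x).prodMk (hasDerivAt_id y)
  exact h.comp_hasDerivAt y h2

lemma px_cont {u : ℝ × ℝ → ℝ} (hu : ContDiff ℝ 1 u) : Continuous (px u) :=
  (hu.continuous_fderiv one_ne_zero).clm_apply continuous_const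
lemma py_cont {u : ℝ × ℝ → ℝ} (hu : ContDiff ℝ 1 u) : Continuous (py u) :=
  (hu.continuous_fderiv one_ne_zero).clm_apply continuous_const

lemma Per.fderiv {u : ℝ × ℝ → ℝ} (h : Per u) : Per (fderiv ℝ u) := by
  refine ⟨fun x y => ?_, fun x y => ?_⟩
  · have : (fun z : ℝ × ℝ => u (z + (1, 0))) = u := by ext ⟨x, y⟩; simp [h.l]
    conv_rhs => rw [← this]
    rw [fderiv_comp_add_right]; simp
  · have : (fun z : ℝ × ℝ => u (z + (0, 1))) = u := by ext ⟨x, y⟩; simp [h.r]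
    conv_rhs => rw [← this]
    rw [fderiv_comp_add_right]; simp

lemma Per.px {u : ℝ × ℝ → ℝ} (h : Per u) : Per (px u) := h.fderiv.comp (fun L => L (1, 0))
lemma Per.py {u : ℝ × ℝ → ℝ} (h : Per u) : Per (py u) := h.fderiv.comp (fun L => L (0, 1))

lemma int_px {u : ℝ × ℝ → ℝ} (hu : ContDiff ℝ 1 u) (hp : Per u) : ∫ z, px u z ∂muQ = 0 := by
  rw [integral_prod_symm _ (intQ (px_cont hu))]
  have : ∀ y, ∫ x, px u (x, y) ∂I1 = 0 := by
    intro y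
    have := intervalIntegral.integral_eq_sub_of_hasDerivAt (a := 0) (b := 1)
      (f := fun x => u (x, y)) (f' := fun x => px u (x, y)) (fun x _ => px_hasDeriv hu x y)
      (((px_cont hu).comp (by fun_prop)).intervalIntegrable _ _)
    rw [intervalIntegral.integral_of_le zero_le_one] at this
    rw [this]
    have := hp.l 0 y
    simp only [zero_add] at this
    simp [this]
  simp [this]

lemma int_py {u : ℝ × ℝ → ℝ} (hu : ContDiff ℝ 1 u) (hp : Per u) : ∫ z, py u z ∂muQ = 0 := by
  rw [integral_prod _ (intQ (py_cont hu))]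
  have : ∀ x, ∫ y, py u (x, y) ∂I1 = 0 := by
    intro x
    have := intervalIntegral.integral_eq_sub_of_hasDerivAt (a := 0) (b := 1)
      (f := fun y => u (x, y)) (f' := fun y => py u (x, y)) (fun y _ => py_hasDeriv hu x y)
      (((py_cont hu).comp (by fun_prop)).intervalIntegrable _ _)
    rw [intervalIntegral.integral_of_le zero_le_one] at this
    rw [this]
    have := hp.r x 0
    simp only [zero_add] at this
    simp [this]
  simp [this]

end

/-! ## Part 2 -/
open Filter Topology Set Function MeasureTheory
noncomputable section
set_option linter.unusedSectionVars false

/-! ## The slope functions -/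

lemma ct_le {n : ℕ∞} {E F : Type*} [NormedAddCommGroup E] [NormedSpace ℝ E] [NormedAddCommGroup F]
    [NormedSpace ℝ F] {u : E → F} (h : ContDiff ℝ (⊤ : ℕ∞) u) : ContDiff ℝ n u :=
  h.of_le (by exact_mod_cast le_top)

lemma ct_one {E F : Type*} [NormedAddCommGroup E] [NormedSpace ℝ E] [NormedAddCommGroup F]
    [NormedSpace ℝ F] {u : E → F} (h : ContDiff ℝ (⊤ : ℕ∞) u) : ContDiff ℝ 1 u :=
  h.of_le (by exact_mod_cast le_top)

lemma ct_deriv {u : ℝ → ℝ} (h : ContDiff ℝ (⊤ : ℕ∞) u) : ContDiff ℝ (⊤ : ℕ∞) (deriv u) :=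
  (contDiff_infty_iff_deriv.1 h).2

lemma glaeser {a : ℝ → ℝ} (ha : ContDiff ℝ (⊤ : ℕ∞) a) (h0 : ∀ y, 0 ≤ a y) {K : ℝ} (hK : 0 < K)
    (hb : ∀ y, |deriv (deriv a) y| ≤ K) (y : ℝ) : |deriv a y| ≤ 2 * √K * √(a y) := by
  have hd : ∀ y, DifferentiableAt ℝ a y := fun y => (ct_one ha).differentiable one_ne_zero y
  have hd' : ∀ y, DifferentiableAt ℝ (deriv a) y :=
    fun y => (ct_one (ct_deriv ha)).differentiable one_ne_zero y
  have lip : ∀ x z, |deriv a z - deriv a x| ≤ K * |z - x| := by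
    intro x z
    exact convex_univ.norm_image_sub_le_of_norm_deriv_le (fun y _ => hd' y) (fun y _ => hb y)
      (mem_univ x) (mem_univ z)
  have key : ∀ H, 0 ≤ a y + deriv a y * H + K * H ^ 2 := by
    intro H
    have h1 := (convex_closedBall (0:ℝ) |H|).norm_image_sub_le_of_norm_hasDerivWithin_le
      (f := fun h => a (y + h) - deriv a y * h) (f' := fun h => deriv a (y + h) - deriv a y)
      (C := K * |H|) (x := 0) (y := H) (fun h _ => by
        have h1 : HasDerivAt (fun h => a (y + h)) (deriv a (y + h)) h := by
          have := ((hd (y + h)).hasDerivAt).comp_const_add y h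
          simpa using this
        have h2 : HasDerivAt (fun h => deriv a y * h) (deriv a y) h := by
          simpa using (hasDerivAt_id h).const_mul (deriv a y)
        exact (h1.sub h2).hasDerivWithinAt) (fun h hh => by
        have := lip y (y + h)
        simp only [add_sub_cancel_left] at this
        rw [Real.norm_eq_abs]
        refine this.trans (mul_le_mul_of_nonneg_left ?_ hK.le)
        simpa using hh) (by simp) (by simp)
    simp only [add_zero, mul_zero, sub_zero, Real.norm_eq_abs] at h1
    have h2 := le_trans (le_abs_self _) h1
    have h3 : K * |H| * |H| = K * H ^ 2 := by rw [mul_assoc, abs_mul_abs_self]; ring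
    rw [h3] at h2
    linarith [h0 (y + H)]
  have h := key (-(deriv a y) / (2 * K))
  have h4 : (deriv a y) ^ 2 ≤ 4 * K * a y := by
    have : a y + deriv a y * (-(deriv a y) / (2 * K)) + K * (-(deriv a y) / (2 * K)) ^ 2
      = a y - (deriv a y) ^ 2 / (4 * K) := by field_simp; ring
    rw [this] at h
    have h5 : (deriv a y) ^ 2 / (4 * K) ≤ a y := by linarith
    rw [div_le_iff₀ (by positivity)] at h5
    linarith
  refine abs_le_of_sq_le_sq ?_ (by positivity)
  rw [mul_pow, mul_pow, Real.sq_sqrt hK.le, Real.sq_sqrt (h0 y)]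
  linarith

lemma per_deriv {φ : ℝ → ℝ} (hφ : PhiD φ) (y : ℝ) : deriv φ (y + 1) = deriv φ y := by
  have : (fun y => φ (y + 1)) = fun y => φ y + 1 := by ext y; exact hφ.one y
  have h1 := congrFun (congrArg deriv this) y
  rw [deriv_comp_add_const, deriv_add_const] at h1
  exact h1

lemma per_deriv2 {u : ℝ → ℝ} (hu : ∀ y, u (y + 1) = u y) (y : ℝ) : deriv u (y + 1) = deriv u y := by
  have : (fun y => u (y + 1)) = u := by ext y; exact hu y
  have h1 := congrFun (congrArg deriv this) y
  rw [deriv_comp_add_const] at h1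
  exact h1

lemma per_bdd {u : ℝ → ℝ} (hu : ∀ y, u (y + 1) = u y) (hc : Continuous u) :
    ∃ C, 1 ≤ C ∧ ∀ z, |u z| ≤ C := by
  obtain ⟨C, hC, h⟩ := Per.bdd (u := fun z => u z.2) ⟨fun x y => rfl, fun x y => hu y⟩ (by fun_prop)
  exact ⟨max C 1, le_max_right _ _, fun z => (h (0, z)).trans (le_max_left _ _)⟩

section tt
variable (φ : ℝ → ℝ) (e : ℝ)

/-- approximate stable slopes -/
def tt : ℕ → ℝ × ℝ → ℝ
  | 0 => fun _ => 1
  | n + 1 => fun p => deriv φ p.2 + (tt n (gm φ e p))⁻¹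

/-- real bound for logarithmic derivatives of slopes -/
def EE : ℕ → ℝ × ℝ → ℝ
  | 0 => fun _ => 0
  | n + 1 => fun p => |deriv (deriv φ) p.2| / (tt φ e (n+1) p * (1 + tt φ e (n+1) p))
      + (1 - deriv φ p.2 / (1 + tt φ e (n+1) p)) * EE n (gm φ e p)

/-- running maximum -/
def MM : ℕ → ℝ × ℝ → ℝ
  | 0 => fun _ => 1
  | n + 1 => fun p => max (MM n p) (tt φ e (n+1) p)

/-- recurrence weight -/
def qq (p : ℝ × ℝ) : ℝ := deriv φ p.2 * deriv φ (p.1 + e * φ p.2)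

variable {φ e}
variable (hφ : PhiD φ) (he : e = 1 ∨ e = -1)
include hφ

lemma tt_pos (n : ℕ) (p : ℝ × ℝ) : 0 < tt φ e n p := by
  induction n generalizing p with
  | zero => simp [tt]
  | succ n ih => exact add_pos_of_nonneg_of_pos (hφ.nonneg _) (inv_pos.2 (ih _))

lemma gm_smooth : ContDiff ℝ (⊤ : ℕ∞) (gm φ e) := by
  unfold gm
  exact contDiff_snd.prodMk (contDiff_fst.add (contDiff_const.mul (hφ.smooth.comp contDiff_snd)))

lemma tt_smooth (n : ℕ) : ContDiff ℝ (⊤ : ℕ∞) (tt φ e n) := by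
  induction n with
  | zero => exact contDiff_const
  | succ n ih =>
    exact ((ct_deriv hφ.smooth).comp contDiff_snd).add
      ((ih.comp (gm_smooth hφ)).inv (fun p => (tt_pos hφ n _).ne'))

lemma px_gm {u : ℝ × ℝ → ℝ} (hu : ContDiff ℝ 1 u) (p : ℝ × ℝ) :
    px (fun z => u (gm φ e z)) p = py u (gm φ e p) := by
  have h1 : DifferentiableAt ℝ u (gm φ e p) := hu.differentiable one_ne_zero _
  obtain ⟨x, y⟩ := p
  have h2 : HasDerivAt (fun x : ℝ => gm φ e (x, y)) (0, 1) x := by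
    exact (hasDerivAt_const x y).prodMk ((hasDerivAt_id' x).add_const (e * φ y))
  have h3 := h1.hasFDerivAt.comp_hasDerivAt x h2
  have h4 := px_hasDeriv (u := fun z => u (gm φ e z)) (hu.comp (ct_one (gm_smooth hφ))) x y
  exact h4.unique h3

lemma py_gm {u : ℝ × ℝ → ℝ} (hu : ContDiff ℝ 1 u) (p : ℝ × ℝ) :
    py (fun z => u (gm φ e z)) p = px u (gm φ e p) + e * deriv φ p.2 * py u (gm φ e p) := by
  have h1 : DifferentiableAt ℝ u (gm φ e p) := hu.differentiable one_ne_zero _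
  obtain ⟨x, y⟩ := p
  have hd : HasDerivAt φ (deriv φ y) y := ((ct_one hφ.smooth).differentiable one_ne_zero y).hasDerivAt
  have h2 : HasDerivAt (fun y : ℝ => gm φ e (x, y)) (1, e * deriv φ y) y := by
    exact (hasDerivAt_id' y).prodMk ((hd.const_mul e).const_add x)
  have h3 := h1.hasFDerivAt.comp_hasDerivAt y h2
  have h4 := py_hasDeriv (u := fun z => u (gm φ e z)) (hu.comp (ct_one (gm_smooth hφ))) x y
  rw [h4.unique h3]
  have : ((1, e * deriv φ y) : ℝ × ℝ) = (1, 0) + (e * deriv φ y) • (0, 1) := by simp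
  rw [this, map_add, map_smul]; rfl

lemma px_tt (n : ℕ) (p : ℝ × ℝ) : px (tt φ e (n+1)) p =
    - (tt φ e n (gm φ e p))⁻¹ ^ 2 * py (tt φ e n) (gm φ e p) := by
  have hs := ct_one (tt_smooth (e := e) hφ n)
  obtain ⟨x, y⟩ := p
  have h0 := px_hasDeriv (u := fun z => tt φ e n (gm φ e z)) (hs.comp (ct_one (gm_smooth hφ))) x y
  rw [px_gm hφ hs] at h0
  have h1 := (h0.fun_inv (tt_pos hφ n _).ne').const_add (deriv φ y)
  have h2 := px_hasDeriv (ct_one (tt_smooth (e := e) hφ (n+1))) x y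
  rw [h2.unique h1]
  field_simp

lemma py_tt (n : ℕ) (p : ℝ × ℝ) : py (tt φ e (n+1)) p = deriv (deriv φ) p.2
    - (tt φ e n (gm φ e p))⁻¹ ^ 2 * (px (tt φ e n) (gm φ e p)
      + e * deriv φ p.2 * py (tt φ e n) (gm φ e p)) := by
  have hs := ct_one (tt_smooth (e := e) hφ n)
  obtain ⟨x, y⟩ := p
  have h0 := py_hasDeriv (u := fun z => tt φ e n (gm φ e z)) (hs.comp (ct_one (gm_smooth hφ))) x y
  rw [py_gm hφ hs] at h0
  have hd : HasDerivAt (deriv φ) (deriv (deriv φ) y) y :=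
    ((ct_one (ct_deriv hφ.smooth)).differentiable one_ne_zero y).hasDerivAt
  have h1 := hd.fun_add (h0.fun_inv (tt_pos hφ n _).ne')
  have h2 := py_hasDeriv (ct_one (tt_smooth (e := e) hφ (n+1))) x y
  rw [h2.unique h1]
  field_simp
  ring

lemma tt_succ (n : ℕ) (p : ℝ × ℝ) : tt φ e (n+1) p = deriv φ p.2 + (tt φ e n (gm φ e p))⁻¹ := rfl

lemma EE_nonneg (n : ℕ) (p : ℝ × ℝ) : 0 ≤ EE φ e n p := by
  induction n generalizing p with
  | zero => simp [EE]
  | succ n ih =>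
    have ht := tt_pos (e := e) hφ (n+1) p
    have ht' := inv_pos.2 (tt_pos (e := e) hφ n (gm φ e p))
    refine add_nonneg (by positivity) (mul_nonneg ?_ (ih _))
    rw [sub_nonneg, div_le_one (by linarith)]
    rw [tt_succ hφ]; linarith

include he in
lemma EE_bound (n : ℕ) (p : ℝ × ℝ) : |px (tt φ e n) p| ≤ (1 + tt φ e n p) * EE φ e n p ∧
    |py (tt φ e n) p| ≤ tt φ e n p * ((1 + tt φ e n p) * EE φ e n p) := by
  induction n generalizing p with
  | zero =>
    have h : tt φ e 0 = fun _ => 1 := rfl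
    simp [h, px, py, EE]
  | succ n ih =>
    obtain ⟨i1, i2⟩ := ih (gm φ e p)
    have ht := tt_pos (e := e) hφ (n+1) p
    have ht' := tt_pos (e := e) hφ n (gm φ e p)
    have hE := EE_nonneg (e := e) hφ n (gm φ e p)
    have ha := hφ.nonneg p.2
    have hs := tt_succ (e := e) hφ n p
    have key : (1 + tt φ e (n+1) p) * EE φ e (n+1) p = |deriv (deriv φ) p.2| / tt φ e (n+1) p
        + (tt φ e n (gm φ e p))⁻¹ * ((1 + tt φ e n (gm φ e p)) * EE φ e n (gm φ e p)) := by
      have h1 : (1 + tt φ e (n+1) p) ≠ 0 := by positivity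
      have h2 : (1 + tt φ e (n+1) p) * (1 - deriv φ p.2 / (1 + tt φ e (n+1) p))
        = (tt φ e n (gm φ e p))⁻¹ * (1 + tt φ e n (gm φ e p)) := by
        rw [mul_sub, mul_div_cancel₀ _ h1, mul_add, inv_mul_cancel₀ ht'.ne', hs]; ring
      rw [← mul_assoc, ← h2]
      simp only [EE]
      field_simp
    set t := tt φ e (n+1) p
    set τ := tt φ e n (gm φ e p)
    set B := (1 + τ) * EE φ e n (gm φ e p)
    have hB : 0 ≤ B := by positivity
    constructor
    · rw [key, px_tt hφ, abs_mul, abs_neg, abs_of_nonneg (by positivity)]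
      have : τ⁻¹ ^ 2 * |py (tt φ e n) (gm φ e p)| ≤ τ⁻¹ ^ 2 * (τ * B) := by gcongr
      have h3 : τ⁻¹ ^ 2 * (τ * B) = τ⁻¹ * B := by field_simp
      have : 0 ≤ |deriv (deriv φ) p.2| / t := by positivity
      linarith
    · rw [key, py_tt hφ]
      have hee : |e| = 1 := by rcases he with rfl | rfl <;> simp
      have h1 : |px (tt φ e n) (gm φ e p) + e * deriv φ p.2 * py (tt φ e n) (gm φ e p)| ≤
          B + deriv φ p.2 * (τ * B) := by
        refine (abs_add_le _ _).trans (add_le_add i1 ?_)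
        rw [abs_mul, abs_mul, hee, one_mul, abs_of_nonneg ha]
        gcongr
      have h2 : |deriv (deriv φ) p.2 - τ⁻¹ ^ 2 * (px (tt φ e n) (gm φ e p)
          + e * deriv φ p.2 * py (tt φ e n) (gm φ e p))| ≤ |deriv (deriv φ) p.2| +
          τ⁻¹ ^ 2 * (B + deriv φ p.2 * (τ * B)) := by
        refine (abs_sub _ _).trans (add_le_add le_rfl ?_)
        rw [abs_mul, abs_of_nonneg (by positivity : (0:ℝ) ≤ τ⁻¹ ^ 2)]
        gcongr
      refine h2.trans (le_of_eq ?_)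
      rw [mul_add t, mul_div_cancel₀ _ ht.ne']
      congr 1
      rw [hs]; field_simp; ring

lemma MM_one_le (n : ℕ) (p : ℝ × ℝ) : 1 ≤ MM φ e n p := by
  induction n with
  | zero => simp [MM]
  | succ n ih => exact ih.trans (le_max_left _ _)

lemma MM_mono (p : ℝ × ℝ) : Monotone (fun n => MM φ e n p) :=
  monotone_nat_of_le_succ (fun _ => le_max_left _ _)

lemma tt_le_MM (n J : ℕ) (h : n ≤ J) (p : ℝ × ℝ) : tt φ e n p ≤ MM φ e J p := by
  refine le_trans ?_ (MM_mono hφ p h)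
  cases n with
  | zero => simp [tt, MM]
  | succ n => exact le_max_right _ _

omit hφ in
lemma MM_le (J : ℕ) (p : ℝ × ℝ) (B : ℝ) (h : ∀ n ≤ J, tt φ e n p ≤ B) : MM φ e J p ≤ B := by
  induction J with
  | zero => simpa [tt, MM] using h 0 le_rfl
  | succ J ih => exact max_le (ih (fun n hn => h n (by omega))) (h _ le_rfl)

lemma MM_cont (n : ℕ) : Continuous (MM φ e n) := by
  induction n with
  | zero => exact continuous_const
  | succ n ih => exact ih.max (tt_smooth hφ (n+1)).continuous

include he in
lemma tt_per (n : ℕ) : Per (tt φ e n) := by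
  induction n with
  | zero => exact ⟨fun _ _ => rfl, fun _ _ => rfl⟩
  | succ n ih =>
    have h1 : Per (fun p : ℝ × ℝ => deriv φ p.2) := ⟨fun _ _ => rfl, fun _ y => per_deriv hφ y⟩
    exact h1.comp2 (ih.gm hφ he) (fun a b => a + b⁻¹)

include he in
lemma MM_per (n : ℕ) : Per (MM φ e n) := by
  induction n with
  | zero => exact ⟨fun _ _ => rfl, fun _ _ => rfl⟩
  | succ n ih => exact ih.comp2 (tt_per hφ he (n+1)) max

lemma gm2_fst (p : ℝ × ℝ) : (gm φ e (gm φ e p)).1 = (gm φ e p).2 := rfl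

lemma MM_key (J : ℕ) (p : ℝ × ℝ) :
    MM φ e (J+2) p + deriv φ (gm φ e (gm φ e p)).1 * (MM φ e J (gm φ e (gm φ e p)))^2 /
      (1 + deriv φ (gm φ e (gm φ e p)).1 * MM φ e J (gm φ e (gm φ e p))) ≤
    deriv φ p.2 + deriv φ (gm φ e (gm φ e p)).1 + MM φ e J (gm φ e (gm φ e p)) := by
  rw [gm2_fst hφ]
  set a0 := deriv φ p.2
  set a1 := deriv φ (gm φ e p).2
  set M := MM φ e J (gm φ e (gm φ e p))
  have h0 : 0 ≤ a0 := hφ.nonneg _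
  have h1 : 0 ≤ a1 := hφ.nonneg _
  have hM : 1 ≤ M := MM_one_le hφ _ _
  have e1 : M - a1 * M ^ 2 / (1 + a1 * M) = M / (1 + a1 * M) := by field_simp; ring
  have hb : 1 ≤ a1 + M / (1 + a1 * M) := by
    have : 1 / (1 + a1) ≤ M / (1 + a1 * M) := by
      rw [div_le_div_iff₀ (by positivity) (by positivity)]; nlinarith
    have : 1 ≤ a1 + 1 / (1 + a1) := by
      rw [← sub_nonneg, show a1 + 1/(1+a1) - 1 = a1^2/(1+a1) by field_simp; ring]; positivity
    linarith
  suffices h : MM φ e (J+2) p ≤ a0 + (a1 + M / (1 + a1 * M)) by linarith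
  refine MM_le _ _ _ (fun n hn => ?_)
  match n, hn with
  | 0, _ => simp only [tt]; linarith
  | 1, _ => simp only [tt, inv_one]; change a0 + 1 ≤ _; linarith
  | n + 2, hn =>
    rw [tt_succ hφ, tt_succ hφ]
    have ht := tt_pos (e := e) hφ n (gm φ e (gm φ e p))
    have htM : tt φ e n (gm φ e (gm φ e p)) ≤ M := tt_le_MM hφ _ _ (by omega) _
    set t := tt φ e n (gm φ e (gm φ e p))
    change a0 + (a1 + t⁻¹)⁻¹ ≤ _
    have : (a1 + t⁻¹)⁻¹ ≤ M / (1 + a1 * M) := by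
      rw [show (a1 + t⁻¹)⁻¹ = t / (1 + a1 * t) by field_simp; ring,
        div_le_div_iff₀ (by positivity) (by positivity)]
      nlinarith
    linarith

end tt
end

/-! ## Part 3 -/
open Filter Topology Set Function MeasureTheory
noncomputable section
set_option linter.unusedSectionVars false

/-! ## Integral estimates -/

section est
variable {φ : ℝ → ℝ} {e : ℝ}
variable (hφ : PhiD φ) (he : e = 1 ∨ e = -1) {A : ℝ} (hA1 : 1 ≤ A) (hA : ∀ y, deriv φ y ≤ A)
include hφ

lemma aper1 : Per (fun p : ℝ × ℝ => deriv φ p.1) := ⟨fun x _ => per_deriv hφ x, fun _ _ => rfl⟩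
lemma aper2 : Per (fun p : ℝ × ℝ => deriv φ p.2) := ⟨fun _ _ => rfl, fun _ y => per_deriv hφ y⟩
lemma acont : Continuous (deriv φ) := (ct_deriv hφ.smooth).continuous

lemma gmm : Measurable (gm φ e) := (gm_cont hφ.smooth.continuous e).measurable

include he hA1 hA in
lemma M_int (J : ℕ) : ∫⁻ z, ENNReal.ofReal (deriv φ z.1 * (MM φ e J z)^2 /
      (1 + deriv φ z.1 * MM φ e J z)) ∂muQ ≤ ENNReal.ofReal (2 * A) := by
  have ac := acont hφ
  have Mc := fun n => MM_cont (e := e) hφ n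
  have Mp := fun n => MM_per (e := e) hφ he n
  set k : ℝ × ℝ → ENNReal := fun z => ENNReal.ofReal (deriv φ z.1 * (MM φ e J z)^2 /
      (1 + deriv φ z.1 * MM φ e J z)) with hk
  have km : Measurable k := by
    have := (Mc J).measurable
    have := ac.measurable
    apply Measurable.ennreal_ofReal; fun_prop
  have kp : Per k := (aper1 hφ).comp2 (Mp J) (fun a M => ENNReal.ofReal (a * M^2 / (1 + a * M)))
  set m : ℕ → ℝ × ℝ → ENNReal := fun n z => ENNReal.ofReal (MM φ e n z)
  have mm : ∀ n, Measurable (m n) := fun n => (Mc n).measurable.ennreal_ofReal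
  have mp : ∀ n, Per (m n) := fun n => (Mp n).comp _
  have h1 : ∀ p, m (J+2) p + k (gm φ e (gm φ e p)) ≤
      ENNReal.ofReal (2 * A) + m J (gm φ e (gm φ e p)) := by
    intro p
    have hk := MM_key (e := e) hφ J p
    have h0 : 0 ≤ MM φ e J (gm φ e (gm φ e p)) := zero_le_one.trans (MM_one_le hφ _ _)
    have h0' : 0 ≤ MM φ e (J+2) p := zero_le_one.trans (MM_one_le hφ _ _)
    have ha := hφ.nonneg (gm φ e (gm φ e p)).1
    simp only [m, k]
    rw [← ENNReal.ofReal_add h0' (by positivity), ← ENNReal.ofReal_add (by positivity) h0]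
    apply ENNReal.ofReal_le_ofReal
    linarith [hA p.2, hA (gm φ e (gm φ e p)).1]
  have hg := gmm (e := e) hφ
  have hc := hφ.smooth.continuous
  have i2 : ∀ u : ℝ × ℝ → ENNReal, Measurable u → Per u →
      ∫⁻ z, u (gm φ e (gm φ e z)) ∂muQ = ∫⁻ z, u z ∂muQ := by
    intro u hu hp
    have hm : Measurable (fun z => u (gm φ e z)) := hu.comp hg
    rw [← lint_gm hu hp hc e]
    exact lint_gm (u := fun z => u (gm φ e z)) hm (hp.gm hφ he) hc e
  have h2 := lintegral_mono (μ := muQ) h1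
  rw [lintegral_add_left (mm _), lintegral_add_left measurable_const, i2 k km kp, i2 _ (mm J) (mp J)] at h2
  have h3 : ∫⁻ z, m J z ∂muQ ≤ ∫⁻ z, m (J+2) z ∂muQ :=
    lintegral_mono (fun z => ENNReal.ofReal_le_ofReal (MM_mono hφ z (by omega)))
  have h4 : ∫⁻ z, m (J+2) z ∂muQ ≠ ⊤ := (intQ (Mc (J+2))).lintegral_lt_top.ne
  have h5 : ∫⁻ z, m (J+2) z ∂muQ + ∫⁻ z, k z ∂muQ ≤ ∫⁻ z, m (J+2) z ∂muQ + ENNReal.ofReal (2*A) := by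
    refine h2.trans ?_
    rw [add_comm]
    gcongr
    simp
  exact (ENNReal.add_le_add_iff_left h4).1 h5

omit hφ in
lemma sqrt_M {a M A : ℝ} (ha : 0 ≤ a) (haA : a ≤ A) (hA1 : 1 ≤ A) (hM : 1 ≤ M) :
    √a * M ≤ 2 * A * (1 + a * M^2 / (1 + a * M)) := by
  have hs := Real.sq_sqrt ha
  have hs0 := Real.sqrt_nonneg a
  rcases le_total (a * M) 1 with h | h
  · have h1 : a * M^2 / 2 ≤ a * M^2 / (1 + a * M) := by
      apply div_le_div_of_nonneg_left (by positivity) (by positivity) (by linarith)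
    have h2 : √a * M ≤ 1/2 + a * M^2 / 2 := by nlinarith [sq_nonneg (√a * M - 1)]
    have h3 : 0 ≤ a * M^2 / (1 + a * M) := by positivity
    nlinarith
  · have h1 : M / 2 ≤ a * M^2 / (1 + a * M) := by
      rw [div_le_div_iff₀ (by positivity) (by positivity)]; nlinarith
    have h2 : √a ≤ A := by
      rw [Real.sqrt_le_left (by linarith)]; nlinarith
    have h3 : √a * M ≤ A * M := by gcongr
    nlinarith

/-- source term -/
def SS (φ : ℝ → ℝ) (e C : ℝ) (p : ℝ × ℝ) : ENNReal :=
  ENNReal.ofReal (C * √(deriv φ p.2)) * ⨆ J, ENNReal.ofReal (MM φ e J (gm φ e p))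

lemma SS_meas (C : ℝ) : Measurable (SS φ e C) := by
  have := (acont hφ).measurable
  have hg := gmm (e := e) hφ
  have Mc := fun n => (MM_cont (e := e) hφ n).measurable
  unfold SS
  refine Measurable.mul (by fun_prop) (Measurable.iSup fun J => ?_)
  exact ((Mc J).comp hg).ennreal_ofReal

include he in
lemma SS_per (C : ℝ) : Per (SS φ e C) :=
  (aper2 hφ).comp2 (⟨fun x y => by simp only [((MM_per hφ he _).gm hφ he).l],
    fun x y => by simp only [((MM_per hφ he _).gm hφ he).r]⟩ :
    Per (fun p => ⨆ J, ENNReal.ofReal (MM φ e J (gm φ e p)))) (fun a b => ENNReal.ofReal (C * √a) * b)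

include he hA1 hA in
lemma SS_int {C : ℝ} (hC : 0 ≤ C) : ∫⁻ z, SS φ e C z ∂muQ ≠ ⊤ := by
  have hm := (acont hφ).measurable
  have hg := gmm (e := e) hφ
  have Mc := fun n => (MM_cont (e := e) hφ n).measurable
  set T : ℝ × ℝ → ENNReal := fun p => ⨆ J, ENNReal.ofReal (C * √(deriv φ p.1)) *
    ENNReal.ofReal (MM φ e J p) with hT
  have hTm : Measurable T := Measurable.iSup fun J => by
    have := Mc J
    fun_prop
  have hTp : Per T := ⟨fun x y => by simp only [hT, (MM_per hφ he _).l, per_deriv hφ],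
    fun x y => by simp only [hT, (MM_per hφ he _).r]⟩
  have e1 : SS φ e C = fun z => T (gm φ e z) := by
    ext z; simp only [SS, hT]; rw [ENNReal.mul_iSup]; rfl
  rw [e1, lint_gm hTm hTp hφ.smooth.continuous]
  rw [hT, lintegral_iSup (fun J => by have := Mc J; fun_prop)
    (fun i j hij z => by
      simp only; gcongr; exact MM_mono hφ z hij)]
  refine ne_top_of_le_ne_top (b := ENNReal.ofReal (C * (2 * A)) * (1 + ENNReal.ofReal (2*A)))
    (ENNReal.mul_ne_top ENNReal.ofReal_ne_top (ENNReal.add_ne_top.2 ⟨ENNReal.one_ne_top, ENNReal.ofReal_ne_top⟩)) (iSup_le fun J => ?_)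
  calc _ ≤ ∫⁻ z, ENNReal.ofReal (C * (2 * A)) * (1 + ENNReal.ofReal (deriv φ z.1 * (MM φ e J z)^2 /
      (1 + deriv φ z.1 * MM φ e J z))) ∂muQ := by
        apply lintegral_mono; intro z
        have h1 := MM_one_le (e := e) hφ J z
        have h0 := hφ.nonneg z.1
        simp only
        rw [← ENNReal.ofReal_mul (by positivity), ← ENNReal.ofReal_one,
          ← ENNReal.ofReal_add (by positivity) (by positivity), ← ENNReal.ofReal_mul (by positivity)]
        apply ENNReal.ofReal_le_ofReal
        have := mul_le_mul_of_nonneg_left (sqrt_M h0 (hA z.1) hA1 h1) hC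
        linarith
    _ ≤ _ := by
        have := Mc J
        rw [lintegral_const_mul _ (by fun_prop), lintegral_add_left measurable_const]
        gcongr
        · simp
        · exact M_int hφ he hA1 hA J

/-- contraction constant -/
def th (A : ℝ) : ℝ := 1 / (2 + A)^2

lemma qq_nonneg (p : ℝ × ℝ) : 0 ≤ qq φ e p := mul_nonneg (hφ.nonneg _) (hφ.nonneg _)

include hA1 hA in
lemma th_le_one (p : ℝ × ℝ) : th A * qq φ e p ≤ 1 := by
  unfold th qq
  have := hφ.nonneg p.2
  have h1 := hφ.nonneg (p.1 + e * φ p.2)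
  rw [div_mul_eq_mul_div, one_mul, div_le_one (by positivity)]
  have : deriv φ p.2 * deriv φ (p.1 + e * φ p.2) ≤ A * A :=
    mul_le_mul (hA _) (hA _) h1 (by linarith)
  nlinarith

include hA1 hA in
lemma th_le (n : ℕ) (p : ℝ × ℝ) : th A * qq φ e p ≤ deriv φ p.2 / (1 + tt φ e (n+1) p) := by
  have h0 := hφ.nonneg p.2
  have h1 : 0 ≤ deriv φ (gm φ e p).2 := hφ.nonneg _
  have hA0 := hA p.2
  have hA1' : deriv φ (gm φ e p).2 ≤ A := hA _
  have ht := tt_pos (e := e) hφ (n+1) p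
  have hq : qq φ e p = deriv φ p.2 * deriv φ (gm φ e p).2 := rfl
  rw [hq, tt_succ hφ]
  set a0 := deriv φ p.2
  set a1 := deriv φ (gm φ e p).2
  have hτ := tt_pos (e := e) hφ n (gm φ e p)
  have : (tt φ e n (gm φ e p))⁻¹ * a1 ≤ A := by
    cases n with
    | zero => simpa [tt] using hA1'
    | succ n =>
      have hτ' := inv_pos.2 (tt_pos (e := e) hφ n (gm φ e (gm φ e p)))
      have : a1 ≤ tt φ e (n+1) (gm φ e p) := by rw [tt_succ hφ]; linarith
      rw [inv_mul_le_iff₀ hτ]; nlinarith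
  have hi := inv_pos.2 hτ
  set i := (tt φ e n (gm φ e p))⁻¹
  unfold th
  rw [div_mul_eq_mul_div, div_le_div_iff₀ (by positivity) (by positivity), one_mul, mul_assoc]
  refine mul_le_mul_of_nonneg_left ?_ h0
  have : a1 * a0 ≤ A * A := mul_le_mul hA1' hA0 h0 (by linarith)
  nlinarith

/-- dominating sequence -/
def DD (φ : ℝ → ℝ) (e θ : ℝ) (S : ℝ × ℝ → ENNReal) : ℕ → ℝ × ℝ → ENNReal
  | 0 => fun _ => 0
  | n + 1 => fun p => S p + ENNReal.ofReal (1 - θ * qq φ e p) * DD φ e θ S n (gm φ e p)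

include hA1 hA in
lemma EE_le_DD {C : ℝ} (hC : ∀ y, |deriv (deriv φ) y| ≤ C * √(deriv φ y)) (n : ℕ) (p : ℝ × ℝ) :
    ENNReal.ofReal (EE φ e n p) ≤ DD φ e (th A) (SS φ e C) n p := by
  induction n generalizing p with
  | zero => simp [EE, DD]
  | succ n ih =>
    have ht := tt_pos (e := e) hφ (n+1) p
    have hτ := tt_pos (e := e) hφ n (gm φ e p)
    have hE := EE_nonneg (e := e) hφ n (gm φ e p)
    simp only [EE, DD]
    have h1 : |deriv (deriv φ) p.2| / (tt φ e (n+1) p * (1 + tt φ e (n+1) p)) ≤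
        C * √(deriv φ p.2) * MM φ e n (gm φ e p) := by
      have h2 : |deriv (deriv φ) p.2| / (tt φ e (n+1) p * (1 + tt φ e (n+1) p)) ≤
        |deriv (deriv φ) p.2| / tt φ e (n+1) p := by
        apply div_le_div_of_nonneg_left (by positivity) ht; nlinarith
      refine h2.trans ?_
      rw [div_eq_mul_inv]
      refine mul_le_mul (hC _) ?_ (by positivity) ((abs_nonneg _).trans (hC _))
      refine le_trans ?_ (tt_le_MM hφ n n le_rfl _)
      rw [inv_le_comm₀ ht hτ, tt_succ hφ]
      linarith [hφ.nonneg p.2]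
    have h3 : 1 - deriv φ p.2 / (1 + tt φ e (n+1) p) ≤ 1 - th A * qq φ e p := by
      linarith [th_le (e := e) hφ hA1 hA n p]
    refine (ENNReal.ofReal_le_ofReal (add_le_add h1 (mul_le_mul_of_nonneg_right h3 hE))).trans ?_
    refine ENNReal.ofReal_add_le.trans (add_le_add ?_ ?_)
    · rw [ENNReal.ofReal_mul ((abs_nonneg _).trans (hC _)), SS]
      gcongr
      exact le_iSup (fun J => ENNReal.ofReal (MM φ e J (gm φ e p))) n
    · rw [ENNReal.ofReal_mul' hE]
      gcongr
      exact ih _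

/-- products of contraction factors -/
def PP (φ : ℝ → ℝ) (e θ : ℝ) : ℕ → ℝ × ℝ → ℝ
  | 0 => fun _ => 1
  | n + 1 => fun p => (1 - θ * qq φ e p) * PP φ e θ n (gm φ e p)

include hA1 hA in
lemma PP_nonneg (n : ℕ) (p : ℝ × ℝ) : 0 ≤ PP φ e (th A) n p := by
  induction n generalizing p with
  | zero => simp [PP]
  | succ n ih => exact mul_nonneg (by linarith [th_le_one (e := e) hφ hA1 hA p]) (ih _)

include hA1 hA in
lemma PP_sum (n : ℕ) (p : ℝ × ℝ) : ∑ k ∈ Finset.range n, ENNReal.ofReal (PP φ e (th A) k p) =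
    DD φ e (th A) (fun _ => 1) n p := by
  induction n generalizing p with
  | zero => simp [DD]
  | succ n ih =>
    simp only [DD]
    rw [Finset.sum_range_succ', ← ih, Finset.mul_sum, add_comm]
    congr 1
    · simp [PP]
    · refine Finset.sum_congr rfl fun k _ => ?_
      rw [PP, ENNReal.ofReal_mul (by linarith [th_le_one (e := e) hφ hA1 hA p])]

lemma qq_cont : Continuous (qq φ e) := by
  have := acont hφ
  have := hφ.smooth.continuous
  unfold qq; fun_prop

include he in
lemma qq_per : Per (qq φ e) :=
  (aper2 hφ).comp2 ((aper2 hφ).gm hφ he) (fun a b => a * b)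

section DD
variable {S : ℝ × ℝ → ENNReal} (hSm : Measurable S) (hSp : Per S) (hSi : ∫⁻ z, S z ∂muQ ≠ ⊤)
include hSm

lemma DD_meas (n : ℕ) (θ : ℝ) : Measurable (DD φ e θ S n) := by
  induction n with
  | zero => exact measurable_const
  | succ n ih =>
    have := (qq_cont (e := e) hφ).measurable
    exact hSm.add (Measurable.mul (by fun_prop) (ih.comp (gmm hφ)))

omit hSm in
include he hSp in
lemma DD_per (n : ℕ) (θ : ℝ) : Per (DD φ e θ S n) := by
  induction n with
  | zero => exact ⟨fun _ _ => rfl, fun _ _ => rfl⟩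
  | succ n ih =>
    exact hSp.comp2 ((qq_per hφ he).comp2 (ih.gm hφ he) (fun a b => ENNReal.ofReal (1 - θ * a) * b))
      (fun a b => a + b)

omit hSm in
lemma DD_mono (θ : ℝ) : Monotone (DD φ e θ S) := by
  refine monotone_nat_of_le_succ fun n => ?_
  induction n with
  | zero => intro p; simp [DD]
  | succ n ih => intro p; simp only [DD]; exact add_le_add le_rfl (mul_le_mul_right (ih _) _)

include he hA1 hA hSp hSi in
lemma DD_int (n : ℕ) : ∫⁻ z, ENNReal.ofReal (th A * qq φ e z) * DD φ e (th A) S n (gm φ e z) ∂muQ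
    ≤ ∫⁻ z, S z ∂muQ ∧ ∫⁻ z, DD φ e (th A) S n z ∂muQ ≠ ⊤ := by
  have qm := (qq_cont (e := e) hφ).measurable
  have id1 : ∀ n z, DD φ e (th A) S (n+1) z + ENNReal.ofReal (th A * qq φ e z) *
      DD φ e (th A) S n (gm φ e z) = S z + DD φ e (th A) S n (gm φ e z) := by
    intro n z
    rw [DD, add_assoc, ← add_mul, ← ENNReal.ofReal_add]
    · simp
    · linarith [th_le_one (e := e) hφ hA1 hA z]
    · exact mul_nonneg (by unfold th; positivity) (qq_nonneg hφ z)
  have Dm := fun n => DD_meas (e := e) hφ hSm n (th A)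
  have Dp := fun n => DD_per hφ he hSp n (th A)
  have id2 : ∀ n, ∫⁻ z, DD φ e (th A) S (n+1) z ∂muQ + ∫⁻ z, ENNReal.ofReal (th A * qq φ e z) *
      DD φ e (th A) S n (gm φ e z) ∂muQ = ∫⁻ z, S z ∂muQ + ∫⁻ z, DD φ e (th A) S n z ∂muQ := by
    intro n
    rw [← lint_gm (Dm n) (Dp n) hφ.smooth.continuous e, ← lintegral_add_left hSm,
      ← lintegral_add_left (Dm _)]
    simp only [id1]
  have fin : ∀ n, ∫⁻ z, DD φ e (th A) S n z ∂muQ ≠ ⊤ := by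
    intro n
    induction n with
    | zero => simp [DD]
    | succ n ih =>
      refine ne_top_of_le_ne_top (b := ∫⁻ z, S z ∂muQ + ∫⁻ z, DD φ e (th A) S n z ∂muQ)
        (ENNReal.add_ne_top.2 ⟨hSi, ih⟩) ?_
      rw [← id2]; exact le_self_add
  refine ⟨?_, fin n⟩
  have h1 : ∫⁻ z, DD φ e (th A) S n z ∂muQ ≤ ∫⁻ z, DD φ e (th A) S (n+1) z ∂muQ :=
    lintegral_mono (DD_mono hφ _ (by omega))
  have h2 : ∫⁻ z, DD φ e (th A) S (n+1) z ∂muQ + ∫⁻ z, ENNReal.ofReal (th A * qq φ e z) *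
      DD φ e (th A) S n (gm φ e z) ∂muQ ≤ ∫⁻ z, DD φ e (th A) S (n+1) z ∂muQ + ∫⁻ z, S z ∂muQ := by
    rw [id2, add_comm]; gcongr
  exact (ENNReal.add_le_add_iff_left (fin _)).1 h2

/-- limit of dominating sequence -/
def Dinf (φ : ℝ → ℝ) (e A : ℝ) (S : ℝ × ℝ → ENNReal) (p : ℝ × ℝ) : ENNReal := ⨆ n, DD φ e (th A) S n p

lemma Dinf_meas : Measurable (Dinf φ e A S) := Measurable.iSup fun n => DD_meas hφ hSm n _

omit hSm in
include he hSp in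
lemma Dinf_per : Per (Dinf φ e A S) :=
  ⟨fun x y => by simp only [Dinf, (DD_per hφ he hSp _ _).l],
    fun x y => by simp only [Dinf, (DD_per hφ he hSp _ _).r]⟩

omit hSm in
include hA1 in
lemma Dinf_le (p : ℝ × ℝ) : Dinf φ e A S p ≤ S p + Dinf φ e A S (gm φ e p) := by
  refine iSup_le fun n => ?_
  cases n with
  | zero => simp [DD]
  | succ n =>
    simp only [DD]
    refine add_le_add le_rfl ?_
    refine le_trans (mul_le_of_le_one_left (zero_le) ?_) (le_iSup (fun n => DD φ e (th A) S n (gm φ e p)) n)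
    rw [ENNReal.ofReal_le_one]
    have : 0 ≤ th A * qq φ e p := mul_nonneg (by unfold th; positivity) (qq_nonneg hφ p)
    linarith

/-- total recurrence weight -/
def QQ (φ : ℝ → ℝ) (e : ℝ) (p : ℝ × ℝ) : ℝ :=
  qq φ e p + qq φ e (gm φ e p) + qq φ e (gm φ e (gm φ e p))

include he hA1 hA hSp hSi in
lemma QQ_int : ∫⁻ z, ENNReal.ofReal (QQ φ e z) * Dinf φ e A S z ∂muQ ≠ ⊤ := by
  have qm := (qq_cont (e := e) hφ).measurable
  have qp := qq_per hφ he
  have hg := gmm (e := e) hφ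
  have hc := hφ.smooth.continuous
  have Dm := Dinf_meas (e := e) (A := A) hφ hSm
  have Dp := Dinf_per (A := A) hφ he hSp
  set D := Dinf φ e A S
  have thp : 0 < th A := by unfold th; positivity
  have h0 : ∫⁻ z, ENNReal.ofReal (qq φ e z) * D (gm φ e z) ∂muQ ≠ ⊤ := by
    have : ∫⁻ z, ENNReal.ofReal (th A * qq φ e z) * D (gm φ e z) ∂muQ ≤ ∫⁻ z, S z ∂muQ := by
      simp only [D, Dinf, ENNReal.mul_iSup]
      have hm1 : ∀ n, Measurable fun z => ENNReal.ofReal (th A * qq φ e z) * DD φ e (th A) S n (gm φ e z) :=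
        fun n => Measurable.mul (by fun_prop) ((DD_meas hφ hSm n _).comp hg)
      rw [lintegral_iSup hm1 (fun i j hij z => mul_le_mul_right (DD_mono hφ _ hij _) _)]
      exact iSup_le fun n => (DD_int hφ he hA1 hA hSm hSp hSi n).1
    simp only [ENNReal.ofReal_mul thp.le, mul_assoc] at this
    have hm2 : Measurable fun z => ENNReal.ofReal (qq φ e z) * D (gm φ e z) :=
      Measurable.mul (by fun_prop) (Dm.comp hg)
    rw [lintegral_const_mul _ hm2] at this
    intro h
    rw [h, ENNReal.mul_top (by simpa using thp)] at this
    exact hSi (top_le_iff.1 this)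
  have step : ∀ w : ℝ × ℝ → ℝ, Continuous w → Per w →
      ∫⁻ z, ENNReal.ofReal (w z) * D (gm φ e z) ∂muQ ≠ ⊤ → ∫⁻ z, ENNReal.ofReal (w z) * D z ∂muQ ≠ ⊤ := by
    intro w wc wp hw
    obtain ⟨C, hC, hb⟩ := wp.bdd wc
    have wm := wc.measurable
    refine ne_top_of_le_ne_top (b := ENNReal.ofReal C * ∫⁻ z, S z ∂muQ +
      ∫⁻ z, ENNReal.ofReal (w z) * D (gm φ e z) ∂muQ)
      (ENNReal.add_ne_top.2 ⟨ENNReal.mul_ne_top (by simp) hSi, hw⟩) ?_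
    rw [← lintegral_const_mul _ hSm, ← lintegral_add_left (hSm.const_mul _)]
    apply lintegral_mono; intro z
    simp only
    calc _ ≤ ENNReal.ofReal (w z) * (S z + D (gm φ e z)) := by gcongr; exact Dinf_le hφ hA1 z
      _ ≤ _ := by rw [mul_add]; gcongr; exact (le_abs_self _).trans (hb z)
  have h1 := step _ (qq_cont hφ) qp h0
  have h2 : ∫⁻ z, ENNReal.ofReal (qq φ e (gm φ e z)) * D z ∂muQ ≠ ⊤ := by
    refine step _ ((qq_cont hφ).comp (gm_cont hc e)) (qp.gm hφ he) ?_
    rw [lint_gm (u := fun z => ENNReal.ofReal (qq φ e z) * D z) (by fun_prop)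
      (qp.comp2 Dp (fun a b => ENNReal.ofReal a * b)) hc]
    exact h1
  have h3 : ∫⁻ z, ENNReal.ofReal (qq φ e (gm φ e (gm φ e z))) * D z ∂muQ ≠ ⊤ := by
    refine step _ (((qq_cont hφ).comp (gm_cont hc e)).comp (gm_cont hc e)) ((qp.gm hφ he).gm hφ he) ?_
    rw [lint_gm (u := fun z => ENNReal.ofReal (qq φ e (gm φ e z)) * D z)
      (Measurable.mul (qm.comp hg).ennreal_ofReal Dm)
      ((qp.gm hφ he).comp2 Dp (fun a b => ENNReal.ofReal a * b)) hc]
    exact h2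
  have e1 : ∀ z, ENNReal.ofReal (QQ φ e z) * D z = ENNReal.ofReal (qq φ e z) * D z +
      ENNReal.ofReal (qq φ e (gm φ e z)) * D z + ENNReal.ofReal (qq φ e (gm φ e (gm φ e z))) * D z := by
    intro z
    rw [QQ, ENNReal.ofReal_add (add_nonneg (qq_nonneg hφ _) (qq_nonneg hφ _)) (qq_nonneg hφ _),
      ENNReal.ofReal_add (qq_nonneg hφ _) (qq_nonneg hφ _), add_mul, add_mul]
  simp only [e1]
  rw [lintegral_add_left, lintegral_add_left]
  · exact ENNReal.add_ne_top.2 ⟨ENNReal.add_ne_top.2 ⟨h1, h2⟩, h3⟩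
  · fun_prop
  · exact Measurable.add (by fun_prop) (Measurable.mul (qm.comp hg).ennreal_ofReal Dm)

end DD
end est
end

/-! ## Part 4 -/
open Filter Topology Set Function MeasureTheory
noncomputable section
set_option linter.unusedSectionVars false

/-- The half-integer lattice. -/
def HLat : Set (ℝ × ℝ) := {p | (∃ k : ℤ, p.1 = k / 2) ∧ ∃ k : ℤ, p.2 = k / 2}

lemma low_bound {w σ : ℝ × ℝ → ℝ} (hw : Continuous w) (hwp : Per w) (h0 : ∀ p, 0 ≤ w p)
    (hL : ∀ p, w p = 0 → p ∈ HLat) (hσ : Continuous σ) (hσp : Per σ) (hσL : ∀ p ∈ HLat, σ p = 0)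
    {δ : ℝ} (hδ : 0 < δ) : ∃ C, 0 < C ∧ ∀ p, δ ≤ σ p → 1 ≤ C * w p := by
  set K : Set (ℝ × ℝ) := (Icc (0:ℝ) 1 ×ˢ Icc (0:ℝ) 1) ∩ {p | δ ≤ σ p}
  have hK : IsCompact K := (isCompact_Icc.prod isCompact_Icc).inter_right (isClosed_le continuous_const hσ)
  have hpos : ∀ p, δ ≤ σ p → 0 < w p := by
    intro p hp
    rcases (h0 p).eq_or_lt with h | h
    · have := hσL p (hL p h.symm); linarith
    · exact h
  have hred : ∀ p, δ ≤ σ p → (Int.fract p.1, Int.fract p.2) ∈ K := by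
    intro p hp
    refine ⟨⟨⟨Int.fract_nonneg _, (Int.fract_lt_one _).le⟩, ⟨Int.fract_nonneg _, (Int.fract_lt_one _).le⟩⟩, ?_⟩
    show δ ≤ σ _
    rw [← hσp.fract]; exact hp
  rcases K.eq_empty_or_nonempty with h | h
  · refine ⟨1, one_pos, fun p hp => ?_⟩
    have := hred p hp; rw [h] at this; exact this.elim
  · obtain ⟨q, hq, hm⟩ := hK.exists_isMinOn h hw.continuousOn
    have hq0 := hpos q hq.2
    refine ⟨(w q)⁻¹, inv_pos.2 hq0, fun p hp => ?_⟩
    have h1 : w q ≤ w (Int.fract p.1, Int.fract p.2) := hm (hred p hp)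
    rw [← hwp.fract] at h1
    rw [← div_eq_inv_mul, one_le_div hq0]; exact h1

section lat
variable {φ : ℝ → ℝ} {e : ℝ}
variable (hφ : PhiD φ) (he : e = 1 ∨ e = -1)
include hφ

lemma phi_half (k : ℤ) : φ ((k:ℝ)/2) = (k:ℝ)/2 := by
  have h0 : φ 0 = 0 := by have := hφ.odd 0; simp at this; linarith
  have hp : Function.Periodic (fun y => φ y - y) (1/2) := fun y => by
    simp only; rw [hφ.half]; ring
  have := hp.int_mul k 0
  simp only [zero_add, h0, sub_zero] at this
  rw [show (k:ℝ) * (1/2) = k/2 by ring] at this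
  linarith

lemma phi_strict : StrictMono φ := by
  have hd : Differentiable ℝ φ := (ct_one hφ.smooth).differentiable one_ne_zero
  have hm : Monotone φ := monotone_of_deriv_nonneg hd hφ.nonneg
  intro a b hab
  rcases (hm hab.le).eq_or_lt with h | h
  · exfalso
    obtain ⟨r, hr, h1, h2⟩ := exists_irrational_btwn hab
    have hev : φ =ᶠ[𝓝 r] fun _ => φ a := by
      filter_upwards [Ioo_mem_nhds h1 h2] with y hy
      exact le_antisymm (by rw [h]; exact hm hy.2.le) (hm hy.1.le)
    have : deriv φ r = 0 := by rw [hev.deriv_eq]; simp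
    obtain ⟨k, hk⟩ := hφ.pos r this
    exact hr ⟨(k:ℚ)/2, by rw [hk]; push_cast; ring⟩
  · exact h

lemma phi_half_inv {y : ℝ} {k : ℤ} (h : φ y = k/2) : y = k/2 :=
  (phi_strict hφ).injective (by rw [h, phi_half hφ])

include he

lemma lat_of_gm {p : ℝ × ℝ} (h : gm φ e p ∈ HLat) : p ∈ HLat := by
  obtain ⟨⟨k, hk⟩, l, hl⟩ := h
  simp only [gm] at hk hl
  refine ⟨?_, k, hk⟩
  rw [hk, phi_half hφ] at hl
  rcases he with rfl | rfl
  · exact ⟨l - k, by push_cast; linarith⟩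
  · exact ⟨l + k, by push_cast; linarith⟩

lemma lat_gm {p : ℝ × ℝ} (h : p ∈ HLat) : gm φ e p ∈ HLat := by
  obtain ⟨⟨k, hk⟩, l, hl⟩ := h
  refine ⟨⟨l, hl⟩, ?_⟩
  simp only [gm, hl, hk, phi_half hφ]
  rcases he with rfl | rfl
  · exact ⟨k + l, by push_cast; ring⟩
  · exact ⟨k - l, by push_cast; ring⟩

lemma lat_two {p : ℝ × ℝ} (h0 : deriv φ p.2 = 0) (h1 : deriv φ (gm φ e p).2 = 0) : p ∈ HLat := by
  obtain ⟨k, hk⟩ := hφ.pos _ h0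
  obtain ⟨l, hl⟩ := hφ.pos _ h1
  exact lat_of_gm hφ he ⟨⟨k, hk⟩, l, hl⟩

lemma lat_three {p : ℝ × ℝ} (h0 : deriv φ p.2 = 0) (h1 : deriv φ (gm φ e (gm φ e p)).2 = 0) :
    p ∈ HLat := by
  obtain ⟨k, hk⟩ := hφ.pos _ h0
  obtain ⟨l, hl⟩ := hφ.pos _ h1
  apply lat_of_gm hφ he
  refine ⟨⟨k, hk⟩, ?_⟩
  have : (gm φ e (gm φ e p)).2 = p.2 + e * φ (gm φ e p).2 := rfl
  rw [this, hk] at hl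
  rcases he with rfl | rfl
  · exact ⟨l - k, phi_half_inv hφ (by push_cast; linarith)⟩
  · exact ⟨k - l, phi_half_inv hφ (by push_cast; linarith)⟩

lemma QQ_zero {p : ℝ × ℝ} (h : QQ φ e p = 0) : p ∈ HLat := by
  have n := fun q => qq_nonneg (e := e) hφ q
  unfold QQ at h
  have h0 : qq φ e p = 0 := by linarith [n p, n (gm φ e p), n (gm φ e (gm φ e p))]
  have h1 : qq φ e (gm φ e p) = 0 := by linarith [n p, n (gm φ e p), n (gm φ e (gm φ e p))]
  have h2 : qq φ e (gm φ e (gm φ e p)) = 0 := by linarith [n p, n (gm φ e p), n (gm φ e (gm φ e p))]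
  have r : ∀ q, qq φ e q = deriv φ q.2 * deriv φ (gm φ e q).2 := fun _ => rfl
  rw [r, mul_eq_zero] at h0 h1 h2
  rcases h0 with h0 | h0
  · rcases h1 with h1 | h1
    · exact lat_two hφ he h0 h1
    · exact lat_three hφ he h0 h1
  · apply lat_of_gm hφ he
    rcases h2 with h2 | h2
    · exact lat_two hφ he h0 h2
    · exact lat_three hφ he h0 h2

lemma aa_zero {p : ℝ × ℝ} (h : deriv φ (gm φ e p).2 + deriv φ (gm φ e (gm φ e (gm φ e p))).2 = 0) :
    p ∈ HLat := by
  have h1 := hφ.nonneg (gm φ e p).2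
  have h2 := hφ.nonneg (gm φ e (gm φ e (gm φ e p))).2
  exact lat_of_gm hφ he (lat_three hφ he (by linarith) (by linarith))

omit he in
lemma tt_mul_le (n : ℕ) (p : ℝ × ℝ) :
    tt φ e (n+2) p * deriv φ (gm φ e p).2 ≤ deriv φ p.2 * deriv φ (gm φ e p).2 + 1 := by
  have h1 := hφ.nonneg (gm φ e p).2
  have ht := tt_pos (e := e) hφ (n+1) (gm φ e p)
  have h2 : deriv φ (gm φ e p).2 ≤ tt φ e (n+1) (gm φ e p) := by
    rw [tt_succ hφ]; linarith [inv_pos.2 (tt_pos (e := e) hφ n (gm φ e (gm φ e p)))]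
  rw [tt_succ hφ, add_mul]
  gcongr
  rw [inv_mul_le_iff₀ ht]; linarith

omit he in
lemma tt_two_le (n : ℕ) (p : ℝ × ℝ) :
    tt φ e (n+2) p ≤ deriv φ p.2 + tt φ e n (gm φ e (gm φ e p)) := by
  have h1 := hφ.nonneg (gm φ e p).2
  have ht := tt_pos (e := e) hφ (n+1) (gm φ e p)
  have ht' := tt_pos (e := e) hφ n (gm φ e (gm φ e p))
  rw [tt_succ hφ]
  gcongr
  rw [inv_le_comm₀ ht ht', tt_succ hφ]
  linarith

lemma box_lemma {σ : ℝ × ℝ → ℝ} (hσ : Continuous σ) (hσp : Per σ) (hσL : ∀ p ∈ HLat, σ p = 0)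
    {δ : ℝ} (hδ : 0 < δ) : ∃ C, 1 ≤ C ∧ ∀ p, δ ≤ σ p → 1 ≤ C * QQ φ e p ∧ ∀ n, tt φ e n p ≤ C := by
  have gc := gm_cont hφ.smooth.continuous e
  have ac := acont hφ
  have qc := qq_cont (e := e) hφ
  have qp := qq_per hφ he
  obtain ⟨C1, hC1, h1⟩ := low_bound (w := QQ φ e) (by unfold QQ; fun_prop)
    ((qp.comp2 (qp.gm hφ he) (fun a b => a + b)).comp2 ((qp.gm hφ he).gm hφ he) (fun a b => a + b))
    (fun p => add_nonneg (add_nonneg (qq_nonneg hφ _) (qq_nonneg hφ _)) (qq_nonneg hφ _))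
    (fun p => QQ_zero hφ he) hσ hσp hσL hδ
  have ap := (aper2 hφ).gm hφ he
  obtain ⟨C2, hC2, h2⟩ := low_bound (w := fun p => deriv φ (gm φ e p).2 +
    deriv φ (gm φ e (gm φ e (gm φ e p))).2)
    ((ac.comp (continuous_snd.comp gc)).add (ac.comp (continuous_snd.comp (gc.comp (gc.comp gc)))))
    (ap.comp2 ((ap.gm hφ he).gm hφ he) (fun a b => a + b))
    (fun p => add_nonneg (hφ.nonneg _) (hφ.nonneg _))
    (fun p => aa_zero hφ he) hσ hσp hσL hδ
  obtain ⟨A, hA1, hA'⟩ := per_bdd (per_deriv hφ) ac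
  have hA : ∀ y, deriv φ y ≤ A := fun y => (le_abs_self _).trans (hA' y)
  obtain ⟨C3, hC3, h3⟩ := (MM_per hφ he 3).bdd (MM_cont (e := e) hφ 3)
  refine ⟨1 + C1 + C3 + C2 * (3 * A^2 + 2), by nlinarith [mul_pos hC2 (by positivity : 0 < 3*A^2+2)], fun p hp => ⟨?_, fun n => ?_⟩⟩
  · have hq : 0 ≤ QQ φ e p := add_nonneg (add_nonneg (qq_nonneg hφ _) (qq_nonneg hφ _)) (qq_nonneg hφ _)
    refine (h1 p hp).trans ?_
    gcongr
    have : 0 < C2 * (3 * A^2 + 2) := by positivity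
    linarith
  · have hpos : 0 < C2 * (3 * A^2 + 2) := by positivity
    rcases Nat.lt_or_ge n 4 with hn | hn
    · have := (tt_le_MM (e := e) hφ n 3 (by omega) p).trans ((le_abs_self _).trans (h3 p))
      linarith
    · obtain ⟨k, rfl⟩ := Nat.exists_eq_add_of_le' hn
      have i1 := tt_mul_le (e := e) hφ (k+2) p
      have i2 := tt_two_le (e := e) hφ (k+2) p
      have i3 := tt_mul_le (e := e) hφ k (gm φ e (gm φ e p))
      have i4 := h2 p hp
      have ht := tt_pos (e := e) hφ (k+4) p
      have n0 := hφ.nonneg p.2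
      have n1 := hφ.nonneg (gm φ e p).2
      have n2 := hφ.nonneg (gm φ e (gm φ e p)).2
      have n3 := hφ.nonneg (gm φ e (gm φ e (gm φ e p))).2
      have m0 := hA p.2
      have m1 := hA (gm φ e p).2
      have m2 := hA (gm φ e (gm φ e p)).2
      have m3 := hA (gm φ e (gm φ e (gm φ e p))).2
      set a0 := deriv φ p.2
      set a1 := deriv φ (gm φ e p).2
      set a2 := deriv φ (gm φ e (gm φ e p)).2
      set a3 := deriv φ (gm φ e (gm φ e (gm φ e p))).2
      set t := tt φ e (k+4) p
      have j1 : t * a1 ≤ A * A + 1 := i1.trans (by gcongr)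
      have j3 : t * a3 ≤ A * A + (A * A + 1) := by
        calc t * a3 ≤ (a0 + tt φ e (k+2) (gm φ e (gm φ e p))) * a3 := by gcongr
          _ ≤ a0 * a3 + (a2 * a3 + 1) := by rw [add_mul]; gcongr
          _ ≤ _ := by gcongr
      have : t ≤ t * (C2 * (a1 + a3)) := by nlinarith
      have : t ≤ C2 * (3 * A^2 + 2) := by nlinarith
      linarith

end lat
end

/-! ## Part 5 -/
open Filter Topology Set Function MeasureTheory
noncomputable section

lemma proj_cont : Continuous proj := by
  unfold proj
  exact ((AddCircle.continuous_mk' 1).comp continuous_fst).prodMk ((AddCircle.continuous_mk' 1).comp continuous_snd)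

lemma proj_mp : MeasurePreserving proj muQ volume := by
  have h := AddCircle.measurePreserving_mk 1 0
  rw [zero_add] at h
  exact h.prod h

lemma proj_surj : Function.Surjective proj := by
  rintro ⟨a, b⟩
  obtain ⟨x, rfl⟩ := QuotientAddGroup.mk_surjective a
  obtain ⟨y, rfl⟩ := QuotientAddGroup.mk_surjective b
  exact ⟨(x, y), rfl⟩

lemma coe_eq_iff {x y : ℝ} : (x : AddCircle (1:ℝ)) = y ↔ ∃ m : ℤ, y = x + m := by
  rw [QuotientAddGroup.eq, AddSubgroup.mem_zmultiples_iff]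
  refine exists_congr fun m => ?_
  simp only [zsmul_eq_mul, mul_one]
  constructor <;> intro h <;> linarith

lemma proj_eq_iff {p q : ℝ × ℝ} : proj p = proj q ↔ ∃ m n : ℤ, q = (p.1 + m, p.2 + n) := by
  unfold proj
  rw [Prod.mk.injEq, coe_eq_iff, coe_eq_iff]
  constructor
  · rintro ⟨⟨m, hm⟩, n, hn⟩; exact ⟨m, n, Prod.ext hm hn⟩
  · rintro ⟨m, n, h⟩; exact ⟨⟨m, by rw [h]⟩, n, by rw [h]⟩

lemma proj_per : Per proj :=
  ⟨fun x y => (proj_eq_iff.2 ⟨1, 0, by simp⟩).symm, fun x y => (proj_eq_iff.2 ⟨0, 1, by simp⟩).symm⟩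

/-- smooth functions on the torus -/
def smoothAlg : Subalgebra ℝ C(T2, ℝ) where
  carrier := {h | ContDiff ℝ (⊤ : ℕ∞) (fun z => h (proj z))}
  mul_mem' {a b} ha hb := by
    show ContDiff ℝ (⊤ : ℕ∞) (fun z => a (proj z) * b (proj z))
    exact ContDiff.mul (id ha) (id hb)
  add_mem' {a b} ha hb := by
    show ContDiff ℝ (⊤ : ℕ∞) (fun z => a (proj z) + b (proj z))
    exact ContDiff.add (id ha) (id hb)
  algebraMap_mem' r := by
    show ContDiff ℝ (⊤ : ℕ∞) (fun _ : ℝ × ℝ => r)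
    exact contDiff_const

/-- trigonometric test functions -/
def tf (b : Bool) (c : Bool) : C(T2, ℝ) where
  toFun z := if b then (if c then ((z.1.toCircle : Circle) : ℂ).re else ((z.1.toCircle : Circle) : ℂ).im)
    else (if c then ((z.2.toCircle : Circle) : ℂ).re else ((z.2.toCircle : Circle) : ℂ).im)
  continuous_toFun := by
    have h : Continuous fun a : AddCircle (1:ℝ) => ((a.toCircle : Circle) : ℂ) :=
      continuous_subtype_val.comp AddCircle.continuous_toCircle
    have h1 := h.comp (continuous_fst : Continuous (Prod.fst : T2 → _))
    have h2 := h.comp (continuous_snd : Continuous (Prod.snd : T2 → _))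
    rcases b <;> rcases c <;> simp only [if_true, Bool.false_eq_true, if_false]
    · exact Complex.continuous_im.comp h2
    · exact Complex.continuous_re.comp h2
    · exact Complex.continuous_im.comp h1
    · exact Complex.continuous_re.comp h1

lemma tf_mem (b c : Bool) : tf b c ∈ smoothAlg := by
  show ContDiff ℝ (⊤ : ℕ∞) (fun z => tf b c (proj z))
  rcases b <;> rcases c <;> simp only [tf, proj, ContinuousMap.coe_mk, if_true, Bool.false_eq_true, if_false,
    AddCircle.toCircle_apply_mk, Circle.coe_exp, Complex.exp_ofReal_mul_I_re, Complex.exp_ofReal_mul_I_im]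
  · exact Real.contDiff_sin.comp (contDiff_const.mul contDiff_snd)
  · exact Real.contDiff_cos.comp (contDiff_const.mul contDiff_snd)
  · exact Real.contDiff_sin.comp (contDiff_const.mul contDiff_fst)
  · exact Real.contDiff_cos.comp (contDiff_const.mul contDiff_fst)

lemma smooth_dense : smoothAlg.topologicalClosure = ⊤ := by
  apply ContinuousMap.subalgebra_topologicalClosure_eq_top_of_separatesPoints
  intro z w hzw
  by_contra hcon
  have key : ∀ b c, tf b c z = tf b c w := by
    intro b c
    by_contra h
    exact hcon ⟨_, ⟨_, tf_mem b c, rfl⟩, h⟩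
  apply hzw
  have k1 := key true true
  have k2 := key true false
  have k3 := key false true
  have k4 := key false false
  simp only [tf, ContinuousMap.coe_mk, if_true, Bool.false_eq_true, if_false] at k1 k2 k3 k4
  refine Prod.ext ?_ ?_
  · exact AddCircle.injective_toCircle one_ne_zero (Circle.ext (Complex.ext k1 k2))
  · exact AddCircle.injective_toCircle one_ne_zero (Circle.ext (Complex.ext k3 k4))

lemma approx {u : ℝ × ℝ → ℝ} (um : Measurable u) (ub : ∀ z, |u z| ≤ 1) {ε : ℝ} (hε : 0 < ε) :
    ∃ h : ℝ × ℝ → ℝ, ContDiff ℝ (⊤ : ℕ∞) h ∧ Per h ∧ (∀ z, |h z| ≤ 2) ∧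
      ∫⁻ z, ENNReal.ofReal |u z - h z| ∂muQ ≤ ENNReal.ofReal ε := by
  set s : AddCircle (1:ℝ) → ℝ := fun a => (AddCircle.measurableEquivIoc 1 0 a : ℝ)
  have sm : Measurable s := measurable_subtype_coe.comp (AddCircle.measurableEquivIoc 1 0).measurable
  have ss : ∀ x ∈ Ioc (0:ℝ) 1, s (x : AddCircle (1:ℝ)) = x := by
    intro x hx
    have hx' : x ∈ Ioc (0:ℝ) (0 + 1) := by simpa using hx
    have := AddCircle.equivIoc_coe_eq (p := (1:ℝ)) hx'
    exact congrArg Subtype.val this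
  set U : T2 → ℝ := fun z => u (s z.1, s z.2)
  have Um : Measurable U := um.comp ((sm.comp measurable_fst).prodMk (sm.comp measurable_snd))
  have Ub : ∀ z, |U z| ≤ 1 := fun z => ub _
  have Ui : Integrable U (volume : Measure T2) :=
    Integrable.of_bound Um.aestronglyMeasurable 1 (ae_of_all _ Ub)
  obtain ⟨G, hG, _⟩ := Ui.exists_boundedContinuous_lintegral_sub_le (ε := ENNReal.ofReal (ε/2))
    (by simpa using hε)
  -- clip
  set H : C(T2, ℝ) := ⟨fun z => max (-1) (min 1 (G z)), by fun_prop⟩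
  have Hb : ∀ z, |H z| ≤ 1 := fun z => abs_le.2 ⟨le_max_left _ _, max_le (by norm_num) (min_le_left _ _)⟩
  have HG : ∀ z, |U z - H z| ≤ |U z - G z| := by
    intro z
    have h1 := abs_le.1 (Ub z)
    show |U z - max (-1) (min 1 (G z))| ≤ _
    rcases le_total (G z) 1 with h | h
    · rw [min_eq_right h]
      rcases le_total (-1) (G z) with h' | h'
      · rw [max_eq_right h']
      · rw [max_eq_left h', abs_of_nonneg (by linarith), abs_of_nonneg (by linarith)]; linarith
    · rw [min_eq_left h, max_eq_right (by norm_num), abs_of_nonpos (by linarith),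
        abs_of_nonpos (by linarith)]; linarith
  have hH : H ∈ smoothAlg.topologicalClosure := by rw [smooth_dense]; trivial
  have hδ : 0 < min (ε/2) 1 := by positivity
  obtain ⟨h, hmem, hd⟩ := Metric.mem_closure_iff.1 (show H ∈ closure (smoothAlg : Set C(T2, ℝ)) from hH) _ hδ
  have hdz : ∀ z, |H z - h z| ≤ min (ε/2) 1 := fun z => by
    have := ContinuousMap.dist_apply_le_dist (f := H) (g := h) z
    rw [Real.dist_eq] at this
    exact this.trans hd.le
  refine ⟨fun z => h (proj z), hmem, proj_per.comp _, fun z => ?_, ?_⟩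
  · have h1 := abs_le.1 (Hb (proj z))
    have h2 := abs_le.1 ((hdz (proj z)).trans (min_le_right _ _))
    exact abs_le.2 ⟨by linarith, by linarith⟩
  · have e1 : ∀ᵐ z ∂muQ, ENNReal.ofReal |u z - h (proj z)| ≤
        ENNReal.ofReal |U (proj z) - G (proj z)| + ENNReal.ofReal (ε/2) := by
      rw [muQ_eq]
      filter_upwards [ae_restrict_mem (measurableSet_Ioc.prod measurableSet_Ioc)] with z hz
      have : U (proj z) = u z := by
        show u (s (z.1 : AddCircle (1:ℝ)), s (z.2 : AddCircle (1:ℝ))) = u z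
        rw [ss _ hz.1, ss _ hz.2]
      rw [← this, ← ENNReal.ofReal_add (abs_nonneg _) (by positivity)]
      apply ENNReal.ofReal_le_ofReal
      calc |U (proj z) - h (proj z)| ≤ |U (proj z) - H (proj z)| + |H (proj z) - h (proj z)| :=
            abs_sub_le _ _ _
        _ ≤ _ := add_le_add (HG _) ((hdz _).trans (min_le_left _ _))
    refine (lintegral_mono_ae e1).trans ?_
    rw [lintegral_add_right _ measurable_const]
    have hmm : Measurable fun z => ENNReal.ofReal |U z - G z| := by
      have := G.continuous.measurable
      exact ((Um.sub this).abs).ennreal_ofReal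
    have e2 := proj_mp.lintegral_comp hmm
    rw [e2]
    have e3 : ∫⁻ z, ENNReal.ofReal |U z - G z| ≤ ENNReal.ofReal (ε/2) := by
      simpa only [← ofReal_norm, Real.norm_eq_abs] using hG
    simp only [lintegral_const, measure_univ, mul_one]
    calc _ ≤ ENNReal.ofReal (ε/2) + ENNReal.ofReal (ε/2) := by gcongr
      _ = _ := by rw [← ENNReal.ofReal_add (by positivity) (by positivity)]; congr 1; ring

end

/-! ## Part 6 -/
open Filter Topology Set Function MeasureTheory
noncomputable section
set_option linter.unusedSectionVars false

lemma absco {W : ℝ × ℝ → ENNReal} (hW : Measurable W) (hWi : ∫⁻ z, W z ∂muQ ≠ ⊤) {ε : ENNReal} (hε : ε ≠ 0) :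
    ∃ δ : ℝ, 0 < δ ∧ ∀ v : ℝ × ℝ → ENNReal, Measurable v → (∀ z, v z ≤ 3) →
      ∫⁻ z, v z ∂muQ ≤ ENNReal.ofReal δ → ∫⁻ z, v z * W z ∂muQ ≤ ε := by
  wlog hεt : ε ≠ ⊤ generalizing ε
  · obtain ⟨δ, h1, _⟩ := this (ε := 1) one_ne_zero ENNReal.one_ne_top
    push Not at hεt
    exact ⟨δ, h1, fun _ _ _ _ => by rw [hεt]; exact le_top⟩
  have h6 : ε / 6 ≠ 0 := by
    rw [Ne, ENNReal.div_eq_zero_iff]; simp [hε]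
  obtain ⟨d, hd, H⟩ := exists_pos_setLIntegral_lt_of_measure_lt hWi h6
  -- choose eta
  set I := ∫⁻ z, W z ∂muQ
  obtain ⟨η, hη0, hη⟩ : ∃ η : ENNReal, 0 < η ∧ η ≠ ⊤ ∧ η * I ≤ ε / 2 := by
    refine ⟨(ε / 2) / (I + 1), ?_, ?_, ?_⟩
    · apply ENNReal.div_pos (by rw [Ne, ENNReal.div_eq_zero_iff]; simp [hε])
      exact ENNReal.add_ne_top.2 ⟨hWi, ENNReal.one_ne_top⟩
    · exact (ENNReal.div_lt_top (ENNReal.div_lt_top hεt (by simp)).ne (by simp)).ne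
    · calc (ε / 2) / (I + 1) * I ≤ (ε/2) / (I+1) * (I+1) := by gcongr; exact le_self_add
        _ ≤ ε / 2 := (ENNReal.div_mul_cancel (by simp) (ENNReal.add_ne_top.2 ⟨hWi, ENNReal.one_ne_top⟩)).le
  obtain ⟨hηt, hηI⟩ := hη
  set d' := min (d / 2) 1
  have hd' : 0 < d' := lt_min (ENNReal.half_pos hd.ne') one_pos
  have hd't : d' ≠ ⊤ := ne_top_of_le_ne_top ENNReal.one_ne_top (min_le_right _ _)
  have hdd : d' < d := by
    by_cases hdt : d = ⊤
    · rw [hdt]; exact hd't.lt_top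
    · exact (min_le_left _ _).trans_lt (ENNReal.half_lt_self hd.ne' hdt)
  refine ⟨(d' * η).toReal, ENNReal.toReal_pos (mul_ne_zero hd'.ne' hη0.ne') (ENNReal.mul_ne_top hd't hηt), ?_⟩
  intro v vm v3 vi
  rw [ENNReal.ofReal_toReal (ENNReal.mul_ne_top hd't hηt)] at vi
  set s := {z | η ≤ v z}
  have sm : MeasurableSet s := measurableSet_le measurable_const vm
  have hs : muQ s < d := by
    refine lt_of_le_of_lt ?_ hdd
    have := mul_meas_ge_le_lintegral vm η (μ := muQ)
    have h2 : η * muQ s ≤ η * d' := this.trans (vi.trans_eq (mul_comm _ _))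
    exact (ENNReal.mul_le_mul_iff_right hη0.ne' hηt).1 h2
  rw [← lintegral_add_compl _ sm]
  have i1 : ∫⁻ z in s, v z * W z ∂muQ ≤ ε / 2 := by
    calc ∫⁻ z in s, v z * W z ∂muQ ≤ ∫⁻ z in s, 3 * W z ∂muQ := lintegral_mono fun z => by
          simp only; gcongr; exact v3 z
      _ = 3 * ∫⁻ z in s, W z ∂muQ := lintegral_const_mul _ hW
      _ ≤ 3 * (ε / 6) := by gcongr; exact (H s hs).le
      _ = ε / 2 := by
        rw [div_eq_mul_inv, div_eq_mul_inv, mul_left_comm]; congr 1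
        rw [show (6:ENNReal) = 3 * 2 by norm_num, ENNReal.mul_inv (by simp) (by simp), ← mul_assoc,
          ENNReal.mul_inv_cancel (by simp) (by simp), one_mul]
  have i2 : ∫⁻ z in sᶜ, v z * W z ∂muQ ≤ ε / 2 := by
    calc ∫⁻ z in sᶜ, v z * W z ∂muQ ≤ ∫⁻ z in sᶜ, η * W z ∂muQ := by
          refine setLIntegral_mono (hW.const_mul _) fun z hz => ?_
          have : v z < η := not_le.1 hz
          gcongr
      _ ≤ ∫⁻ z, η * W z ∂muQ := setLIntegral_le_lintegral _ _
      _ = η * I := lintegral_const_mul _ hW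
      _ ≤ _ := hηI
  calc _ ≤ ε / 2 + ε / 2 := add_le_add i1 i2
    _ = ε := ENNReal.add_halves ε

section yd
variable {φ : ℝ → ℝ} {e : ℝ}
variable (hφ : PhiD φ) (he : e = 1 ∨ e = -1) {A : ℝ} (hA1 : 1 ≤ A) (hA : ∀ y, deriv φ y ≤ A)

/-- derivative along the approximate stable direction -/
def Yd (φ : ℝ → ℝ) (e : ℝ) (n : ℕ) (h : ℝ × ℝ → ℝ) (p : ℝ × ℝ) : ℝ := tt φ e n p * px h p - e * py h p

include hφ

lemma Yd_step (he : e = 1 ∨ e = -1) (n : ℕ) {h : ℝ × ℝ → ℝ} (hh : ContDiff ℝ 1 h) (p : ℝ × ℝ) :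
    |Yd φ e (n+1) (fun z => h (gm φ e z)) p| = (tt φ e n (gm φ e p))⁻¹ * |Yd φ e n h (gm φ e p)| := by
  have ht := tt_pos (e := e) hφ n (gm φ e p)
  have : Yd φ e (n+1) (fun z => h (gm φ e z)) p =
      (-e) * ((tt φ e n (gm φ e p))⁻¹ * Yd φ e n h (gm φ e p)) := by
    unfold Yd
    rw [px_gm hφ hh, py_gm hφ hh, tt_succ hφ]
    have e2 : e * e = 1 := by rcases he with rfl | rfl <;> norm_num
    have hi := inv_mul_cancel₀ ht.ne'
    set i := (tt φ e n (gm φ e p))⁻¹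
    set a := deriv φ p.2
    linear_combination (-a * py h (gm φ e p) + (- i) * py h (gm φ e p)) * e2 + e * px h (gm φ e p) * hi
  rw [this, abs_mul, abs_mul, abs_of_pos (inv_pos.2 ht), abs_neg]
  rcases he with rfl | rfl <;> simp

lemma gm_iter_smooth (k : ℕ) : ContDiff ℝ (⊤ : ℕ∞) ((gm φ e)^[k]) := by
  induction k with
  | zero => exact contDiff_id
  | succ k ih => rw [iterate_succ]; exact ih.comp (gm_smooth hφ)

lemma per_gm_iter {α : Type*} {u : ℝ × ℝ → α} (h : Per u) (he : e = 1 ∨ e = -1) (k : ℕ) :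
    Per (fun z => u ((gm φ e)^[k] z)) := by
  induction k with
  | zero => exact h
  | succ k ih => exact ih.gm hφ he

lemma lint_gm_iter {u : ℝ × ℝ → ENNReal} (hu : Measurable u) (h : Per u) (he : e = 1 ∨ e = -1) (k : ℕ) :
    ∫⁻ z, u ((gm φ e)^[k] z) ∂muQ = ∫⁻ z, u z ∂muQ := by
  induction k with
  | zero => rfl
  | succ k ih =>
    rw [← ih]
    exact lint_gm (u := fun z => u ((gm φ e)^[k] z)) (hu.comp (gm_iter_smooth hφ k).continuous.measurable)
      (per_gm_iter hφ h he k) hφ.smooth.continuous e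

include he hA1 hA in
lemma Yd_iter {h : ℝ × ℝ → ℝ} (hh : ContDiff ℝ (⊤ : ℕ∞) h) {c : ℝ} (hc : 0 ≤ c) (h1 : ∀ z, |px h z| ≤ c)
    (h2 : ∀ z, |py h z| ≤ c) (n k : ℕ) (p : ℝ × ℝ) :
    |Yd φ e (n+k) (fun z => h ((gm φ e)^[k] z)) p| ≤ c * (1 + tt φ e (n+k) p) * PP φ e (th A) k p := by
  induction k generalizing p with
  | zero =>
    have ht := tt_pos (e := e) hφ n p
    simp only [add_zero, iterate_zero, id, PP, mul_one, Yd]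
    have e1 : |e| = 1 := by rcases he with rfl | rfl <;> simp
    calc |tt φ e n p * px h p - e * py h p| ≤ |tt φ e n p * px h p| + |e * py h p| := abs_sub _ _
      _ = tt φ e n p * |px h p| + |py h p| := by rw [abs_mul, abs_mul, e1, one_mul, abs_of_pos ht]
      _ ≤ tt φ e n p * c + c := by gcongr; exacts [h1 p, h2 p]
      _ = _ := by ring
  | succ k ih =>
    have := Yd_step hφ he (n+k) (h := fun z => h ((gm φ e)^[k] z)) ((ct_one (hh.comp (gm_iter_smooth hφ k)))) p
    rw [← add_assoc]
    refine (this.trans_le ?_)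
    have ht := tt_pos (e := e) hφ (n+k) (gm φ e p)
    have ht1 := tt_pos (e := e) hφ (n+k+1) p
    have hP := PP_nonneg (e := e) hφ hA1 hA k (gm φ e p)
    have hth := th_le (e := e) hφ hA1 hA (n+k) p
    have hi := inv_mul_cancel₀ ht.ne'
    have hi0 := inv_pos.2 ht
    calc _ ≤ (tt φ e (n+k) (gm φ e p))⁻¹ * (c * (1 + tt φ e (n+k) (gm φ e p)) * PP φ e (th A) k (gm φ e p)) := by
          gcongr; exact ih _
      _ = c * (1 + (tt φ e (n+k) (gm φ e p))⁻¹) * PP φ e (th A) k (gm φ e p) := by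
          linear_combination (c * PP φ e (th A) k (gm φ e p)) * hi
      _ ≤ c * ((1 + tt φ e (n+k+1) p) * (1 - th A * qq φ e p)) * PP φ e (th A) k (gm φ e p) := by
          gcongr
          rw [le_div_iff₀ (by linarith)] at hth
          have := tt_succ (e := e) hφ (n+k) p
          nlinarith
      _ = _ := by rw [PP]; ring


omit hφ in
lemma px_mul {u v : ℝ × ℝ → ℝ} (hu : ContDiff ℝ 1 u) (hv : ContDiff ℝ 1 v) (p : ℝ × ℝ) :
    px (fun z => u z * v z) p = u p * px v p + v p * px u p := by
  unfold px
  rw [fderiv_fun_mul (hu.differentiable one_ne_zero p) (hv.differentiable one_ne_zero p)]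
  simp

omit hφ in
lemma py_mul {u v : ℝ × ℝ → ℝ} (hu : ContDiff ℝ 1 u) (hv : ContDiff ℝ 1 v) (p : ℝ × ℝ) :
    py (fun z => u z * v z) p = u p * py v p + v p * py u p := by
  unfold py
  rw [fderiv_fun_mul (hu.differentiable one_ne_zero p) (hv.differentiable one_ne_zero p)]
  simp

/-- divergence of a multiple of the approximate stable field -/
def dv (φ : ℝ → ℝ) (e : ℝ) (n : ℕ) (α : ℝ × ℝ → ℝ) (z : ℝ × ℝ) : ℝ :=
  px (fun z => α z * tt φ e n z) z - e * py α z

lemma dv_cont (n : ℕ) {α : ℝ × ℝ → ℝ} (hα : ContDiff ℝ 1 α) : Continuous (dv φ e n α) :=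
  (px_cont (hα.mul (ct_one (tt_smooth hφ n)))).sub (continuous_const.mul (py_cont hα))

include he in
lemma parts (n : ℕ) {α h : ℝ × ℝ → ℝ} (hα : ContDiff ℝ 1 α) (hαp : Per α) (hh : ContDiff ℝ 1 h) (hhp : Per h) :
    ∫ z, h z * dv φ e n α z ∂muQ = - ∫ z, α z * Yd φ e n h z ∂muQ := by
  have ts := ct_one (tt_smooth (e := e) hφ n)
  have tp := tt_per hφ he n
  have h1 := int_px (hh.mul (hα.mul ts)) (hhp.comp2 (hαp.comp2 tp (fun a b => a * b)) (fun a b => a * b))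
  have h2 := int_py (hh.mul hα) (hhp.comp2 hαp (fun a b => a * b))
  have e0 : ∀ z, h z * dv φ e n α z = px (fun z => h z * (α z * tt φ e n z)) z
      - e * py (fun z => h z * α z) z - α z * Yd φ e n h z := by
    intro z
    rw [px_mul hh (hα.mul ts), py_mul hh hα, dv, Yd]; ring
  have c1 := px_cont (hh.mul (hα.mul ts))
  have c2 := py_cont (hh.mul hα)
  have c3 : Continuous (fun z => α z * Yd φ e n h z) :=
    hα.continuous.mul ((ts.continuous.mul (px_cont hh)).sub (continuous_const.mul (py_cont hh)))
  simp only [e0]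
  rw [integral_sub (intQ (by fun_prop)) (intQ c3), integral_sub (intQ c1) ((intQ c2).const_mul e), integral_const_mul, h1, h2]
  simp

include he hA1 hA in
lemma L1 {h : ℝ × ℝ → ℝ} (hh : ContDiff ℝ (⊤ : ℕ∞) h) (hhp : Per h) {c C : ℝ} (hc : 0 ≤ c)
    (h1 : ∀ z, |px h z| ≤ c) (h2 : ∀ z, |py h z| ≤ c) (n k : ℕ) (hkn : k ≤ n)
    {α : ℝ × ℝ → ℝ} (hα : ContDiff ℝ 1 α) (hαp : Per α)
    (hC : ∀ z, |α z| * (1 + tt φ e n z) ≤ C * QQ φ e z) :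
    ENNReal.ofReal |∫ z, h ((gm φ e)^[k] z) * dv φ e n α z ∂muQ| ≤
      ∫⁻ z, ENNReal.ofReal (c * C) * (ENNReal.ofReal (QQ φ e z) * ENNReal.ofReal (PP φ e (th A) k z)) ∂muQ := by
  obtain ⟨m, rfl⟩ := Nat.exists_eq_add_of_le' hkn
  have hs := ct_one (hh.comp (gm_iter_smooth (e := e) hφ k))
  rw [parts hφ he (m+k) (h := fun z => h ((gm φ e)^[k] z)) hα hαp hs (per_gm_iter hφ hhp he k), abs_neg,
    ← Real.norm_eq_abs, ofReal_norm]
  refine (enorm_integral_le_lintegral_enorm _).trans (lintegral_mono fun z => ?_)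
  have hQ : 0 ≤ QQ φ e z := add_nonneg (add_nonneg (qq_nonneg hφ _) (qq_nonneg hφ _)) (qq_nonneg hφ _)
  have hP := PP_nonneg (e := e) hφ hA1 hA k z
  simp only
  rw [← ofReal_norm, Real.norm_eq_abs, abs_mul, ← ENNReal.ofReal_mul hQ, ← ENNReal.ofReal_mul' (by positivity)]
  apply ENNReal.ofReal_le_ofReal
  calc |α z| * _ ≤ |α z| * (c * (1 + tt φ e (m+k) z) * PP φ e (th A) k z) := by
        gcongr; exact Yd_iter hφ he hA1 hA hh hc h1 h2 m k z
    _ = c * (|α z| * (1 + tt φ e (m+k) z)) * PP φ e (th A) k z := by ring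
    _ ≤ c * (C * QQ φ e z) * PP φ e (th A) k z := mul_le_mul_of_nonneg_right (mul_le_mul_of_nonneg_left (hC z) hc) hP
    _ = _ := by ring

lemma PP_meas (k : ℕ) (θ : ℝ) : Measurable (PP φ e θ k) := by
  induction k with
  | zero => exact measurable_const
  | succ k ih =>
    have := (qq_cont (e := e) hφ).measurable
    exact Measurable.mul (by fun_prop) (ih.comp (gmm hφ))

lemma QQ_cont : Continuous (QQ φ e) := by
  have gc := gm_cont hφ.smooth.continuous e
  have qc := qq_cont (e := e) hφ
  unfold QQ; fun_prop

include he hA1 hA in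
lemma L2 {h : ℝ × ℝ → ℝ} (hh : ContDiff ℝ (⊤ : ℕ∞) h) (hhp : Per h) {c C : ℝ} (hc : 0 ≤ c)
    (h1 : ∀ z, |px h z| ≤ c) (h2 : ∀ z, |py h z| ≤ c) (N : ℕ)
    {α : ℝ × ℝ → ℝ} (hα : ContDiff ℝ 1 α) (hαp : Per α)
    (hC : ∀ z, |α z| * (1 + tt φ e (6*N) z) ≤ C * QQ φ e z) :
    ENNReal.ofReal |∑ j ∈ Finset.range N, ∫ z, h ((gm φ e)^[6*j] z) * dv φ e (6*N) α z ∂muQ| ≤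
      ENNReal.ofReal (c * C) * ∫⁻ z, (ENNReal.ofReal (QQ φ e z) * Dinf φ e A (fun _ => 1) z) ∂muQ := by
  have Qm := (QQ_cont (e := e) hφ).measurable
  have Pm := fun k => PP_meas (e := e) hφ k (th A)
  calc _ ≤ ∑ j ∈ Finset.range N, ENNReal.ofReal |∫ z, h ((gm φ e)^[6*j] z) * dv φ e (6*N) α z ∂muQ| := by
        refine (ENNReal.ofReal_le_ofReal (Finset.abs_sum_le_sum_abs _ _)).trans ?_
        rw [ENNReal.ofReal_sum_of_nonneg (fun _ _ => abs_nonneg _)]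
    _ ≤ ∑ j ∈ Finset.range N, ∫⁻ z, ENNReal.ofReal (c * C) * (ENNReal.ofReal (QQ φ e z) *
          ENNReal.ofReal (PP φ e (th A) (6*j) z)) ∂muQ := by
        refine Finset.sum_le_sum fun j hj => ?_
        have := Finset.mem_range.1 hj
        exact L1 hφ he hA1 hA hh hhp hc h1 h2 (6*N) (6*j) (by omega) hα hαp hC
    _ = ∫⁻ z, ∑ j ∈ Finset.range N, ENNReal.ofReal (c * C) * (ENNReal.ofReal (QQ φ e z) *
          ENNReal.ofReal (PP φ e (th A) (6*j) z)) ∂muQ := by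
        rw [lintegral_finsetSum]
        intro j _
        have := Pm (6*j)
        fun_prop
    _ ≤ ∫⁻ z, ENNReal.ofReal (c * C) * (ENNReal.ofReal (QQ φ e z) * Dinf φ e A (fun _ => 1) z) ∂muQ := by
        refine lintegral_mono fun z => ?_
        simp only
        rw [← Finset.mul_sum, ← Finset.mul_sum]
        gcongr
        refine le_trans ?_ (le_iSup (fun n => DD φ e (th A) (fun _ => 1) n z) (6*N))
        rw [← PP_sum hφ hA1 hA]
        have inj : Set.InjOn (fun j => 6 * j) (Finset.range N : Set ℕ) := fun a _ b _ h => by simpa using h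
        rw [← Finset.sum_image (f := fun k => ENNReal.ofReal (PP φ e (th A) k z)) inj]
        refine Finset.sum_le_sum_of_subset ?_
        intro k hk
        obtain ⟨j, hj, rfl⟩ := Finset.mem_image.1 hk
        have := Finset.mem_range.1 hj
        exact Finset.mem_range.2 (by omega)
    _ = _ := by
        rw [lintegral_const_mul]
        have := Dinf_meas (e := e) (A := A) hφ (S := fun _ => 1) measurable_const
        fun_prop

end yd
end

/-! ## Part 7 -/
open Filter Topology Set Function MeasureTheory
noncomputable section
set_option linter.unusedSectionVars false

section st
variable {φ : ℝ → ℝ} {e : ℝ}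
variable (hφ : PhiD φ) (he : e = 1 ∨ e = -1)
include hφ he

lemma stable {u : ℝ × ℝ → ℝ} (um : Measurable u) (ub : ∀ z, |u z| ≤ 1) (up : Per u)
    (ui : ∀ z, u ((gm φ e)^[6] z) = u z) {α : ℕ → ℝ × ℝ → ℝ} (hα : ∀ n, ContDiff ℝ 1 (α n))
    (hαp : ∀ n, Per (α n)) {C : ℝ} (hC : ∀ N z, |α N z| * (1 + tt φ e (6*N) z) ≤ C * QQ φ e z)
    {W : ℝ × ℝ → ENNReal} (hW : Measurable W) (hWi : ∫⁻ z, W z ∂muQ ≠ ⊤)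
    (hdW : ∀ N z, ENNReal.ofReal |dv φ e (6*N) (α N) z| ≤ W z) :
    Tendsto (fun N => ∫ z, u z * dv φ e (6*N) (α N) z ∂muQ) atTop (𝓝 0) := by
  obtain ⟨A, hA1, hA'⟩ := per_bdd (per_deriv hφ) (acont hφ)
  have hA : ∀ y, deriv φ y ≤ A := fun y => (le_abs_self _).trans (hA' y)
  have hV := QQ_int hφ he hA1 hA (S := fun _ => 1) measurable_const ⟨fun _ _ => rfl, fun _ _ => rfl⟩ (by simp)
  set V := ∫⁻ z, (ENNReal.ofReal (QQ φ e z) * Dinf φ e A (fun _ => 1) z) ∂muQ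
  rw [Metric.tendsto_atTop]
  intro ε hε
  obtain ⟨δ, hδ, hab⟩ := absco hW hWi (ε := ENNReal.ofReal (ε/3)) (by simpa using hε)
  obtain ⟨h, hh, hhp, hb, hd⟩ := approx um ub hδ
  obtain ⟨c1, hc1, hx⟩ := hhp.px.bdd (px_cont (ct_one hh))
  obtain ⟨c2, hc2, hy⟩ := hhp.py.bdd (py_cont (ct_one hh))
  set c := c1 + c2
  have hc : 0 ≤ c := by positivity
  set K := (ENNReal.ofReal (c * C) * V).toReal
  have hKt : ENNReal.ofReal (c * C) * V ≠ ⊤ := ENNReal.mul_ne_top (by simp) hV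
  obtain ⟨N0, hN0⟩ := exists_nat_gt (K / (ε/3))
  refine ⟨N0 + 1, fun N hN => ?_⟩
  have hNpos : (0:ℝ) < N := by exact_mod_cast (by omega : 0 < N)
  have gs := fun k => gm_iter_smooth (e := e) hφ k
  have uj : ∀ j z, u ((gm φ e)^[6*j] z) = u z := by
    intro j
    induction j with
    | zero => intro z; rfl
    | succ j ih => intro z; rw [show 6 * (j+1) = 6*j + 6 by ring, iterate_add_apply, ih, ui]
  have dc := dv_cont (e := e) hφ (6*N) (hα N)
  -- the average
  set B : ℝ × ℝ → ℝ := fun z => (N:ℝ)⁻¹ * ∑ j ∈ Finset.range N, h ((gm φ e)^[6*j] z)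
  have Bc : Continuous B := continuous_const.mul
    (continuous_finsetSum _ fun j _ => hh.continuous.comp (gs _).continuous)
  have cardN : (N:ℝ)⁻¹ * ∑ j ∈ Finset.range N, (1:ℝ) = 1 := by simp [hNpos.ne']
  have diff : ∀ z, |u z - B z| ≤ (N:ℝ)⁻¹ * ∑ j ∈ Finset.range N, |u ((gm φ e)^[6*j] z) - h ((gm φ e)^[6*j] z)| := by
    intro z
    have : u z - B z = (N:ℝ)⁻¹ * ∑ j ∈ Finset.range N, (u ((gm φ e)^[6*j] z) - h ((gm φ e)^[6*j] z)) := by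
      rw [Finset.sum_sub_distrib, mul_sub]
      congr 1
      simp only [uj]
      simp [hNpos.ne']
    rw [this, abs_mul, abs_of_pos (inv_pos.2 hNpos)]
    gcongr
    exact Finset.abs_sum_le_sum_abs _ _
  have i1 : ∫⁻ z, ENNReal.ofReal |u z - B z| * W z ∂muQ ≤ ENNReal.ofReal (ε/3) := by
    apply hab _ ((um.sub Bc.measurable).abs.ennreal_ofReal)
    · intro z
      rw [show (3:ENNReal) = ENNReal.ofReal 3 by simp]
      apply ENNReal.ofReal_le_ofReal
      refine (diff z).trans ?_
      calc _ ≤ (N:ℝ)⁻¹ * ∑ j ∈ Finset.range N, (3:ℝ) := by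
            gcongr with j hj
            refine (abs_sub _ _).trans ?_
            linarith [ub ((gm φ e)^[6*j] z), hb ((gm φ e)^[6*j] z)]
        _ = 3 := by simp [hNpos.ne']
    · have wm : Measurable fun z => ENNReal.ofReal |u z - h z| := (um.sub hh.continuous.measurable).abs.ennreal_ofReal
      have wp : Per fun z => ENNReal.ofReal |u z - h z| := up.comp2 hhp (fun a b => ENNReal.ofReal |a - b|)
      calc _ ≤ ∫⁻ z, ENNReal.ofReal (N:ℝ)⁻¹ * ∑ j ∈ Finset.range N,
              ENNReal.ofReal |u ((gm φ e)^[6*j] z) - h ((gm φ e)^[6*j] z)| ∂muQ := by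
            refine lintegral_mono fun z => ?_
            simp only
            rw [← ENNReal.ofReal_sum_of_nonneg (fun _ _ => abs_nonneg _), ← ENNReal.ofReal_mul (by positivity)]
            exact ENNReal.ofReal_le_ofReal (diff z)
        _ = ENNReal.ofReal (N:ℝ)⁻¹ * ∑ j ∈ Finset.range N, ∫⁻ z, ENNReal.ofReal |u z - h z| ∂muQ := by
            have hm : ∀ j, Measurable fun z => ENNReal.ofReal |u ((gm φ e)^[6*j] z) - h ((gm φ e)^[6*j] z)| :=
              fun j => wm.comp (gs (6*j)).continuous.measurable
            rw [lintegral_const_mul _ (Finset.measurable_fun_sum _ fun j _ => hm j),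
              lintegral_finsetSum _ fun j _ => hm j]
            congr 1
            refine Finset.sum_congr rfl fun j _ => ?_
            exact lint_gm_iter hφ wm wp he (6*j)
        _ ≤ ENNReal.ofReal (N:ℝ)⁻¹ * ∑ j ∈ Finset.range N, ENNReal.ofReal δ := by gcongr
        _ = ENNReal.ofReal δ := by
            rw [Finset.sum_const, Finset.card_range, nsmul_eq_mul, ← mul_assoc, ← ENNReal.ofReal_natCast,
              ← ENNReal.ofReal_mul (by positivity), inv_mul_cancel₀ hNpos.ne', ENNReal.ofReal_one, one_mul]
  have i2 : |∫ z, B z * dv φ e (6*N) (α N) z ∂muQ| ≤ ε/3 := by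
    have e1 : ∫ z, B z * dv φ e (6*N) (α N) z ∂muQ = (N:ℝ)⁻¹ * ∑ j ∈ Finset.range N,
        ∫ z, h ((gm φ e)^[6*j] z) * dv φ e (6*N) (α N) z ∂muQ := by
      simp only [B, mul_assoc, Finset.sum_mul]
      rw [integral_const_mul, integral_finsetSum]
      exact fun j _ => intQ ((hh.continuous.comp (gs (6*j)).continuous).mul dc)
    have := L2 hφ he hA1 hA hh hhp hc (fun z => (hx z).trans (by simp only [c]; linarith))
      (fun z => (hy z).trans (by simp only [c]; linarith)) N (hα N) (hαp N) (hC N)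
    rw [ENNReal.ofReal_le_iff_le_toReal hKt] at this
    rw [e1, abs_mul, abs_of_pos (inv_pos.2 hNpos), inv_mul_le_iff₀ hNpos]
    refine this.trans ?_
    rw [div_lt_iff₀ (by positivity)] at hN0
    have : (N0:ℝ) ≤ N := by exact_mod_cast (by omega)
    nlinarith
  have ii : Integrable (fun z => (u z - B z) * dv φ e (6*N) (α N) z) muQ := by
    refine (intQ (dc.norm.const_mul 3)).mono' ((um.sub Bc.measurable).mul dc.measurable).aestronglyMeasurable
      (ae_of_all _ fun z => ?_)
    rw [norm_mul]
    gcongr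
    have := diff z
    rw [Real.norm_eq_abs]
    refine (diff z).trans ?_
    calc _ ≤ (N:ℝ)⁻¹ * ∑ j ∈ Finset.range N, (3:ℝ) := by
          gcongr with j hj
          refine (abs_sub _ _).trans ?_
          linarith [ub ((gm φ e)^[6*j] z), hb ((gm φ e)^[6*j] z)]
      _ = 3 := by simp [hNpos.ne']
  have i3 : |∫ z, (u z - B z) * dv φ e (6*N) (α N) z ∂muQ| ≤ ε/3 := by
    rw [← ENNReal.ofReal_le_ofReal_iff (by positivity), ← Real.norm_eq_abs, ofReal_norm]
    refine (enorm_integral_le_lintegral_enorm _).trans (le_trans (lintegral_mono fun z => ?_) i1)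
    simp only
    rw [enorm_mul, ← ofReal_norm, ← ofReal_norm, Real.norm_eq_abs, Real.norm_eq_abs]
    gcongr
    exact hdW N z
  rw [Real.dist_eq, sub_zero]
  have : ∫ z, u z * dv φ e (6*N) (α N) z ∂muQ = ∫ z, (u z - B z) * dv φ e (6*N) (α N) z ∂muQ
      + ∫ z, B z * dv φ e (6*N) (α N) z ∂muQ := by
    have ij : Integrable (fun z => B z * dv φ e (6*N) (α N) z) muQ := intQ (Bc.mul dc)
    rw [← integral_add ii ij]
    congr 1; ext z; ring
  rw [this]
  calc _ ≤ ε/3 + ε/3 := (abs_add_le _ _).trans (add_le_add i3 i2)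
    _ < ε := by linarith

end st
end

/-! ## Part 8 -/
open Filter Topology Set Function MeasureTheory
noncomputable section
set_option linter.unusedSectionVars false

lemma quot_bound {χ P t m : ℝ × ℝ → ℝ} (hχ : ContDiff ℝ 1 χ) (hP : ContDiff ℝ 1 P) (ht : ContDiff ℝ 1 t)
    (hm : ContDiff ℝ 1 m) (t0 : ∀ z, 0 < t z) (m0 : ∀ z, 0 < m z) (z v : ℝ × ℝ) :
    |fderiv ℝ (fun z => χ z * P z / (1 + t z * m z)) z v| ≤ |fderiv ℝ χ z v| * |P z| +
      |χ z| * (|fderiv ℝ P z v| + |P z| * (t z * |fderiv ℝ m z v| + m z * |fderiv ℝ t z v|)) := by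
  have q0 : ∀ z, 1 + t z * m z ≠ 0 := fun z => by have := mul_pos (t0 z) (m0 z); linarith
  have hq : ContDiff ℝ 1 (fun z => 1 + t z * m z) := contDiff_const.add (ht.mul hm)
  have hF : ContDiff ℝ 1 (fun z => χ z * P z / (1 + t z * m z)) := (hχ.mul hP).div hq q0
  have d := fun {f : ℝ × ℝ → ℝ} (h : ContDiff ℝ 1 f) => h.differentiable one_ne_zero z
  have e1 : (fun z => (χ z * P z / (1 + t z * m z)) * (1 + t z * m z)) = fun z => χ z * P z := by
    ext z; exact div_mul_cancel₀ _ (q0 z)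
  have e2 : fderiv ℝ (fun z => (χ z * P z / (1 + t z * m z)) * (1 + t z * m z)) z v = fderiv ℝ (fun z => χ z * P z) z v := by rw [e1]
  rw [fderiv_fun_mul (d hF) (d hq), fderiv_fun_mul (d hχ) (d hP), fderiv_const_add,
    fderiv_fun_mul (d ht) (d hm)] at e2
  simp only [ContinuousLinearMap.add_apply, ContinuousLinearMap.smul_apply, smul_eq_mul] at e2
  set dF := fderiv ℝ (fun z => χ z * P z / (1 + t z * m z)) z v
  set dχ := fderiv ℝ χ z v
  set dP := fderiv ℝ P z v
  set dt := fderiv ℝ t z v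
  set dm := fderiv ℝ m z v
  have tz := t0 z
  have mz := m0 z
  have q1 : 1 ≤ 1 + t z * m z := by have := mul_pos tz mz; linarith
  have e3 : dF * (1 + t z * m z) = χ z * dP + P z * dχ - (χ z * P z / (1 + t z * m z)) * (t z * dm + m z * dt) := by
    linarith
  have hX : |χ z * P z / (1 + t z * m z)| ≤ |χ z| * |P z| := by
    rw [abs_div, abs_mul, abs_of_pos (by linarith : 0 < 1 + t z * m z)]
    exact div_le_self (by positivity) q1
  have h1 : |dF| ≤ |dF * (1 + t z * m z)| := by
    rw [abs_mul, abs_of_pos (by linarith : 0 < 1 + t z * m z)]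
    exact le_mul_of_one_le_right (abs_nonneg _) q1
  refine h1.trans ?_
  rw [e3]
  have h2 : |t z * dm + m z * dt| ≤ t z * |dm| + m z * |dt| := by
    refine (abs_add_le _ _).trans ?_
    rw [abs_mul, abs_mul, abs_of_pos tz, abs_of_pos mz]
  calc _ ≤ |χ z * dP + P z * dχ| + |χ z * P z / (1 + t z * m z) * (t z * dm + m z * dt)| := abs_sub _ _
    _ ≤ (|χ z| * |dP| + |P z| * |dχ|) + (|χ z| * |P z|) * (t z * |dm| + m z * |dt|) := by
        gcongr
        · refine (abs_add_le _ _).trans ?_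
          rw [abs_mul, abs_mul]
        · rw [abs_mul]; gcongr
    _ = _ := by ring

lemma gm_swap_inv (φ : ℝ → ℝ) (e : ℝ) (k : ℕ) (p : ℝ × ℝ) :
    (gm φ (-e))^[k] (((gm φ e)^[k] p).swap) = p.swap := by
  induction k generalizing p with
  | zero => rfl
  | succ k ih =>
    rw [iterate_succ_apply, iterate_succ_apply']
    have : gm φ (-e) ((gm φ e ((gm φ e)^[k] p)).swap) = ((gm φ e)^[k] p).swap := by
      simp [gm]; rfl
    rw [this, ih]

lemma inv_swap {φ : ℝ → ℝ} {e : ℝ} {u : ℝ × ℝ → ℝ} (ui : ∀ z, u ((gm φ e)^[6] z) = u z) (w : ℝ × ℝ) :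
    u ((gm φ (-e))^[6] w).swap = u w.swap := by
  have := gm_swap_inv φ (-e) 6 w
  rw [neg_neg] at this
  rw [← ui ((gm φ (-e))^[6] w).swap, this]

lemma fderiv_swap {f : ℝ × ℝ → ℝ} (hf : ContDiff ℝ 1 f) (z v : ℝ × ℝ) :
    fderiv ℝ (fun z => f z.swap) z v = fderiv ℝ f z.swap v.swap := by
  have h1 : HasFDerivAt (fun z : ℝ × ℝ => z.swap) ((ContinuousLinearEquiv.prodComm ℝ ℝ ℝ : (ℝ × ℝ) →L[ℝ] (ℝ × ℝ))) z :=
    (ContinuousLinearEquiv.prodComm ℝ ℝ ℝ).hasFDerivAt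
  have := ((hf.differentiable one_ne_zero z.swap).hasFDerivAt.comp z h1).fderiv
  rw [show (fun z : ℝ × ℝ => f z.swap) = f ∘ (fun z : ℝ × ℝ => z.swap) from rfl, this]
  rfl

lemma swap_contDiff {n : WithTop ℕ∞} {f : ℝ × ℝ → ℝ} (hf : ContDiff ℝ n f) : ContDiff ℝ n (fun z : ℝ × ℝ => f z.swap) :=
  hf.comp (contDiff_snd.prodMk contDiff_fst)

end

/-! ## Part 9 -/
open Filter Topology Set Function MeasureTheory
noncomputable section
set_option linter.unusedSectionVars false

lemma qb {χ P t m : ℝ × ℝ → ℝ} (hχ : ContDiff ℝ 1 χ) (hP : ContDiff ℝ 1 P) (ht : ContDiff ℝ 1 t)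
    (hm : ContDiff ℝ 1 m) (t0 : ∀ z, 0 < t z) (m0 : ∀ z, 0 < m z) (z v : ℝ × ℝ) {C K E E' : ℝ} (hC : 1 ≤ C)
    (hE : 0 ≤ E) (hE' : 0 ≤ E') (tC : t z ≤ C) (mC : m z ≤ C)
    (dt : |fderiv ℝ t z v| ≤ 2 * C^2 * E) (dm : |fderiv ℝ m z v| ≤ 2 * C^2 * E')
    (kx : |χ z| ≤ K) (kd : |fderiv ℝ χ z v| ≤ K) (hPb : |P z| ≤ C^2)
    (hPd : |fderiv ℝ P z v| ≤ 2 * C^3 * (E + E')) :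
    |fderiv ℝ (fun z => χ z * P z / (1 + t z * m z)) z v| ≤ 4 * K * C^5 * (1 + E + E') := by
  refine (quot_bound hχ hP ht hm t0 m0 z v).trans ?_
  have K0 : 0 ≤ K := (abs_nonneg _).trans kx
  have h1 : t z * |fderiv ℝ m z v| + m z * |fderiv ℝ t z v| ≤ 2 * C^3 * (E + E') := by
    have a1 : t z * |fderiv ℝ m z v| ≤ C * (2 * C^2 * E') := by gcongr
    have a2 : m z * |fderiv ℝ t z v| ≤ C * (2 * C^2 * E) := by gcongr
    nlinarith
  calc _ ≤ K * C^2 + K * (2 * C^3 * (E+E') + C^2 * (2 * C^3 * (E + E'))) := by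
        have := (abs_nonneg (P z))
        have c0 : 0 ≤ t z * |fderiv ℝ m z v| + m z * |fderiv ℝ t z v| := by
          have := t0 z; have := m0 z; positivity
        gcongr
    _ ≤ K * C^5 + K * (2 * C^5 * (E+E') + (2 * C^5 * (E + E'))) := by
        have b1 : C^2 ≤ C^5 := pow_le_pow_right₀ hC (by norm_num)
        have b2 : C^3 ≤ C^5 := pow_le_pow_right₀ hC (by norm_num)
        have b3 : C^2 * (2 * C^3 * (E+E')) = 2 * C^5 * (E + E') := by ring
        rw [b3]; gcongr
    _ ≤ _ := by
        have : 0 ≤ K * C^5 := by positivity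
        nlinarith

lemma fderiv_zero_of {χ : ℝ × ℝ → ℝ} {σ : ℝ × ℝ → ℝ} (hσ : Continuous σ) {δ : ℝ}
    (h : ∀ z, χ z ≠ 0 → δ ≤ σ z) {z : ℝ × ℝ} (hz : σ z < δ) : χ =ᶠ[𝓝 z] fun _ => 0 := by
  have : {z | σ z < δ} ∈ 𝓝 z := (isOpen_lt hσ continuous_const).mem_nhds hz
  filter_upwards [this] with w hw
  by_contra h0
  exact absurd (h w h0) (not_le.2 hw)

section
variable {φ : ℝ → ℝ} {e : ℝ} (hφ : PhiD φ) (he : e = 1 ∨ e = -1)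

/-- transverse slope -/
def mm (φ : ℝ → ℝ) (e : ℝ) (n : ℕ) (z : ℝ × ℝ) : ℝ := tt φ (-e) n z.swap

def aal (χ : ℝ × ℝ → ℝ) (φ : ℝ → ℝ) (e : ℝ) (n : ℕ) (z : ℝ × ℝ) : ℝ :=
  χ z * mm φ e n z / (1 + tt φ e n z * mm φ e n z)
def bbe (χ : ℝ × ℝ → ℝ) (φ : ℝ → ℝ) (e : ℝ) (n : ℕ) (z : ℝ × ℝ) : ℝ :=
  χ z * e / (1 + tt φ e n z * mm φ e n z)

include hφ

lemma mm_smooth (n : ℕ) : ContDiff ℝ 1 (mm φ e n) := swap_contDiff (ct_one (tt_smooth hφ n))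

lemma mm_pos (n : ℕ) (z : ℝ × ℝ) : 0 < mm φ e n z := tt_pos hφ n _

lemma den_ne (n : ℕ) (z : ℝ × ℝ) : 1 + tt φ e n z * mm φ e n z ≠ 0 := by
  have := mul_pos (tt_pos (e := e) hφ n z) (mm_pos (e := e) hφ n z); linarith

lemma aal_smooth {χ : ℝ × ℝ → ℝ} (hχ : ContDiff ℝ 1 χ) (n : ℕ) : ContDiff ℝ 1 (aal χ φ e n) :=
  (hχ.mul (mm_smooth hφ n)).div (contDiff_const.add ((ct_one (tt_smooth hφ n)).mul (mm_smooth hφ n))) (den_ne hφ n)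

lemma bbe_smooth {χ : ℝ × ℝ → ℝ} (hχ : ContDiff ℝ 1 χ) (n : ℕ) : ContDiff ℝ 1 (bbe χ φ e n) :=
  (hχ.mul contDiff_const).div (contDiff_const.add ((ct_one (tt_smooth hφ n)).mul (mm_smooth hφ n))) (den_ne hφ n)

lemma dv_sum {χ : ℝ × ℝ → ℝ} (hχ : ContDiff ℝ 1 χ) (he : e = 1 ∨ e = -1) (n : ℕ) (z : ℝ × ℝ) :
    dv φ e n (aal χ φ e n) z + dv φ (-e) n (fun w => bbe χ φ e n w.swap) z.swap = px χ z := by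
  have ha := aal_smooth (e := e) hφ hχ n
  have hb := bbe_smooth (e := e) hφ hχ n
  have ht := ct_one (tt_smooth (e := e) hφ n)
  have hm := mm_smooth (e := e) hφ n
  have e1 : ∀ w : ℝ × ℝ, bbe χ φ e n w.swap * tt φ (-e) n w = (fun z => bbe χ φ e n z * mm φ e n z) w.swap := by
    intro w; simp [mm]
  unfold dv
  simp only [e1]
  unfold px py
  rw [fderiv_swap (hb.mul hm), fderiv_swap hb]
  have e2 : (fun z => bbe χ φ e n z * mm φ e n z) = fun z => e * aal χ φ e n z := by
    ext z; simp only [bbe, aal]; ring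
  have e3 : χ = fun z => aal χ φ e n z * tt φ e n z + e * bbe χ φ e n z := by
    ext z; simp only [bbe, aal]
    have := den_ne (e := e) hφ n z
    have ee : e * e = 1 := by rcases he with h | h <;> simp [h]
    rw [eq_comm, div_mul_eq_mul_div, mul_div_assoc', ← add_div, div_eq_iff this]
    linear_combination χ z * ee
  have e4 : fderiv ℝ χ z (1, 0) = fderiv ℝ (fun z => aal χ φ e n z * tt φ e n z + e * bbe χ φ e n z) z (1, 0) := by
    rw [← e3]
  have dd := fun {f : ℝ × ℝ → ℝ} (h : ContDiff ℝ 1 f) => h.differentiable one_ne_zero z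
  rw [e4, e2, fderiv_fun_add (dd (ha.mul ht)) (dd (contDiff_const.mul hb)), Prod.swap_swap,
    fderiv_const_mul (dd ha), fderiv_const_mul (dd hb)]
  simp
  ring

lemma EE_le_Dinf {A C : ℝ} (hA1 : 1 ≤ A) (hA : ∀ y, deriv φ y ≤ A)
    (hC : ∀ y, |deriv (deriv φ) y| ≤ C * √(deriv φ y)) (n : ℕ) (p : ℝ × ℝ) {B : ℝ} (hB : 1 ≤ B * QQ φ e p)
    (hB0 : 0 ≤ B) : ENNReal.ofReal (EE φ e n p) ≤
      ENNReal.ofReal B * (ENNReal.ofReal (QQ φ e p) * Dinf φ e A (SS φ e C) p) := by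
  have h1 : ENNReal.ofReal (EE φ e n p) ≤ Dinf φ e A (SS φ e C) p :=
    (EE_le_DD hφ hA1 hA hC n p).trans (le_iSup (fun n => DD φ e (th A) (SS φ e C) n p) n)
  refine h1.trans ?_
  rw [← mul_assoc, ← ENNReal.ofReal_mul hB0]
  calc _ = 1 * Dinf φ e A (SS φ e C) p := (one_mul _).symm
    _ ≤ _ := by
      gcongr
      rw [← ENNReal.ofReal_one]
      exact ENNReal.ofReal_le_ofReal hB
end
end

/-! ## Part 10 -/
open Filter Topology Set Function MeasureTheory
noncomputable section
set_option linter.unusedSectionVars false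

lemma lat_swap {p : ℝ × ℝ} (h : p ∈ HLat) : p.swap ∈ HLat := ⟨h.2, h.1⟩

section
variable {φ : ℝ → ℝ} {e : ℝ} (hφ : PhiD φ) (he : e = 1 ∨ e = -1)

include he in
lemma neg_pm : -e = 1 ∨ -e = -1 := by rcases he with h | h <;> simp [h]

include hφ
lemma QQ_nonneg (p : ℝ × ℝ) : 0 ≤ QQ φ e p :=
  add_nonneg (add_nonneg (qq_nonneg hφ _) (qq_nonneg hφ _)) (qq_nonneg hφ _)

include he
lemma box2 {σ : ℝ × ℝ → ℝ} (hσ : Continuous σ) (hσp : Per σ) (hσL : ∀ p ∈ HLat, σ p = 0)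
    {δ : ℝ} (hδ : 0 < δ) : ∃ C, 1 ≤ C ∧ ∀ p, δ ≤ σ p → 1 ≤ C * QQ φ e p ∧ 1 ≤ C * QQ φ (-e) p.swap ∧
      ∀ n, tt φ e n p ≤ C ∧ mm φ e n p ≤ C := by
  obtain ⟨C1, h1, b1⟩ := box_lemma hφ he hσ hσp hσL hδ
  obtain ⟨C2, h2, b2⟩ := box_lemma hφ (neg_pm he) (hσ.comp continuous_swap) hσp.swap
    (fun p hp => hσL _ (lat_swap hp)) hδ
  refine ⟨max C1 C2, h1.trans (le_max_left _ _), fun p hp => ?_⟩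
  have c1 := b1 p hp
  have c2 := b2 p.swap (by simpa using hp)
  refine ⟨c1.1.trans ?_, c2.1.trans ?_, fun n => ⟨(c1.2 n).trans (le_max_left _ _), (c2.2 n).trans (le_max_right _ _)⟩⟩
  · exact mul_le_mul_of_nonneg_right (le_max_left _ _) (QQ_nonneg hφ _)
  · exact mul_le_mul_of_nonneg_right (le_max_right _ _) (QQ_nonneg hφ _)

lemma tt_fd {C : ℝ} (hC : 1 ≤ C) (n : ℕ) (p : ℝ × ℝ) (h : tt φ e n p ≤ C) (v : ℝ × ℝ) (hv : v = (1,0) ∨ v = (0,1)) :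
    |fderiv ℝ (tt φ e n) p v| ≤ 2 * C^2 * EE φ e n p := by
  have t0 := tt_pos (e := e) hφ n p
  have E0 := EE_nonneg (e := e) hφ n p
  have b := EE_bound hφ he n p
  rcases hv with rfl | rfl
  · refine b.1.trans ?_
    have : 1 + tt φ e n p ≤ 2 * C^2 := by nlinarith
    gcongr
  · refine b.2.trans ?_
    rw [← mul_assoc]
    have : tt φ e n p * (1 + tt φ e n p) ≤ 2 * C^2 := by nlinarith
    gcongr

section
variable {χ : ℝ × ℝ → ℝ} (hχ : ContDiff ℝ 1 χ) {σ : ℝ × ℝ → ℝ} (hσ : Continuous σ) {δ : ℝ} 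
  (hsupp : ∀ z, χ z ≠ 0 → δ ≤ σ z) {C K : ℝ} (hC : 1 ≤ C)
  (hb : ∀ p, δ ≤ σ p → 1 ≤ C * QQ φ e p ∧ 1 ≤ C * QQ φ (-e) p.swap ∧
      ∀ n, tt φ e n p ≤ C ∧ mm φ e n p ≤ C)
  (hK1 : ∀ z, |χ z| ≤ K) (hK2 : ∀ z v, (v = (1,0) ∨ v = (0,1)) → |fderiv ℝ χ z v| ≤ K)
include hχ hσ hsupp hC hb hK1 hK2

lemma three (n : ℕ) (z v : ℝ × ℝ) (hv : v = (1,0) ∨ v = (0,1)) :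
    (σ z < δ → fderiv ℝ (aal χ φ e n) z v = 0 ∧ fderiv ℝ (fun z => aal χ φ e n z * tt φ e n z) z v = 0
      ∧ fderiv ℝ (bbe χ φ e n) z v = 0) ∧
    (δ ≤ σ z → |fderiv ℝ (aal χ φ e n) z v| ≤ 4 * K * C^5 * (1 + EE φ e n z + EE φ (-e) n z.swap) ∧
      |fderiv ℝ (fun z => aal χ φ e n z * tt φ e n z) z v| ≤ 4 * K * C^5 * (1 + EE φ e n z + EE φ (-e) n z.swap)
      ∧ |fderiv ℝ (bbe χ φ e n) z v| ≤ 4 * K * C^5 * (1 + EE φ e n z + EE φ (-e) n z.swap)) := by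
  have ht := ct_one (tt_smooth (e := e) hφ n)
  have hm := mm_smooth (e := e) hφ n
  constructor
  · intro hz
    have h0 := fderiv_zero_of hσ hsupp hz
    refine ⟨?_, ?_, ?_⟩
    · rw [(show aal χ φ e n =ᶠ[𝓝 z] fun _ => 0 by filter_upwards [h0] with w hw; simp [aal, hw]).fderiv_eq]; simp
    · rw [(show (fun z => aal χ φ e n z * tt φ e n z) =ᶠ[𝓝 z] fun _ => 0 by filter_upwards [h0] with w hw; simp [aal, hw]).fderiv_eq]; simp
    · rw [(show bbe χ φ e n =ᶠ[𝓝 z] fun _ => 0 by filter_upwards [h0] with w hw; simp [bbe, hw]).fderiv_eq]; simp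
  · intro hz
    obtain ⟨-, -, b⟩ := hb z hz
    have tC := (b n).1
    have mC := (b n).2
    have t0 := tt_pos (e := e) hφ n
    have m0 := mm_pos (e := e) hφ n
    have E0 := EE_nonneg (e := e) hφ n z
    have E0' := EE_nonneg (e := -e) hφ n z.swap
    have dt := tt_fd hφ he hC n z tC v hv
    have dm : |fderiv ℝ (mm φ e n) z v| ≤ 2 * C^2 * EE φ (-e) n z.swap := by
      unfold mm
      rw [fderiv_swap (ct_one (tt_smooth hφ n))]
      exact tt_fd hφ (neg_pm he) hC n z.swap mC v.swap (by rcases hv with rfl | rfl <;> simp)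
    have C23 : C^2 ≤ C^3 := pow_le_pow_right₀ hC (by norm_num)
    have C12 : C ≤ C^2 := by nlinarith
    have tz := t0 z
    have mz := m0 z
    refine ⟨?_, ?_, ?_⟩
    · refine qb hχ hm ht hm t0 m0 z v hC E0 E0' tC mC dt dm (hK1 z) (hK2 z v hv) ?_ ?_
      · rw [abs_of_pos mz]; linarith
      · refine dm.trans ?_
        have : 2 * C^2 * EE φ (-e) n z.swap ≤ 2 * C^3 * EE φ (-e) n z.swap := by gcongr
        have h2 : 0 ≤ 2 * C^3 * EE φ e n z := by positivity
        linarith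
    · have : (fun z => aal χ φ e n z * tt φ e n z) = fun z => χ z * (mm φ e n z * tt φ e n z) / (1 + tt φ e n z * mm φ e n z) := by
        ext w; simp only [aal]; ring
      rw [this]
      refine qb hχ (hm.mul ht) ht hm t0 m0 z v hC E0 E0' tC mC dt dm (hK1 z) (hK2 z v hv) ?_ ?_
      · show |mm φ e n z * tt φ e n z| ≤ _
        rw [abs_of_pos (mul_pos mz tz), sq]; gcongr
      · rw [fderiv_fun_mul (hm.differentiable one_ne_zero z) (ht.differentiable one_ne_zero z)]
        simp only [add_apply, smul_apply, smul_eq_mul]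
        refine (abs_add_le _ _).trans ?_
        rw [abs_mul, abs_mul, abs_of_pos mz, abs_of_pos tz]
        have a1 : tt φ e n z * |fderiv ℝ (mm φ e n) z v| ≤ C * (2 * C^2 * EE φ (-e) n z.swap) := by gcongr
        have a2 : mm φ e n z * |fderiv ℝ (tt φ e n) z v| ≤ C * (2 * C^2 * EE φ e n z) := by gcongr
        nlinarith
    · refine qb hχ contDiff_const ht hm t0 m0 z v hC E0 E0' tC mC dt dm (hK1 z) (hK2 z v hv) ?_ ?_
      · have : |e| = 1 := by rcases he with h | h <;> simp [h]
        rw [this]; nlinarith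
      · simp; positivity

lemma dva (n : ℕ) (z : ℝ × ℝ) : (σ z < δ → dv φ e n (aal χ φ e n) z = 0) ∧
    (δ ≤ σ z → |dv φ e n (aal χ φ e n) z| ≤ 8 * K * C^5 * (1 + EE φ e n z + EE φ (-e) n z.swap)) := by
  have h1 := three hφ he hχ hσ hsupp hC hb hK1 hK2 n z (1,0) (Or.inl rfl)
  have h2 := three hφ he hχ hσ hsupp hC hb hK1 hK2 n z (0,1) (Or.inr rfl)
  have ea : |e| = 1 := by rcases he with h | h <;> simp [h]
  refine ⟨fun h => ?_, fun h => ?_⟩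
  · simp only [dv, px, py]; rw [(h1.1 h).2.1, (h2.1 h).1]; simp
  · simp only [dv, px, py]
    refine (abs_sub _ _).trans ?_
    rw [abs_mul, ea]
    linarith [(h1.2 h).2.1, (h2.2 h).1]

lemma dvb (n : ℕ) (z : ℝ × ℝ) : (σ z < δ → dv φ (-e) n (fun w => bbe χ φ e n w.swap) z.swap = 0) ∧
    (δ ≤ σ z → |dv φ (-e) n (fun w => bbe χ φ e n w.swap) z.swap| ≤
       8 * K * C^5 * (1 + EE φ e n z + EE φ (-e) n z.swap)) := by
  have h1 := three hφ he hχ hσ hsupp hC hb hK1 hK2 n z (1,0) (Or.inl rfl)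
  have h2 := three hφ he hχ hσ hsupp hC hb hK1 hK2 n z (0,1) (Or.inr rfl)
  have ea : |e| = 1 := by rcases he with h | h <;> simp [h]
  have hbs := bbe_smooth (e := e) hφ hχ n
  have has := aal_smooth (e := e) hφ hχ n
  have e1 : ∀ w : ℝ × ℝ, bbe χ φ e n w.swap * tt φ (-e) n w = (fun z => e * aal χ φ e n z) w.swap := by
    intro w; simp only [bbe, aal, mm, Prod.swap_swap]; ring
  have e5 : dv φ (-e) n (fun w => bbe χ φ e n w.swap) z.swap =
      e * fderiv ℝ (aal χ φ e n) z (0,1) + e * fderiv ℝ (bbe χ φ e n) z (1,0) := by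
    unfold dv
    simp only [e1]
    unfold px py
    rw [fderiv_swap (contDiff_const.mul has), fderiv_swap hbs, Prod.swap_swap,
      fderiv_const_mul (has.differentiable one_ne_zero z)]
    simp
  rw [e5]
  refine ⟨fun h => ?_, fun h => ?_⟩
  · rw [(h1.1 h).2.2, (h2.1 h).1]; simp
  · refine (abs_add_le _ _).trans ?_
    rw [abs_mul, abs_mul, ea]
    linarith [(h1.2 h).2.2, (h2.2 h).1]

lemma cona (n : ℕ) (z : ℝ × ℝ) : |aal χ φ e n z| * (1 + tt φ e n z) ≤ 2 * K * C^3 * QQ φ e z := by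
  by_cases h0 : χ z = 0
  · simp only [aal, h0]; simp
    have := QQ_nonneg (e := e) hφ z
    have := (abs_nonneg _).trans (hK1 z)
    positivity
  · obtain ⟨q, -, b⟩ := hb z (hsupp z h0)
    have tz := tt_pos (e := e) hφ n z
    have mz := mm_pos (e := e) hφ n z
    have K0 := (abs_nonneg _).trans (hK1 z)
    have : |aal χ φ e n z| ≤ K * C := by
      unfold aal
      rw [abs_div, abs_mul, abs_of_pos mz, abs_of_pos (a := 1 + _) (by positivity)]
      have : 1 ≤ 1 + tt φ e n z * mm φ e n z := by nlinarith [mul_pos tz mz]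
      refine (div_le_self (by positivity) this).trans ?_
      have := (b n).2
      gcongr
      exact hK1 z
    calc _ ≤ (K * C) * (2 * C) := by
          have := (b n).1
          gcongr; linarith
      _ = (2 * K * C^2) * 1 := by ring
      _ ≤ (2 * K * C^2) * (C * QQ φ e z) := by gcongr
      _ = _ := by ring

lemma conb (n : ℕ) (w : ℝ × ℝ) : |bbe χ φ e n w.swap| * (1 + tt φ (-e) n w) ≤ 2 * K * C^3 * QQ φ (-e) w := by
  have K0 := (abs_nonneg _).trans (hK1 w)
  by_cases h0 : χ w.swap = 0
  · simp only [bbe, h0]; simp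
    have := QQ_nonneg (e := -e) hφ w
    positivity
  · obtain ⟨-, q, b⟩ := hb _ (hsupp _ h0)
    rw [Prod.swap_swap] at q
    have tz := tt_pos (e := e) hφ n w.swap
    have mz := mm_pos (e := e) hφ n w.swap
    have mz2 : 0 < tt φ (-e) n w := tt_pos hφ n w
    have mw : tt φ (-e) n w ≤ C := by simpa [mm] using (b n).2
    have ea : |e| = 1 := by rcases he with h | h <;> simp [h]
    have : |bbe χ φ e n w.swap| ≤ K := by
      unfold bbe
      rw [abs_div, abs_mul, ea, mul_one, abs_of_pos (a := 1 + _) (by positivity)]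
      have : 1 ≤ 1 + tt φ e n w.swap * mm φ e n w.swap := by nlinarith [mul_pos tz mz]
      exact (div_le_self (by positivity) this).trans (hK1 _)
    calc _ ≤ K * (2 * C) := by gcongr; linarith
      _ ≤ K * (2 * C^2) := by gcongr; nlinarith
      _ = (2 * K * C^2) * 1 := by ring
      _ ≤ (2 * K * C^2) * (C * QQ φ (-e) w) := by gcongr
      _ = _ := by ring
end

lemma phi_consts : ∃ A C : ℝ, 1 ≤ A ∧ (∀ y, deriv φ y ≤ A) ∧ 0 ≤ C ∧ ∀ y, |deriv (deriv φ) y| ≤ C * √(deriv φ y) := by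
  have s1 := ct_deriv hφ.smooth
  have s3 := ct_deriv (ct_deriv s1)
  obtain ⟨A, hA, h1⟩ := per_bdd (per_deriv hφ) s1.continuous
  obtain ⟨K, hK, h2⟩ := per_bdd (per_deriv2 (per_deriv2 (per_deriv hφ))) s3.continuous
  exact ⟨A, 2 * √K, hA, fun y => (le_abs_self _).trans (h1 y), by positivity, fun y => glaeser s1 hφ.nonneg (by linarith) h2 y⟩

lemma test_px {u : ℝ × ℝ → ℝ} (um : Measurable u) (ub : ∀ z, |u z| ≤ 1) (up : Per u)
    (ui : ∀ z, u ((gm φ e)^[6] z) = u z) {χ : ℝ × ℝ → ℝ} (hχ : ContDiff ℝ 1 χ) (hχp : Per χ) {σ : ℝ × ℝ → ℝ}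
    (hσ : Continuous σ) (hσp : Per σ) (hσL : ∀ p ∈ HLat, σ p = 0)
    {δ : ℝ} (hδ : 0 < δ) (hsupp : ∀ z, χ z ≠ 0 → δ ≤ σ z) : ∫ z, u z * px χ z ∂muQ = 0 := by
  obtain ⟨C, hC, hb⟩ := box2 hφ he hσ hσp hσL hδ
  obtain ⟨K0, k0, hk0⟩ := hχp.bdd hχ.continuous
  obtain ⟨K1, k1, hk1⟩ := hχp.px.bdd (px_cont hχ)
  obtain ⟨K2, k2, hk2⟩ := hχp.py.bdd (py_cont hχ)
  set K := K0 + K1 + K2 with hK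
  have hK1 : ∀ z, |χ z| ≤ K := fun z => (hk0 z).trans (by linarith)
  have hK2 : ∀ z v, (v = (1,0) ∨ v = (0,1)) → |fderiv ℝ χ z v| ≤ K := by
    rintro z v (rfl | rfl)
    · exact (hk1 z).trans (by linarith)
    · exact (hk2 z).trans (by linarith)
  obtain ⟨A, c, hA1, hA, hc0, hc⟩ := phi_consts hφ he
  set R : ℝ → ℝ × ℝ → ENNReal := fun e z => ENNReal.ofReal (QQ φ e z) * Dinf φ e A (SS φ e c) z with hR
  have Rm : ∀ e, Measurable (R e) := fun e =>
    ((QQ_cont hφ).measurable.ennreal_ofReal).mul (Dinf_meas hφ (SS_meas hφ c))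
  have Ri : ∀ e, (e = 1 ∨ e = -1) → ∫⁻ z, R e z ∂muQ ≠ ⊤ := fun e he =>
    QQ_int hφ he hA1 hA (SS_meas hφ c) (SS_per hφ he c) (SS_int hφ he hA1 hA hc0)
  set W : ℝ × ℝ → ENNReal := fun z => ENNReal.ofReal (8 * K * C^5) *
    (1 + ENNReal.ofReal C * R e z + ENNReal.ofReal C * R (-e) z.swap) with hW
  have Wm : Measurable W := ((measurable_const.add ((Rm e).const_mul _)).add
    (((Rm (-e)).comp measurable_swap).const_mul _)).const_mul _
  have Wi : ∫⁻ z, W z ∂muQ ≠ ⊤ := by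
    rw [hW, lintegral_const_mul' _ _ ENNReal.ofReal_ne_top]
    refine ENNReal.mul_ne_top ENNReal.ofReal_ne_top ?_
    rw [lintegral_add_left (f := fun a => 1 + ENNReal.ofReal C * R e a) (measurable_const.add ((Rm e).const_mul _)), lintegral_add_left measurable_const,
      lintegral_const_mul' _ _ ENNReal.ofReal_ne_top, lintegral_const_mul' _ _ ENNReal.ofReal_ne_top,
      lint_swap (Rm (-e))]
    refine ENNReal.add_ne_top.2 ⟨ENNReal.add_ne_top.2 ⟨?_, ?_⟩, ?_⟩
    · rw [lintegral_const]; simp [muQ, I1]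
    · exact ENNReal.mul_ne_top ENNReal.ofReal_ne_top (Ri e he)
    · exact ENNReal.mul_ne_top ENNReal.ofReal_ne_top (Ri (-e) (neg_pm he))
  have key : ∀ n z (d : ℝ), ((σ z < δ → d = 0) ∧ (δ ≤ σ z → |d| ≤ 8 * K * C^5 * (1 + EE φ e n z + EE φ (-e) n z.swap))) →
      ENNReal.ofReal |d| ≤ W z := by
    intro n z d hd
    rcases lt_or_ge (σ z) δ with h | h
    · rw [hd.1 h]; simp
    · refine (ENNReal.ofReal_le_ofReal (hd.2 h)).trans ?_
      have E0 := EE_nonneg (e := e) hφ n z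
      have E0' := EE_nonneg (e := -e) hφ n z.swap
      rw [ENNReal.ofReal_mul (by positivity), ENNReal.ofReal_add (by positivity) E0',
        ENNReal.ofReal_add (by positivity) E0, ENNReal.ofReal_one]
      simp only [hW]
      gcongr
      · exact EE_le_Dinf hφ hA1 hA hc n z (hb z h).1 (by linarith)
      · exact EE_le_Dinf hφ hA1 hA hc n z.swap (hb z h).2.1 (by linarith)
  have S1 := stable hφ he um ub up ui (α := fun N => aal χ φ e (6*N)) (fun N => aal_smooth hφ hχ _)
    (fun N => by
      have hm : Per (mm φ e (6*N)) := (tt_per hφ (neg_pm he) (6*N)).swap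
      have ht := tt_per hφ he (6*N)
      exact ⟨fun x y => by simp only [aal, hm.l, ht.l, hχp.l], fun x y => by simp only [aal, hm.r, ht.r, hχp.r]⟩)
    (fun N z => cona hφ he hχ hσ hsupp hC hb hK1 hK2 (6*N) z) Wm Wi
    (fun N z => key (6*N) z _ (dva hφ he hχ hσ hsupp hC hb hK1 hK2 (6*N) z))
  have S2 := stable (u := fun z => u z.swap) hφ (neg_pm he) (um.comp measurable_swap) (fun z => ub _) up.swap (inv_swap ui)
    (α := fun N w => bbe χ φ e (6*N) w.swap) (fun N => swap_contDiff (bbe_smooth hφ hχ _))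
    (fun N => by
      have hm : Per (mm φ e (6*N)) := (tt_per hφ (neg_pm he) (6*N)).swap
      have ht := tt_per hφ he (6*N)
      have : Per (bbe χ φ e (6*N)) :=
        ⟨fun x y => by simp only [bbe, hm.l, ht.l, hχp.l], fun x y => by simp only [bbe, hm.r, ht.r, hχp.r]⟩
      exact this.swap)
    (fun N z => conb hφ he hχ hσ hsupp hC hb hK1 hK2 (6*N) z) (W := fun z => W z.swap) (Wm.comp measurable_swap)
    (by rw [lint_swap Wm]; exact Wi)
    (fun N z => key (6*N) z.swap _ (by simpa using dvb hφ he hχ hσ hsupp hC hb hK1 hK2 (6*N) z.swap))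
  have S3 := S1.add S2
  simp only [add_zero] at S3
  have swap_int : ∀ f : ℝ × ℝ → ℝ, ∫ z, f z.swap ∂muQ = ∫ z, f z ∂muQ := fun f =>
    integral_prod_swap f
  refine tendsto_nhds_unique (tendsto_const_nhds.congr fun N => ?_) S3
  rw [← swap_int (fun z => u z.swap * dv φ (-e) (6*N) (fun w => bbe χ φ e (6*N) w.swap) z)]
  have cc := dv_cont (e := e) hφ (6*N) (aal_smooth (e := e) hφ hχ (6*N))
  have cc2 := dv_cont (e := -e) hφ (6*N) (swap_contDiff (bbe_smooth (e := e) hφ hχ (6*N)))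
  have ij : ∀ f : ℝ × ℝ → ℝ, Continuous f → Integrable (fun z => u z * f z) muQ := fun f hf =>
    (intQ hf).bdd_mul um.aestronglyMeasurable (c := 1) (Eventually.of_forall fun z => by simpa using ub z)
  simp only [Prod.swap_swap]
  rw [← integral_add (ij _ cc) (ij (fun z => dv φ (-e) (6*N) (fun w => bbe χ φ e (6*N) w.swap) z.swap) (cc2.comp continuous_swap))]
  congr 1; ext z
  rw [← dv_sum (e := e) hφ hχ he (6*N) z]; ring
end
end

/-! ## Part 11 -/
open Filter Topology Set Function MeasureTheory
noncomputable section
set_option linter.unusedSectionVars false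

lemma ae_sin : ∀ᵐ z ∂muQ, Real.sin (2 * Real.pi * z.2) ≠ 0 := by
  have h : ∀ᵐ y ∂I1, Real.sin (2 * Real.pi * y) ≠ 0 := by
    refine ae_restrict_of_ae ?_
    have : {y : ℝ | Real.sin (2 * Real.pi * y) = 0} ⊆ range (fun k : ℤ => (k:ℝ)/2) := by
      intro y hy
      obtain ⟨k, hk⟩ := Real.sin_eq_zero_iff.1 hy
      refine ⟨k, ?_⟩
      have := Real.pi_pos
      field_simp
      nlinarith
    have h0 : volume {y : ℝ | Real.sin (2 * Real.pi * y) = 0} = 0 :=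
      measure_mono_null this ((countable_range _).measure_zero _)
    rw [ae_iff]; simpa using h0
  exact Measure.quasiMeasurePreserving_snd.ae h

def cut (n : ℕ) (y : ℝ) : ℝ := Real.smoothTransition (n * Real.sin (2 * Real.pi * y)^2 - 1)

lemma cut_smooth (n : ℕ) : ContDiff ℝ (⊤ : ℕ∞) (cut n) := by
  unfold cut
  refine Real.smoothTransition.contDiff.comp ?_
  fun_prop

lemma sin_add_one (y : ℝ) : Real.sin (2 * Real.pi * (y + 1)) = Real.sin (2 * Real.pi * y) := by
  rw [mul_add, mul_one, Real.sin_add_two_pi]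

section
variable {φ : ℝ → ℝ} {e : ℝ} (hφ : PhiD φ) (he : e = 1 ∨ e = -1)
include hφ he

lemma test_px2 {u : ℝ × ℝ → ℝ} (um : Measurable u) (ub : ∀ z, |u z| ≤ 1) (up : Per u)
    (ui : ∀ z, u ((gm φ e)^[6] z) = u z) {k : ℝ × ℝ → ℝ} (hk : ContDiff ℝ 1 k) (hkp : Per k) :
    ∫ z, u z * px k z ∂muQ = 0 := by
  have h1 : ∀ n : ℕ, ∫ z, u z * (px k z * cut (n+1) z.2) ∂muQ = 0 := by
    intro n
    have hc : ContDiff ℝ 1 (fun z : ℝ × ℝ => cut (n+1) z.2) := (ct_one (cut_smooth _)).comp contDiff_snd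
    have e1 : ∀ z, px (fun z => k z * cut (n+1) z.2) z = px k z * cut (n+1) z.2 := by
      intro z
      rw [px_mul hk hc]
      have : px (fun z : ℝ × ℝ => cut (n+1) z.2) z = 0 := by
        have := (px_hasDeriv hc z.1 z.2).unique (hasDerivAt_const z.1 (cut (n+1) z.2))
        simpa using this
      rw [this]; ring
    have := test_px hφ he um ub up ui (χ := fun z => k z * cut (n+1) z.2) (hk.mul hc)
      ⟨fun x y => by simp only [hkp.l], fun x y => by simp only [hkp.r, cut, sin_add_one]⟩
      (σ := fun z => Real.sin (2 * Real.pi * z.2)^2) (by fun_prop) ⟨fun x y => rfl, fun x y => by simp only [sin_add_one]⟩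
      (by
        rintro p ⟨-, m, hm⟩
        simp only [hm]
        rw [show 2 * Real.pi * ((m:ℝ)/2) = m * Real.pi by ring, Real.sin_int_mul_pi]; simp)
      (δ := 1 / ((n+1 : ℕ):ℝ)) (by positivity) (by
        intro z hz
        by_contra hlt
        push Not at hlt
        refine hz ?_
        have : cut (n+1) z.2 = 0 := Real.smoothTransition.zero_of_nonpos (by
          rw [lt_div_iff₀ (by positivity)] at hlt; linarith)
        simp [this])
    simpa only [e1] using this
  have lim : Tendsto (fun n : ℕ => ∫ z, u z * (px k z * cut (n+1) z.2) ∂muQ) atTop (𝓝 (∫ z, u z * px k z ∂muQ)) := by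
    refine tendsto_integral_of_dominated_convergence (fun z => |px k z|) ?_ (intQ (px_cont hk).abs) ?_ ?_
    · intro n
      exact (um.mul ((px_cont hk).measurable.mul ((cut_smooth _).continuous.measurable.comp measurable_snd))).aestronglyMeasurable
    · intro n
      refine Eventually.of_forall fun z => ?_
      rw [Real.norm_eq_abs, abs_mul, abs_mul]
      have c1 : |cut (n+1) z.2| ≤ 1 := by
        unfold cut
        rw [abs_of_nonneg (Real.smoothTransition.nonneg _)]; exact Real.smoothTransition.le_one _
      have := ub z
      calc _ ≤ 1 * (|px k z| * 1) := by gcongr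
        _ = _ := by ring
    · filter_upwards [ae_sin] with z hz
      refine tendsto_const_nhds.congr' ?_
      have hp : 0 < Real.sin (2 * Real.pi * z.2)^2 := by positivity
      obtain ⟨N, hN⟩ := exists_nat_gt (2 / Real.sin (2 * Real.pi * z.2)^2)
      filter_upwards [eventually_ge_atTop N] with n hn
      have : cut (n+1) z.2 = 1 := Real.smoothTransition.one_of_one_le (by
        rw [div_lt_iff₀ hp] at hN
        have : (N:ℝ) ≤ ((n+1:ℕ):ℝ) := by exact_mod_cast (by omega : N ≤ n + 1)
        nlinarith)
      rw [this, mul_one]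
  exact tendsto_nhds_unique (lim) (tendsto_const_nhds.congr fun n => (h1 n).symm)

lemma test_py2 {u : ℝ × ℝ → ℝ} (um : Measurable u) (ub : ∀ z, |u z| ≤ 1) (up : Per u)
    (ui : ∀ z, u ((gm φ e)^[6] z) = u z) {k : ℝ × ℝ → ℝ} (hk : ContDiff ℝ 1 k) (hkp : Per k) :
    ∫ z, u z * py k z ∂muQ = 0 := by
  have := test_px2 hφ (neg_pm he) (um.comp measurable_swap) (fun z => ub _) up.swap (inv_swap ui) (swap_contDiff hk) hkp.swap
  have e1 : ∀ z : ℝ × ℝ, (u ∘ Prod.swap) z * px (fun z => k z.swap) z = (fun z => u z * py k z) z.swap := by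
    intro z; simp only [px, py, Function.comp]; rw [fderiv_swap hk]; rfl
  simp only [e1] at this
  rw [← this]; exact (integral_prod_swap (fun z => u z * py k z)).symm

/-- translation invariance along any direction -/
lemma trans_const {u : ℝ × ℝ → ℝ} (um : Measurable u) (ub : ∀ z, |u z| ≤ 1) (up : Per u)
    (ui : ∀ z, u ((gm φ e)^[6] z) = u z) {k : ℝ × ℝ → ℝ} (hk : ContDiff ℝ 1 k) (hkp : Per k) (v : ℝ × ℝ) :
    ∫ z, u z * k (z + v) ∂muQ = ∫ z, u z * k z ∂muQ := by
  obtain ⟨K1, k1, hk1⟩ := hkp.px.bdd (px_cont hk)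
  obtain ⟨K2, k2, hk2⟩ := hkp.py.bdd (py_cont hk)
  have hfd : ∀ z, fderiv ℝ k z v = v.1 * px k z + v.2 * py k z := by
    intro z
    have : v = v.1 • ((1:ℝ),(0:ℝ)) + v.2 • ((0:ℝ),(1:ℝ)) := by ext <;> simp
    conv_lhs => rw [this]
    rw [map_add, map_smul, map_smul]; rfl
  have hper : ∀ w : ℝ × ℝ, Per (fun z => k (z + w)) := fun w =>
    ⟨fun x y => by
      have := hkp.l (x + w.1) (y + w.2)
      simp only [Prod.add_def] at *
      rw [← this]; congr 2; ring,
     fun x y => by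
      have := hkp.r (x + w.1) (y + w.2)
      simp only [Prod.add_def] at *
      rw [← this]; congr 2; ring⟩
  have hsm : ∀ w : ℝ × ℝ, ContDiff ℝ 1 (fun z => k (z + w)) := fun w => hk.comp (contDiff_id.add contDiff_const)
  have hder : ∀ s : ℝ, HasDerivAt (fun s : ℝ => ∫ z, u z * k (z + s • v) ∂muQ) 0 s := by
    intro s
    have := (hasDerivAt_integral_of_dominated_loc_of_deriv_le (μ := muQ) (F := fun (s : ℝ) z => u z * k (z + s • v))
      (F' := fun s z => u z * fderiv ℝ k (z + s • v) v) (x₀ := s) (s := univ) (bound := fun _ => |v.1| * K1 + |v.2| * K2)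
      univ_mem ?_ ?_ ?_ ?_ (integrable_const _) ?_).2
    · suffices hz : ∫ a, u a * fderiv ℝ k (a + s • v) v ∂muQ = 0 by rw [hz] at this; exact this
      have e1 : ∀ z, u z * fderiv ℝ k (z + s • v) v = v.1 * (u z * px (fun z => k (z + s • v)) z) + v.2 * (u z * py (fun z => k (z + s • v)) z) := by
        intro z
        rw [hfd]; simp only [px, py]; rw [fderiv_comp_add_right]; ring
      have ij : ∀ f : ℝ × ℝ → ℝ, Continuous f → Integrable (fun z => u z * f z) muQ := fun f hf =>
        (intQ hf).bdd_mul um.aestronglyMeasurable (c := 1) (Eventually.of_forall fun z => by simpa using ub z)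
      rw [integral_congr_ae (Eventually.of_forall e1)]
      rw [integral_add ((ij _ (px_cont (hsm _))).const_mul _) ((ij _ (py_cont (hsm _))).const_mul _), integral_const_mul, integral_const_mul,
        test_px2 hφ he um ub up ui (hsm _) (hper _), test_py2 hφ he um ub up ui (hsm _) (hper _)]
      simp
    · exact Eventually.of_forall fun s => (um.mul (hsm _).continuous.measurable).aestronglyMeasurable
    · exact (intQ (hsm _).continuous).bdd_mul um.aestronglyMeasurable (c := 1) (Eventually.of_forall fun z => by simpa using ub z)
    · have : Continuous fun z => fderiv ℝ k (z + s • v) v :=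
        ((hk.continuous_fderiv one_ne_zero).comp (continuous_id.add continuous_const)).clm_apply continuous_const
      exact (um.mul this.measurable).aestronglyMeasurable
    · refine Eventually.of_forall fun z s _ => ?_
      rw [Real.norm_eq_abs, abs_mul, hfd]
      have := ub z
      calc _ ≤ 1 * (|v.1| * K1 + |v.2| * K2) := by
            gcongr
            refine (abs_add_le _ _).trans ?_
            rw [abs_mul, abs_mul]
            have := hk1 (z + s • v); have := hk2 (z + s • v)
            gcongr
        _ = _ := one_mul _
    · refine Eventually.of_forall fun z s _ => ?_
      have h1 : HasDerivAt (fun s : ℝ => z + s • v) v s := by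
        simpa using ((hasDerivAt_id s).smul_const v).const_add z
      exact ((hk.differentiable one_ne_zero (z + s • v)).hasFDerivAt.comp_hasDerivAt s h1).const_mul (u z)
  have := is_const_of_deriv_eq_zero (fun s => (hder s).differentiableAt) (fun s => (hder s).deriv) 1 0
  simpa using this

lemma int_split {u : ℝ × ℝ → ℝ} (um : Measurable u) (ub : ∀ z, |u z| ≤ 1) (up : Per u)
    (ui : ∀ z, u ((gm φ e)^[6] z) = u z) {k : ℝ × ℝ → ℝ} (hk : ContDiff ℝ 1 k) (hkp : Per k) :
    ∫ z, u z * k z ∂muQ = (∫ z, u z ∂muQ) * ∫ z, k z ∂muQ := by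
  obtain ⟨K, k0, hK⟩ := hkp.bdd hk.continuous
  have h1 : ∫ v, (∫ z, u z * k (z + v) ∂muQ) ∂muQ = ∫ z, u z * k z ∂muQ := by
    simp only [trans_const hφ he um ub up ui hk hkp]
    rw [integral_const]; simp [muQ, I1]
  have hIntg : Integrable (uncurry fun v z : ℝ × ℝ => u z * k (z + v)) (muQ.prod muQ) := by
    refine Integrable.of_bound (C := K) ?_ (Eventually.of_forall fun p => ?_)
    · refine Measurable.aestronglyMeasurable ?_
      exact (um.comp measurable_snd).mul (hk.continuous.measurable.comp (measurable_snd.add measurable_fst))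
    · simp only [uncurry]
      rw [Real.norm_eq_abs, abs_mul]
      have := ub p.2; have := hK (p.2 + p.1)
      calc _ ≤ 1 * K := by gcongr
        _ = K := one_mul _
  rw [← h1, integral_integral_swap hIntg]
  have h2 : ∀ z, ∫ v, u z * k (z + v) ∂muQ = u z * ∫ z, k z ∂muQ := by
    intro z
    rw [integral_const_mul]; congr 1
    obtain ⟨z1, z2⟩ := z
    have aux : ∀ f : ℝ × ℝ → ℝ, Continuous f → Per f → (∀ z, 0 ≤ f z) → ∫ v, f ((z1, z2) + v) ∂muQ = ∫ v, f v ∂muQ := by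
      intro f hf hfp f0
      rw [integral_eq_lintegral_of_nonneg_ae (Eventually.of_forall fun _ => f0 _) (by
        exact (hf.comp (continuous_const.add continuous_id)).aestronglyMeasurable),
        integral_eq_lintegral_of_nonneg_ae (Eventually.of_forall fun _ => f0 _) hf.aestronglyMeasurable]
      congr 1
      have := lint_trans (u := fun z => ENNReal.ofReal (f z)) hf.measurable.ennreal_ofReal (hfp.comp _) z1 z2
      rw [← this]
      congr 1; ext v; congr 2; ext <;> simp [add_comm]
    have := aux (fun z => k z + K) (hk.continuous.add continuous_const) (hkp.comp (fun x => x + K))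
      (fun z => by have := (abs_le.1 (hK z)).1; linarith)
    rw [integral_add (f := fun v => k ((z1, z2) + v)) (intQ (hk.continuous.comp (continuous_const.add continuous_id))) (integrable_const _),
      integral_add (intQ hk.continuous) (integrable_const _)] at this
    linarith
  simp only [h2]
  rw [integral_mul_const]

/-- Ergodicity of the sixth iterate of the twist map on the torus. -/
theorem PhiErg {A : Set (ℝ × ℝ)} (hA : MeasurableSet A) (hAp : Per (fun z => z ∈ A))
    (hAi : ∀ z, (gm φ e)^[6] z ∈ A ↔ z ∈ A) : muQ A = 0 ∨ muQ A = 1 := by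
  classical
  set u : ℝ × ℝ → ℝ := A.indicator 1 with hu
  have um : Measurable u := measurable_one.indicator hA
  have u01 : ∀ z, u z = 0 ∨ u z = 1 := fun z => by by_cases h : z ∈ A <;> simp [hu, h]
  have ub : ∀ z, |u z| ≤ 1 := fun z => by rcases u01 z with h | h <;> simp [h]
  have up : Per u := by
    constructor <;> intro x y <;> simp only [hu, indicator]
    · have := hAp.l x y; simp only [eq_iff_iff] at this; simp only [this, Pi.one_apply]
    · have := hAp.r x y; simp only [eq_iff_iff] at this; simp only [this, Pi.one_apply]
  have ui : ∀ z, u ((gm φ e)^[6] z) = u z := fun z => by simp only [hu, indicator, hAi, Pi.one_apply]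
  have iu : Integrable u muQ := Integrable.of_bound um.aestronglyMeasurable 1 (Eventually.of_forall ub)
  set m := ∫ z, u z ∂muQ with hm
  have key : ∀ ε > 0, |m - m * m| ≤ ε := by
    intro ε hε
    obtain ⟨h, hs, hp, hb, hi⟩ := approx um ub (half_pos hε)
    have ih : Integrable h muQ := intQ hs.continuous
    have iuh : Integrable (fun z => u z * h z) muQ := ih.bdd_mul um.aestronglyMeasurable (c := 1) (Eventually.of_forall fun z => by simpa using ub z)
    have e0 : ∫ z, |u z - h z| ∂muQ ≤ ε / 2 := by
      rw [integral_eq_lintegral_of_nonneg_ae (Eventually.of_forall fun _ => abs_nonneg _) (f := fun z => |u z - h z|) (iu.sub ih).abs.aestronglyMeasurable]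
      exact ENNReal.toReal_le_of_le_ofReal (by positivity) hi
    have e1 := int_split hφ he um ub up ui (ct_one hs) hp
    have uu : ∀ z, u z * u z = u z := fun z => by rcases u01 z with h | h <;> simp [h]
    have e2 : |m - ∫ z, u z * h z ∂muQ| ≤ ε / 2 := by
      rw [hm, ← integral_sub iu iuh]
      refine (abs_integral_le_integral_abs).trans (le_trans ?_ e0)
      refine integral_mono (iu.sub iuh).abs (iu.sub ih).abs fun z => ?_
      show |u z - u z * h z| ≤ |u z - h z|
      have : u z - u z * h z = u z * (u z - h z) := by rw [mul_sub, uu]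
      rw [this, abs_mul]
      exact mul_le_of_le_one_left (abs_nonneg _) (ub z)
    have e3 : |m - ∫ z, h z ∂muQ| ≤ ε / 2 := by
      rw [hm, ← integral_sub iu ih]
      exact (abs_integral_le_integral_abs).trans e0
    have m1 : |m| ≤ 1 := by
      have := norm_integral_le_of_norm_le_const (μ := muQ) (f := u) (C := 1) (Eventually.of_forall ub)
      simpa [muQ, I1, measureReal_def] using this
    rw [e1] at e2
    have : m - m * m = (m - m * ∫ z, h z ∂muQ) - m * (m - ∫ z, h z ∂muQ) := by ring
    rw [this]
    refine (abs_sub _ _).trans ?_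
    rw [abs_mul m]
    nlinarith [abs_nonneg m, abs_nonneg (m - ∫ z, h z ∂muQ)]
  have m2 : m - m * m = 0 := by
    have := le_of_forall_pos_le_add (a := |m - m*m|) (b := 0) fun ε hε => by simpa using key ε hε
    exact abs_nonpos_iff.1 this
  have m3 : m = (muQ A).toReal := by
    rw [hm, hu, integral_indicator_one hA]; rfl
  have fin : muQ A ≠ ⊤ := measure_ne_top _ _
  have : m = 0 ∨ m = 1 := by
    have : m * (1 - m) = 0 := by linarith
    rcases mul_eq_zero.1 this with h | h
    · exact Or.inl h
    · exact Or.inr (by linarith)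
  rcases this with h | h
  · left; rw [h] at m3
    rcases (ENNReal.toReal_eq_zero_iff _).1 m3.symm with h | h
    · exact h
    · exact absurd h fin
  · right; rw [h] at m3
    exact (ENNReal.toReal_eq_one_iff _).1 m3.symm
end
end

/-! ## Part 12 -/
open Filter Topology Set Function MeasureTheory
noncomputable section
set_option linter.unusedSectionVars false

/-! ### Part I: the pillow map, algebra -/

def cX (z : ℝ × ℝ) : ℝ := Real.cos (2 * Real.pi * z.1)
def cY (z : ℝ × ℝ) : ℝ := Real.cos (2 * Real.pi * z.2)
def sX (z : ℝ × ℝ) : ℝ := Real.sin (2 * Real.pi * z.1)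
def sY (z : ℝ × ℝ) : ℝ := Real.sin (2 * Real.pi * z.2)
def n1 (z : ℝ × ℝ) : ℝ := cX z - cY z
def n2 (z : ℝ × ℝ) : ℝ := sX z * sY z
def dD (z : ℝ × ℝ) : ℝ := 2 - cX z - cY z + (cX z - cY z) ^ 2 / 2
def dl (z : ℝ × ℝ) : ℝ := dD z ^ 2 - n1 z ^ 2 - n2 z ^ 2
def ZLat : Set (ℝ × ℝ) := {p | (∃ k : ℤ, p.1 = k) ∧ ∃ k : ℤ, p.2 = k}

lemma sX_sq (z : ℝ × ℝ) : sX z ^ 2 = 1 - cX z ^ 2 := by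
  simp only [sX, cX]; have := Real.sin_sq_add_cos_sq (2 * Real.pi * z.1); linarith
lemma sY_sq (z : ℝ × ℝ) : sY z ^ 2 = 1 - cY z ^ 2 := by
  simp only [sY, cY]; have := Real.sin_sq_add_cos_sq (2 * Real.pi * z.2); linarith

lemma cos_one_iff (x : ℝ) : Real.cos (2 * Real.pi * x) = 1 ↔ ∃ k : ℤ, x = k := by
  rw [Real.cos_eq_one_iff]
  have := Real.pi_pos
  constructor
  · rintro ⟨k, hk⟩
    refine ⟨k, ?_⟩
    have : (2 * Real.pi) * (k - x) = 0 := by linarith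
    rcases mul_eq_zero.1 this with h | h
    · linarith
    · linarith
  · rintro ⟨k, rfl⟩
    exact ⟨k, by ring⟩

lemma sin_zero_iff (x : ℝ) : Real.sin (2 * Real.pi * x) = 0 ↔ ∃ k : ℤ, x = k / 2 := by
  rw [Real.sin_eq_zero_iff]
  have := Real.pi_pos
  constructor
  · rintro ⟨k, hk⟩
    refine ⟨k, ?_⟩
    have : (Real.pi) * (k - 2 * x) = 0 := by linarith
    rcases mul_eq_zero.1 this with h | h
    · linarith
    · linarith
  · rintro ⟨k, rfl⟩
    exact ⟨k, by ring⟩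

lemma dl_eq (z : ℝ × ℝ) : dl z = ((1 - cX z) + (1 - cY z)) * ((1 - cX z) ^ 2 + (1 - cY z) ^ 2)
    + ((1 - cX z) - (1 - cY z)) ^ 4 / 4 - (1 - cX z) ^ 2 * (1 - cY z) ^ 2 := by
  simp only [dl, n1, n2, dD, mul_pow, sX_sq, sY_sq]; ring

lemma cX_le (z : ℝ × ℝ) : cX z ≤ 1 := Real.cos_le_one _
lemma cY_le (z : ℝ × ℝ) : cY z ≤ 1 := Real.cos_le_one _
lemma le_cX (z : ℝ × ℝ) : -1 ≤ cX z := Real.neg_one_le_cos _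
lemma le_cY (z : ℝ × ℝ) : -1 ≤ cY z := Real.neg_one_le_cos _

lemma dl_lower (z : ℝ × ℝ) :
    ((1 - cX z) + (1 - cY z)) * ((1 - cX z) ^ 2 + (1 - cY z) ^ 2) / 2 ≤ dl z := by
  rw [dl_eq]
  have h1 := cX_le z; have h2 := cY_le z; have h3 := le_cX z; have h4 := le_cY z
  generalize ha : 1 - cX z = a
  generalize hb : 1 - cY z = b
  have a0 : 0 ≤ a := by linarith
  have b0 : 0 ≤ b := by linarith
  have a2 : a ≤ 2 := by linarith
  have b2 : b ≤ 2 := by linarith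
  have h5 : a * b ≤ a + b := by nlinarith
  have h6 : 0 ≤ (a - b) ^ 4 := by positivity
  have h7 : (a * b) * (a * b) ≤ (a + b) * ((a ^ 2 + b ^ 2) / 2) :=
    mul_le_mul h5 (by nlinarith [sq_nonneg (a - b)]) (by positivity) (by positivity)
  nlinarith

lemma ab_zero (z : ℝ × ℝ) (hz : z ∉ ZLat) : 0 < (1 - cX z) + (1 - cY z) := by
  have h1 := cX_le z; have h2 := cY_le z
  by_contra h
  have hx : cX z = 1 := by linarith
  have hy : cY z = 1 := by linarith
  exact hz ⟨(cos_one_iff _).1 hx, (cos_one_iff _).1 hy⟩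

lemma ab_sq (z : ℝ × ℝ) (hz : z ∉ ZLat) : 0 < (1 - cX z) ^ 2 + (1 - cY z) ^ 2 := by
  have := ab_zero z hz
  nlinarith [sq_nonneg ((1 - cX z) - (1 - cY z)), sq_nonneg ((1 - cX z) + (1 - cY z))]

lemma dl_pos (z : ℝ × ℝ) (hz : z ∉ ZLat) : 0 < dl z :=
  lt_of_lt_of_le (by have := ab_zero z hz; have := ab_sq z hz; positivity) (dl_lower z)

lemma dl_nonneg (z : ℝ × ℝ) : 0 ≤ dl z := by
  refine le_trans ?_ (dl_lower z)
  have h1 := cX_le z; have h2 := cY_le z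
  have : 0 ≤ (1 - cX z) + (1 - cY z) := by linarith
  positivity

lemma dD_ge (z : ℝ × ℝ) : (1 - cX z) + (1 - cY z) ≤ dD z := by
  simp only [dD]; nlinarith [sq_nonneg (cX z - cY z)]

lemma dD_pos (z : ℝ × ℝ) (hz : z ∉ ZLat) : 0 < dD z := lt_of_lt_of_le (ab_zero z hz) (dD_ge z)

lemma dl_le (z : ℝ × ℝ) : dl z ≤ 2 * dD z ^ 3 := by
  rw [dl_eq, dD]
  have h1 := cX_le z; have h2 := cY_le z
  have e : (2 - cX z - cY z + (cX z - cY z) ^ 2 / 2)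
    = (1 - cX z) + (1 - cY z) + ((1 - cX z) - (1 - cY z)) ^ 2 / 2 := by ring
  rw [e]
  generalize ha : 1 - cX z = a
  generalize hb : 1 - cY z = b
  have a0 : 0 ≤ a := by linarith
  have b0 : 0 ≤ b := by linarith
  set q := (a - b) ^ 2 with hq
  have q0 : 0 ≤ q := sq_nonneg _
  have e4 : (a - b) ^ 4 = q * q := by rw [hq]; ring
  rw [e4]
  have hqs : q ≤ (a + b) ^ 2 := by rw [hq]; nlinarith
  set s := a + b with hs
  have s0 : 0 ≤ s := by positivity
  have h3 : a ^ 2 + b ^ 2 ≤ s ^ 2 := by rw [hs]; nlinarith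
  have h4 : s * (a ^ 2 + b ^ 2) ≤ s * s ^ 2 := by gcongr
  have h5 : q * q ≤ q * s ^ 2 := by gcongr
  have h6 : 0 ≤ a ^ 2 * b ^ 2 := by positivity
  have h7 : 0 ≤ s * q ^ 2 := by positivity
  have h8 : 0 ≤ q ^ 3 := by positivity
  have h9 : 0 ≤ s ^ 3 := by positivity
  have h10 : 0 ≤ q * s ^ 2 := by positivity
  nlinarith

lemma HLat_iff (z : ℝ × ℝ) : z ∈ HLat ↔ sX z = 0 ∧ sY z = 0 := by
  simp only [HLat, sX, sY, mem_setOf_eq, sin_zero_iff]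

lemma ZLat_sub : ZLat ⊆ HLat := by
  rintro z ⟨⟨k, hk⟩, l, hl⟩
  exact ⟨⟨2 * k, by push_cast; rw [hk]; ring⟩, 2 * l, by push_cast; rw [hl]; ring⟩

def det3 (z : ℝ × ℝ) : ℝ := (1 - cX z * cY z) *
  (2 * (1 - cX z) * (1 - cY z) + (cX z - cY z) ^ 2 * (cX z + cY z) / 2)

lemma det3_pos (z : ℝ × ℝ) (hz : z ∉ HLat) : 0 < det3 z := by
  have h1 := cX_le z; have h2 := cY_le z; have h3 := le_cX z; have h4 := le_cY z
  have hS := sX_sq z; have hT := sY_sq z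
  have hne : ¬ (cX z ^ 2 = 1 ∧ cY z ^ 2 = 1) := by
    rintro ⟨e1, e2⟩
    refine hz ((HLat_iff z).2 ⟨?_, ?_⟩)
    · exact pow_eq_zero_iff (two_ne_zero) |>.1 (by linarith)
    · exact pow_eq_zero_iff (two_ne_zero) |>.1 (by linarith)
  rw [det3]
  generalize cX z = X at *
  generalize cY z = Y at *
  have hXY : X * Y < 1 := by
    by_contra h
    push Not at h
    have : X ^ 2 ≤ 1 := by nlinarith
    have : Y ^ 2 ≤ 1 := by nlinarith
    exact hne ⟨by nlinarith [sq_nonneg (X - Y)], by nlinarith [sq_nonneg (X - Y)]⟩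
  apply mul_pos (by linarith)
  by_cases hab : 0 ≤ X + Y
  · have t1 : 0 ≤ (1 - X) * (1 - Y) := mul_nonneg (by linarith) (by linarith)
    have t2 : 0 ≤ (X - Y) ^ 2 * (X + Y) := mul_nonneg (sq_nonneg _) hab
    by_contra h
    have e1 : (1 - X) * (1 - Y) = 0 := by nlinarith
    have e2 : (X - Y) ^ 2 * (X + Y) = 0 := by nlinarith
    rcases mul_eq_zero.1 e2 with e2 | e2
    · have : X = Y := by nlinarith
      subst this
      have : 1 - X = 0 := by simpa using e1
      have : X = 1 := by linarith
      subst this; norm_num at hXY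
    · rcases mul_eq_zero.1 e1 with e1 | e1
      · apply hne
        have : X = 1 := by linarith
        have : Y = -1 := by linarith
        subst X; subst Y; norm_num
      · apply hne
        have : Y = 1 := by linarith
        have : X = -1 := by linarith
        subst X; subst Y; norm_num
  · push Not at hab
    have X1 : X < 1 := by linarith
    have Y1 : Y < 1 := by linarith
    have p0 : 0 < (1 - X) * (1 - Y) := mul_pos (by linarith) (by linarith)
    have t1 : -(X + Y) * 2 ≤ (1 - X) * (1 - Y) := by nlinarith
    have t2 : (X - Y) ^ 2 < 4 := by nlinarith
    have t3 : (X - Y) ^ 2 * (-(X + Y) * 2) ≤ 4 * ((1 - X) * (1 - Y)) := by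
      apply mul_le_mul t2.le t1 (by linarith) (by norm_num)
    nlinarith
end

/-! ## Part 13 -/
open Filter Topology Set Function MeasureTheory
noncomputable section
set_option linter.unusedSectionVars false

/-! ### derivatives by partials -/

def lf (a b : ℝ) : ℝ × ℝ →L[ℝ] ℝ :=
  a • ContinuousLinearMap.fst ℝ ℝ ℝ + b • ContinuousLinearMap.snd ℝ ℝ ℝ

lemma lf_apply (a b : ℝ) (v : ℝ × ℝ) : lf a b v = a * v.1 + b * v.2 := by
  simp [lf]

def HP (f : ℝ × ℝ → ℝ) (a b : ℝ) (z : ℝ × ℝ) : Prop := HasFDerivAt f (lf a b) z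

lemma lf_det (a b c d : ℝ) : ((lf a b).prod (lf c d)).det = a * d - b * c := by
  have : (lf a b).prod (lf c d) = LinearMap.toContinuousLinearMap (Matrix.toLin
      (Module.Basis.finTwoProd ℝ) (Module.Basis.finTwoProd ℝ) !![a, b; c, d]) := by
    rw [Matrix.toLin_finTwoProd_toContinuousLinearMap]; rfl
  rw [this, LinearMap.det_toContinuousLinearMap, LinearMap.det_toLin, Matrix.det_fin_two_of]

lemma HP.congr {f a b a' b' z} (h : HP f a b z) (h1 : a = a') (h2 : b = b') : HP f a' b' z := by
  subst h1; subst h2; exact h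

lemma HP.ext {f g a b a' b' z} (h : HP f a b z) (hg : ∀ w, g w = f w) (h1 : a = a') (h2 : b = b') :
    HP g a' b' z := by
  subst h1; subst h2; obtain rfl : g = f := funext hg; exact h

lemma HP.mul {f g a b c d z} (h : HP f a b z) (h' : HP g c d z) :
    HP (fun w => f w * g w) (a * g z + f z * c) (b * g z + f z * d) z := by
  refine (HasFDerivAt.mul h h').congr_fderiv ?_
  ext <;> simp [lf] <;> ring
lemma HP.add {f g a b c d z} (h : HP f a b z) (h' : HP g c d z) :
    HP (fun w => f w + g w) (a + c) (b + d) z := by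
  refine (HasFDerivAt.add h h').congr_fderiv ?_
  ext <;> simp [lf]
lemma HP.sub {f g a b c d z} (h : HP f a b z) (h' : HP g c d z) :
    HP (fun w => f w - g w) (a - c) (b - d) z := by
  refine (HasFDerivAt.sub h h').congr_fderiv ?_
  ext <;> simp [lf]
lemma HP.const (c : ℝ) (z) : HP (fun _ => c) 0 0 z := by
  refine (hasFDerivAt_const c z).congr_fderiv ?_
  ext <;> simp [lf]
lemma HP.comp {f a b z} (h : HP f a b z) {k : ℝ → ℝ} {k'} (hk : HasDerivAt k k' (f z)) :
    HP (fun w => k (f w)) (k' * a) (k' * b) z := by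
  refine (HasDerivAt.comp_hasFDerivAt z hk h).congr_fderiv ?_
  ext <;> simp [lf]
lemma HP.div {f g a b c d z} (h : HP f a b z) (h' : HP g c d z) (h0 : g z ≠ 0) :
    HP (fun w => f w / g w) (a / g z - f z * c / g z ^ 2) (b / g z - f z * d / g z ^ 2) z := by
  have := h.mul (h'.comp (hasDerivAt_inv h0))
  refine HP.congr (f := fun w => f w / g w) (by simpa only [div_eq_mul_inv] using this) ?_ ?_ <;>
    field_simp <;> ring

lemma HP.fst (z : ℝ × ℝ) : HP (fun w => w.1) 1 0 z := by
  refine hasFDerivAt_fst.congr_fderiv ?_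
  ext <;> simp [lf]
lemma HP.snd (z : ℝ × ℝ) : HP (fun w => w.2) 0 1 z := by
  refine hasFDerivAt_snd.congr_fderiv ?_
  ext <;> simp [lf]

lemma cX_hp (z) : HP cX (-(2 * Real.pi) * sX z) 0 z := by
  have := ((HP.const (2 * Real.pi) z).mul (HP.fst z)).comp (Real.hasDerivAt_cos _)
  exact this.congr (by simp [sX]; ring) (by simp)
lemma cY_hp (z) : HP cY 0 (-(2 * Real.pi) * sY z) z := by
  have := ((HP.const (2 * Real.pi) z).mul (HP.snd z)).comp (Real.hasDerivAt_cos _)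
  exact this.congr (by simp) (by simp [sY]; ring)
lemma sX_hp (z) : HP sX ((2 * Real.pi) * cX z) 0 z := by
  have := ((HP.const (2 * Real.pi) z).mul (HP.fst z)).comp (Real.hasDerivAt_sin _)
  exact this.congr (by simp [cX]; ring) (by simp)
lemma sY_hp (z) : HP sY 0 ((2 * Real.pi) * cY z) z := by
  have := ((HP.const (2 * Real.pi) z).mul (HP.snd z)).comp (Real.hasDerivAt_sin _)
  exact this.congr (by simp) (by simp [cY]; ring)

lemma n1_hp (z) : HP n1 (-(2 * Real.pi) * sX z) ((2 * Real.pi) * sY z) z :=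
  ((cX_hp z).sub (cY_hp z)).congr (by ring) (by ring)
lemma n2_hp (z) : HP n2 ((2 * Real.pi) * (cX z * sY z)) ((2 * Real.pi) * (sX z * cY z)) z :=
  ((sX_hp z).mul (sY_hp z)).congr (by ring) (by ring)
lemma dD_hp (z) : HP dD (-(2 * Real.pi) * (sX z * (cX z - cY z - 1)))
    (-(2 * Real.pi) * (sY z * (-1 - (cX z - cY z)))) z := by
  have h := (((HP.const 2 z).sub (cX_hp z)).sub (cY_hp z)).add
    ((((cX_hp z).sub (cY_hp z)).mul ((cX_hp z).sub (cY_hp z))).mul (HP.const (1/2) z))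
  exact h.ext (fun w => by simp only [dD]; ring) (by ring) (by ring)
lemma dl_hp (z) {a b c d e f : ℝ} (hD : HP dD a b z) (h1 : HP n1 c d z) (h2 : HP n2 e f z) :
    HP dl (2 * (dD z * a - n1 z * c - n2 z * e)) (2 * (dD z * b - n1 z * d - n2 z * f)) z := by
  have h := ((hD.mul hD).sub (h1.mul h1)).sub (h2.mul h2)
  exact h.ext (fun w => by simp only [dl]; ring) (by ring) (by ring)

/-- the map to the plane -/
def tP (z : ℝ × ℝ) : ℝ := n1 z * dD z / dl z
def tR (z : ℝ × ℝ) : ℝ := n2 z * dD z / dl z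

def tdet (z : ℝ × ℝ) : ℝ := (2 * Real.pi) ^ 2 * ((2 * dD z ^ 2 - dl z) * dD z * det3 z) / dl z ^ 3

lemma th_deriv (z) (hz : z ∉ ZLat) : ∃ a b c d, HP tP a b z ∧ HP tR c d z ∧
    a * d - b * c = tdet z := by
  have h0 := (dl_pos z hz).ne'
  have hdl := dl_hp z (dD_hp z) (n1_hp z) (n2_hp z)
  refine ⟨_, _, _, _, ((n1_hp z).mul (dD_hp z)).div hdl h0,
    ((n2_hp z).mul (dD_hp z)).div hdl h0, ?_⟩
  have key : ∀ D N M Dx Dy Nx Ny Mx My L : ℝ, L = D ^ 2 - N ^ 2 - M ^ 2 → L ≠ 0 →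
      ((Nx * D + N * Dx) / L - N * D * (2 * (D * Dx - N * Nx - M * Mx)) / L ^ 2) *
      ((My * D + M * Dy) / L - M * D * (2 * (D * Dy - N * Ny - M * My)) / L ^ 2) -
      ((Ny * D + N * Dy) / L - N * D * (2 * (D * Dy - N * Ny - M * My)) / L ^ 2) *
      ((Mx * D + M * Dx) / L - M * D * (2 * (D * Dx - N * Nx - M * Mx)) / L ^ 2) =
      (2 * D ^ 2 - L) * D * (N * (Mx * Dy - My * Dx) - M * (Nx * Dy - Ny * Dx)
        + D * (Nx * My - Ny * Mx)) / L ^ 3 := by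
    intro D N M Dx Dy Nx Ny Mx My L hL hL0
    field_simp
    subst hL
    ring
  refine (key _ _ _ _ _ _ _ _ _ (dl z) rfl h0).trans ?_
  rw [tdet]
  congr 1
  have hS := sX_sq z
  have hT := sY_sq z
  rw [mul_left_comm ((2 * Real.pi) ^ 2) ((2 * dD z ^ 2 - dl z) * dD z) (det3 z)]
  congr 1
  · have : ∀ X Y S T : ℝ, S ^ 2 = 1 - X ^ 2 → T ^ 2 = 1 - Y ^ 2 → 
      (X - Y) * (X * T * (-(T * (-1 - (X - Y)))) - S * Y * (-(S * (X - Y - 1)))) 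
      - S * T * (S * (T * (-1 - (X - Y))) + T * (S * (X - Y - 1))) 
      + (2 - X - Y + (X - Y) ^ 2 / 2) * (-(S * S * Y) - T * (X * T)) = 
      ((1 - X * Y) * (2 * (1 - X) * (1 - Y) + (X - Y) ^ 2 * (X + Y) / 2)) := by
      intro X Y S T hS hT
      have e : ∀ s t : ℝ, s = 1 - X ^ 2 → t = 1 - Y ^ 2 →
        (X - Y) * (X * t * (-((-1 - (X - Y)))) - Y * (-(s * (X - Y - 1)))) 
      - (s * (t * (-1 - (X - Y))) + t * (s * (X - Y - 1))) 
      + (2 - X - Y + (X - Y) ^ 2 / 2) * (-(s * Y) - t * X) = 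
      ((1 - X * Y) * (2 * (1 - X) * (1 - Y) + (X - Y) ^ 2 * (X + Y) / 2)) := by
        intro s t hs ht; subst hs; subst ht; ring
      rw [← e _ _ hS hT]; ring
    have := this _ _ _ _ hS hT
    simp only [n1, n2, dD, det3]
    linear_combination (2 * Real.pi) ^ 2 * this

lemma dl_le_sq (z) : dl z ≤ dD z ^ 2 := by
  rw [dl]; nlinarith [sq_nonneg (n1 z), sq_nonneg (n2 z)]

lemma tdet_pos (z) (hz : z ∉ HLat) : 0 < tdet z := by
  have hz' : z ∉ ZLat := fun h => hz (ZLat_sub h)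
  have h1 := dl_pos z hz'
  have h2 := dD_pos z hz'
  have h3 := det3_pos z hz
  have h4 := dl_le_sq z
  have h5 : 0 < 2 * dD z ^ 2 - dl z := by nlinarith
  rw [tdet]
  positivity

/-! ### injectivity -/

lemma tau_aux {c s t : ℝ} (hc : 0 ≤ c) (hs : 0 < s) (hst : s < t)
    (ct : c * t ≤ 1 / 2) (c1 : c < 1)
    (g1 : 0 ≤ (1 - c * t) ^ 2 - c) (g2 : 0 ≤ (2 - t + c * t ^ 2) ^ 2 - c * t ^ 2)
    (hσ : 0 ≤ 2 - t + c * t ^ 2)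
    (h : ((1 - c * s) ^ 2 - c) * ((2 - s + c * s ^ 2) ^ 2 - c * s ^ 2) =
      ((1 - c * t) ^ 2 - c) * ((2 - t + c * t ^ 2) ^ 2 - c * t ^ 2)) : False := by
  have cs : c * s ≤ c * t := by gcongr
  have k1 : (1 - c * t) ^ 2 ≤ (1 - c * s) ^ 2 := by
    apply pow_le_pow_left₀ (by linarith); linarith
  have k2 : 2 - t + c * t ^ 2 ≤ 2 - s + c * s ^ 2 := by
    have : (t - s) * (c * t + c * s) ≤ (t - s) * 1 := by
      apply mul_le_mul_of_nonneg_left (by linarith) (by linarith)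
    nlinarith
  have k3 : (2 - t + c * t ^ 2) ^ 2 ≤ (2 - s + c * s ^ 2) ^ 2 := pow_le_pow_left₀ hσ k2 2
  rcases hc.eq_or_lt with rfl | hc
  · have : 2 - t < 2 - s := by linarith
    nlinarith
  · have k4 : c * s ^ 2 < c * t ^ 2 := by
      have : s ^ 2 < t ^ 2 := by nlinarith
      gcongr
    have k5 : c * s < c * t := by gcongr
    have k6 : (1 - c * t) ^ 2 < (1 - c * s) ^ 2 := by nlinarith
    have k7 : ((1 - c * t) ^ 2 - c) * ((2 - t + c * t ^ 2) ^ 2 - c * t ^ 2) <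
      ((1 - c * s) ^ 2 - c) * ((2 - s + c * s ^ 2) ^ 2 - c * s ^ 2) := by
      apply mul_lt_mul'' (by linarith) (by linarith) g1 g2
    linarith

lemma tau_rel (z) (hz : z ∉ ZLat) {U W : ℝ} (hU : U = n1 z / dD z) (hW : W = n2 z / dD z) :
    U ^ 2 * (dD z / 2) ≤ 1 / 2 ∧ 0 ≤ (1 - U ^ 2 * (dD z / 2)) ^ 2 - U ^ 2 ∧
    0 ≤ (2 - dD z / 2 + U ^ 2 * (dD z / 2) ^ 2) ^ 2 - U ^ 2 * (dD z / 2) ^ 2 ∧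
    0 ≤ 2 - dD z / 2 + U ^ 2 * (dD z / 2) ^ 2 ∧
    4 * W ^ 2 = ((1 - U ^ 2 * (dD z / 2)) ^ 2 - U ^ 2) *
      ((2 - dD z / 2 + U ^ 2 * (dD z / 2) ^ 2) ^ 2 - U ^ 2 * (dD z / 2) ^ 2) := by
  have hD := dD_pos z hz
  have h1 := cX_le z; have h2 := cY_le z; have h3 := le_cX z; have h4 := le_cY z
  have hUD : U * dD z = n1 z := by rw [hU]; field_simp
  have hWD : W * dD z = n2 z := by rw [hW]; field_simp
  have e0 : U ^ 2 * (dD z / 2) ^ 2 = (n1 z / 2) ^ 2 := by rw [← hUD]; ring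
  have e1 : dD z / 2 - U ^ 2 * (dD z / 2) ^ 2 = 1 - (cX z + cY z) / 2 := by
    rw [e0]; simp only [n1, dD]; ring
  have e2 : 2 - dD z / 2 + U ^ 2 * (dD z / 2) ^ 2 = 1 + (cX z + cY z) / 2 := by linarith
  have e3 : (dD z / 2) ^ 2 * ((1 - U ^ 2 * (dD z / 2)) ^ 2 - U ^ 2) = (1 - cX z) * (1 - cY z) := by
    have : (dD z / 2) ^ 2 * ((1 - U ^ 2 * (dD z / 2)) ^ 2 - U ^ 2) =
      (dD z / 2 - U ^ 2 * (dD z / 2) ^ 2) ^ 2 - U ^ 2 * (dD z / 2) ^ 2 := by ring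
    rw [this, e1, e0, n1]; ring
  have e4 : (2 - dD z / 2 + U ^ 2 * (dD z / 2) ^ 2) ^ 2 - U ^ 2 * (dD z / 2) ^ 2 =
      (1 + cX z) * (1 + cY z) := by
    rw [e2, e0, n1]; ring
  have hD2 : 0 < (dD z / 2) ^ 2 := by positivity
  refine ⟨?_, ?_, ?_, ?_, ?_⟩
  · have : (n1 z / 2) ^ 2 ≤ 1 / 2 * (dD z / 2) := by
      have : n1 z ^ 2 ≤ dD z := by
        simp only [n1, dD]
        rcases le_total (cX z) (cY z) with h | h <;> nlinarith
      nlinarith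
    rw [← e0] at this
    have : U ^ 2 * (dD z / 2) * (dD z / 2) ≤ 1 / 2 * (dD z / 2) := by nlinarith
    exact le_of_mul_le_mul_right this (by positivity)
  · refine nonneg_of_mul_nonneg_right (a := (dD z / 2) ^ 2) ?_ hD2
    rw [e3]; exact mul_nonneg (by linarith) (by linarith)
  · rw [e4]; exact mul_nonneg (by linarith) (by linarith)
  · rw [e2]; linarith
  · rw [e4]
    apply mul_left_cancel₀ hD2.ne'
    rw [← mul_assoc _ _ ((1 + cX z) * (1 + cY z)), e3]
    have : (dD z / 2) ^ 2 * (4 * W ^ 2) = (W * dD z) ^ 2 := by ring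
    rw [this, hWD, n2, mul_pow, sX_sq, sY_sq]; ring

lemma cos_eq_iff' {x y : ℝ} (h : Real.cos (2 * Real.pi * x) = Real.cos (2 * Real.pi * y)) :
    ∃ k : ℤ, y = x + k ∨ y = -x + k := by
  obtain ⟨k, hk⟩ := Real.cos_eq_cos_iff.1 h
  have := Real.pi_pos
  refine ⟨k, ?_⟩
  rcases hk with hk | hk
  · left
    have : (2 * Real.pi) * (y - (x + k)) = 0 := by linarith
    rcases mul_eq_zero.1 this with h | h <;> linarith
  · right
    have : (2 * Real.pi) * (y - (-x + k)) = 0 := by linarith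
    rcases mul_eq_zero.1 this with h | h <;> linarith

lemma sin_shift (x : ℝ) (k : ℤ) : Real.sin (2 * Real.pi * (x + k)) = Real.sin (2 * Real.pi * x) := by
  rw [mul_add, mul_comm (2 * Real.pi) (k : ℝ)]; exact Real.sin_add_int_mul_two_pi _ _
lemma cos_shift (x : ℝ) (k : ℤ) : Real.cos (2 * Real.pi * (x + k)) = Real.cos (2 * Real.pi * x) := by
  rw [mul_add, mul_comm (2 * Real.pi) (k : ℝ)]; exact Real.cos_add_int_mul_two_pi _ _

/-- integer translation equivalence up to sign -/
def Pm (z w : ℝ × ℝ) : Prop := ∃ m n : ℤ, w = (z.1 + m, z.2 + n) ∨ w = (-z.1 + m, -z.2 + n)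

lemma pm_of_xyz {z w : ℝ × ℝ} (hX : cX z = cX w) (hY : cY z = cY w) (hZ : n2 z = n2 w) :
    Pm z w := by
  obtain ⟨m, hm⟩ := cos_eq_iff' hX
  obtain ⟨n, hn⟩ := cos_eq_iff' hY
  have neg : ∀ t : ℝ, ∀ k : ℤ, Real.sin (2 * Real.pi * (-t + k)) = - Real.sin (2 * Real.pi * t) := by
    intro t k; rw [sin_shift, mul_neg, Real.sin_neg]
  obtain ⟨x, y⟩ := z
  obtain ⟨x', y'⟩ := w
  simp only [n2, sX, sY] at *
  rcases hm with hm | hm <;> rcases hn with hn | hn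
  · exact ⟨m, n, Or.inl (by simp [hm, hn])⟩
  · rw [hm, hn, sin_shift, neg] at hZ
    have : Real.sin (2 * Real.pi * x) * Real.sin (2 * Real.pi * y) = 0 := by linarith
    rcases mul_eq_zero.1 this with h | h
    · obtain ⟨k, rfl⟩ := (sin_zero_iff _).1 h
      exact ⟨k + m, n, Or.inr (by rw [hm, hn]; push_cast; ext <;> simp; ring)⟩
    · obtain ⟨k, rfl⟩ := (sin_zero_iff _).1 h
      exact ⟨m, -k + n, Or.inl (by rw [hm, hn]; push_cast; ext <;> simp; ring)⟩
  · rw [hm, hn, neg, sin_shift] at hZ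
    have : Real.sin (2 * Real.pi * x) * Real.sin (2 * Real.pi * y) = 0 := by linarith
    rcases mul_eq_zero.1 this with h | h
    · obtain ⟨k, rfl⟩ := (sin_zero_iff _).1 h
      exact ⟨-k + m, n, Or.inl (by rw [hm, hn]; push_cast; ext <;> simp; ring)⟩
    · obtain ⟨k, rfl⟩ := (sin_zero_iff _).1 h
      exact ⟨m, k + n, Or.inr (by rw [hm, hn]; push_cast; ext <;> simp; ring)⟩
  · exact ⟨m, n, Or.inr (by simp [hm, hn])⟩

lemma th_inj {z w : ℝ × ℝ} (hz : z ∉ ZLat) (hw : w ∉ ZLat) (hP : tP z = tP w) (hR : tR z = tR w) :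
    Pm z w := by
  have lam : ∀ z, z ∉ ZLat → tP z ^ 2 + tR z ^ 2 = (dD z ^ 2 / dl z) ^ 2 - dD z ^ 2 / dl z := by
    intro z hz
    have := (dl_pos z hz).ne'
    rw [tP, tR]; field_simp; simp only [dl]; ring
  have lam1 : ∀ z, z ∉ ZLat → 1 ≤ dD z ^ 2 / dl z := by
    intro z hz
    rw [le_div_iff₀ (dl_pos z hz), one_mul]; exact dl_le_sq z
  have el : dD z ^ 2 / dl z = dD w ^ 2 / dl w := by
    have h1 := lam z hz; have h2 := lam w hw; have h3 := lam1 z hz; have h4 := lam1 w hw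
    rw [hP, hR, h2] at h1
    generalize dD z ^ 2 / dl z = a at *
    generalize dD w ^ 2 / dl w = b at *
    have : (a - b) * (a + b - 1) = 0 := by linarith
    rcases mul_eq_zero.1 this with h | h <;> linarith
  have form : ∀ z, z ∉ ZLat → n1 z / dD z = tP z / (dD z ^ 2 / dl z) ∧
      n2 z / dD z = tR z / (dD z ^ 2 / dl z) := by
    intro z hz
    have := (dl_pos z hz).ne'
    have := (dD_pos z hz).ne'
    rw [tP, tR]; constructor <;> field_simp
  have eU : n1 z / dD z = n1 w / dD w := by rw [(form z hz).1, (form w hw).1, hP, el]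
  have eW : n2 z / dD z = n2 w / dD w := by rw [(form z hz).2, (form w hw).2, hR, el]
  obtain ⟨a1, a2, a3, a4, a5⟩ := tau_rel z hz rfl rfl
  obtain ⟨b1, b2, b3, b4, b5⟩ := tau_rel w hw eU eW
  have hDz := dD_pos z hz
  have hDw := dD_pos w hw
  have c1 : (n1 z / dD z) ^ 2 < 1 := by
    rw [div_pow, div_lt_one (by positivity)]
    have := dl_pos z hz
    rw [dl] at this; nlinarith [sq_nonneg (n2 z)]
  have eD : dD z = dD w := by
    rcases lt_trichotomy (dD z) (dD w) with h | h | h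
    · exact (tau_aux (sq_nonneg _) (by positivity) (by linarith) b1 c1 b2 b3 b4
        (a5.symm.trans b5)).elim
    · exact h
    · exact (tau_aux (sq_nonneg _) (by positivity) (by linarith) a1 c1 a2 a3 a4
        (b5.symm.trans a5)).elim
  rw [eD] at eU eW
  rw [div_left_inj' hDw.ne'] at eU eW
  have eS : cX z + cY z = cX w + cY w := by
    have := eD
    simp only [dD] at this
    have e := eU
    simp only [n1] at e
    rw [e] at this
    linarith
  simp only [n1] at eU
  exact pm_of_xyz (by linarith) (by linarith) eW
end

/-! ## Part 14 -/
open Filter Topology Set Function MeasureTheory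
noncomputable section
set_option linter.unusedSectionVars false

lemma cX_sm : ContDiff ℝ (⊤ : ℕ∞) cX := by unfold cX; fun_prop
lemma cY_sm : ContDiff ℝ (⊤ : ℕ∞) cY := by unfold cY; fun_prop
lemma sX_sm : ContDiff ℝ (⊤ : ℕ∞) sX := by unfold sX; fun_prop
lemma sY_sm : ContDiff ℝ (⊤ : ℕ∞) sY := by unfold sY; fun_prop
lemma n1_sm : ContDiff ℝ (⊤ : ℕ∞) n1 := cX_sm.sub cY_sm
lemma n2_sm : ContDiff ℝ (⊤ : ℕ∞) n2 := sX_sm.mul sY_sm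
lemma dD_sm : ContDiff ℝ (⊤ : ℕ∞) dD :=
  ((contDiff_const.sub cX_sm).sub cY_sm).add (((cX_sm.sub cY_sm).pow 2).div_const 2)
lemma dl_sm : ContDiff ℝ (⊤ : ℕ∞) dl := ((dD_sm.pow 2).sub (n1_sm.pow 2)).sub (n2_sm.pow 2)

lemma tP_sm (z) (hz : z ∉ ZLat) : ContDiffAt ℝ (⊤ : ℕ∞) tP z :=
  (n1_sm.mul dD_sm).contDiffAt.div dl_sm.contDiffAt (dl_pos z hz).ne'
lemma tR_sm (z) (hz : z ∉ ZLat) : ContDiffAt ℝ (⊤ : ℕ∞) tR z :=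
  (n2_sm.mul dD_sm).contDiffAt.div dl_sm.contDiffAt (dl_pos z hz).ne'

def TH (z : ℝ × ℝ) : ℝ × ℝ := (tP z, tR z)

lemma TH_sm (z) (hz : z ∉ ZLat) : ContDiffAt ℝ (⊤ : ℕ∞) TH z := (tP_sm z hz).prodMk (tR_sm z hz)

lemma TH_deriv (z) (hz : z ∉ ZLat) : ∃ f' : ℝ × ℝ →L[ℝ] ℝ × ℝ, HasFDerivAt TH f' z ∧
    f'.det = tdet z := by
  obtain ⟨a, b, c, d, h1, h2, h3⟩ := th_deriv z hz
  exact ⟨_, HasFDerivAt.prodMk h1 h2, by rw [lf_det, h3]⟩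

lemma cX_per : Per cX := by
  constructor <;> intro x y <;> simp only [cX]
  have := cos_shift x 1; push_cast at this; exact this
lemma cY_per : Per cY := by
  constructor <;> intro x y <;> simp only [cY]
  have := cos_shift y 1; push_cast at this; exact this
lemma sX_per : Per sX := by
  constructor <;> intro x y <;> simp only [sX]
  have := sin_shift x 1; push_cast at this; exact this
lemma sY_per : Per sY := by
  constructor <;> intro x y <;> simp only [sY]
  have := sin_shift y 1; push_cast at this; exact this
lemma n1_per : Per n1 := cX_per.comp2 cY_per (fun a b => a - b)
lemma n2_per : Per n2 := sX_per.comp2 sY_per (fun a b => a * b)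
lemma dD_per : Per dD := cX_per.comp2 cY_per (fun a b => 2 - a - b + (a - b) ^ 2 / 2)
lemma dl_per : Per dl := dD_per.comp2 (n1_per.comp2 n2_per Prod.mk) (fun a b => a ^ 2 - b.1 ^ 2 - b.2 ^ 2)
lemma tP_per : Per tP := (n1_per.comp2 dD_per (fun a b => a * b)).comp2 dl_per (fun a b => a / b)
lemma tR_per : Per tR := (n2_per.comp2 dD_per (fun a b => a * b)).comp2 dl_per (fun a b => a / b)
lemma TH_per : Per TH := tP_per.comp2 tR_per Prod.mk

lemma cX_even (z) : cX (-z) = cX z := by simp [cX]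
lemma cY_even (z) : cY (-z) = cY z := by simp [cY]
lemma n1_even (z) : n1 (-z) = n1 z := by simp [n1, cX_even, cY_even]
lemma n2_even (z) : n2 (-z) = n2 z := by simp [n2, sX, sY]
lemma dD_even (z) : dD (-z) = dD z := by simp [dD, cX_even, cY_even]
lemma dl_even (z) : dl (-z) = dl z := by simp [dl, n1_even, n2_even, dD_even]
lemma TH_even (z) : TH (-z) = TH z := by simp [TH, tP, tR, n1_even, n2_even, dD_even, dl_even]

/-- smooth local inverse -/
lemma loc_inv {f : ℝ × ℝ → ℝ × ℝ} {f' : ℝ × ℝ →L[ℝ] ℝ × ℝ} {z : ℝ × ℝ}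
    (hf : ContDiffAt ℝ (⊤ : ℕ∞) f z) (hf' : HasFDerivAt f f' z) (hd : f'.det ≠ 0) :
    ∃ G : ℝ × ℝ → ℝ × ℝ, G (f z) = z ∧ ContDiffAt ℝ (⊤ : ℕ∞) G (f z) ∧
      (∀ᶠ w in 𝓝 (f z), f (G w) = w) ∧ (∀ᶠ x in 𝓝 z, G (f x) = x) := by
  let e : (ℝ × ℝ) ≃L[ℝ] (ℝ × ℝ) := ContinuousLinearMap.toContinuousLinearEquivOfDetNeZero f' hd
  have he : (e : ℝ × ℝ →L[ℝ] ℝ × ℝ) = f' := by ext <;> simp [e]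
  have hf2 : HasFDerivAt f (e : ℝ × ℝ →L[ℝ] ℝ × ℝ) z := by rw [he]; exact hf'
  have hn : ((⊤ : ℕ∞) : WithTop ℕ∞) ≠ 0 := by simp
  refine ⟨hf.localInverse hf2 hn, hf.localInverse_apply_image hf2 hn, hf.to_localInverse hf2 hn, ?_, ?_⟩
  · exact (hf.hasStrictFDerivAt' hf2 hn).eventually_right_inverse
  · exact (hf.hasStrictFDerivAt' hf2 hn).eventually_left_inverse

lemma HLat_closed : IsClosed HLat := by
  have : HLat = {z | sX z = 0} ∩ {z | sY z = 0} := by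
    ext z; rw [HLat_iff]; rfl
  rw [this]
  exact (isClosed_eq sX_sm.continuous continuous_const).inter
    (isClosed_eq sY_sm.continuous continuous_const)

def BadP : Set (ℝ × ℝ) := {(2/3, 0), (-2/3, 0), (0, 0)}

lemma TH_open : IsOpen (TH '' HLatᶜ) := by
  rw [isOpen_iff_mem_nhds]
  rintro _ ⟨z, hz, rfl⟩
  have hz' : z ∉ ZLat := fun h => hz (ZLat_sub h)
  obtain ⟨f', h1, h2⟩ := TH_deriv z hz'
  obtain ⟨G, g1, g2, g3, -⟩ := loc_inv (TH_sm z hz') h1 (by rw [h2]; exact (tdet_pos z hz).ne')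
  have : ∀ᶠ w in 𝓝 (TH z), G w ∈ HLatᶜ :=
    g2.continuousAt.eventually (by rw [g1]; exact HLat_closed.isOpen_compl.mem_nhds hz)
  filter_upwards [g3, this] with w h1 h2
  exact ⟨_, h2, h1⟩

lemma TH_norm (z) (hz : z ∉ ZLat) : tP z ^ 2 + tR z ^ 2 = (dD z ^ 2 / dl z) ^ 2 - dD z ^ 2 / dl z := by
  have := (dl_pos z hz).ne'
  rw [tP, tR]; field_simp; simp only [dl]; ring

lemma TH_proper (z) (hz : z ∉ ZLat) : 1 ≤ 2 * dD z * (tP z ^ 2 + tR z ^ 2 + 2) := by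
  have h1 := dl_pos z hz
  have h2 := dD_pos z hz
  rw [TH_norm z hz]
  have h3 : 1 ≤ 2 * dD z * (dD z ^ 2 / dl z) := by
    rw [← mul_div_assoc, le_div_iff₀ h1]; have := dl_le z; nlinarith
  refine h3.trans ?_
  gcongr
  nlinarith [sq_nonneg (dD z ^ 2 / dl z - 1)]

lemma sq_eq_one' {a : ℝ} (h : a ^ 2 = 1) : a = 1 ∨ a = -1 := by
  have : (a - 1) * (a + 1) = 0 := by linarith
  rcases mul_eq_zero.1 this with h | h
  · left; linarith
  · right; linarith

lemma not_bad {w : ℝ × ℝ} (h : w.2 ≠ 0) : w ∉ BadP := by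
  rintro (rfl | rfl | rfl) <;> simp at h

lemma TH_bad (z) (hz : z ∉ ZLat) (hz' : z ∈ HLat) : TH z ∈ BadP := by
  obtain ⟨h1, h2⟩ := (HLat_iff z).1 hz'
  have h3 := sX_sq z
  have h4 := sY_sq z
  rw [h1] at h3; rw [h2] at h4
  have hx : cX z = 1 ∨ cX z = -1 := sq_eq_one' (by linarith)
  have hy : cY z = 1 ∨ cY z = -1 := sq_eq_one' (by linarith)
  have := ab_zero z hz
  simp only [TH, tP, tR, dl, n1, n2, dD, h1, h2, BadP]
  rcases hx with hx | hx <;> rcases hy with hy | hy <;> rw [hx, hy] at * <;> norm_num at *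

lemma TH_surj (w : ℝ × ℝ) (hw : w ∉ BadP) : ∃ z ∉ HLat, TH z = w := by
  have hB : BadP.Countable := by unfold BadP; exact (Set.toFinite _).countable
  have hc : IsConnected BadPᶜ := hB.isConnected_compl_of_one_lt_rank (by simp [one_add_one_eq_two])
  have key := hc.isPreconnected.subset_of_closure_inter_subset TH_open ?_ ?_
  · obtain ⟨z, hz, h⟩ := key hw
    exact ⟨z, hz, h⟩
  · have e1 : sX (1/4, 1/4) = 1 := by
      have : 2 * Real.pi * (1 / 4) = Real.pi / 2 := by ring
      simp only [sX]; rw [this, Real.sin_pi_div_two]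
    have e2 : sY (1/4, 1/4) = 1 := e1
    have e3 : cX (1/4, 1/4) = 0 := by have := sX_sq (1/4, 1/4); rw [e1] at this; nlinarith
    have e4 : cY (1/4, 1/4) = 0 := e3
    refine ⟨TH (1/4, 1/4), not_bad ?_, mem_image_of_mem _ ?_⟩
    · simp only [TH, tR, n2, dD, dl, n1, e1, e2, e3, e4]; norm_num
    · rw [mem_compl_iff, HLat_iff, e1]; simp
  · rintro w ⟨hw, hwB⟩
    obtain ⟨u, hu, hlim⟩ := mem_closure_iff_seq_limit.1 hw
    have : ∀ n, ∃ z ∈ Icc (0:ℝ) 1 ×ˢ Icc (0:ℝ) 1, z ∉ HLat ∧ TH z = u n := by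
      intro n
      obtain ⟨z, hz, h⟩ := hu n
      refine ⟨(Int.fract z.1, Int.fract z.2), ⟨⟨Int.fract_nonneg _, (Int.fract_lt_one _).le⟩,
        ⟨Int.fract_nonneg _, (Int.fract_lt_one _).le⟩⟩, ?_, ?_⟩
      · rw [HLat_iff, ← sX_per.fract, ← sY_per.fract, ← HLat_iff]; exact hz
      · rw [← TH_per.fract, h]
    choose z hz1 hz2 hz3 using this
    obtain ⟨a, -, φ, hφ, ha⟩ := (isCompact_Icc.prod isCompact_Icc).tendsto_subseq hz1
    have hlim' := hlim.comp hφ.tendsto_atTop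
    have haZ : a ∉ ZLat := by
      intro h
      have hd : dD a = 0 := by
        have h1 := (cos_one_iff a.1).2 h.1
        have h2 := (cos_one_iff a.2).2 h.2
        simp only [dD, cX, cY, h1, h2]; norm_num
      have t1 : Tendsto (fun n => 2 * dD (z (φ n)) * ((u (φ n)).1 ^ 2 + (u (φ n)).2 ^ 2 + 2)) atTop
          (𝓝 (2 * dD a * (w.1 ^ 2 + w.2 ^ 2 + 2))) := by
        have e1 : Tendsto (fun n => (u (φ n)).1) atTop (𝓝 w.1) := (continuous_fst.tendsto w).comp hlim'
        have e2 : Tendsto (fun n => (u (φ n)).2) atTop (𝓝 w.2) := (continuous_snd.tendsto w).comp hlim'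
        have e3 : Tendsto (fun n => dD (z (φ n))) atTop (𝓝 (dD a)) := (dD_sm.continuous.tendsto a).comp ha
        exact (e3.const_mul 2).mul (((e1.pow 2).add (e2.pow 2)).add_const 2)
      rw [hd] at t1
      have : (1:ℝ) ≤ 2 * 0 * (w.1 ^ 2 + w.2 ^ 2 + 2) := by
        refine ge_of_tendsto t1 (Eventually.of_forall fun n => ?_)
        have := TH_proper (z (φ n)) (fun h => hz2 _ (ZLat_sub h))
        rw [← hz3 (φ n)]; exact this
      norm_num at this
    have hT : TH a = w := by
      refine tendsto_nhds_unique ((TH_sm a haZ).continuousAt.tendsto.comp ha) ?_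
      refine hlim'.congr fun n => ?_
      simp [hz3]
    refine ⟨a, fun h => hwB ?_, hT⟩
    rw [← hT]; exact TH_bad a haZ h
end

/-! ## Part 15 -/
open Filter Topology Set Function MeasureTheory
noncomputable section
set_option linter.unusedSectionVars false

/-! ### flat functions -/
def nN (z : ℝ × ℝ) : ℝ := (n1 z ^ 2 + n2 z ^ 2) * dD z ^ 2
def gK (k : ℕ) (z : ℝ × ℝ) : ℝ := (dl z)⁻¹ ^ k * Real.exp (-(nN z * (dl z)⁻¹ ^ 2))

lemma nN_sm : ContDiff ℝ (⊤ : ℕ∞) nN := ((n1_sm.pow 2).add (n2_sm.pow 2)).mul (dD_sm.pow 2)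

lemma dD_nonneg (z) : 0 ≤ dD z := by
  have h1 := cX_le z; have h2 := cY_le z; have := dD_ge z; linarith

lemma nN_nonneg (z) : 0 ≤ nN z := by unfold nN; positivity

lemma gK_nonneg (k z) : 0 ≤ gK k z := by
  have := dl_nonneg z
  unfold gK; positivity

lemma gK_bdd (k : ℕ) : ∃ C, 0 ≤ C ∧ ∀ z, gK k z ≤ C := by
  refine ⟨1 + 32 ^ k + 128 ^ k * (3 * k).factorial, by positivity, fun z => ?_⟩
  have hdl := dl_nonneg z
  have hD := dD_nonneg z
  have hN := nN_nonneg z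
  have hexp : Real.exp (-(nN z * (dl z)⁻¹ ^ 2)) ≤ 1 := by
    rw [Real.exp_le_one_iff]; have : 0 ≤ nN z * (dl z)⁻¹ ^ 2 := by positivity
    linarith
  have hfac : (0:ℝ) ≤ 128 ^ k * (3 * k).factorial := by positivity
  rcases hdl.eq_or_lt with h0 | hpos
  · have : gK k z ≤ 1 := by
      unfold gK
      apply mul_le_one₀ _ (Real.exp_pos _).le hexp
      rw [← h0, inv_zero]
      exact pow_le_one₀ le_rfl zero_le_one
    have : (0:ℝ) ≤ 32 ^ k := by positivity
    linarith
  have hDpos : 0 < dD z := by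
    rcases hD.eq_or_lt with h | h
    · have := dl_le z; rw [← h] at this; norm_num at this; linarith
    · exact h
  by_cases hc : dD z ^ 2 / 2 ≤ dl z
  · have h1 := dl_le z
    have h2 : 1 / 4 ≤ dD z := by
      have : dD z ^ 2 * (1 / 4) ≤ dD z ^ 2 * dD z := by nlinarith
      exact le_of_mul_le_mul_left this (by positivity)
    have h3 : 1 / 32 ≤ dl z := by nlinarith
    have h4 : (dl z)⁻¹ ≤ 32 := by
      rw [inv_le_comm₀ hpos (by norm_num)]; linarith
    have : gK k z ≤ 32 ^ k * 1 := by
      unfold gK; gcongr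
    linarith
  · push Not at hc
    set s := nN z * (dl z)⁻¹ ^ 2 with hs
    have hs0 : 0 ≤ s := by positivity
    have hNe : nN z = (dD z ^ 2 - dl z) * dD z ^ 2 := by simp only [nN, dl]; ring
    have hN2 : dD z ^ 4 / 2 ≤ nN z := by rw [hNe]; nlinarith [sq_nonneg (dD z)]
    have hs1 : dD z ^ 4 / 2 * (dl z)⁻¹ ^ 2 ≤ s := by rw [hs]; gcongr
    have hs2 : (dl z)⁻¹ ^ 2 ≤ 128 * s ^ 3 := by
      have a1 : (dD z ^ 4 / 2 * (dl z)⁻¹ ^ 2) ^ 3 ≤ s ^ 3 := by gcongr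
      have a2 : dl z / 2 ≤ dD z ^ 3 := by have := dl_le z; linarith
      have a3 : (dl z / 2) ^ 4 ≤ (dD z ^ 3) ^ 4 := by gcongr
      have a4 : (dD z ^ 4 / 2 * (dl z)⁻¹ ^ 2) ^ 3 = (dD z ^ 3) ^ 4 * (dl z)⁻¹ ^ 6 / 8 := by ring
      have a5 : (dl z / 2) ^ 4 * (dl z)⁻¹ ^ 6 ≤ (dD z ^ 3) ^ 4 * (dl z)⁻¹ ^ 6 := by gcongr
      have a6 : (dl z / 2) ^ 4 * (dl z)⁻¹ ^ 6 = (dl z)⁻¹ ^ 2 / 16 := by field_simp; norm_num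
      linarith
    have h5 : (dl z)⁻¹ ^ k ≤ 1 + ((dl z)⁻¹ ^ 2) ^ k := by
      have : ((dl z)⁻¹ ^ 2) ^ k = ((dl z)⁻¹ ^ k) ^ 2 := by rw [← pow_mul, ← pow_mul, mul_comm]
      rw [this]; nlinarith [sq_nonneg ((dl z)⁻¹ ^ k - 1), sq_nonneg ((dl z)⁻¹ ^ k)]
    have h6 : ((dl z)⁻¹ ^ 2) ^ k ≤ 128 ^ k * (3 * k).factorial * Real.exp s := by
      have a1 : ((dl z)⁻¹ ^ 2) ^ k ≤ (128 * s ^ 3) ^ k := by gcongr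
      have a2 := Real.pow_div_factorial_le_exp s hs0 (3 * k)
      rw [div_le_iff₀ (by positivity)] at a2
      rw [mul_pow, ← pow_mul s] at a1
      refine a1.trans ?_
      rw [mul_assoc]
      gcongr
      linarith
    have h7 : Real.exp s * Real.exp (-s) = 1 := by rw [← Real.exp_add]; simp
    have : gK k z ≤ (1 + 128 ^ k * (3 * k).factorial * Real.exp s) * Real.exp (-s) := by
      unfold gK; rw [← hs]; gcongr; linarith
    have e : (1 + 128 ^ k * (3 * k).factorial * Real.exp s) * Real.exp (-s) =
      Real.exp (-s) + 128 ^ k * (3 * k).factorial := by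
      rw [add_mul, mul_assoc, h7]; ring
    have : (0:ℝ) ≤ 32 ^ k := by positivity
    linarith

def fK {F : Type} [NormedAddCommGroup F] [NormedSpace ℝ F] (p : ℝ × ℝ → F) (k : ℕ) (z : ℝ × ℝ) : F :=
  gK k z • p z

def fD {F : Type} [NormedAddCommGroup F] [NormedSpace ℝ F] (p : ℝ × ℝ → F) (k : ℕ) (z : ℝ × ℝ) :
    ℝ × ℝ →L[ℝ] F :=
  dl z ^ 3 • fderiv ℝ p z + (-(k * dl z ^ 2) • fderiv ℝ dl z - dl z • fderiv ℝ nN z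
    + (2 * nN z) • fderiv ℝ dl z).smulRight (p z)

lemma gK_dl (k j : ℕ) (z) (h0 : dl z ≠ 0) : gK (k + j) z * dl z ^ j = gK k z := by
  unfold gK
  rw [pow_add, mul_right_comm, mul_assoc _ ((dl z)⁻¹ ^ j), ← mul_pow, inv_mul_cancel₀ h0, one_pow,
    mul_one]

lemma gK_deriv (k : ℕ) (hk : 1 ≤ k) (z : ℝ × ℝ) (h0 : dl z ≠ 0) :
    HasFDerivAt (gK k) (gK (k + 3) z • (-(k * dl z ^ 2) • fderiv ℝ dl z - dl z • fderiv ℝ nN z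
    + (2 * nN z) • fderiv ℝ dl z)) z := by
  have d1 : HasFDerivAt dl (fderiv ℝ dl z) z := (dl_sm.differentiable (by simp) z).hasFDerivAt
  have d2 : HasFDerivAt nN (fderiv ℝ nN z) z := (nN_sm.differentiable (by simp) z).hasFDerivAt
  have di : HasFDerivAt (fun w => (dl w)⁻¹) (-(dl z ^ 2)⁻¹ • fderiv ℝ dl z) z :=
    (hasDerivAt_inv h0).comp_hasFDerivAt z d1
  have dg := ((di.pow k).mul ((d2.mul (di.pow 2)).neg.exp))
  refine dg.congr_fderiv ?_
  obtain ⟨j, rfl⟩ : ∃ j, k = j + 1 := ⟨k - 1, by omega⟩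
  ext
  all_goals
    simp only [ContinuousLinearMap.comp_apply, add_apply, smul_apply, sub_apply, neg_apply, smul_eq_mul, gK,
      add_tsub_cancel_right]
    generalize Real.exp _ = E
    generalize (fderiv ℝ dl z) _ = A
    generalize (fderiv ℝ nN z) _ = B
    generalize hi : (dl z)⁻¹ = i
    have : dl z = i⁻¹ := by rw [← hi, inv_inv]
    have hi0 : i ≠ 0 := by rw [← hi]; exact inv_ne_zero h0
    rw [this]
    push_cast
    field_simp
    ring

lemma fK_deriv {F : Type} [NormedAddCommGroup F] [NormedSpace ℝ F] {p : ℝ × ℝ → F}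
    (hp : ContDiff ℝ (⊤ : ℕ∞) p) (k : ℕ) (hk : 1 ≤ k) (z : ℝ × ℝ) :
    HasFDerivAt (fK p k) (fK (fD p k) (k + 3) z) z := by
  have d1 : HasFDerivAt dl (fderiv ℝ dl z) z := (dl_sm.differentiable (by simp) z).hasFDerivAt
  have d2 : HasFDerivAt nN (fderiv ℝ nN z) z := (nN_sm.differentiable (by simp) z).hasFDerivAt
  have d3 : HasFDerivAt p (fderiv ℝ p z) z := (hp.differentiable (by simp) z).hasFDerivAt
  have hk0 : k ≠ 0 := by omega
  by_cases h0 : dl z = 0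
  · have e0 : fK (fD p k) (k + 3) z = 0 := by simp [fK, gK, h0]
    have e1 : fK p k z = 0 := by simp [fK, gK, h0, hk0]
    rw [e0]
    obtain ⟨C, hC0, hC⟩ := gK_bdd (k + 2)
    have h1 : HasFDerivAt (fun w => dl w ^ 2 • p w) (0 : ℝ × ℝ →L[ℝ] F) z := by
      refine ((d1.pow 2).smul d3).congr_fderiv ?_
      ext <;> simp [h0]
    rw [hasFDerivAt_iff_isLittleO] at h1 ⊢
    refine Asymptotics.IsBigO.trans_isLittleO ?_ h1
    refine Asymptotics.IsBigO.of_bound C (Eventually.of_forall fun w => ?_)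
    simp only [e1, h0, sub_zero, zero_apply]
    have : fK p k w = gK (k + 2) w • (dl w ^ 2 • p w) := by
      unfold fK
      rw [smul_smul]; congr 1
      by_cases hw : dl w = 0
      · simp [gK, hw, hk0]
      · rw [← gK_dl k 2 w hw, mul_comm]
    rw [this, norm_smul, Real.norm_of_nonneg (gK_nonneg _ _)]
    simp
    gcongr
    exact hC w
  · refine ((gK_deriv k hk z h0).smul d3).congr_fderiv ?_
    rw [← gK_dl k 3 z h0]
    ext <;> simp [fK, fD, smul_smul, mul_comm] <;> congr 1 <;> ring

lemma fK_cd (n : ℕ) : ∀ {F : Type} [NormedAddCommGroup F] [NormedSpace ℝ F] {p : ℝ × ℝ → F}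
    (_ : ContDiff ℝ (⊤ : ℕ∞) p) (k : ℕ) (_ : 1 ≤ k), ContDiff ℝ n (fK p k) := by
  induction n with
  | zero =>
    intro F _ _ p hp k hk
    rw [Nat.cast_zero, contDiff_zero, continuous_iff_continuousAt]
    exact fun z => (fK_deriv hp k hk z).continuousAt
  | succ n ih =>
    intro F _ _ p hp k hk
    rw [Nat.cast_succ, contDiff_succ_iff_fderiv]
    refine ⟨fun z => (fK_deriv hp k hk z).differentiableAt, by simp, ?_⟩
    have e : fderiv ℝ (fK p k) = fK (fD p k) (k + 3) := funext fun z => (fK_deriv hp k hk z).fderiv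
    rw [e]
    refine ih ?_ _ (by omega)
    have d1 : ContDiff ℝ (⊤ : ℕ∞) (fderiv ℝ dl) := dl_sm.fderiv_right (by simp)
    have d2 : ContDiff ℝ (⊤ : ℕ∞) (fderiv ℝ nN) := nN_sm.fderiv_right (by simp)
    have d3 : ContDiff ℝ (⊤ : ℕ∞) (fderiv ℝ p) := hp.fderiv_right (by simp)
    unfold fD
    refine ((dl_sm.pow 3).smul d3).add (ContDiff.smulRight ?_ hp)
    exact (((contDiff_const.mul (dl_sm.pow 2)).neg.smul d1).sub (dl_sm.smul d2)).add
      ((contDiff_const.mul nN_sm).smul d1)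

lemma fK_sm {F : Type} [NormedAddCommGroup F] [NormedSpace ℝ F] {p : ℝ × ℝ → F}
    (hp : ContDiff ℝ (⊤ : ℕ∞) p) (k : ℕ) (hk : 1 ≤ k) : ContDiff ℝ (⊤ : ℕ∞) (fK p k) :=
  contDiff_infty.2 fun n => fK_cd n hp k hk

/-- the density -/
def rho (z : ℝ × ℝ) : ℝ := Real.pi⁻¹ * Real.exp (-(tP z ^ 2 + tR z ^ 2)) * tdet z

lemma det3_sm : ContDiff ℝ (⊤ : ℕ∞) det3 := by
  unfold det3
  exact (contDiff_const.sub (cX_sm.mul cY_sm)).mul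
    (((contDiff_const.mul (contDiff_const.sub cX_sm)).mul (contDiff_const.sub cY_sm)).add
    ((((cX_sm.sub cY_sm).pow 2).mul (cX_sm.add cY_sm)).div_const 2))

lemma rho_sm : ContDiff ℝ (⊤ : ℕ∞) rho := by
  have : rho = fK (fun z => Real.pi⁻¹ * ((2 * Real.pi) ^ 2 * ((2 * dD z ^ 2 - dl z) * dD z * det3 z))) 3 := by
    ext z
    have : tP z ^ 2 + tR z ^ 2 = nN z * (dl z)⁻¹ ^ 2 := by
      simp only [tP, tR, nN, div_eq_mul_inv]; ring
    rw [rho, this, fK, gK, tdet, smul_eq_mul, div_eq_mul_inv, inv_pow]; ring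
  rw [this]
  refine fK_sm ?_ 3 (by norm_num)
  exact contDiff_const.mul (contDiff_const.mul
    ((((contDiff_const.mul (dD_sm.pow 2)).sub dl_sm).mul dD_sm).mul det3_sm))

lemma rho_pos (z) (hz : z ∉ HLat) : 0 < rho z := by
  have := tdet_pos z hz
  unfold rho; have := Real.pi_pos; positivity

lemma rho_nonneg (z) : 0 ≤ rho z := by
  have : Dense (HLatᶜ) := by
    have : HLat.Countable := by
      refine (((Set.countable_range (fun k : ℤ => (k:ℝ)/2)).prod
        (Set.countable_range (fun k : ℤ => (k:ℝ)/2)))).mono ?_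
      rintro z ⟨⟨k, hk⟩, l, hl⟩
      exact ⟨⟨k, hk.symm⟩, ⟨l, hl.symm⟩⟩
    exact this.dense_compl ℝ
  have h := (isClosed_le continuous_const rho_sm.continuous : IsClosed {z | 0 ≤ rho z})
  have h2 : HLatᶜ ⊆ {z | 0 ≤ rho z} := fun z hz => (rho_pos z hz).le
  have := h.closure_subset_iff.2 h2
  rw [Dense.closure_eq ‹_›] at this
  exact this (mem_univ z)

lemma det3_per : Per det3 := cX_per.comp2 cY_per (fun a b => (1 - a * b) *
  (2 * (1 - a) * (1 - b) + (a - b) ^ 2 * (a + b) / 2))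
lemma rho_per : Per rho := (tP_per.comp2 tR_per Prod.mk).comp2
  ((dD_per.comp2 dl_per Prod.mk).comp2 det3_per Prod.mk) (fun a b =>
    Real.pi⁻¹ * Real.exp (-(a.1 ^ 2 + a.2 ^ 2)) *
    ((2 * Real.pi) ^ 2 * ((2 * b.1.1 ^ 2 - b.1.2) * b.1.1 * b.2) / b.1.2 ^ 3))
lemma rho_even (z) : rho (-z) = rho z := by
  simp only [rho, tdet, tP, tR, det3, cX_even, cY_even, n1_even, n2_even, dD_even, dl_even]
end

/-! ## Part 16 -/
open Filter Topology Set Function MeasureTheory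
noncomputable section
set_option linter.unusedSectionVars false

/-! ### Gaussian CDF -/
def cA (t : ℝ) : ℝ := 1 / 2 + (Real.sqrt Real.pi)⁻¹ * ∫ s in (0:ℝ)..t, Real.exp (-s ^ 2)

lemma ge_cont : Continuous (fun s : ℝ => Real.exp (-s ^ 2)) := by fun_prop

lemma cA_deriv (t) : HasDerivAt cA ((Real.sqrt Real.pi)⁻¹ * Real.exp (-t ^ 2)) t :=
  ((ge_cont.integral_hasStrictDerivAt 0 t).hasDerivAt.const_mul _).const_add _

lemma sp_pos : 0 < (Real.sqrt Real.pi)⁻¹ := inv_pos.2 (Real.sqrt_pos.2 Real.pi_pos)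

lemma cA_sm : ContDiff ℝ (⊤ : ℕ∞) cA := by
  rw [contDiff_infty_iff_deriv]
  refine ⟨fun t => (cA_deriv t).differentiableAt, ?_⟩
  have : deriv cA = fun t => (Real.sqrt Real.pi)⁻¹ * Real.exp (-t ^ 2) :=
    funext fun t => (cA_deriv t).deriv
  rw [this]; fun_prop

lemma cA_mono : StrictMono cA := by
  apply strictMono_of_deriv_pos
  intro t; rw [(cA_deriv t).deriv]; have := sp_pos; positivity

lemma cA_top : Tendsto cA atTop (𝓝 1) := by
  have h1 : IntegrableOn (fun s : ℝ => Real.exp (-1 * s ^ 2)) (Ioi 0) :=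
    (integrable_exp_neg_mul_sq one_pos).integrableOn
  have h2 := intervalIntegral_tendsto_integral_Ioi 0 h1 tendsto_id
  rw [integral_gaussian_Ioi] at h2
  have h3 := (h2.const_mul (Real.sqrt Real.pi)⁻¹).const_add (1 / 2)
  have e : (1:ℝ) / 2 + (Real.sqrt Real.pi)⁻¹ * (Real.sqrt (Real.pi / 1) / 2) = 1 := by
    have := sp_pos
    rw [div_one]; have : Real.sqrt Real.pi ≠ 0 := (Real.sqrt_pos.2 Real.pi_pos).ne'
    field_simp; norm_num
  rw [e] at h3
  refine h3.congr fun t => ?_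
  simp [cA]

lemma cA_neg (t) : cA (-t) = 1 - cA t := by
  have : ∫ s in (0:ℝ)..(-t), Real.exp (-s ^ 2) = - ∫ s in (0:ℝ)..t, Real.exp (-s ^ 2) := by
    have := intervalIntegral.integral_comp_neg (a := 0) (b := t) (fun s : ℝ => Real.exp (-s ^ 2))
    simp only [neg_sq, neg_zero] at this
    rw [this, intervalIntegral.integral_symm, ]
  rw [cA, cA, this]; ring

lemma cA_bot : Tendsto cA atBot (𝓝 0) := by
  have h := (cA_top.comp tendsto_neg_atBot_atTop).const_sub 1
  rw [sub_self] at h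
  refine h.congr fun t => ?_
  simp [cA_neg]

lemma cA_mem (t) : cA t ∈ Ioo (0:ℝ) 1 := by
  constructor
  · have h1 : 0 ≤ cA (t - 1) := by
      have := cA_mono.monotone.le_of_tendsto cA_bot (t - 1); exact this
    exact h1.trans_lt (cA_mono (by linarith))
  · have h1 : cA (t + 1) ≤ 1 := cA_mono.monotone.ge_of_tendsto cA_top (t + 1)
    exact (cA_mono (by linarith : t < t + 1)).trans_le h1

lemma cA_surj {s : ℝ} (hs : s ∈ Ioo (0:ℝ) 1) : ∃ t, cA t = s := by
  obtain ⟨a, ha⟩ := (cA_bot.eventually_lt_const hs.1).exists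
  obtain ⟨b, hb⟩ := (cA_top.eventually_const_lt hs.2).exists
  obtain ⟨t, ht⟩ := mem_range_of_exists_le_of_exists_ge cA_sm.continuous ⟨a, ha.le⟩ ⟨b, hb.le⟩
  exact ⟨t, ht⟩

lemma cA_zero : cA 0 = 1 / 2 := by simp [cA]

/-! ### the map Psi1 -/
def Psi1 (z : ℝ × ℝ) : ℝ × ℝ := (cA (tP z), cA (tR z))

abbrev Q0 : Set (ℝ × ℝ) := Ioo (0:ℝ) 1 ×ˢ Ioo (0:ℝ) 1

lemma Psi1_mem (z) : Psi1 z ∈ Q0 := ⟨cA_mem _, cA_mem _⟩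
lemma Psi1_per : Per Psi1 := TH_per.comp (fun w => (cA w.1, cA w.2))
lemma Psi1_even (z) : Psi1 (-z) = Psi1 z := by
  have := TH_even z
  simp only [TH, Prod.mk.injEq] at this
  simp only [Psi1, this]
lemma Psi1_sm (z) (hz : z ∉ ZLat) : ContDiffAt ℝ (⊤ : ℕ∞) Psi1 z :=
  (cA_sm.contDiffAt.comp z (tP_sm z hz)).prodMk (cA_sm.contDiffAt.comp z (tR_sm z hz))
lemma Psi1_inj {z w} (hz : z ∉ ZLat) (hw : w ∉ ZLat) (h : Psi1 z = Psi1 w) : Pm z w := by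
  simp only [Psi1, Prod.mk.injEq] at h
  exact th_inj hz hw (cA_mono.injective h.1) (cA_mono.injective h.2)
lemma Psi1_surj {q} (hq : q ∈ Q0) (h : q.2 ≠ 1 / 2) : ∃ z ∉ HLat, Psi1 z = q := by
  obtain ⟨a, ha⟩ := cA_surj hq.1
  obtain ⟨b, hb⟩ := cA_surj hq.2
  have hb0 : b ≠ 0 := by rintro rfl; rw [cA_zero] at hb; exact h hb.symm
  obtain ⟨z, hz, hzz⟩ := TH_surj (a, b) (not_bad hb0)
  refine ⟨z, hz, ?_⟩
  simp only [TH, Prod.mk.injEq] at hzz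
  simp only [Psi1, hzz, ha, hb]
lemma Psi1_deriv (z) (hz : z ∉ ZLat) : ∃ f' : ℝ × ℝ →L[ℝ] ℝ × ℝ, HasFDerivAt Psi1 f' z ∧
    f'.det = rho z := by
  obtain ⟨a, b, c, d, h1, h2, h3⟩ := th_deriv z hz
  refine ⟨_, HasFDerivAt.prodMk (h1.comp (cA_deriv _)) (h2.comp (cA_deriv _)), ?_⟩
  rw [lf_det, rho, neg_add, Real.exp_add]
  have : Real.pi⁻¹ = (Real.sqrt Real.pi)⁻¹ * (Real.sqrt Real.pi)⁻¹ := by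
    rw [← mul_inv, Real.mul_self_sqrt Real.pi_pos.le]
  rw [this, ← h3]; ring
lemma Psi1_meas : Measurable Psi1 := by
  have : Measurable tP := (n1_sm.mul dD_sm).continuous.measurable.div dl_sm.continuous.measurable
  have : Measurable tR := (n2_sm.mul dD_sm).continuous.measurable.div dl_sm.continuous.measurable
  have := cA_sm.continuous.measurable
  unfold Psi1; fun_prop

def Hc (c : ℝ) : Set (ℝ × ℝ) := Ioc (0:ℝ) 1 ×ˢ Ioo c (c + 1/2)
lemma Hc_meas (c) : MeasurableSet (Hc c) := measurableSet_Ioc.prod measurableSet_Ioo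

lemma Hc_not {c : ℝ} {k : ℤ} (hc : c = k / 2) {z : ℝ × ℝ} (hz : z ∈ Hc c) : z ∉ HLat := by
  rintro ⟨-, l, hl⟩
  have h1 := hz.2.1; have h2 := hz.2.2
  rw [hl, hc] at h1 h2
  have h1' : (k:ℝ) < l := by linarith
  have h2' : (l:ℝ) < k + 1 := by linarith
  have : k < l := by exact_mod_cast h1'
  have : l < k + 1 := by exact_mod_cast h2'
  omega

lemma Hc_inj {c : ℝ} {k : ℤ} (hc : c = k / 2) : InjOn Psi1 (Hc c) := by
  intro z hz w hw h
  obtain ⟨m, n, h1⟩ := Psi1_inj (fun h => Hc_not hc hz (ZLat_sub h)) (fun h => Hc_not hc hw (ZLat_sub h)) h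
  obtain ⟨⟨a1, a2⟩, a3, a4⟩ := hz
  obtain ⟨⟨b1, b2⟩, b3, b4⟩ := hw
  rcases h1 with rfl | rfl
  · simp only at *
    have m1 : ((-1 : ℤ):ℝ) < m := by push_cast; linarith
    have m2 : (m:ℝ) < (1:ℤ) := by push_cast; linarith
    have n1 : ((-1 : ℤ):ℝ) < n := by push_cast; linarith
    have n2 : (n:ℝ) < (1:ℤ) := by push_cast; linarith
    have m0 : m = 0 := by have := Int.cast_lt.1 m1; have := Int.cast_lt.1 m2; omega
    have n0 : n = 0 := by have := Int.cast_lt.1 n1; have := Int.cast_lt.1 n2; omega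
    subst m0; subst n0; simp
  · exfalso
    simp only [hc] at *
    have n1 : (k:ℝ) < n := by linarith
    have n2 : (n:ℝ) < (k+1:ℤ) := by push_cast; linarith
    have := Int.cast_lt.1 n1; have := Int.cast_lt.1 n2; omega

lemma line_null : volume {z : ℝ × ℝ | ∃ k : ℤ, z.2 = k / 2} = 0 := by
  have : {z : ℝ × ℝ | ∃ k : ℤ, z.2 = k / 2} = univ ×ˢ (range (fun k : ℤ => (k:ℝ)/2)) := by
    ext z; simp [eq_comm]
  rw [this, Measure.volume_eq_prod, Measure.prod_prod, (countable_range _).measure_zero volume, mul_zero]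

lemma Psi1_cover (c : ℝ) (hc : c = 0 ∨ c = 1 / 2) : volume (Q0 \ Psi1 '' Hc c) = 0 := by
  have n1 : volume (Psi1 '' ({z : ℝ × ℝ | ∃ k : ℤ, z.2 = k / 2} \ ZLat)) = 0 := by
    apply addHaar_image_eq_zero_of_differentiableOn_of_addHaar_eq_zero
    · intro z hz
      exact ((Psi1_sm z hz.2).differentiableAt (by simp)).differentiableWithinAt
    · exact measure_mono_null sdiff_subset line_null
  have n2 : volume {z : ℝ × ℝ | z.2 = 1 / 2} = 0 :=
    measure_mono_null (t := {z : ℝ × ℝ | ∃ k : ℤ, z.2 = k / 2})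
      (fun z (hz : z.2 = 1 / 2) => show ∃ k : ℤ, z.2 = k / 2 from ⟨1, by rw [hz]; norm_num⟩) line_null
  refine measure_mono_null ?_ (measure_union_null n1 n2)
  rintro q ⟨hq, hqn⟩
  by_cases hq2 : q.2 = 1 / 2
  · right; exact hq2
  left
  obtain ⟨z, hz, rfl⟩ := Psi1_surj hq hq2
  by_cases hl : ∃ k : ℤ, z.2 = k / 2
  · exact ⟨z, ⟨hl, fun h => hz (ZLat_sub h)⟩, rfl⟩
  exfalso; apply hqn
  -- normal form
  have key : ∀ z : ℝ × ℝ, Int.fract z.2 ∈ Ioo c (c + 1/2) → Psi1 z ∈ Psi1 '' Hc c := by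
    intro z hz
    refine ⟨(1 - Int.fract (-z.1), Int.fract z.2), ⟨⟨?_, ?_⟩, hz⟩, ?_⟩
    · have := Int.fract_lt_one (-z.1); simp only; linarith
    · have := Int.fract_nonneg (-z.1); simp only; linarith
    · have := Psi1_per.int (1 + ⌊-z.1⌋) (-⌊z.2⌋) z.1 z.2
      rw [← this]; congr 1
      ext
      · simp only [Int.fract]; push_cast; ring
      · simp only [Int.fract]; push_cast; ring
  have f0 : Int.fract z.2 ≠ 0 := by
    intro h
    apply hl
    obtain ⟨k, hk⟩ := Int.fract_eq_zero_iff.1 h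
    exact ⟨2 * k, by rw [← hk]; push_cast; ring⟩
  have f1 : Int.fract z.2 ≠ 1 / 2 := by
    intro h
    apply hl
    refine ⟨2 * ⌊z.2⌋ + 1, ?_⟩
    have := Int.fract_add_floor z.2
    push_cast; linarith
  have f2 := Int.fract_nonneg z.2
  have f3 := Int.fract_lt_one z.2
  by_cases hh : Int.fract z.2 ∈ Ioo c (c + 1/2)
  · exact key z hh
  · rw [← Psi1_even z]
    apply key
    have : Int.fract (-z).2 = 1 - Int.fract z.2 := by
      rw [Prod.snd_neg]; exact Int.fract_neg f0
    rw [this]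
    rcases hc with rfl | rfl
    · rcases lt_or_gt_of_ne f1 with h | h
      · exact (hh ⟨lt_of_le_of_ne f2 f0.symm, by linarith⟩).elim
      · constructor <;> linarith
    · rcases lt_or_gt_of_ne f1 with h | h
      · have := lt_of_le_of_ne f2 f0.symm
        constructor <;> linarith
      · exact (hh ⟨by linarith, by linarith⟩).elim

lemma Psi1_half (c : ℝ) (hc : c = 0 ∨ c = 1 / 2) {B : Set (ℝ × ℝ)} (hB : MeasurableSet B) :
    ∫⁻ z in Hc c, B.indicator 1 (Psi1 z) * ENNReal.ofReal (rho z) = volume (B ∩ Q0) := by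
  obtain ⟨k, hk⟩ : ∃ k : ℤ, c = k / 2 := by
    rcases hc with rfl | rfl
    · exact ⟨0, by simp⟩
    · exact ⟨1, by simp⟩
  have hZ : ∀ z ∈ Hc c, z ∉ ZLat := fun z hz h => Hc_not hk hz (ZLat_sub h)
  have hd : ∀ z ∈ Hc c, HasFDerivWithinAt Psi1 (fderiv ℝ Psi1 z) (Hc c) z := by
    intro z hz
    exact ((Psi1_sm z (hZ z hz)).differentiableAt (by simp)).hasFDerivAt.hasFDerivWithinAt
  have h := lintegral_image_eq_lintegral_abs_det_fderiv_mul volume (Hc_meas c) hd (Hc_inj hk)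
    (B.indicator 1)
  have e1 : ∫⁻ z in Hc c, B.indicator 1 (Psi1 z) * ENNReal.ofReal (rho z) =
      ∫⁻ z in Hc c, ENNReal.ofReal |(fderiv ℝ Psi1 z).det| * B.indicator 1 (Psi1 z) := by
    refine setLIntegral_congr_fun (Hc_meas c) fun z hz => ?_
    obtain ⟨f', h1, h2⟩ := Psi1_deriv z (hZ z hz)
    rw [h1.fderiv, h2, abs_of_nonneg (rho_nonneg z), mul_comm]
  rw [e1, ← h, lintegral_indicator_one hB, Measure.restrict_apply hB]
  refine le_antisymm (measure_mono (inter_subset_inter_right _ ?_)) ?_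
  · rintro _ ⟨z, -, rfl⟩; exact Psi1_mem z
  · calc volume (B ∩ Q0) ≤ volume ((B ∩ Psi1 '' Hc c) ∪ (Q0 \ Psi1 '' Hc c)) := by
          apply measure_mono
          rintro q ⟨h1, h2⟩
          by_cases h : q ∈ Psi1 '' Hc c
          · exact Or.inl ⟨h1, h⟩
          · exact Or.inr ⟨h2, h⟩
      _ ≤ _ := (measure_union_le _ _).trans (by rw [Psi1_cover c hc, add_zero])

lemma Psi1_int {B : Set (ℝ × ℝ)} (hB : MeasurableSet B) :
    ∫⁻ z, B.indicator 1 (Psi1 z) * ENNReal.ofReal (rho z) ∂muQ = 2 * volume (B ∩ Q0) := by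
  have hae : (Ioc (0:ℝ) 1 ×ˢ Ioc (0:ℝ) 1 : Set (ℝ × ℝ)) =ᵐ[volume] (Hc 0 ∪ Hc (1/2) : Set (ℝ × ℝ)) := by
    have h0 : ∀ᵐ z : ℝ × ℝ, ¬ ∃ k : ℤ, z.2 = k / 2 := by
      rw [ae_iff]; simpa using line_null
    filter_upwards [h0] with z hz
    have a0 : z.2 ≠ 1 / 2 := fun h => hz ⟨1, by rw [h]; norm_num⟩
    have a1 : z.2 ≠ 1 := fun h => hz ⟨2, by rw [h]; norm_num⟩
    refine propext ⟨?_, ?_⟩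
    · rintro ⟨h1, h2, h3⟩
      rcases lt_or_gt_of_ne a0 with h | h
      · exact Or.inl ⟨h1, h2, by linarith⟩
      · exact Or.inr ⟨h1, h, by have := lt_of_le_of_ne h3 a1; linarith⟩
    · rintro (⟨h1, h2, h3⟩ | ⟨h1, h2, h3⟩)
      · exact ⟨h1, h2, by linarith⟩
      · exact ⟨h1, by linarith, by linarith⟩
  have hdis : Disjoint (Hc 0) (Hc (1/2)) := by
    rw [Set.disjoint_left]
    rintro z ⟨-, h1⟩ ⟨-, h2⟩
    have := h1.2; have := h2.1; linarith
  rw [muQ_eq, setLIntegral_congr hae, lintegral_union (Hc_meas _) hdis,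
    Psi1_half 0 (Or.inl rfl) hB, Psi1_half (1/2) (Or.inr rfl) hB, two_mul]
end

/-! ## Part 17 -/
open Filter Topology Set Function MeasureTheory
noncomputable section
set_option linter.unusedSectionVars false

/-! ### smooth parametric integrals -/
lemma int_par_nat (n : ℕ) : ∀ {F : Type} [NormedAddCommGroup F] [NormedSpace ℝ F] {g : (ℝ × ℝ) × ℝ → F},
    ContDiff ℝ (⊤ : ℕ∞) g → ContDiff ℝ n (fun p => ∫ t in (0:ℝ)..1, g (p, t)) := by
  induction n with
  | zero =>
    intro F _ _ g hg
    apply contDiff_zero.2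
    exact intervalIntegral.continuous_parametric_intervalIntegral_of_continuous'
      (f := fun p t => g (p, t)) (by exact hg.continuous) 0 1
  | succ n ih =>
    intro F _ _ g hg
    have hD : ContDiff ℝ (⊤ : ℕ∞) (fun q : (ℝ × ℝ) × ℝ =>
        (fderiv ℝ g q).comp (ContinuousLinearMap.inl ℝ (ℝ × ℝ) ℝ)) :=
      (hg.fderiv_right (by simp)).clm_comp contDiff_const
    push_cast
    rw [contDiff_succ_iff_hasFDerivAt]
    refine ⟨_, ih hD, fun p => ?_⟩
    obtain ⟨C, hC⟩ := ((isCompact_closedBall p 1).prod (isCompact_Icc (a := (0:ℝ)) (b := 1))).exists_bound_of_continuousOn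
      hD.continuous.continuousOn
    refine intervalIntegral.hasFDerivAt_integral_of_dominated_of_fderiv_le (𝕜 := ℝ)
      (F := fun p t => g (p, t)) (bound := fun _ => C)
      (F' := fun p t => (fderiv ℝ g (p, t)).comp (ContinuousLinearMap.inl ℝ (ℝ × ℝ) ℝ))
      (Metric.closedBall_mem_nhds p one_pos) ?_ ?_ ?_ ?_ ?_ ?_
    · refine Eventually.of_forall fun x => ?_
      have : Continuous fun t => g (x, t) := hg.continuous.comp (by fun_prop)
      exact this.aestronglyMeasurable
    · have : Continuous fun t => g (p, t) := hg.continuous.comp (by fun_prop)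
      exact this.intervalIntegrable _ _
    · have : Continuous fun t => (fderiv ℝ g (p, t)).comp (ContinuousLinearMap.inl ℝ (ℝ × ℝ) ℝ) :=
        hD.continuous.comp (by fun_prop)
      exact this.aestronglyMeasurable
    · refine Eventually.of_forall fun t ht x hx => ?_
      rw [uIoc_of_le zero_le_one] at ht
      exact hC (x, t) ⟨hx, ht.1.le, ht.2⟩
    · simp
    · refine Eventually.of_forall fun t _ x _ => ?_
      have h1 : HasFDerivAt g (fderiv ℝ g (x, t)) (x, t) :=
        (hg.differentiable (by simp) _).hasFDerivAt
      exact h1.comp x (hasFDerivAt_prodMk_left x t)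

lemma int_par {F : Type} [NormedAddCommGroup F] [NormedSpace ℝ F] {g : (ℝ × ℝ) × ℝ → F}
    (hg : ContDiff ℝ (⊤ : ℕ∞) g) : ContDiff ℝ (⊤ : ℕ∞) (fun p => ∫ t in (0:ℝ)..1, g (p, t)) :=
  contDiff_infty.2 fun n => int_par_nat n hg

/-! ### the Knothe map -/
def kR (p : ℝ × ℝ) : ℝ := ∫ s in (0:ℝ)..p.2, rho (p.1, s)
def km (x : ℝ) : ℝ := kR (x, 1) / 2
def kM (x : ℝ) : ℝ := ∫ s in (0:ℝ)..x, km s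
def kN (p : ℝ × ℝ) : ℝ := kR p / (2 * km p.1)
def Gam (p : ℝ × ℝ) : ℝ × ℝ := (kM p.1, kN p)

lemma rho_contx (x : ℝ) : Continuous (fun s => rho (x, s)) := rho_sm.continuous.comp (by fun_prop)
lemma rho_ii (x a b : ℝ) : IntervalIntegrable (fun s => rho (x, s)) volume a b :=
  (rho_contx x).intervalIntegrable _ _

lemma kR_sm : ContDiff ℝ (⊤ : ℕ∞) kR := by
  have h1 : ContDiff ℝ (⊤ : ℕ∞) (fun q : (ℝ × ℝ) × ℝ => rho (q.1.1, q.2 * q.1.2)) :=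
    rho_sm.comp (by fun_prop)
  have h2 := (contDiff_snd (𝕜 := ℝ) (E := ℝ) (F := ℝ)).mul (int_par h1)
  have e : kR = fun p : ℝ × ℝ => p.2 * ∫ t in (0:ℝ)..1, rho (p.1, t * p.2) := by
   ext p
   rw [intervalIntegral.mul_integral_comp_mul_right (f := fun s => rho (p.1, s))]
   simp [kR]
  rw [e]; exact h2

lemma irr_half {c : ℝ} (hc : Irrational c) : ∀ k : ℤ, c ≠ k / 2 := by
  intro k h
  apply hc
  exact ⟨(k:ℚ) / 2, by push_cast; exact h.symm⟩

lemma kR_lt (x : ℝ) : StrictMono (fun y => kR (x, y)) := by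
  intro y y' h
  have e : kR (x, y') - kR (x, y) = ∫ s in y..y', rho (x, s) := by
    simp only [kR]
    rw [intervalIntegral.integral_interval_sub_left (rho_ii _ _ _) (rho_ii _ _ _)]
  have : 0 < ∫ s in y..y', rho (x, s) := by
    obtain ⟨c, hc, h1, h2⟩ := exists_irrational_btwn h
    refine intervalIntegral.integral_pos h (rho_contx x).continuousOn (fun s _ => rho_nonneg _)
      ⟨c, ⟨h1.le, h2.le⟩, rho_pos _ ?_⟩
    rintro ⟨-, k, hk⟩
    exact irr_half hc k hk
  simp only; linarith

lemma kR_zero (x : ℝ) : kR (x, 0) = 0 := by simp [kR]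

lemma km_pos (x) : 0 < km x := by
  have := kR_lt x (zero_lt_one' ℝ); simp only [kR_zero] at this
  unfold km; linarith

lemma kR_y (x y : ℝ) : kR (x, y + 1) = kR (x, y) + 2 * km x := by
  simp only [kR, km]
  rw [← intervalIntegral.integral_add_adjacent_intervals (rho_ii x 0 y) (rho_ii x y (y+1))]
  have : Function.Periodic (fun s => rho (x, s)) 1 := fun s => rho_per.r x s
  rw [this.intervalIntegral_add_eq y 0, zero_add]; ring

lemma kR_x (x y : ℝ) : kR (x + 1, y) = kR (x, y) := by
  simp only [kR]; congr 1; ext s; exact rho_per.l x s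

lemma kR_neg (p) : kR (-p) = - kR p := by
  have := intervalIntegral.integral_comp_neg (a := 0) (b := p.2) (fun s : ℝ => rho (-p.1, s))
  simp only [kR, Prod.fst_neg, Prod.snd_neg]
  rw [intervalIntegral.integral_symm]
  simp only [neg_zero] at this
  rw [← this]; congr 2; ext s
  exact rho_even (p.1, s)

lemma km_sm : ContDiff ℝ (⊤ : ℕ∞) km := by
  have : ContDiff ℝ (⊤ : ℕ∞) (fun x : ℝ => kR (x, 1)) := kR_sm.comp (by fun_prop)
  exact this.div_const 2

lemma km_per (x : ℝ) : km (x + 1) = km x := by simp [km, kR_x]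
lemma km_neg (x : ℝ) : km (-x) = km x := by
  have h1 := kR_neg (x, -1)
  have h2 := kR_y x (-1)
  simp only [Prod.neg_mk, neg_neg, neg_add_cancel, kR_zero] at h1 h2
  have : km (-x) = kR (-x, 1) / 2 := rfl
  rw [this, h1]; linarith

lemma km_int : ∫ s in (0:ℝ)..1, km s = 1 := by
  have h1 := Psi1_int MeasurableSet.univ
  have h2 : volume (univ ∩ Q0) = 1 := by
    rw [univ_inter, Q0, Measure.volume_eq_prod, Measure.prod_prod]; simp
  have h3 : ∫⁻ z, ENNReal.ofReal (rho z) ∂muQ = 2 := by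
    rw [h2, mul_one] at h1; rw [← h1]; congr 1; ext z; simp
  have h4 : ∫ z, rho z ∂muQ = 2 := by
    rw [integral_eq_lintegral_of_nonneg_ae (Eventually.of_forall rho_nonneg)
      rho_sm.continuous.aestronglyMeasurable, h3]; simp
  rw [integral_prod _ (intQ rho_sm.continuous)] at h4
  rw [intervalIntegral.integral_of_le zero_le_one]
  have h5 : ∀ x, km x = (∫ y, rho (x, y) ∂I1) / 2 := by
    intro x; simp only [km, kR]; rw [intervalIntegral.integral_of_le zero_le_one]
  simp_rw [h5]
  rw [integral_div, h4]; norm_num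

lemma km_ii (a b : ℝ) : IntervalIntegrable km volume a b := km_sm.continuous.intervalIntegrable _ _

lemma kM_deriv (x) : HasDerivAt kM (km x) x :=
  intervalIntegral.integral_hasDerivAt_right (km_ii _ _)
    (km_sm.continuous.stronglyMeasurableAtFilter _ _) km_sm.continuous.continuousAt

lemma kM_sm : ContDiff ℝ (⊤ : ℕ∞) kM := by
  rw [contDiff_infty_iff_deriv]
  refine ⟨fun x => (kM_deriv x).differentiableAt, ?_⟩
  have : deriv kM = km := funext fun x => (kM_deriv x).deriv
  rw [this]; exact km_sm

lemma kM_lt : StrictMono kM := by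
  apply strictMono_of_deriv_pos
  intro t; rw [(kM_deriv t).deriv]; exact km_pos t

lemma kM_one (x : ℝ) : kM (x + 1) = kM x + 1 := by
  simp only [kM]
  rw [← intervalIntegral.integral_add_adjacent_intervals (km_ii 0 x) (km_ii x (x+1))]
  have : Function.Periodic km 1 := km_per
  rw [this.intervalIntegral_add_eq x 0, zero_add, km_int]

lemma kM_neg (x : ℝ) : kM (-x) = - kM x := by
  have := intervalIntegral.integral_comp_neg (a := 0) (b := x) km
  simp only [kM]
  rw [intervalIntegral.integral_symm]
  simp only [neg_zero] at this
  rw [← this]; simp_rw [km_neg]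

lemma kM_zero : kM 0 = 0 := by simp [kM]

lemma kN_sm : ContDiff ℝ (⊤ : ℕ∞) kN :=
  kR_sm.div (contDiff_const.mul (km_sm.comp contDiff_fst)) (fun p => by have := km_pos p.1; positivity)

lemma kN_lt (x : ℝ) : StrictMono (fun y => kN (x, y)) := by
  intro y y' h
  have := kR_lt x h
  have hp := km_pos x
  simp only [kN] at *
  gcongr

lemma kN_y (x y : ℝ) : kN (x, y + 1) = kN (x, y) + 1 := by
  have hp := km_pos x
  simp only [kN, kR_y]; field_simp
lemma kN_x (x y : ℝ) : kN (x + 1, y) = kN (x, y) := by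
  simp only [kN, kR_x, km_per]
lemma kN_neg (p) : kN (-p) = - kN p := by
  simp only [kN, kR_neg, Prod.fst_neg, km_neg, neg_div]
lemma kN_zero (x : ℝ) : kN (x, 0) = 0 := by simp [kN, kR_zero]

lemma surj_of_per {h : ℝ → ℝ} (hc : Continuous h) (h1 : ∀ x, h (x + 1) = h x + 1) : Surjective h := by
  intro c
  have hn : ∀ n : ℕ, h n = h 0 + n := by
    intro n; induction n with
    | zero => simp
    | succ n ih => push_cast; rw [h1, ih]; ring
  have hm : ∀ n : ℕ, h (-n) = h 0 - n := by
    intro n; induction n with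
    | zero => simp
    | succ n ih =>
      have := h1 (-(n+1)); rw [show -((n:ℝ)+1)+1 = -n by ring, ih] at this
      push_cast; linarith
  obtain ⟨N, hN⟩ := exists_nat_ge (|c - h 0|)
  refine mem_range_of_exists_le_of_exists_ge hc ⟨-N, ?_⟩ ⟨N, ?_⟩
  · rw [hm]; have := neg_abs_le (c - h 0); linarith
  · rw [hn]; have := le_abs_self (c - h 0); linarith

lemma Gam_sm : ContDiff ℝ (⊤ : ℕ∞) Gam := (kM_sm.comp contDiff_fst).prodMk kN_sm

lemma Gam_bij : Bijective Gam := by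
  constructor
  · rintro ⟨x, y⟩ ⟨x', y'⟩ h
    obtain rfl : x = x' := kM_lt.injective (congrArg Prod.fst h)
    obtain rfl : y = y' := (kN_lt x).injective (congrArg Prod.snd h)
    rfl
  · rintro ⟨a, b⟩
    obtain ⟨x, rfl⟩ := surj_of_per kM_sm.continuous kM_one a
    obtain ⟨y, hy⟩ := surj_of_per (h := fun y => kN (x, y)) (kN_sm.continuous.comp (by fun_prop)) (kN_y x) b
    exact ⟨(x, y), Prod.ext rfl hy⟩

lemma Gam_deriv (z) : ∃ f' : ℝ × ℝ →L[ℝ] ℝ × ℝ, HasFDerivAt Gam f' z ∧ f'.det = rho z / 2 := by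
  have hM : HasFDerivAt (fun p : ℝ × ℝ => kM p.1) (lf (km z.1) 0) z := by
    have := (kM_deriv z.1).comp_hasFDerivAt z (hasFDerivAt_fst (𝕜 := ℝ) (E := ℝ) (F := ℝ) (p := z))
    refine this.congr_fderiv ?_
    ext <;> simp [lf]
  have hN : HasFDerivAt kN (fderiv ℝ kN z) z := (kN_sm.differentiable (by simp) z).hasFDerivAt
  have hr : HasDerivAt (fun y => kN (z.1, y)) (rho z / (2 * km z.1)) z.2 := by
    have : HasDerivAt (fun y => kR (z.1, y)) (rho (z.1, z.2)) z.2 :=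
      intervalIntegral.integral_hasDerivAt_right (rho_ii _ _ _)
        ((rho_contx _).stronglyMeasurableAtFilter _ _) (rho_contx _).continuousAt
    exact this.div_const (2 * km z.1)
  have hr2 : HasDerivAt (fun y => kN (z.1, y)) (fderiv ℝ kN z (0, 1)) z.2 := by
    have h0 : HasFDerivAt kN (fderiv ℝ kN z) (z.1, z.2) := hN
    have := h0.comp_hasDerivAt z.2 ((hasDerivAt_const z.2 z.1).prodMk (hasDerivAt_id z.2))
    exact this
  have hb := hr2.unique hr
  have hN' : HasFDerivAt kN (lf (fderiv ℝ kN z (1, 0)) (rho z / (2 * km z.1))) z := by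
    refine hN.congr_fderiv ?_
    ext
    · simp [lf]
    · simp [lf, hb]
  refine ⟨_, hM.prodMk hN', ?_⟩
  rw [lf_det]; have := km_pos z.1; field_simp; ring

lemma Gam_add (z : ℝ × ℝ) (m n : ℤ) : Gam (z.1 + m, z.2 + n) = ((Gam z).1 + m, (Gam z).2 + n) := by
  have : Per (fun z => Gam z - z) := by
    constructor
    · intro x y; ext
      · simp [Gam, kM_one]
      · simp [Gam, kN_x]
    · intro x y; ext
      · simp [Gam]
      · simp [Gam, kN_y]
  have h := this.int m n z.1 z.2
  rw [sub_eq_iff_eq_add] at h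
  rw [h]; ext <;> simp <;> ring

lemma Gam_neg (z) : Gam (-z) = - Gam z := by
  ext <;> simp [Gam, kM_neg, kN_neg]

lemma Gam_fix {z} (hz : z ∈ HLat) : Gam z = z := by
  obtain ⟨⟨k, hk⟩, l, hl⟩ := hz
  have h1 := Gam_add z (-k) (-l)
  have h2 : ((z.1 + ((-k:ℤ):ℝ), z.2 + ((-l:ℤ):ℝ)) : ℝ × ℝ) = -z := by
    ext
    · simp [hk]; ring
    · simp [hl]; ring
  rw [h2, Gam_neg] at h1
  have h3 := congrArg Prod.fst h1
  have h4 := congrArg Prod.snd h1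
  simp at h3 h4
  ext <;> linarith

def gE : (ℝ × ℝ) ≃ (ℝ × ℝ) := Equiv.ofBijective Gam Gam_bij
lemma gE_apply (z) : gE z = Gam z := rfl

lemma gE_lat {w} : gE.symm w ∈ HLat ↔ w ∈ HLat := by
  constructor
  · intro h
    have := Gam_fix h; rw [← gE_apply, gE.apply_symm_apply] at this; rwa [this]
  · intro h
    have : gE.symm w = w := by rw [Equiv.symm_apply_eq]; exact (Gam_fix h).symm
    rwa [this]

lemma gE_add (w : ℝ × ℝ) (m n : ℤ) : gE.symm (w.1 + m, w.2 + n) = ((gE.symm w).1 + m, (gE.symm w).2 + n) := by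
  rw [Equiv.symm_apply_eq, gE_apply, Gam_add, ← gE_apply, gE.apply_symm_apply]

lemma gE_neg (w) : gE.symm (-w) = - gE.symm w := by
  rw [Equiv.symm_apply_eq, gE_apply, Gam_neg, ← gE_apply, gE.apply_symm_apply]

lemma gE_sm {w} (hw : w ∉ HLat) : ContDiffAt ℝ (⊤ : ℕ∞) gE.symm w := by
  have hz : gE.symm w ∉ HLat := fun h => hw (gE_lat.1 h)
  obtain ⟨f', h1, h2⟩ := Gam_deriv (gE.symm w)
  obtain ⟨G, g1, g2, g3, -⟩ := loc_inv Gam_sm.contDiffAt h1 (by rw [h2]; have := rho_pos _ hz; positivity)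
  have e : Gam (gE.symm w) = w := gE.apply_symm_apply w
  rw [e] at g2 g3
  refine g2.congr_of_eventuallyEq ?_
  filter_upwards [g3] with q hq
  rw [Equiv.symm_apply_eq]; exact hq.symm

lemma gE_meas : Measurable gE.symm := by
  have h := Gam_sm.continuous.measurableEmbedding Gam_bij.1
  intro S hS
  have : gE.symm ⁻¹' S = Gam '' S := by
    rw [← Equiv.image_eq_preimage_symm]; rfl
  rw [this]; exact h.measurableSet_image.2 hS

lemma Gam_Q : Gam '' (Ioc (0:ℝ) 1 ×ˢ Ioc (0:ℝ) 1) = Ioc (0:ℝ) 1 ×ˢ Ioc (0:ℝ) 1 := by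
  have m1 : kM 1 = 1 := by have := kM_one 0; simpa [kM_zero] using this
  have n1 : ∀ x, kN (x, 1) = 1 := fun x => by have := kN_y x 0; simpa [kN_zero] using this
  have key : ∀ z, Gam z ∈ Ioc (0:ℝ) 1 ×ˢ Ioc (0:ℝ) 1 ↔ z ∈ Ioc (0:ℝ) 1 ×ˢ Ioc (0:ℝ) 1 := by
    rintro ⟨x, y⟩
    have a1 : 0 < kM x ↔ 0 < x := by have := kM_lt.lt_iff_lt (a := 0) (b := x); rwa [kM_zero] at this
    have a2 : kM x ≤ 1 ↔ x ≤ 1 := by have := kM_lt.le_iff_le (a := x) (b := 1); rwa [m1] at this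
    have a3 : 0 < kN (x, y) ↔ 0 < y := by have := (kN_lt x).lt_iff_lt (a := 0) (b := y); simpa only [kN_zero] using this
    have a4 : kN (x, y) ≤ 1 ↔ y ≤ 1 := by have := (kN_lt x).le_iff_le (a := y) (b := 1); simpa only [n1] using this
    simp only [Gam, mem_prod, mem_Ioc, a1, a2, a3, a4]
  ext w
  constructor
  · rintro ⟨z, hz, rfl⟩; exact (key z).2 hz
  · intro hw; obtain ⟨z, rfl⟩ := Gam_bij.2 w; exact ⟨z, (key z).1 hw, rfl⟩

/-! ### Psi2 -/
def Psi2 (w : ℝ × ℝ) : ℝ × ℝ := Psi1 (gE.symm w)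

lemma Psi2_mem (z) : Psi2 z ∈ Q0 := Psi1_mem _
lemma Psi2_per : Per Psi2 := by
  constructor
  · intro x y
    have := gE_add (x, y) 1 0
    simp only [Int.cast_one, Int.cast_zero, add_zero] at this
    rw [Psi2, this]; exact Psi1_per.l _ _
  · intro x y
    have := gE_add (x, y) 0 1
    simp only [Int.cast_one, Int.cast_zero, add_zero] at this
    rw [Psi2, this]; exact Psi1_per.r _ _
lemma Psi2_even (z) : Psi2 (-z) = Psi2 z := by simp only [Psi2, gE_neg, Psi1_even]
lemma Psi2_meas : Measurable Psi2 := Psi1_meas.comp gE_meas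
lemma Psi2_sm (z) (hz : z ∉ HLat) : ContDiffAt ℝ (⊤ : ℕ∞) Psi2 z :=
  (Psi1_sm _ fun h => hz (gE_lat.1 (ZLat_sub h))).comp z (gE_sm hz)
lemma Pm_Gam {z w} (h : Pm z w) : Pm (Gam z) (Gam w) := by
  obtain ⟨m, n, rfl | rfl⟩ := h
  · exact ⟨m, n, Or.inl (Gam_add z m n)⟩
  · refine ⟨m, n, Or.inr ?_⟩
    have := Gam_add (-z) m n
    rw [Gam_neg] at this
    simpa using this
lemma Psi2_inj {z w} (hz : z ∉ HLat) (hw : w ∉ HLat) (h : Psi2 z = Psi2 w) : Pm z w := by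
  have := Pm_Gam (Psi1_inj (fun h => hz (gE_lat.1 (ZLat_sub h))) (fun h => hw (gE_lat.1 (ZLat_sub h))) h)
  rwa [← gE_apply, ← gE_apply, gE.apply_symm_apply, gE.apply_symm_apply] at this
lemma Psi2_surj {q} (hq : q ∈ Q0) (h : q.2 ≠ 1 / 2) : ∃ z ∉ HLat, Psi2 z = q := by
  obtain ⟨z, hz, rfl⟩ := Psi1_surj hq h
  refine ⟨gE z, fun h => hz ?_, ?_⟩
  · have := gE_lat.2 h; rwa [gE.symm_apply_apply] at this
  · simp [Psi2]

lemma Psi2_LI (w) (hw : w ∉ HLat) : ∃ G : ℝ × ℝ → ℝ × ℝ, G (Psi2 w) = w ∧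
    ContDiffAt ℝ (⊤ : ℕ∞) G (Psi2 w) ∧ ∀ᶠ q in 𝓝 (Psi2 w), G q ∉ HLat ∧ Psi2 (G q) = q := by
  have hz : gE.symm w ∉ HLat := fun h => hw (gE_lat.1 h)
  have hz' : gE.symm w ∉ ZLat := fun h => hz (ZLat_sub h)
  obtain ⟨f', h1, h2⟩ := Psi1_deriv _ hz'
  obtain ⟨G, g1, g2, g3, -⟩ := loc_inv (Psi1_sm _ hz') h1 (by rw [h2]; exact (rho_pos _ hz).ne')
  refine ⟨Gam ∘ G, ?_, ?_, ?_⟩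
  · simp only [comp_apply, Psi2, g1]; exact gE.apply_symm_apply w
  · exact Gam_sm.contDiffAt.comp _ g2
  · have hc : ContinuousAt (Gam ∘ G) (Psi2 w) := (Gam_sm.contDiffAt.comp _ g2).continuousAt
    have ho : HLatᶜ ∈ 𝓝 ((Gam ∘ G) (Psi2 w)) := by
      refine HLat_closed.isOpen_compl.mem_nhds ?_
      simp only [comp_apply, Psi2, g1]
      intro h; apply hw; rwa [← gE_apply, gE.apply_symm_apply] at h
    filter_upwards [hc.preimage_mem_nhds ho, g3] with q q1 q2
    refine ⟨q1, ?_⟩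
    simp only [comp_apply, Psi2, ← gE_apply, gE.symm_apply_apply]; exact q2

lemma Psi2_map : Measure.map Psi2 muQ = volume.restrict Q0 := by
  ext B hB
  rw [Measure.map_apply Psi2_meas hB, Measure.restrict_apply hB, ← lintegral_indicator_one (Psi2_meas hB)]
  have h1 : ∀ w, (Psi2 ⁻¹' B).indicator (1 : ℝ × ℝ → ENNReal) w = B.indicator 1 (Psi2 w) := fun w => by
    simp only [indicator, mem_preimage]; rfl
  simp_rw [h1]
  have hd : ∀ z ∈ (Ioc (0:ℝ) 1 ×ˢ Ioc (0:ℝ) 1), HasFDerivWithinAt Gam (fderiv ℝ Gam z) (Ioc (0:ℝ) 1 ×ˢ Ioc (0:ℝ) 1) z :=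
    fun z _ => ((Gam_sm.differentiable (by simp) z).hasFDerivAt).hasFDerivWithinAt
  have h := lintegral_image_eq_lintegral_abs_det_fderiv_mul volume
    (measurableSet_Ioc.prod measurableSet_Ioc) hd Gam_bij.1.injOn (fun w => B.indicator 1 (Psi2 w))
  rw [Gam_Q] at h
  rw [muQ_eq, h]
  have e : ∀ z, ENNReal.ofReal |(fderiv ℝ Gam z).det| * B.indicator 1 (Psi2 (Gam z)) =
     2⁻¹ * (B.indicator 1 (Psi1 z) * ENNReal.ofReal (rho z)) := by
    intro z
    obtain ⟨f', h1, h2⟩ := Gam_deriv z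
    have e1 : Psi2 (Gam z) = Psi1 z := by simp only [Psi2, ← gE_apply, gE.symm_apply_apply]
    rw [h1.fderiv, h2, e1, abs_of_nonneg (by have := rho_nonneg z; positivity),
      ENNReal.ofReal_div_of_pos two_pos, ENNReal.div_eq_inv_mul]
    simp only [ENNReal.ofReal_ofNat]; ring
  simp_rw [e]
  rw [lintegral_const_mul' _ _ (by simp), ← muQ_eq, Psi1_int hB, ← mul_assoc,
    ENNReal.inv_mul_cancel (by simp) (by simp), one_mul]
end

/-! ## Part 18 -/
open Filter Topology Set Function MeasureTheory
noncomputable section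
set_option linter.unusedSectionVars false

/-! ### the infinite composition of shears -/
/-- maps commuting with integer translations -/
def Eqv (f : ℝ × ℝ → ℝ × ℝ) : Prop :=
  ∀ z (m n : ℤ), f (z.1 + m, z.2 + n) = ((f z).1 + m, (f z).2 + n)

lemma Eqv.comp {f g} (hf : Eqv f) (hg : Eqv g) : Eqv (fun z => f (g z)) := by
  intro z m n; simp only [hg z m n, hf (g z) m n]

lemma Per.eqv {α : Type*} {u : ℝ × ℝ → α} (hu : Per u) {f} (hf : Eqv f) : Per (fun z => u (f z)) := by
  constructor
  · intro x y
    have := hf (x, y) 1 0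
    simp only [Int.cast_one, Int.cast_zero, add_zero] at this
    simp only [this]; exact hu.l _ _
  · intro x y
    have := hf (x, y) 0 1
    simp only [Int.cast_one, Int.cast_zero, add_zero] at this
    simp only [this]; exact hu.r _ _

def sn (x : ℝ) : ℝ := Real.sin (Real.pi * x) ^ 2
def uth (t : ℝ) : ℝ := Real.smoothTransition (4 / 3 * (1 - t))
def uB (n : ℕ) (x : ℝ) : ℝ := uth (4 ^ n * sn x)

lemma sn_sm : ContDiff ℝ (⊤ : ℕ∞) sn := by unfold sn; fun_prop
lemma sn_one (x : ℝ) : sn (x + 1) = sn x := by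
  simp only [sn, mul_add, mul_one, Real.sin_add_pi, neg_sq]
lemma sn_int (x : ℝ) (k : ℤ) : sn (x + k) = sn x := by
  have : Function.Periodic sn 1 := sn_one
  have := this.int_mul k x; simpa using this
lemma uth_sm : ContDiff ℝ (⊤ : ℕ∞) uth := by
  unfold uth
  exact Real.smoothTransition.contDiff.comp (by fun_prop)
lemma uth_one {t : ℝ} (h : t ≤ 1 / 4) : uth t = 1 := Real.smoothTransition.one_of_one_le (by linarith)
lemma uth_zero {t : ℝ} (h : 1 ≤ t) : uth t = 0 := Real.smoothTransition.zero_of_nonpos (by linarith)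
lemma uth_mem (t : ℝ) : 0 ≤ uth t ∧ uth t ≤ 1 :=
  ⟨Real.smoothTransition.nonneg _, Real.smoothTransition.le_one _⟩
lemma uB_sm (n) : ContDiff ℝ (⊤ : ℕ∞) (uB n) := uth_sm.comp (contDiff_const.mul sn_sm)
lemma uB_int (n) (x : ℝ) (k : ℤ) : uB n (x + k) = uB n x := by simp [uB, sn_int]

/-- enumeration of the integer vectors -/
def uw : ℕ → ℤ × ℤ := (exists_surjective_nat (ℤ × ℤ)).choose
lemma uw_surj : Surjective uw := (exists_surjective_nat (ℤ × ℤ)).choose_spec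

def uS : ℕ → ℕ
  | 0 => 1
  | n + 1 => uS n + uS n * ((uw n).1.natAbs + (uw n).2.natAbs)

lemma uS_pos (n) : 1 ≤ uS n := by
  induction n with
  | zero => simp [uS]
  | succ n ih => simp only [uS]; exact ih.trans (Nat.le_add_right _ _)

def ua (n : ℕ) : ℤ := uS n * (uw n).1
def ub (n : ℕ) : ℤ := uS n * (uw n).2

def uX (n : ℕ) (z : ℝ × ℝ) : ℝ × ℝ := (z.1 + ua n * uB n z.2, z.2)
def uY (n : ℕ) (z : ℝ × ℝ) : ℝ × ℝ := (z.1, z.2 + ub n * uB n z.1)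
def uXi (n : ℕ) (z : ℝ × ℝ) : ℝ × ℝ := (z.1 - ua n * uB n z.2, z.2)
def uYi (n : ℕ) (z : ℝ × ℝ) : ℝ × ℝ := (z.1, z.2 - ub n * uB n z.1)

def uP : ℕ → ℝ × ℝ → ℝ × ℝ
  | 0, z => z
  | n + 1, z => uP n (uY n (uX n z))
def uI : ℕ → ℝ × ℝ → ℝ × ℝ
  | 0, z => z
  | n + 1, z => uXi n (uYi n (uI n z))

lemma uX_sm (n) : ContDiff ℝ (⊤ : ℕ∞) (uX n) :=
  (contDiff_fst.add (contDiff_const.mul ((uB_sm n).comp contDiff_snd))).prodMk contDiff_snd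
lemma uY_sm (n) : ContDiff ℝ (⊤ : ℕ∞) (uY n) :=
  contDiff_fst.prodMk (contDiff_snd.add (contDiff_const.mul ((uB_sm n).comp contDiff_fst)))
lemma uXi_sm (n) : ContDiff ℝ (⊤ : ℕ∞) (uXi n) :=
  (contDiff_fst.sub (contDiff_const.mul ((uB_sm n).comp contDiff_snd))).prodMk contDiff_snd
lemma uYi_sm (n) : ContDiff ℝ (⊤ : ℕ∞) (uYi n) :=
  contDiff_fst.prodMk (contDiff_snd.sub (contDiff_const.mul ((uB_sm n).comp contDiff_fst)))
lemma uX_eqv (n) : Eqv (uX n) := by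
  intro z k l; simp only [uX, uB_int]; ext <;> simp; ring
lemma uY_eqv (n) : Eqv (uY n) := by
  intro z k l; simp only [uY, uB_int]; ext <;> simp; ring

lemma uP_sm (n) : ContDiff ℝ (⊤ : ℕ∞) (uP n) := by
  induction n with
  | zero => exact contDiff_id
  | succ n ih => exact ih.comp ((uY_sm n).comp (uX_sm n))
lemma uI_sm (n) : ContDiff ℝ (⊤ : ℕ∞) (uI n) := by
  induction n with
  | zero => exact contDiff_id
  | succ n ih => exact (uXi_sm n).comp ((uYi_sm n).comp ih)
lemma uP_eqv (n) : Eqv (uP n) := by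
  induction n with
  | zero => intro z k l; rfl
  | succ n ih => exact ih.comp ((uY_eqv n).comp (uX_eqv n))
lemma uIP (n z) : uI n (uP n z) = z := by
  induction n generalizing z with
  | zero => rfl
  | succ n ih => simp only [uI, uP, ih]; simp [uXi, uYi, uX, uY]
lemma uPI (n z) : uP n (uI n z) = z := by
  induction n generalizing z with
  | zero => rfl
  | succ n ih =>
    have : uY n (uX n (uXi n (uYi n (uI n z)))) = uI n z := by simp [uXi, uYi, uX, uY]
    simp only [uI, uP, this, ih]

/-- stabilization region -/
def uQ (n : ℕ) : Set (ℝ × ℝ) := {z | 1 ≤ 4 ^ n * sn z.1 ∧ 1 ≤ 4 ^ n * sn z.2}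

lemma sn_nonneg (x) : 0 ≤ sn x := sq_nonneg _

lemma uQ_mono : Monotone uQ := by
  intro m n h z hz
  have h4 : (4:ℝ) ^ m ≤ 4 ^ n := pow_le_pow_right₀ (by norm_num) h
  exact ⟨hz.1.trans (mul_le_mul_of_nonneg_right h4 (sn_nonneg _)),
    hz.2.trans (mul_le_mul_of_nonneg_right h4 (sn_nonneg _))⟩

lemma uQ_closed (n) : IsClosed (uQ n) := by
  have := sn_sm.continuous
  have c1 : Continuous (fun w : ℝ × ℝ => 4 ^ n * sn w.1) := by fun_prop
  have c2 : Continuous (fun w : ℝ × ℝ => 4 ^ n * sn w.2) := by fun_prop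
  exact (isClosed_le continuous_const c1).inter (isClosed_le continuous_const c2)

lemma uP_stab {n m : ℕ} (h : n ≤ m) {z} (hz : z ∈ uQ n) : uP m z = uP n z := by
  induction m, h using Nat.le_induction with
  | base => rfl
  | succ m hm ih =>
    have hz' := uQ_mono hm hz
    have e1 : uX m z = z := by simp [uX, uB, uth_zero hz'.2]
    have e2 : uY m z = z := by simp [uY, uB, uth_zero hz'.1]
    simp only [uP, e1, e2, ih]

open Classical in
def psi (z : ℝ × ℝ) : ℝ × ℝ := if h : ∃ n, z ∈ uQ n then uP h.choose z else z

lemma psi_eq {n z} (hz : z ∈ uQ n) : psi z = uP n z := by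
  have h : ∃ n, z ∈ uQ n := ⟨n, hz⟩
  rw [psi, dif_pos h]
  rcases le_total n h.choose with h' | h'
  · exact uP_stab h' hz
  · exact (uP_stab h' h.choose_spec).symm

lemma sn_pos {x : ℝ} (h : x ∈ Ioo (0:ℝ) 1) : 0 < sn x := by
  have : 0 < Real.sin (Real.pi * x) := by
    apply Real.sin_pos_of_pos_of_lt_pi
    · have := h.1; positivity
    · have := mul_lt_mul_of_pos_left h.2 Real.pi_pos; linarith
  unfold sn; positivity

lemma uQ_nhds {z} (hz : z ∈ Q0) : ∃ n, ∀ᶠ w in 𝓝 z, w ∈ uQ n := by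
  have h1 := sn_pos hz.1
  have h2 := sn_pos hz.2
  obtain ⟨n, hn⟩ := pow_unbounded_of_one_lt (max (sn z.1)⁻¹ (sn z.2)⁻¹) (show (1:ℝ) < 4 by norm_num)
  refine ⟨n, ?_⟩
  have := sn_sm.continuous
  have c1 : ContinuousAt (fun w : ℝ × ℝ => 4 ^ n * sn w.1) z := by fun_prop
  have c2 : ContinuousAt (fun w : ℝ × ℝ => 4 ^ n * sn w.2) z := by fun_prop
  have l1 : 1 < 4 ^ n * sn z.1 := by
    have := (le_max_left _ _).trans_lt hn; rwa [inv_lt_iff_one_lt_mul₀ h1] at this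
  have l2 : 1 < 4 ^ n * sn z.2 := by
    have := (le_max_right _ _).trans_lt hn; rwa [inv_lt_iff_one_lt_mul₀ h2] at this
  filter_upwards [c1.eventually_const_lt l1, c2.eventually_const_lt l2] with w w1 w2
  exact ⟨w1.le, w2.le⟩

lemma uQ_ex {z} (hz : z ∈ Q0) : ∃ n, z ∈ uQ n := by
  obtain ⟨n, h⟩ := uQ_nhds hz; exact ⟨n, h.self_of_nhds⟩

lemma psi_meas : Measurable psi := by
  classical
  have h : ∀ n, Measurable (fun z => if z ∈ uQ n then uP n z else z) := fun n =>
    Measurable.ite (uQ_closed n).measurableSet (uP_sm n).continuous.measurable measurable_id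
  refine measurable_of_tendsto_metrizable h (tendsto_pi_nhds.2 fun z => ?_)
  by_cases hz : ∃ n, z ∈ uQ n
  · obtain ⟨n, hn⟩ := hz
    refine tendsto_const_nhds.congr' ?_
    filter_upwards [eventually_ge_atTop n] with m hm
    rw [if_pos (uQ_mono hm hn), psi_eq (uQ_mono hm hn)]
  · refine tendsto_const_nhds.congr fun m => ?_
    rw [if_neg (fun h => hz ⟨m, h⟩), psi, dif_neg hz]

lemma lint_uP (n) {u : ℝ × ℝ → ENNReal} (hu : Measurable u) (hp : Per u) :
    ∫⁻ z, u (uP n z) ∂muQ = ∫⁻ z, u z ∂muQ := by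
  induction n generalizing u with
  | zero => rfl
  | succ n ih =>
    rw [← ih hu hp]
    have m1 : Measurable (fun z => u (uP n z)) := hu.comp (uP_sm n).continuous.measurable
    have p1 : Per (fun z => u (uP n z)) := hp.eqv (uP_eqv n)
    have m2 : Measurable (fun z => u (uP n (uY n z))) := m1.comp (uY_sm n).continuous.measurable
    have p2 : Per (fun z => u (uP n (uY n z))) := p1.eqv (uY_eqv n)
    have e1 := lint_gm (m2.comp measurable_swap) p2.swap (uB_sm n).continuous (ua n)
    have e2 := lint_gm m1 p1 (uB_sm n).continuous (ub n)
    have e3 := lint_swap m2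
    have e4 := lint_swap (m1.comp (gm_cont (uB_sm n).continuous (ub n)).measurable)
    calc ∫⁻ z, u (uP n (uY n (uX n z))) ∂muQ = ∫⁻ z, u (uP n (uY n z.swap)) ∂muQ := e1
      _ = ∫⁻ z, u (uP n (uY n z)) ∂muQ := e3
      _ = ∫⁻ z, u (uP n (gm (uB n) (ub n) z.swap)) ∂muQ := rfl
      _ = ∫⁻ z, u (uP n (gm (uB n) (ub n) z)) ∂muQ := e4
      _ = _ := e2

lemma Q0_muQ : volume.restrict Q0 = muQ := by
  have : (Q0 : Set (ℝ × ℝ)) =ᵐ[volume] (Ioc (0:ℝ) 1 ×ˢ Ioc (0:ℝ) 1 : Set (ℝ × ℝ)) := by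
    rw [Q0, Measure.volume_eq_prod]
    exact Measure.set_prod_ae_eq Ioo_ae_eq_Ioc Ioo_ae_eq_Ioc
  rw [muQ_eq, Measure.restrict_congr_set this]

lemma psi_map : Measure.map (fun z => proj (psi z)) muQ = volume := by
  have hm : Measurable (fun z => proj (psi z)) := proj_cont.measurable.comp psi_meas
  ext B hB
  have hind : Measurable (fun z => B.indicator (1 : T2 → ENNReal) (proj z)) :=
    (measurable_one.indicator hB).comp proj_cont.measurable
  have h1 := tendsto_lintegral_of_dominated_convergence (μ := muQ)
    (F := fun n z => B.indicator (1 : T2 → ENNReal) (proj (uP n z)))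
    (f := fun z => B.indicator (1 : T2 → ENNReal) (proj (psi z))) (fun _ => 1)
    (fun n => hind.comp (uP_sm n).continuous.measurable)
    (fun n => Eventually.of_forall fun z => indicator_le_self' (by simp) _) (by simp) (by
      rw [← Q0_muQ]
      filter_upwards [ae_restrict_mem (measurableSet_Ioo.prod measurableSet_Ioo)] with z hz
      obtain ⟨n, hn⟩ := uQ_ex hz
      refine tendsto_const_nhds.congr' ?_
      filter_upwards [eventually_ge_atTop n] with m hm
      rw [psi_eq (uQ_mono hm hn)])
  have h2 : ∀ n, ∫⁻ z, B.indicator (1 : T2 → ENNReal) (proj (uP n z)) ∂muQ = volume B := by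
    intro n
    rw [lint_uP n hind (proj_per.comp _), proj_mp.lintegral_comp (measurable_one.indicator hB),
      lintegral_indicator_one hB]
  simp only [h2] at h1
  have h3 := tendsto_nhds_unique h1 tendsto_const_nhds
  rw [← h3, ← lintegral_indicator_one hB, lintegral_map (measurable_one.indicator hB) hm]

/-! ### norm bounds -/
lemma uX_norm (n z) : ‖uX n z - z‖ ≤ |(ua n : ℝ)| := by
  have h := uth_mem (4 ^ n * sn z.2)
  rw [Prod.norm_def]
  simp only [uX, Prod.fst_sub, Prod.snd_sub, add_sub_cancel_left, sub_self, norm_zero, Real.norm_eq_abs,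
    abs_mul]
  apply max_le _ (abs_nonneg _)
  have : |uB n z.2| ≤ 1 := abs_le.2 ⟨by simp only [uB]; linarith, h.2⟩
  exact mul_le_of_le_one_right (abs_nonneg _) this
lemma uY_norm (n z) : ‖uY n z - z‖ ≤ |(ub n : ℝ)| := by
  have h := uth_mem (4 ^ n * sn z.1)
  rw [Prod.norm_def]
  simp only [uY, Prod.fst_sub, Prod.snd_sub, add_sub_cancel_left, sub_self, norm_zero, Real.norm_eq_abs,
    abs_mul]
  apply max_le (abs_nonneg _) _
  have : |uB n z.1| ≤ 1 := abs_le.2 ⟨by simp only [uB]; linarith, h.2⟩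
  exact mul_le_of_le_one_right (abs_nonneg _) this

lemma uP_norm (n z) : ‖uP n z - z‖ + 1 ≤ uS n := by
  induction n generalizing z with
  | zero => simp [uP, uS]
  | succ n ih =>
    have h1 := uX_norm n z
    have h2 := uY_norm n (uX n z)
    have h3 := ih (uY n (uX n z))
    have h4 : ‖uP n (uY n (uX n z)) - z‖ ≤ ‖uP n (uY n (uX n z)) - uY n (uX n z)‖ +
        (‖uY n (uX n z) - uX n z‖ + ‖uX n z - z‖) := by
      refine le_trans (le_of_eq ?_) ((norm_add_le _ _).trans (add_le_add le_rfl (norm_add_le _ _)))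
      congr 1; abel
    have e1 : |(ua n : ℝ)| = uS n * ((uw n).1.natAbs : ℝ) := by
      simp only [ua, Int.cast_mul, Int.cast_natCast, abs_mul, Nat.abs_cast, Nat.cast_natAbs, Int.cast_abs]
    have e2 : |(ub n : ℝ)| = uS n * ((uw n).2.natAbs : ℝ) := by
      simp only [ub, Int.cast_mul, Int.cast_natCast, abs_mul, Nat.abs_cast, Nat.cast_natAbs, Int.cast_abs]
    simp only [uP, uS]; push_cast
    rw [e1] at h1; rw [e2] at h2
    linarith

lemma dir_norm {u a : ℝ × ℝ} (hu : ‖u‖ = 1) {t : ℝ} (ht : 0 < t) :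
    ‖‖a‖⁻¹ • a - u‖ ≤ 2 * ‖a - t • u‖ / t := by
  by_cases ha : a = 0
  · subst ha
    simp only [norm_zero, inv_zero, smul_zero, zero_sub, norm_neg, norm_smul, hu, Real.norm_eq_abs, abs_of_pos ht]
    rw [le_div_iff₀ ht]; linarith
  have hn : 0 < ‖a‖ := norm_pos_iff.2 ha
  have e1 : ‖‖a‖⁻¹ • a - t⁻¹ • a‖ ≤ ‖a - t • u‖ / t := by
    rw [← sub_smul, norm_smul, Real.norm_eq_abs, show ‖a‖⁻¹ - t⁻¹ = (t - ‖a‖) / (‖a‖ * t) by field_simp,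
      abs_div, abs_of_pos (mul_pos hn ht)]
    have : |t - ‖a‖| ≤ ‖a - t • u‖ := by
      have := abs_norm_sub_norm_le a (t • u)
      rwa [norm_smul, hu, Real.norm_eq_abs, abs_of_pos ht, mul_one, abs_sub_comm] at this
    rw [show |t - ‖a‖| / (‖a‖ * t) * ‖a‖ = |t - ‖a‖| / t by field_simp]
    gcongr
  have e2 : ‖t⁻¹ • a - u‖ = ‖a - t • u‖ / t := by
    rw [show t⁻¹ • a - u = t⁻¹ • (a - t • u) by rw [smul_sub, smul_smul, inv_mul_cancel₀ ht.ne', one_smul],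
      norm_smul, norm_inv, Real.norm_eq_abs, abs_of_pos ht]; ring
  calc _ ≤ ‖‖a‖⁻¹ • a - t⁻¹ • a‖ + ‖t⁻¹ • a - u‖ := by
        refine le_trans (le_of_eq ?_) (norm_add_le _ _); congr 1; abel
    _ ≤ _ := by rw [e2]; linarith [e1, show 2 * ‖a - t • u‖ / t = ‖a - t • u‖ / t + ‖a - t • u‖ / t by ring]

lemma psi_dir {u : ℝ × ℝ} (hu : ‖u‖ = 1) {ε : ℝ} (hε : 0 < ε) (R : ℝ) :
    ∃ q ∈ Q0, q.2 ≠ 1 / 2 ∧ R < ‖psi q‖ ∧ ‖‖psi q‖⁻¹ • psi q - u‖ < ε := by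
  obtain ⟨K, hK⟩ := exists_nat_gt (|R| + 4 + 4 / ε)
  have hd : 0 < 4 / ε := by positivity
  have hR := abs_nonneg R
  have hK0 : (0:ℝ) < K := by linarith
  obtain ⟨n, hn⟩ := uw_surj (round (K * u.1), round (K * u.2))
  have hsp : (0:ℝ) < (4:ℝ)⁻¹ ^ (n + 1) := by positivity
  have hsl : (4:ℝ)⁻¹ ^ (n + 1) < 1 := pow_lt_one₀ (by norm_num) (by norm_num) (by simp)
  have s0 : sn 0 = 0 := by simp [sn]
  have s1 : sn (1/2) = 1 := by
    simp only [sn]; rw [show Real.pi * (1/2) = Real.pi / 2 by ring, Real.sin_pi_div_two]; norm_num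
  obtain ⟨x, hx, hxs⟩ := intermediate_value_Icc (show (0:ℝ) ≤ 1 / 2 by norm_num)
    (sn_sm.continuous.continuousOn) (show (4:ℝ)⁻¹ ^ (n+1) ∈ Icc (sn 0) (sn (1/2)) by
      rw [s0, s1]; exact ⟨hsp.le, hsl.le⟩)
  have hx0 : x ≠ 0 := by rintro rfl; rw [s0] at hxs; linarith
  have hx1 : x ≠ 1 / 2 := by rintro rfl; rw [s1] at hxs; linarith
  have hx2 : 0 < x := lt_of_le_of_ne hx.1 hx0.symm
  have hx3 : x < 1 := by linarith [hx.2]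
  have e4 : (4:ℝ) ^ (n+1) * sn x = 1 := by rw [hxs, ← mul_pow]; norm_num
  have hq : ((x, x) : ℝ × ℝ) ∈ uQ (n + 1) := ⟨e4.ge, e4.ge⟩
  have e5 : uB n x = 1 := uth_one (by rw [pow_succ] at e4; linarith)
  have ep : psi (x, x) = uP n (x, x) + ((ua n : ℝ), (ub n : ℝ)) := by
    rw [psi_eq hq]
    have := uP_eqv n (x, x) (ua n) (ub n)
    simp only [uP, uX, uY, e5, mul_one, uB_int, this]; rfl
  have hS : (1:ℝ) ≤ uS n := by exact_mod_cast uS_pos n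
  set t : ℝ := uS n * K with ht
  have htp : 0 < t := by positivity
  have hba : ‖psi (x, x) - t • u‖ ≤ 2 * uS n := by
    have b1 : ‖uP n (x, x)‖ ≤ uS n := by
      have := uP_norm n (x, x)
      have h2 : ‖((x, x) : ℝ × ℝ)‖ ≤ 1 := by
        rw [Prod.norm_def]; simp [abs_of_pos hx2, hx3.le]
      have := norm_sub_norm_le (uP n (x, x)) (x, x)
      linarith
    have b2 : ‖(((ua n : ℝ), (ub n : ℝ)) : ℝ × ℝ) - t • u‖ ≤ uS n := by
      have r1 := abs_sub_round (K * u.1)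
      have r2 := abs_sub_round (K * u.2)
      have r1' : |(round (K * u.1) : ℝ) - K * u.1| ≤ 1 := by rw [abs_sub_comm]; linarith
      have r2' : |(round (K * u.2) : ℝ) - K * u.2| ≤ 1 := by rw [abs_sub_comm]; linarith
      have hS0 : (0:ℝ) ≤ uS n := by linarith
      rw [Prod.norm_def]
      simp only [ua, ub, hn, Prod.fst_sub, Prod.snd_sub, Prod.smul_fst, Prod.smul_snd, smul_eq_mul, ht,
        Int.cast_mul, Int.cast_natCast, mul_assoc, ← mul_sub, norm_mul, Real.norm_eq_abs, Nat.abs_cast]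
      exact max_le (mul_le_of_le_one_right hS0 r1') (mul_le_of_le_one_right hS0 r2')
    rw [ep]
    calc _ = ‖uP n (x, x) + ((((ua n : ℝ), (ub n : ℝ)) : ℝ × ℝ) - t • u)‖ := by congr 1; abel
      _ ≤ _ := (norm_add_le _ _).trans (by linarith)
  refine ⟨(x, x), ⟨⟨hx2, hx3⟩, ⟨hx2, hx3⟩⟩, hx1, ?_, ?_⟩
  · have h1 := norm_sub_norm_le (t • u) (psi (x, x))
    rw [norm_smul, hu, Real.norm_eq_abs, abs_of_pos htp, norm_sub_rev] at h1
    have h2 : (uS n : ℝ) * (|R| + 4) ≤ t := by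
      rw [ht]; apply mul_le_mul_of_nonneg_left _ (by positivity); linarith
    have h3 : |R| ≤ uS n * |R| := le_mul_of_one_le_left hR hS
    have := le_abs_self R
    nlinarith
  · refine (dir_norm hu htp).trans_lt ?_
    rw [div_lt_iff₀ htp]
    have h5 : 4 < ε * K := by
      have : 4 / ε < K := by linarith
      rwa [div_lt_iff₀ hε, mul_comm] at this
    have : ε * t = (ε * K) * uS n := by rw [ht]; ring
    rw [this]
    nlinarith

/-! ### the final map -/
structure PsiD (Ψ : ℝ × ℝ → ℝ × ℝ) : Prop where
  per : Per Ψ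
  even : ∀ z, Ψ (-z) = Ψ z
  sm : ∀ z ∉ HLat, ContDiffAt ℝ (⊤ : ℕ∞) Ψ z
  LI : ∀ z ∉ HLat, ∃ G : ℝ × ℝ → ℝ × ℝ, G (Ψ z) = z ∧ ContDiffAt ℝ (⊤ : ℕ∞) G (Ψ z) ∧
    ∀ᶠ w in 𝓝 (Ψ z), G w ∉ HLat ∧ Ψ (G w) = w
  inj : ∀ z ∉ HLat, ∀ z' ∉ HLat, ∀ m n : ℤ, Ψ z = ((Ψ z').1 + m, (Ψ z').2 + n) →
    m = 0 ∧ n = 0 ∧ Pm z z'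
  meas : Measurable Ψ
  map : Measure.map (fun z => proj (Ψ z)) muQ = volume
  dir : ∀ u : ℝ × ℝ, ‖u‖ = 1 → ∀ ε > 0, ∀ R : ℝ, ∃ z ∉ HLat, R < ‖Ψ z‖ ∧ ‖‖Ψ z‖⁻¹ • Ψ z - u‖ < ε

lemma psiD_exists : ∃ Ψ, PsiD Ψ := by
  refine ⟨fun z => psi (Psi2 z), ?_, ?_, ?_, ?_, ?_, ?_, ?_, ?_⟩
  · exact Psi2_per.comp psi
  · intro z; simp only [Psi2_even]
  · intro z hz
    obtain ⟨n, hn⟩ := uQ_nhds (Psi2_mem z)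
    have h1 : ContDiffAt ℝ (⊤ : ℕ∞) (fun z => uP n (Psi2 z)) z := (uP_sm n).contDiffAt.comp z (Psi2_sm z hz)
    refine h1.congr_of_eventuallyEq ?_
    filter_upwards [(Psi2_sm z hz).continuousAt.eventually hn] with w hw
    exact psi_eq hw
  · intro z hz
    obtain ⟨n, hn⟩ := uQ_nhds (Psi2_mem z)
    obtain ⟨G, g1, g2, g3⟩ := Psi2_LI z hz
    have e : psi (Psi2 z) = uP n (Psi2 z) := psi_eq hn.self_of_nhds
    have e2 : uI n (psi (Psi2 z)) = Psi2 z := by rw [e, uIP]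
    have hc : ContinuousAt (uI n) (psi (Psi2 z)) := (uI_sm n).continuous.continuousAt
    have ht : Tendsto (uI n) (𝓝 (psi (Psi2 z))) (𝓝 (Psi2 z)) := by
      have := hc.tendsto; rwa [e2] at this
    refine ⟨fun w => G (uI n w), by simp only [e2, g1], ?_, ?_⟩
    · refine ContDiffAt.comp (g := G) _ ?_ (uI_sm n).contDiffAt
      rw [e2]; exact g2
    · filter_upwards [ht.eventually g3, ht.eventually hn] with w w1 w2
      refine ⟨w1.1, ?_⟩
      rw [w1.2, psi_eq w2, uPI]
  · intro z hz z' hz' m n h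
    obtain ⟨k, hk⟩ := uQ_ex (Psi2_mem z)
    obtain ⟨k', hk'⟩ := uQ_ex (Psi2_mem z')
    rw [psi_eq (uQ_mono (le_max_left k k') hk), psi_eq (uQ_mono (le_max_right k k') hk'),
      ← uP_eqv] at h
    have h2 := congrArg (uI (max k k')) h
    rw [uIP, uIP] at h2
    have a := Psi2_mem z
    have a' := Psi2_mem z'
    have i1 : ∀ (x y : ℝ) (m : ℤ), x ∈ Ioo (0:ℝ) 1 → y ∈ Ioo (0:ℝ) 1 → x = y + m → m = 0 := by
      intro x y m hx hy h
      have h1 : (m:ℝ) < (1:ℤ) := by push_cast; linarith [hx.2, hy.1]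
      have h2 : ((-1:ℤ):ℝ) < m := by push_cast; linarith [hx.1, hy.2]
      have := Int.cast_lt.1 h1; have := Int.cast_lt.1 h2; omega
    have m0 := i1 _ _ m a.1 a'.1 (congrArg Prod.fst h2)
    have n0 := i1 _ _ n a.2 a'.2 (congrArg Prod.snd h2)
    refine ⟨m0, n0, Psi2_inj hz hz' ?_⟩
    rw [h2, m0, n0]; simp
  · exact psi_meas.comp Psi2_meas
  · rw [← psi_map]
    have hm : Measurable (fun z => proj (psi z)) := proj_cont.measurable.comp psi_meas
    rw [show (fun z => proj (psi (Psi2 z))) = (fun z => proj (psi z)) ∘ Psi2 from rfl,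
      ← Measure.map_map hm Psi2_meas, Psi2_map, Q0_muQ]
  · intro u hu ε hε R
    obtain ⟨q, q1, q2, q3, q4⟩ := psi_dir hu hε R
    obtain ⟨z, hz, rfl⟩ := Psi2_surj q1 q2
    exact ⟨z, hz, q3, q4⟩
end

/-! ## Part 19 -/
open Filter Topology Set Function MeasureTheory
noncomputable section
set_option linter.unusedSectionVars false

/-! ### the profiles `BB k` -/
def s2 (y : ℝ) : ℝ := Real.sin (2 * Real.pi * y) ^ 2

lemma s2_cos (y : ℝ) : s2 y = (1 - Real.cos (4 * Real.pi * y)) / 2 := by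
  rw [s2, Real.sin_sq_eq_half_sub, show 2 * (2 * Real.pi * y) = 4 * Real.pi * y by ring]; ring

lemma s2_half (y : ℝ) : s2 (y + 1/2) = s2 y := by
  rw [s2_cos, s2_cos, show 4 * Real.pi * (y + 1/2) = 4 * Real.pi * y + 2 * Real.pi by ring,
    Real.cos_add_two_pi]

lemma s2_neg (y : ℝ) : s2 (-y) = s2 y := by simp [s2]

lemma s2_int (y : ℝ) (k : ℤ) : s2 (y + k / 2) = s2 y := by
  rw [s2_cos, s2_cos, show 4 * Real.pi * (y + k/2) = 4 * Real.pi * y + k * (2 * Real.pi) by ring,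
    Real.cos_add_int_mul_two_pi]

lemma s2_mono {u t : ℝ} (h : |u| ≤ |t|) (ht : |t| ≤ 1/4) : s2 u ≤ s2 t := by
  rw [s2_cos, s2_cos]
  have hp := Real.pi_pos
  have e : ∀ v : ℝ, Real.cos (4 * Real.pi * v) = Real.cos (4 * Real.pi * |v|) := by
    intro v
    rw [← Real.cos_abs, abs_mul, abs_of_pos (by positivity : (0:ℝ) < 4 * Real.pi)]
  rw [e u, e t]
  have : Real.cos (4 * Real.pi * |t|) ≤ Real.cos (4 * Real.pi * |u|) := by
    apply Real.cos_le_cos_of_nonneg_of_le_pi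
    · positivity
    · nlinarith
    · exact mul_le_mul_of_nonneg_left h (by positivity)
  linarith

lemma s2_smooth : ContDiff ℝ (⊤ : ℕ∞) s2 := by
  have : s2 = fun y => Real.sin (2 * Real.pi * y) ^ 2 := rfl
  rw [this]; fun_prop

def sK (k : ℕ) : ℝ := 1 / (k + 2)

lemma sK_pos (k : ℕ) : 0 < sK k := by unfold sK; positivity
lemma sK_le (k : ℕ) : sK k ≤ 1/2 := by
  unfold sK
  apply one_div_le_one_div_of_le (by norm_num); have : (0:ℝ) ≤ k := by positivity
  linarith
lemma sK_anti {j k : ℕ} (h : j ≤ k) : sK k ≤ sK j := by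
  unfold sK
  apply one_div_le_one_div_of_le (by positivity)
  have : (j:ℝ) ≤ k := by exact_mod_cast h
  linarith

def gB (k : ℕ) (y : ℝ) : ℝ := expNegInvGlue (s2 y - sK k)

lemma gB_smooth (k : ℕ) : ContDiff ℝ (⊤ : ℕ∞) (gB k) :=
  expNegInvGlue.contDiff.comp (s2_smooth.sub contDiff_const)

lemma gB_nonneg (k : ℕ) (y : ℝ) : 0 ≤ gB k y := expNegInvGlue.nonneg _

lemma gB_int_pos (k : ℕ) : 0 < ∫ t in (0:ℝ)..(1/2), gB k t := by
  have hc := (gB_smooth k).continuous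
  apply intervalIntegral.integral_pos (by norm_num) hc.continuousOn (fun x _ => gB_nonneg k x)
  refine ⟨1/4, by constructor <;> norm_num, ?_⟩
  apply expNegInvGlue.pos_of_pos
  have : s2 (1/4) = 1 := by
    rw [s2, show 2 * Real.pi * (1/4) = Real.pi / 2 by ring, Real.sin_pi_div_two]; norm_num
  have := sK_le k
  linarith

def BB (k : ℕ) (y : ℝ) : ℝ := (∫ t in (0:ℝ)..y, gB k t) / (2 * ∫ t in (0:ℝ)..(1/2), gB k t)

lemma BB_deriv (k : ℕ) (y : ℝ) :
    HasDerivAt (BB k) (gB k y / (2 * ∫ t in (0:ℝ)..(1/2), gB k t)) y := by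
  have hc := (gB_smooth k).continuous
  exact (intervalIntegral.integral_hasDerivAt_right (hc.intervalIntegrable _ _)
    (hc.stronglyMeasurableAtFilter _ _) hc.continuousAt).div_const _

/-- smooth odd profile commuting with the half translation -/
structure Phi0 (φ : ℝ → ℝ) : Prop where
  smooth : ContDiff ℝ (⊤ : ℕ∞) φ
  half : ∀ y, φ (y + 1/2) = φ y + 1/2
  odd : ∀ y, φ (-y) = - φ y

lemma BB_phi0 (k : ℕ) : Phi0 (BB k) := by
  have hc := (gB_smooth k).continuous
  have hpos := gB_int_pos k
  refine ⟨?_, ?_, ?_⟩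
  · rw [contDiff_infty_iff_deriv]
    refine ⟨fun y => (BB_deriv k y).differentiableAt, ?_⟩
    have : deriv (BB k) = fun y => gB k y / (2 * ∫ t in (0:ℝ)..(1/2), gB k t) :=
      funext fun y => (BB_deriv k y).deriv
    rw [this]
    exact (gB_smooth k).div_const _
  · intro y
    have hper : Function.Periodic (gB k) (1/2) := fun y => by simp only [gB, s2_half]
    have h1 := hper.intervalIntegral_add_eq y 0
    rw [zero_add] at h1
    have h2 := intervalIntegral.integral_add_adjacent_intervals
      (hc.intervalIntegrable (μ := volume) 0 y) (hc.intervalIntegrable y (y + 1/2))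
    unfold BB
    rw [← h2, h1, add_div]
    congr 1
    field_simp
  · intro y
    unfold BB
    have h1 : ∫ t in (0:ℝ)..(-y), gB k t = - ∫ t in (0:ℝ)..y, gB k t := by
      have := intervalIntegral.integral_comp_neg (a := 0) (b := y) (fun t => gB k t)
      have e : ∀ t, gB k (-t) = gB k t := fun t => by simp only [gB, s2_neg]
      simp only [e, neg_zero] at this
      rw [this, intervalIntegral.integral_symm]
    rw [h1, neg_div]

lemma BB_mono (k : ℕ) : Monotone (BB k) := by
  apply monotone_of_deriv_nonneg (fun y => (BB_deriv k y).differentiableAt)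
  intro y
  rw [(BB_deriv k y).deriv]
  have := gB_int_pos k
  have := gB_nonneg k y
  positivity

lemma BB_deriv_zero {k : ℕ} {y : ℝ} (h : deriv (BB k) y = 0) : s2 y ≤ sK k := by
  rw [(BB_deriv k y).deriv] at h
  have := gB_int_pos k
  have h2 : gB k y = 0 := by
    rcases div_eq_zero_iff.1 h with h | h
    · exact h
    · linarith
  have := expNegInvGlue.zero_iff_nonpos.1 h2
  linarith

section
variable {φ : ℝ → ℝ} (hφ : Phi0 φ)
include hφ

lemma Phi0.zero : φ 0 = 0 := by have := hφ.odd 0; simp at this; linarith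

lemma Phi0.addInt (y : ℝ) (k : ℤ) : φ (y + k/2) = φ y + k/2 := by
  induction k using Int.induction_on with
  | zero => simp
  | succ i ih =>
    have := hφ.half (y + (i:ℤ)/2)
    push_cast at *
    rw [show y + ((i:ℝ)+1)/2 = y + i/2 + 1/2 by ring, this, ih]; ring
  | pred i ih =>
    have := hφ.half (y + ((-(i:ℤ) - 1 : ℤ):ℝ)/2)
    push_cast at *
    rw [show y + (-(i:ℝ) - 1)/2 + 1/2 = y + -i/2 by ring, ih] at this
    linarith

lemma Phi0.int (k : ℤ) : φ ((k:ℝ)/2) = (k:ℝ)/2 := by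
  have := hφ.addInt 0 k
  simpa [hφ.zero] using this

lemma Phi0.one (y : ℝ) (k : ℤ) : φ (y + k) = φ y + k := by
  have := hφ.addInt y (2 * k)
  push_cast at this
  rwa [show 2 * (k:ℝ)/2 = k by ring] at this

lemma Phi0.add {b : ℝ → ℝ} {c : ℝ → ℝ} (hb : Phi0 b) (hc : Phi0 c) (ε : ℝ) :
    Phi0 (fun y => φ y + ε * (b y - c y)) :=
  ⟨hφ.smooth.add (contDiff_const.mul (hb.smooth.sub hc.smooth)),
    fun y => by rw [hφ.half, hb.half, hc.half]; ring,
    fun y => by rw [hφ.odd, hb.odd, hc.odd]; ring⟩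

end

/-- locally constant near the half integers -/
def Flat (s : ℝ) (φ : ℝ → ℝ) : Prop := ∀ y, s2 y ≤ s → ∀ k : ℤ, |y - k/2| ≤ 1/4 → φ y = k/2

lemma Flat.mono {s t : ℝ} {φ} (h : Flat s φ) (hst : t ≤ s) : Flat t φ :=
  fun y hy k hk => h y (hy.trans hst) k hk

lemma Flat.add {s : ℝ} {φ b c : ℝ → ℝ} (h : Flat s φ) (hb : Flat s b) (hc : Flat s c) (ε : ℝ) :
    Flat s (fun y => φ y + ε * (b y - c y)) :=
  fun y hy k hk => by beta_reduce; rw [h y hy k hk, hb y hy k hk, hc y hy k hk]; ring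

lemma BB_flat (k : ℕ) : Flat (sK k) (BB k) := by
  intro y hy j hj
  have h1 := (BB_phi0 k).addInt (y - j/2) j
  rw [sub_add_cancel] at h1
  rw [h1]
  have h2 : s2 (y - j/2) ≤ sK k := by
    have := s2_int (y - j/2) j
    rw [sub_add_cancel] at this; rwa [← this]
  set t := y - j/2
  have : BB k t = 0 := by
    unfold BB
    rw [div_eq_zero_iff]; left
    rw [intervalIntegral.integral_congr (g := fun _ => (0:ℝ))]
    · simp
    · intro u hu
      apply expNegInvGlue.zero_of_nonpos
      have : |u| ≤ |t| := by
        rw [mem_uIcc] at hu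
        rcases hu with hu | hu
        · rw [abs_of_nonneg hu.1, abs_of_nonneg (hu.1.trans hu.2)]; exact hu.2
        · rw [abs_of_nonpos hu.2, abs_of_nonpos (hu.1.trans hu.2)]; linarith [hu.1]
      have := s2_mono this hj
      linarith
  rw [this, zero_add]

lemma Flat.ex {s : ℝ} {φ} (h : Flat s φ) {y : ℝ} (hy : s2 y ≤ s) : ∃ k : ℤ, φ y = k/2 := by
  refine ⟨round (2 * y), h y hy _ ?_⟩
  have := abs_sub_round (2 * y)
  rw [show y - (round (2*y) : ℝ)/2 = (2 * y - round (2*y)) * (1/2) by ring, abs_mul]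
  rw [abs_of_pos (by norm_num : (0:ℝ) < 1/2)]
  linarith

/-! ### admissible maps -/
lemma Pm.refl (z : ℝ × ℝ) : Pm z z := ⟨0, 0, Or.inl (by simp)⟩

structure Adm (f : ℝ × ℝ → ℝ × ℝ) : Prop where
  lat : ∀ z, z ∉ HLat → f z ∉ HLat
  pm : ∀ z w, Pm z w → Pm (f z) (f w)

lemma Adm.comp {f g} (hf : Adm f) (hg : Adm g) : Adm (fun z => f (g z)) :=
  ⟨fun z hz => hf.lat _ (hg.lat z hz), fun z w h => hf.pm _ _ (hg.pm z w h)⟩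

lemma adm_iter {f} (hf : Adm f) (k : ℕ) : Adm (f^[k]) := by
  induction k with
  | zero => exact ⟨fun z h => h, fun z w h => h⟩
  | succ k ih =>
    rw [iterate_succ]; exact ih.comp hf

lemma adm_swap : Adm (fun z : ℝ × ℝ => z.swap) :=
  ⟨fun z hz h => hz ⟨h.2, h.1⟩, fun z w ⟨m, n, h⟩ => ⟨n, m, by
    rcases h with h | h <;> subst h <;> simp⟩⟩

lemma adm_gm {φ} (hφ : Phi0 φ) {e : ℝ} (he : e = 1 ∨ e = -1) : Adm (gm φ e) := by
  obtain ⟨e', rfl⟩ : ∃ e' : ℤ, e = e' := by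
    rcases he with rfl | rfl
    · exact ⟨1, by simp⟩
    · exact ⟨-1, by simp⟩
  refine ⟨?_, ?_⟩
  · rintro z hz ⟨⟨k, hk⟩, ⟨j, hj⟩⟩
    apply hz
    simp only [gm] at hk hj
    refine ⟨⟨j - e' * k, ?_⟩, k, hk⟩
    rw [hk, hφ.int] at hj
    push_cast; linarith
  · rintro z w ⟨m, n, h⟩
    rcases h with h | h
    · subst h
      refine ⟨n, m + e' * n, Or.inl ?_⟩
      simp only [gm, hφ.one]
      push_cast
      ext <;> simp only <;> ring
    · subst h
      refine ⟨n, m + e' * n, Or.inr ?_⟩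
      simp only [gm, hφ.one, hφ.odd]
      push_cast
      ext <;> simp only <;> ring

def fw (φ : ℝ → ℝ) (z : ℝ × ℝ) : ℝ × ℝ := (gm φ 1)^[6] z
def bw (φ : ℝ → ℝ) (z : ℝ × ℝ) : ℝ × ℝ := ((gm φ (-1))^[6] z.swap).swap

lemma adm_fw {φ} (hφ : Phi0 φ) : Adm (fw φ) := adm_iter (adm_gm hφ (Or.inl rfl)) 6
lemma adm_bw {φ} (hφ : Phi0 φ) : Adm (bw φ) :=
  adm_swap.comp ((adm_iter (adm_gm hφ (Or.inr rfl)) 6).comp adm_swap)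

lemma bw_fw (φ : ℝ → ℝ) (z : ℝ × ℝ) : bw φ (fw φ z) = z := by
  unfold bw fw
  rw [gm_swap_inv, Prod.swap_swap]

lemma fw_bw (φ : ℝ → ℝ) (z : ℝ × ℝ) : fw φ (bw φ z) = z := by
  unfold bw fw
  have := gm_swap_inv φ (-1) 6 z.swap
  rw [neg_neg] at this
  rw [this, Prod.swap_swap]

lemma fw_flat {φ} (hφ : Phi0 φ) {s : ℝ} (hs : Flat s φ) {z : ℝ × ℝ} (h1 : s2 z.1 ≤ s)
    (h2 : s2 z.2 ≤ s) : ∃ m n : ℤ, fw φ z = (z.1 + m, z.2 + n) := by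
  obtain ⟨j, hj⟩ := hs.ex h1
  obtain ⟨k, hk⟩ := hs.ex h2
  have a1 : ∀ m : ℤ, φ (z.1 + m/2) = (j + m : ℤ)/2 := fun m => by
    rw [hφ.addInt, hj]; push_cast; ring
  have a2 : ∀ m : ℤ, φ (z.2 + m/2) = (k + m : ℤ)/2 := fun m => by
    rw [hφ.addInt, hk]; push_cast; ring
  have g1 : ∀ m n : ℤ, gm φ 1 (z.1 + m/2, z.2 + n/2) = (z.2 + n/2, z.1 + ((m + (k + n) : ℤ):ℝ)/2) := by
    intro m n
    simp only [gm, a2]; push_cast; ext <;> simp only; ring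
  have g2 : ∀ m n : ℤ, gm φ 1 (z.2 + m/2, z.1 + n/2) = (z.1 + n/2, z.2 + ((m + (j + n) : ℤ):ℝ)/2) := by
    intro m n
    simp only [gm, a1]; push_cast; ext <;> simp only; ring
  have h0 : z = (z.1 + ((0:ℤ):ℝ)/2, z.2 + ((0:ℤ):ℝ)/2) := by simp
  have : fw φ z = gm φ 1 (gm φ 1 (gm φ 1 (gm φ 1 (gm φ 1 (gm φ 1 z))))) := rfl
  rw [this]
  refine ⟨4 * k + 2 * j, 6 * k + 4 * j, ?_⟩
  conv_lhs => rw [h0]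
  rw [g1, g2, g1, g2, g1, g2]
  push_cast
  ext <;> simp only <;> ring

end

/-! ## Part 20 -/
open Filter Topology Set Function MeasureTheory
noncomputable section
set_option linter.unusedSectionVars false

/-! ### conjugated maps -/
open Classical in
/-- The map of the plane that is conjugate through `Ψ` to `f` and is the identity off the range. -/
def FF (Ψ : ℝ × ℝ → ℝ × ℝ) (f : ℝ × ℝ → ℝ × ℝ) (w : ℝ × ℝ) : ℝ × ℝ :=
  if h : ∃ p : (ℝ × ℝ) × ℤ × ℤ, p.1 ∉ HLat ∧ w = ((Ψ p.1).1 + p.2.1, (Ψ p.1).2 + p.2.2) then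
    ((Ψ (f h.choose.1)).1 + h.choose.2.1, (Ψ (f h.choose.1)).2 + h.choose.2.2) else w

/-- range of Ψ modulo integer translations -/
def VV (Ψ : ℝ × ℝ → ℝ × ℝ) : Set (ℝ × ℝ) :=
  {w | ∃ z, z ∉ HLat ∧ ∃ m n : ℤ, w = ((Ψ z).1 + m, (Ψ z).2 + n)}

lemma PsiD.pm {Ψ} (h : PsiD Ψ) {z w : ℝ × ℝ} (hp : Pm z w) : Ψ z = Ψ w := by
  obtain ⟨m, n, rfl | rfl⟩ := hp
  · exact (h.per.int m n z.1 z.2).symm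
  · have := h.per.int m n (-z.1) (-z.2)
    rw [this, ← h.even z]; rfl

section
variable {Ψ : ℝ × ℝ → ℝ × ℝ} (hΨ : PsiD Ψ)
include hΨ

lemma FF_eq {f} (hf : Adm f) {z : ℝ × ℝ} (hz : z ∉ HLat) (m n : ℤ) :
    FF Ψ f ((Ψ z).1 + m, (Ψ z).2 + n) = ((Ψ (f z)).1 + m, (Ψ (f z)).2 + n) := by
  have h : ∃ p : (ℝ × ℝ) × ℤ × ℤ, p.1 ∉ HLat ∧
      ((Ψ z).1 + (m:ℝ), (Ψ z).2 + (n:ℝ)) = ((Ψ p.1).1 + p.2.1, (Ψ p.1).2 + p.2.2) := ⟨(z, m, n), hz, rfl⟩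
  unfold FF
  rw [dif_pos h]
  obtain ⟨h1, h2⟩ := h.choose_spec
  generalize h.choose = q at *
  have e1 := congrArg Prod.fst h2
  have e2 := congrArg Prod.snd h2
  simp only at e1 e2
  obtain ⟨a, b, c⟩ := hΨ.inj z hz q.1 h1 (q.2.1 - m) (q.2.2 - n)
    (by ext <;> push_cast <;> linarith)
  rw [hΨ.pm (hf.pm _ _ c), sub_eq_zero.1 a, sub_eq_zero.1 b]

omit hΨ in
lemma FF_off {f} {w : ℝ × ℝ} (hw : w ∉ VV Ψ) : FF Ψ f w = w := by
  unfold FF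
  rw [dif_neg]
  rintro ⟨p, h1, h2⟩
  exact hw ⟨p.1, h1, p.2.1, p.2.2, h2⟩

lemma FF_eqv {f} (hf : Adm f) : Eqv (FF Ψ f) := by
  intro w m n
  by_cases hw : w ∈ VV Ψ
  · obtain ⟨z, hz, a, b, rfl⟩ := hw
    rw [FF_eq hΨ hf hz]
    have := FF_eq hΨ hf hz (a + m) (b + n)
    push_cast at this
    simp only [add_assoc] at this ⊢
    exact this
  · rw [FF_off hw, FF_off]
    rintro ⟨z, hz, a, b, h⟩
    apply hw
    refine ⟨z, hz, a - m, b - n, ?_⟩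
    have e1 := congrArg Prod.fst h
    have e2 := congrArg Prod.snd h
    simp only at e1 e2
    ext <;> push_cast <;> linarith

lemma FF_inv {f g} (hf : Adm f) (hg : Adm g) (h : ∀ z, f (g z) = z) (w : ℝ × ℝ) :
    FF Ψ f (FF Ψ g w) = w := by
  by_cases hw : w ∈ VV Ψ
  · obtain ⟨z, hz, a, b, rfl⟩ := hw
    rw [FF_eq hΨ hg hz, FF_eq hΨ hf (hg.lat z hz), h]
  · rw [FF_off hw, FF_off hw]

/-- the part of the plane where the approximating maps are not the identity -/
def KK (Ψ : ℝ × ℝ → ℝ × ℝ) (s : ℝ) : Set (ℝ × ℝ) :=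
  {w | ∃ z, (s ≤ s2 z.1 ∨ s ≤ s2 z.2) ∧ ∃ m n : ℤ, w = ((Ψ z).1 + m, (Ψ z).2 + n)}

/-- the fundamental compact piece -/
def RC (s : ℝ) : Set (ℝ × ℝ) := {z | s ≤ s2 z.1 ∨ s ≤ s2 z.2} ∩ Icc 0 1 ×ˢ Icc 0 1

omit hΨ in
lemma RC_compact (s : ℝ) : IsCompact (RC s) := by
  have hc := s2_smooth.continuous
  apply IsCompact.inter_left (isCompact_Icc.prod isCompact_Icc)
  have h1 : IsClosed {z : ℝ × ℝ | s ≤ s2 z.1} :=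
    isClosed_le continuous_const (hc.comp continuous_fst)
  have h2 : IsClosed {z : ℝ × ℝ | s ≤ s2 z.2} :=
    isClosed_le continuous_const (hc.comp continuous_snd)
  exact h1.union h2

omit hΨ in
lemma s2_lat {z : ℝ × ℝ} {s : ℝ} (hs : 0 < s) (h : s ≤ s2 z.1 ∨ s ≤ s2 z.2) : z ∉ HLat := by
  rintro ⟨⟨k, hk⟩, j, hj⟩
  have h0 : s2 0 = 0 := by simp [s2]
  have e1 : s2 z.1 = 0 := by rw [hk, ← zero_add ((k:ℝ)/2), s2_int, h0]
  have e2 : s2 z.2 = 0 := by rw [hj, ← zero_add ((j:ℝ)/2), s2_int, h0]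
  rcases h with h | h <;> linarith

omit hΨ in
lemma s2_one (y : ℝ) (k : ℤ) : s2 (y + k) = s2 y := by
  have := s2_int y (2 * k)
  push_cast at this
  rwa [show 2 * (k:ℝ) / 2 = k by ring] at this

lemma KK_rep {s : ℝ} {z : ℝ × ℝ} (h : s ≤ s2 z.1 ∨ s ≤ s2 z.2) :
    ∃ z' ∈ RC s, Ψ z = Ψ z' := by
  refine ⟨(z.1 + ((-⌊z.1⌋ : ℤ) : ℝ), z.2 + ((-⌊z.2⌋ : ℤ) : ℝ)), ⟨?_, ?_⟩, ?_⟩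
  · simp only [Set.mem_ofPred_eq, s2_one]; exact h
  · have a1 := Int.floor_le z.1
    have a2 := Int.lt_floor_add_one z.1
    have b1 := Int.floor_le z.2
    have b2 := Int.lt_floor_add_one z.2
    simp only [mem_prod, mem_Icc]
    push_cast
    refine ⟨⟨?_, ?_⟩, ?_, ?_⟩ <;> linarith
  · exact (hΨ.per.int _ _ z.1 z.2).symm

lemma RC_image {s : ℝ} (hs : 0 < s) : IsCompact (Ψ '' RC s) := by
  apply (RC_compact s).image_of_continuousOn
  intro z hz
  exact (hΨ.sm z (s2_lat hs hz.1)).continuousAt.continuousWithinAt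

lemma KK_closed {s : ℝ} (hs : 0 < s) : IsClosed (KK Ψ s) := by
  have h1 : IsClosed (proj '' (Ψ '' RC s)) := ((RC_image hΨ hs).image proj_cont).isClosed
  have : KK Ψ s = proj ⁻¹' (proj '' (Ψ '' RC s)) := by
    ext w
    constructor
    · rintro ⟨z, hz, m, n, rfl⟩
      obtain ⟨z', hz', e⟩ := KK_rep hΨ hz
      exact ⟨Ψ z', ⟨z', hz', rfl⟩, by rw [← e]; exact proj_eq_iff.2 ⟨m, n, rfl⟩⟩
    · rintro ⟨_, ⟨z, hz, rfl⟩, e⟩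
      obtain ⟨m, n, e⟩ := proj_eq_iff.1 e
      exact ⟨z, hz.1, m, n, e⟩
  rw [this]
  exact h1.preimage proj_cont

omit hΨ in
lemma KK_sub {s : ℝ} (hs : 0 < s) : KK Ψ s ⊆ VV Ψ :=
  fun _ ⟨z, hz, h⟩ => ⟨z, s2_lat hs hz, h⟩

lemma FF_fw_id {φ} (hφ : Phi0 φ) {s : ℝ} (hs : Flat s φ) {w : ℝ × ℝ} (hw : w ∉ KK Ψ s) :
    FF Ψ (fw φ) w = w := by
  by_cases h : w ∈ VV Ψ
  · obtain ⟨z, hz, a, b, rfl⟩ := h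
    rw [FF_eq hΨ (adm_fw hφ) hz]
    have : ¬ (s ≤ s2 z.1 ∨ s ≤ s2 z.2) := fun h => hw ⟨z, h, a, b, rfl⟩
    push Not at this
    obtain ⟨m, n, e⟩ := fw_flat hφ hs this.1.le this.2.le
    rw [e, hΨ.per.int]
  · exact FF_off h

lemma FF_bw_id {φ} (hφ : Phi0 φ) {s : ℝ} (hs : Flat s φ) {w : ℝ × ℝ} (hw : w ∉ KK Ψ s) :
    FF Ψ (bw φ) w = w := by
  conv_lhs => rw [← FF_fw_id hΨ hφ hs hw]
  exact FF_inv hΨ (adm_bw hφ) (adm_fw hφ) (bw_fw φ) w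

lemma FF_smooth {fam : ℝ → ℝ × ℝ → ℝ × ℝ} (hs : ContDiff ℝ (⊤ : ℕ∞) (fun p : ℝ × (ℝ × ℝ) => fam p.1 p.2))
    (ha : ∀ ε, Adm (fam ε)) {s : ℝ} (hs0 : 0 < s) (hid : ∀ ε, ∀ w ∉ KK Ψ s, FF Ψ (fam ε) w = w) :
    ContDiff ℝ (⊤ : ℕ∞) (fun p : ℝ × (ℝ × ℝ) => FF Ψ (fam p.1) p.2) := by
  rw [contDiff_iff_contDiffAt]
  rintro ⟨ε, w⟩
  by_cases h : w ∈ VV Ψ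
  · obtain ⟨z, hz, m, n, rfl⟩ := h
    obtain ⟨G, hG, hGs, hGe⟩ := hΨ.LI z hz
    set τ : ℝ × (ℝ × ℝ) → ℝ × ℝ := fun p => (p.2.1 - m, p.2.2 - n) with hτ
    have hτs : ContDiff ℝ (⊤ : ℕ∞) τ := by rw [hτ]; fun_prop
    have hτ0 : τ (ε, (Ψ z).1 + m, (Ψ z).2 + n) = Ψ z := by simp [hτ]
    have hev : ∀ᶠ p in 𝓝 (ε, ((Ψ z).1 + (m:ℝ), (Ψ z).2 + (n:ℝ))), FF Ψ (fam p.1) p.2 =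
        Ψ (fam p.1 (G (τ p))) + ((m:ℝ), (n:ℝ)) := by
      have := hτs.continuous.tendsto (ε, (Ψ z).1 + (m:ℝ), (Ψ z).2 + (n:ℝ))
      rw [hτ0] at this
      filter_upwards [this.eventually hGe] with p hp
      have e : p.2 = ((Ψ (G (τ p))).1 + m, (Ψ (G (τ p))).2 + n) := by
        rw [hp.2, hτ]; simp
      conv_lhs => rw [e]
      rw [FF_eq hΨ (ha _) hp.1]; rfl
    refine ContDiffAt.congr_of_eventuallyEq ?_ hev
    refine ContDiffAt.add ?_ contDiffAt_const
    have h1 : ContDiffAt ℝ (⊤ : ℕ∞) (fun p => G (τ p)) (ε, ((Ψ z).1 + (m:ℝ), (Ψ z).2 + (n:ℝ))) := by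
      apply ContDiffAt.comp (g := G) _ (by rw [hτ0]; exact hGs) hτs.contDiffAt
    have h2 : ContDiffAt ℝ (⊤ : ℕ∞) (fun p : ℝ × (ℝ × ℝ) => fam p.1 (G (τ p)))
        (ε, ((Ψ z).1 + (m:ℝ), (Ψ z).2 + (n:ℝ))) :=
      ContDiffAt.comp (g := fun p : ℝ × (ℝ × ℝ) => fam p.1 p.2)
        (f := fun p : ℝ × (ℝ × ℝ) => (p.1, G (τ p))) _ hs.contDiffAt (contDiffAt_fst.prodMk h1)
    apply ContDiffAt.comp (g := Ψ) _ ?_ h2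
    simp only [hτ0, hG]
    exact hΨ.sm _ ((ha ε).lat z hz)
  · have hK : w ∉ KK Ψ s := fun h' => h (KK_sub hs0 h')
    have hev : ∀ᶠ p in 𝓝 (ε, w), FF Ψ (fam p.1) p.2 = p.2 := by
      have : ∀ᶠ p in 𝓝 (ε, w), p.2 ∈ (KK Ψ s)ᶜ :=
        continuous_snd.continuousAt.eventually ((KK_closed hΨ hs0).isOpen_compl.mem_nhds hK)
      filter_upwards [this] with p hp using hid _ _ hp
    exact contDiffAt_snd.congr_of_eventuallyEq hev

end

lemma gmfam_smooth {φ : ℝ → ℝ → ℝ} (h : ContDiff ℝ (⊤ : ℕ∞) (fun p : ℝ × ℝ => φ p.1 p.2)) (e : ℝ) (k : ℕ) :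
    ContDiff ℝ (⊤ : ℕ∞) (fun p : ℝ × (ℝ × ℝ) => (gm (φ p.1) e)^[k] p.2) := by
  induction k with
  | zero => simpa using contDiff_snd
  | succ k ih =>
    simp only [iterate_succ_apply', gm]
    refine ih.snd.prodMk (ih.fst.add (contDiff_const.mul ?_))
    exact h.comp (contDiff_fst.prodMk ih.snd)

lemma fwfam_smooth {φ : ℝ → ℝ → ℝ} (h : ContDiff ℝ (⊤ : ℕ∞) (fun p : ℝ × ℝ => φ p.1 p.2)) :
    ContDiff ℝ (⊤ : ℕ∞) (fun p : ℝ × (ℝ × ℝ) => fw (φ p.1) p.2) := gmfam_smooth h 1 6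

lemma bwfam_smooth {φ : ℝ → ℝ → ℝ} (h : ContDiff ℝ (⊤ : ℕ∞) (fun p : ℝ × ℝ => φ p.1 p.2)) :
    ContDiff ℝ (⊤ : ℕ∞) (fun p : ℝ × (ℝ × ℝ) => bw (φ p.1) p.2) := by
  have h1 := (gmfam_smooth h (-1) 6).comp
    (f := fun p : ℝ × (ℝ × ℝ) => (p.1, p.2.2, p.2.1)) (by fun_prop)
  have h2 := h1.snd.prodMk h1.fst
  exact h2

/-! ### small perturbations are close in `C^n` -/
lemma fam_close {D : ℝ × (ℝ × ℝ) → ℝ × ℝ} (hD : ContDiff ℝ (⊤ : ℕ∞) D) (h0 : ∀ w, D (0, w) = 0)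
    (hper : ∀ ε, Per (fun w => D (ε, w))) (n : ℕ) {δ : ℝ} (hδ : 0 < δ) :
    ∃ ε0 > 0, ∀ ε, 0 ≤ ε → ε ≤ ε0 → ∀ j ≤ n, ∀ w,
      ‖iteratedFDeriv ℝ j (fun w => D (ε, w)) w‖ ≤ δ := by
  have key : ∀ j, Continuous (fun p : ℝ × (ℝ × ℝ) => iteratedFDeriv ℝ j (fun w => D (p.1, w)) p.2) := by
    intro j
    set L := ContinuousLinearMap.inr ℝ ℝ (ℝ × ℝ)
    have : (fun p : ℝ × (ℝ × ℝ) => iteratedFDeriv ℝ j (fun w => D (p.1, w)) p.2) =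
        fun p => (iteratedFDeriv ℝ j D p).compContinuousLinearMap (fun _ => L) := by
      funext p
      have e : (fun w => D (p.1, w)) = (fun q => D (q + (p.1, (0 : ℝ × ℝ)))) ∘ L := by
        funext w; simp [L]
      rw [e, ContinuousLinearMap.iteratedFDeriv_comp_right L (n := (⊤ : ℕ∞)) _ _ (by exact_mod_cast le_top)]
      · rw [iteratedFDeriv_comp_add_right]
        congr 2
        simp [L]
      · exact hD.comp (contDiff_id.add contDiff_const)
    rw [this]
    have hc := hD.continuous_iteratedFDeriv (m := j) (by exact_mod_cast le_top)
    exact (ContinuousMultilinearMap.compContinuousLinearMapL (F := ℝ × ℝ) (fun _ : Fin j => L)).continuous.comp hc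
  have hz : ∀ j w, iteratedFDeriv ℝ j (fun w => D (0, w)) w = 0 := by
    intro j w
    simp only [h0]
    rw [iteratedFDeriv_fun_zero]
    rfl
  have tube : ∀ j, ∀ᶠ ε in 𝓝 (0:ℝ), ∀ w ∈ (Icc 0 1 ×ˢ Icc 0 1 : Set (ℝ × ℝ)),
      ‖iteratedFDeriv ℝ j (fun w => D (ε, w)) w‖ < δ := by
    intro j
    have hK : IsCompact (Icc 0 1 ×ˢ Icc 0 1 : Set (ℝ × ℝ)) := isCompact_Icc.prod isCompact_Icc
    apply hK.eventually_forall_of_forall_eventually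
    intro w _
    have := (key j).norm.continuousAt (x := ((0:ℝ), w))
    apply this.eventually_lt continuousAt_const
    simp only [hz]
    simpa using hδ
  have all : ∀ᶠ ε in 𝓝 (0:ℝ), ∀ j ∈ Iic n, ∀ w ∈ (Icc 0 1 ×ˢ Icc 0 1 : Set (ℝ × ℝ)),
      ‖iteratedFDeriv ℝ j (fun w => D (ε, w)) w‖ < δ :=
    (Filter.eventually_all_finite (finite_Iic n)).2 (fun j _ => tube j)
  obtain ⟨r, hr, hball⟩ := Metric.eventually_nhds_iff.1 all
  refine ⟨r/2, by positivity, fun ε h1 h2 j hj w => ?_⟩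
  have hb := hball (y := ε) (by rw [Real.dist_eq, sub_zero, abs_of_nonneg h1]; linarith) j hj
  have hshift : ∀ m n : ℤ, iteratedFDeriv ℝ j (fun w => D (ε, w)) (w + ((m:ℝ), (n:ℝ))) =
      iteratedFDeriv ℝ j (fun w => D (ε, w)) w := by
    intro m n
    rw [← iteratedFDeriv_comp_add_right]
    congr 1
    funext v
    exact (hper ε).int m n v.1 v.2
  rw [← hshift (-⌊w.1⌋) (-⌊w.2⌋)]
  refine (hb _ ?_).le
  have a1 := Int.floor_le w.1
  have a2 := Int.lt_floor_add_one w.1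
  have b1 := Int.floor_le w.2
  have b2 := Int.lt_floor_add_one w.2
  simp only [mem_prod, mem_Icc, Prod.fst_add, Prod.snd_add]
  push_cast
  refine ⟨⟨?_, ?_⟩, ?_, ?_⟩ <;> linarith

lemma lim_smooth {H : ℕ → ℝ × ℝ → ℝ × ℝ} {h : ℝ × ℝ → ℝ × ℝ} (hs : ∀ n, ContDiff ℝ (⊤ : ℕ∞) (H n))
    (hb : ∀ n, ∀ j ≤ n, ∀ w, ‖iteratedFDeriv ℝ j (fun w => H (n+1) w - H n w) w‖ ≤ (1/2)^n)
    (hl : ∀ w, Tendsto (fun n => H n w) atTop (𝓝 (h w))) :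
    ContDiff ℝ (⊤ : ℕ∞) h ∧ ∀ n w, ‖h w - H n w‖ ≤ 2 * (1/2)^n := by
  have hb0 : ∀ n w, ‖H (n+1) w - H n w‖ ≤ (1/2)^n := fun n w => by
    have := hb n 0 (Nat.zero_le _) w
    rwa [norm_iteratedFDeriv_zero] at this
  have sumN : ∀ N : ℕ, HasSum (fun i : ℕ => ((1:ℝ)/2)^(i + N)) (2 * (1/2)^N) := by
    intro N
    have := hasSum_geometric_two.mul_right (((1:ℝ)/2)^N)
    simpa only [pow_add] using this
  have hsum : ∀ N w, HasSum (fun i => H (i + N + 1) w - H (i + N) w) (h w - H N w) := by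
    intro N w
    have hsm : Summable (fun i => H (i + N + 1) w - H (i + N) w) :=
      Summable.of_norm_bounded (sumN N).summable (fun i => hb0 _ w)
    rw [hsm.hasSum_iff_tendsto_nat]
    have e : ∀ n, ∑ i ∈ Finset.range n, (H (i + N + 1) w - H (i + N) w) = H (n + N) w - H N w := by
      intro n
      have := Finset.sum_range_sub (fun i => H (i + N) w) n
      simp only [zero_add] at this
      rw [← this]
      refine Finset.sum_congr rfl fun i _ => ?_
      rw [add_right_comm]
    simp only [e]
    exact ((tendsto_add_atTop_iff_nat N).2 (hl w)).sub_const _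
  constructor
  · rw [contDiff_infty]
    intro N
    have e : h = fun w => H N w + ∑' i, (H (i + N + 1) w - H (i + N) w) := by
      funext w
      rw [(hsum N w).tsum_eq]; simp
    rw [e]
    refine ((hs N).of_le (by exact_mod_cast le_top)).add ?_
    apply contDiff_tsum (v := fun _ i => ((1:ℝ)/2)^(i + N))
    · intro i
      exact ((hs _).sub (hs _)).of_le (by exact_mod_cast le_top)
    · intro k _
      exact (sumN N).summable
    · intro k i w hk
      exact hb (i + N) k (by have : k ≤ N := by exact_mod_cast hk
                             omega) w
  · intro n w
    rw [← (hsum n w).tsum_eq]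
    exact tsum_of_norm_bounded (sumN n) (fun i => hb0 _ w)

end

/-! ## Part 21 -/
open Filter Topology Set Function MeasureTheory
noncomputable section
set_option linter.unusedSectionVars false

/-- one perturbation of a profile -/
def pert (φ : ℝ → ℝ) (n : ℕ) (ε : ℝ) (y : ℝ) : ℝ := φ y + ε * (BB (n+1) y - BB 0 y)

lemma pert_phi0 {φ} (hφ : Phi0 φ) (n : ℕ) (ε : ℝ) : Phi0 (pert φ n ε) :=
  hφ.add (BB_phi0 _) (BB_phi0 _) ε

lemma pert_flat {φ} {n : ℕ} (h : Flat (sK n) φ) (ε : ℝ) : Flat (sK (n+1)) (pert φ n ε) :=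
  (h.mono (sK_anti (Nat.le_succ n))).add (BB_flat _) ((BB_flat 0).mono (sK_anti (Nat.zero_le _))) ε

lemma pert_zero (φ : ℝ → ℝ) (n : ℕ) : pert φ n 0 = φ := by funext y; simp [pert]

lemma pert_smooth {φ} (hφ : Phi0 φ) (n : ℕ) :
    ContDiff ℝ (⊤ : ℕ∞) (fun p : ℝ × ℝ => pert φ n p.1 p.2) := by
  unfold pert
  refine (hφ.smooth.comp contDiff_snd).add (contDiff_fst.mul ?_)
  exact ((BB_phi0 _).smooth.comp contDiff_snd).sub ((BB_phi0 _).smooth.comp contDiff_snd)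

/-- closeness in `C^n` -/
def CC (n : ℕ) (f g : ℝ × ℝ → ℝ × ℝ) : Prop :=
  ∀ j ≤ n, ∀ w, ‖iteratedFDeriv ℝ j (fun w => f w - g w) w‖ ≤ (1/2)^n

lemma eqv_sub_per {f g} (hf : Eqv f) (hg : Eqv g) : Per (fun w => f w - g w) := by
  constructor
  · intro x y
    have h1 := hf (x, y) 1 0
    have h2 := hg (x, y) 1 0
    simp only [Int.cast_one, Int.cast_zero, add_zero] at h1 h2
    rw [h1, h2]; ext <;> simp
  · intro x y
    have h1 := hf (x, y) 0 1
    have h2 := hg (x, y) 0 1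
    simp only [Int.cast_one, Int.cast_zero, add_zero] at h1 h2
    rw [h1, h2]; ext <;> simp

/-- profile as a map of the plane -/
def emb (φ : ℝ → ℝ) (w : ℝ × ℝ) : ℝ × ℝ := (0, φ w.2)

section
variable {Ψ : ℝ × ℝ → ℝ × ℝ} (hΨ : PsiD Ψ)
include hΨ

lemma FF_close {fam : ℝ → ℝ × ℝ → ℝ × ℝ} (hs : ContDiff ℝ (⊤ : ℕ∞) (fun p : ℝ × (ℝ × ℝ) => fam p.1 p.2))
    (ha : ∀ ε, Adm (fam ε)) {s : ℝ} (hs0 : 0 < s) (hid : ∀ ε, ∀ w ∉ KK Ψ s, FF Ψ (fam ε) w = w) (n : ℕ) :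
    ∃ ε0 > 0, ∀ ε, 0 ≤ ε → ε ≤ ε0 → CC n (FF Ψ (fam ε)) (FF Ψ (fam 0)) := by
  have h := FF_smooth hΨ hs ha hs0 hid
  have h2 : ContDiff ℝ (⊤ : ℕ∞) (fun p : ℝ × (ℝ × ℝ) => FF Ψ (fam p.1) p.2 - FF Ψ (fam 0) p.2) :=
    h.sub (h.comp (f := fun p : ℝ × (ℝ × ℝ) => ((0:ℝ), p.2)) (contDiff_const.prodMk contDiff_snd))
  exact fam_close h2 (fun w => sub_self _)
    (fun ε => eqv_sub_per (FF_eqv hΨ (ha ε)) (FF_eqv hΨ (ha 0))) n (by positivity)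

lemma step_ex (n : ℕ) (φ : ℝ → ℝ) : ∃ ε, 0 < ε ∧ ε ≤ (1/2)^(n+2) ∧ (Phi0 φ ∧ Flat (sK n) φ →
    CC n (FF Ψ (fw (pert φ n ε))) (FF Ψ (fw φ)) ∧ CC n (FF Ψ (bw (pert φ n ε))) (FF Ψ (bw φ)) ∧
    CC n (emb (pert φ n ε)) (emb φ)) := by
  by_cases h : Phi0 φ ∧ Flat (sK n) φ
  swap
  · exact ⟨(1/2)^(n+2), by positivity, le_rfl, fun h' => absurd h' h⟩
  obtain ⟨h1, h2⟩ := h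
  have hsm := pert_smooth h1 n
  obtain ⟨a, ha, A⟩ := FF_close hΨ (fwfam_smooth hsm) (fun ε => adm_fw (pert_phi0 h1 n ε)) (sK_pos (n+1))
    (fun ε w hw => FF_fw_id hΨ (pert_phi0 h1 n ε) (pert_flat h2 ε) hw) n
  obtain ⟨b, hb, B⟩ := FF_close hΨ (bwfam_smooth hsm) (fun ε => adm_bw (pert_phi0 h1 n ε)) (sK_pos (n+1))
    (fun ε w hw => FF_bw_id hΨ (pert_phi0 h1 n ε) (pert_flat h2 ε) hw) n
  have hd : ContDiff ℝ (⊤ : ℕ∞) (fun p : ℝ × (ℝ × ℝ) => emb (pert φ n p.1) p.2 - emb φ p.2) := by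
    unfold emb
    refine (contDiff_const.prodMk ?_).sub (contDiff_const.prodMk ?_)
    · exact hsm.comp (f := fun p : ℝ × (ℝ × ℝ) => (p.1, p.2.2)) (by fun_prop)
    · exact h1.smooth.comp (f := fun p : ℝ × (ℝ × ℝ) => p.2.2) (by fun_prop)
  obtain ⟨c, hc, C⟩ := fam_close (D := fun p : ℝ × (ℝ × ℝ) => emb (pert φ n p.1) p.2 - emb φ p.2)
    hd (fun w => by simp [pert_zero]) (fun ε => by
      have q1 := (pert_phi0 h1 n ε).one
      have q2 := h1.one
      constructor
      · intro x y; rfl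
      · intro x y
        have q1 := q1 y 1
        have q2 := q2 y 1
        simp only [Int.cast_one] at q1 q2
        simp [emb, q1, q2]) n (δ := (1/2)^n) (by positivity)
  refine ⟨min (min a b) (min c ((1/2)^(n+2))), by positivity, (min_le_right _ _).trans (min_le_right _ _),
    fun _ => ⟨?_, ?_, ?_⟩⟩
  · have := A _ (by positivity) ((min_le_left (min a b) (min c ((1/2)^(n+2)))).trans (min_le_left _ _))
    rwa [pert_zero] at this
  · have := B _ (by positivity) ((min_le_left (min a b) (min c ((1/2)^(n+2)))).trans (min_le_right _ _))
    rwa [pert_zero] at this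
  · exact C _ (by positivity) ((min_le_right (min a b) (min c ((1/2)^(n+2)))).trans (min_le_left _ _))

/-- the sequence of profiles -/
lemma seq_ex : ∃ (ph : ℕ → ℝ → ℝ) (ε : ℕ → ℝ), ph 0 = BB 0 ∧ ∀ n, 0 < ε n ∧ ε n ≤ (1/2)^(n+2) ∧
    ph (n+1) = pert (ph n) n (ε n) ∧ Phi0 (ph n) ∧ Flat (sK n) (ph n) ∧
    CC n (FF Ψ (fw (ph (n+1)))) (FF Ψ (fw (ph n))) ∧ CC n (FF Ψ (bw (ph (n+1)))) (FF Ψ (bw (ph n))) ∧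
    CC n (emb (ph (n+1))) (emb (ph n)) := by
  choose e he1 he2 he3 using step_ex hΨ
  let ph : ℕ → ℝ → ℝ := fun n => Nat.rec (BB 0) (fun n φ => pert φ n (e n φ)) n
  have h0 : ph 0 = BB 0 := rfl
  have h1 : ∀ n, ph (n+1) = pert (ph n) n (e n (ph n)) := fun n => rfl
  have h2 : ∀ n, Phi0 (ph n) ∧ Flat (sK n) (ph n) := by
    intro n
    induction n with
    | zero => exact ⟨BB_phi0 0, BB_flat 0⟩
    | succ n ih => rw [h1]; exact ⟨pert_phi0 ih.1 _ _, pert_flat ih.2 _⟩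
  refine ⟨ph, fun n => e n (ph n), h0, fun n => ⟨he1 _ _, he2 _ _, h1 n, (h2 n).1, (h2 n).2, ?_⟩⟩
  rw [h1]
  exact he3 n (ph n) (h2 n)

end

lemma mono_lim {f : ℕ → ℝ → ℝ} {g : ℝ → ℝ} (N : ℕ) (hm : ∀ n ≥ N, Monotone (f n))
    (hl : ∀ y, Tendsto (fun n => f n y) atTop (𝓝 (g y))) : Monotone g := by
  intro x y hxy
  apply le_of_tendsto_of_tendsto (hl x) (hl y)
  filter_upwards [eventually_ge_atTop N] with n hn using hm n hn hxy

lemma phi_lim {ph : ℕ → ℝ → ℝ} {ε : ℕ → ℝ} {φ : ℝ → ℝ} (h0 : ph 0 = BB 0)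
    (hε : ∀ n, 0 < ε n ∧ ε n ≤ (1/2)^(n+2)) (h1 : ∀ n, ph (n+1) = pert (ph n) n (ε n))
    (h2 : ∀ n, Phi0 (ph n)) (hs : ContDiff ℝ (⊤ : ℕ∞) φ)
    (hl : ∀ y, Tendsto (fun n => ph n y) atTop (𝓝 (φ y))) : PhiD φ := by
  have hA : ∀ n, Monotone (fun y => ph n y - (1/2 + (1/2)^(n+1)) * BB 0 y) := by
    intro n
    induction n with
    | zero =>
      intro x y _; simp only [h0]; apply le_of_eq; ring
    | succ n ih =>
      have e : (fun y => ph (n+1) y - (1/2 + (1/2)^(n+1+1)) * BB 0 y) = fun y =>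
        (ph n y - (1/2 + (1/2)^(n+1)) * BB 0 y) + (ε n * BB (n+1) y + ((1/2)^(n+2) - ε n) * BB 0 y) := by
        funext y; rw [h1]; unfold pert; ring
      rw [e]
      refine ih.add (Monotone.add ?_ ?_)
      · exact (BB_mono _).const_mul (hε n).1.le
      · exact (BB_mono _).const_mul (sub_nonneg.2 (hε n).2)
  have hB : ∀ k n, Monotone (fun y => ph (n+k+1) y - (1/2 + (1/2)^(n+k+1+1)) * BB 0 y - ε k * BB (k+1) y) := by
    intro k n
    induction n with
    | zero =>
      have e : (fun y => ph (0+k+1) y - (1/2 + (1/2)^(0+k+1+1)) * BB 0 y - ε k * BB (k+1) y) = fun y =>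
        (ph k y - (1/2 + (1/2)^(k+1)) * BB 0 y) + ((1/2)^(k+2) - ε k) * BB 0 y := by
        funext y; rw [zero_add, h1]; unfold pert; ring
      rw [e]
      exact (hA k).add ((BB_mono _).const_mul (sub_nonneg.2 (hε k).2))
    | succ n ih =>
      have e : (fun y => ph (n+1+k+1) y - (1/2 + (1/2)^(n+1+k+1+1)) * BB 0 y - ε k * BB (k+1) y) = fun y =>
        (ph (n+k+1) y - (1/2 + (1/2)^(n+k+1+1)) * BB 0 y - ε k * BB (k+1) y) +
          (ε (n+k+1) * BB (n+k+1+1) y + ((1/2)^(n+k+1+2) - ε (n+k+1)) * BB 0 y) := by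
        funext y; rw [show n+1+k+1 = n+k+1+1 by ring, h1]; unfold pert; ring
      rw [e]
      refine ih.add (Monotone.add ?_ ?_)
      · exact (BB_mono _).const_mul (hε _).1.le
      · exact (BB_mono _).const_mul (sub_nonneg.2 (hε _).2)
  have hM : ∀ k, Monotone (fun y => φ y - ε k * BB (k+1) y) := by
    intro k
    apply mono_lim (f := fun n y => ph (n+k+1) y - ε k * BB (k+1) y) 0
    · intro n _
      have := (hB k n).add ((BB_mono 0).const_mul (a := 1/2 + (1/2)^(n+k+1+1)) (by positivity))
      intro x y hxy
      have := this hxy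
      simp only at this ⊢
      linarith
    · intro y
      have := (tendsto_add_atTop_iff_nat (k+1)).2 (hl y)
      exact this.sub_const _
  have hd : ∀ k y, ε k * deriv (BB (k+1)) y ≤ deriv φ y := by
    intro k y
    have h1 : DifferentiableAt ℝ φ y := hs.differentiable (by simp) y
    have h2 := (BB_deriv (k+1) y).differentiableAt
    have h3 := (hM k).deriv_nonneg (x := y)
    have h4 : HasDerivAt (fun y => φ y - ε k * BB (k+1) y) (deriv φ y - ε k * deriv (BB (k+1)) y) y :=
      h1.hasDerivAt.sub (h2.hasDerivAt.const_mul _)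
    rw [h4.deriv] at h3
    linarith
  have hBn : ∀ k y, 0 ≤ deriv (BB k) y := fun k y => (BB_mono k).deriv_nonneg
  refine ⟨hs, ?_, ?_, ?_, ?_⟩
  · intro y
    refine tendsto_nhds_unique (hl (y + 1/2)) ?_
    simp only [(h2 _).half]
    exact (hl y).add_const _
  · intro y
    refine tendsto_nhds_unique (hl (-y)) ?_
    simp only [(h2 _).odd]
    exact (hl y).neg
  · intro y
    exact (mul_nonneg (hε 0).1.le (hBn 1 y)).trans (hd 0 y)
  · intro y hy
    have hk : ∀ k, s2 y ≤ sK (k+1) := by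
      intro k
      apply BB_deriv_zero
      have h3 := hd k y
      rw [hy] at h3
      have h4 := hBn (k+1) y
      have h5 := (hε k).1
      by_contra hne
      have : 0 < deriv (BB (k+1)) y := lt_of_le_of_ne h4 (Ne.symm hne)
      have := mul_pos h5 this
      linarith
    have hlim : Tendsto (fun k : ℕ => sK (k+1)) atTop (𝓝 0) := by
      have h3 : Tendsto (fun k : ℕ => (1:ℝ) / ((k:ℝ) + 1)) atTop (𝓝 0) := tendsto_one_div_add_atTop_nhds_zero_nat
      have h4 := (tendsto_add_atTop_iff_nat 2).2 h3
      refine h4.congr fun k => ?_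
      unfold sK; push_cast; congr 1; ring
    have h5 : s2 y ≤ 0 := ge_of_tendsto' hlim hk
    have h6 : Real.sin (2 * Real.pi * y) = 0 := by
      have : 0 ≤ Real.sin (2 * Real.pi * y) ^ 2 := sq_nonneg _
      unfold s2 at h5
      exact pow_eq_zero_iff (two_ne_zero) |>.1 (le_antisymm h5 this)
    exact (sin_zero_iff y).1 h6

lemma PhiD.phi0 {φ} (h : PhiD φ) : Phi0 φ := ⟨h.smooth, h.half, h.odd⟩

lemma gm_lim {ph : ℕ → ℝ → ℝ} {φ : ℝ → ℝ} (hc : Continuous φ) (hu : ∀ n y, |φ y - ph n y| ≤ 2 * (1/2)^n)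
    (e : ℝ) (k : ℕ) (z : ℝ × ℝ) :
    Tendsto (fun n => (gm (ph n) e)^[k] z) atTop (𝓝 ((gm φ e)^[k] z)) := by
  induction k with
  | zero => exact tendsto_const_nhds
  | succ k ih =>
    simp only [iterate_succ_apply']
    set a : ℕ → ℝ × ℝ := fun n => (gm (ph n) e)^[k] z
    set b := (gm φ e)^[k] z
    have h1 : Tendsto (fun n => (a n).1) atTop (𝓝 b.1) := (continuous_fst.tendsto b).comp ih
    have h2 : Tendsto (fun n => (a n).2) atTop (𝓝 b.2) := (continuous_snd.tendsto b).comp ih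
    have h3 : Tendsto (fun n => φ (a n).2) atTop (𝓝 (φ b.2)) := (hc.tendsto b.2).comp h2
    have h4 : Tendsto (fun n => φ (a n).2 - ph n (a n).2) atTop (𝓝 0) := by
      have : Tendsto (fun n : ℕ => 2 * ((1:ℝ)/2)^n) atTop (𝓝 0) := by
        have := (tendsto_pow_atTop_nhds_zero_of_lt_one (by norm_num : (0:ℝ) ≤ 1/2) (by norm_num)).const_mul 2
        simpa using this
      exact squeeze_zero_norm (fun n => hu n _) this
    have h5 : Tendsto (fun n => ph n (a n).2) atTop (𝓝 (φ b.2)) := by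
      have := h3.sub h4
      simpa using this
    exact h2.prodMk_nhds (h1.add (h5.const_mul e))

section
variable {Ψ : ℝ × ℝ → ℝ × ℝ} (hΨ : PsiD Ψ)
include hΨ

lemma FF_lim {f : ℕ → ℝ × ℝ → ℝ × ℝ} {g} (hf : ∀ n, Adm (f n)) (hg : Adm g)
    (hl : ∀ z, Tendsto (fun n => f n z) atTop (𝓝 (g z))) (w : ℝ × ℝ) :
    Tendsto (fun n => FF Ψ (f n) w) atTop (𝓝 (FF Ψ g w)) := by
  by_cases hw : w ∈ VV Ψ
  · obtain ⟨z, hz, m, n, rfl⟩ := hw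
    rw [FF_eq hΨ hg hz]
    simp only [FF_eq hΨ (hf _) hz]
    have h1 : Tendsto (fun n => Ψ (f n z)) atTop (𝓝 (Ψ (g z))) :=
      (hΨ.sm _ (hg.lat z hz)).continuousAt.tendsto.comp (hl z)
    have h2 : Tendsto (fun n => (Ψ (f n z)).1) atTop (𝓝 (Ψ (g z)).1) := (continuous_fst.tendsto _).comp h1
    have h3 : Tendsto (fun n => (Ψ (f n z)).2) atTop (𝓝 (Ψ (g z)).2) := (continuous_snd.tendsto _).comp h1
    exact (h2.add_const _).prodMk_nhds (h3.add_const _)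
  · rw [FF_off hw]
    simp only [FF_off hw]
    exact tendsto_const_nhds

lemma FF_iter {f} (hf : Adm f) {z : ℝ × ℝ} (hz : z ∉ HLat) (m n : ℤ) (N : ℕ) :
    (FF Ψ f)^[N] ((Ψ z).1 + m, (Ψ z).2 + n) = ((Ψ (f^[N] z)).1 + m, (Ψ (f^[N] z)).2 + n) := by
  induction N with
  | zero => rfl
  | succ N ih => rw [iterate_succ_apply', ih, FF_eq hΨ hf ((adm_iter hf N).lat z hz), iterate_succ_apply']

lemma irrot {f} (hf : Adm f) (hc : Continuous (FF Ψ f))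
    (hk : ∀ n : ℕ, ∀ w ∉ KK Ψ (sK n), ‖FF Ψ f w - w‖ ≤ 2 * (1/2)^n) (x : ℝ × ℝ) :
    Tendsto (fun n : ℕ => (n:ℝ)⁻¹ • ((FF Ψ f)^[n] x - x)) atTop (𝓝 0) := by
  by_cases hx : x ∈ VV Ψ
  swap
  · have : ∀ n, (FF Ψ f)^[n] x = x := fun n => iterate_fixed (FF_off hx) n
    simp [this]
  obtain ⟨z, hz, a, b, hxz⟩ := hx
  have hper : Per (fun w => ‖FF Ψ f w - w‖) :=
    (eqv_sub_per (FF_eqv hΨ hf) (g := fun w => w) (fun z m n => rfl)).comp _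
  obtain ⟨M, hM0, hM⟩ := hper.bdd (hc.sub continuous_id).norm
  have hM' : ∀ w, ‖FF Ψ f w - w‖ ≤ M := fun w => by have := hM w; rwa [abs_norm] at this
  have main : ∀ n : ℕ, ∃ A, ∀ N : ℕ, ‖(FF Ψ f)^[N] x - x‖ ≤ A + N * (2 * (1/2)^n) := by
    intro n
    obtain ⟨C, hC⟩ := (RC_image hΨ (sK_pos n)).isBounded.exists_norm_le
    set v : ℝ × ℝ := ((a:ℝ), (b:ℝ)) with hv
    have hC0 : 0 ≤ max C 0 := le_max_right _ _
    have key : ∀ N : ℕ, ‖(FF Ψ f)^[N] x - v‖ ≤ max C 0 + M + ‖x - v‖ + N * (2 * (1/2)^n) := by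
      intro N
      induction N with
      | zero => simp; positivity
      | succ N ih =>
        rw [iterate_succ_apply']
        set y := (FF Ψ f)^[N] x with hy
        have tri : ‖FF Ψ f y - v‖ ≤ ‖FF Ψ f y - y‖ + ‖y - v‖ := by
          rw [show FF Ψ f y - v = (FF Ψ f y - y) + (y - v) by abel]; exact norm_add_le _ _
        by_cases hyK : y ∈ KK Ψ (sK n)
        · obtain ⟨z', hz', m', n', e⟩ := hyK
          have hy2 : y = ((Ψ (f^[N] z)).1 + a, (Ψ (f^[N] z)).2 + b) := by
            rw [hy, hxz, FF_iter hΨ hf hz]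
          have e1 := congrArg Prod.fst (e.symm.trans hy2)
          have e2 := congrArg Prod.snd (e.symm.trans hy2)
          simp only at e1 e2
          obtain ⟨q1, q2, -⟩ := hΨ.inj z' (s2_lat (sK_pos n) hz') _ ((adm_iter hf N).lat z hz)
            (a - m') (b - n') (by ext <;> push_cast <;> linarith)
          rw [sub_eq_zero] at q1 q2
          subst q1 q2
          obtain ⟨z'', hz'', e'⟩ := KK_rep hΨ hz'
          have h1 : y - v = Ψ z'' := by
            rw [e, e', hv]; ext <;> simp
          have h2 : ‖y - v‖ ≤ C := by rw [h1]; exact hC _ ⟨z'', hz'', rfl⟩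
          have h3 := hM' y
          have h4 := le_max_left C 0
          have h5 := norm_nonneg (x - v)
          have h6 : 0 ≤ ((N+1:ℕ):ℝ) * (2 * (1/2)^n) := by positivity
          linarith
        · have h3 := hk n y hyK
          push_cast
          linarith
    refine ⟨max C 0 + M + ‖x - v‖ + ‖x - v‖, fun N => ?_⟩
    have h1 := key N
    have h2 : ‖(FF Ψ f)^[N] x - x‖ ≤ ‖(FF Ψ f)^[N] x - v‖ + ‖x - v‖ := by
      rw [show (FF Ψ f)^[N] x - x = ((FF Ψ f)^[N] x - v) - (x - v) by abel]; exact norm_sub_le _ _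
    linarith
  rw [Metric.tendsto_atTop]
  intro ε hε
  obtain ⟨n, hn⟩ := exists_pow_lt_of_lt_one (by positivity : 0 < ε/4) (by norm_num : (1/2:ℝ) < 1)
  obtain ⟨A, hA⟩ := main n
  obtain ⟨N0, hN0⟩ := exists_nat_gt (2 * |A| / ε)
  refine ⟨N0 + 1, fun N hN => ?_⟩
  have hNpos : 0 < (N:ℝ) := by exact_mod_cast (by omega : 0 < N)
  have hNN : (N0:ℝ) ≤ N := by exact_mod_cast (by omega : N0 ≤ N)
  rw [dist_zero_right, norm_smul, norm_inv, Real.norm_of_nonneg hNpos.le]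
  have h1 := hA N
  have h2 : 2 * |A| < ε * N := by
    have := (div_lt_iff₀ hε).1 (hN0.trans_le hNN)
    linarith
  have h3 : A ≤ |A| := le_abs_self A
  rw [inv_mul_lt_iff₀ hNpos]
  have h4 : (N:ℝ) * (2 * (1/2)^n) ≤ N * (ε/2) := by
    apply mul_le_mul_of_nonneg_left _ hNpos.le
    linarith
  linarith

theorem main2 : ∃ φ, PhiD φ ∧ ContDiff ℝ (⊤ : ℕ∞) (FF Ψ (fw φ)) ∧ ContDiff ℝ (⊤ : ℕ∞) (FF Ψ (bw φ)) ∧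
    ∀ x, Tendsto (fun n : ℕ => (n:ℝ)⁻¹ • ((FF Ψ (fw φ))^[n] x - x)) atTop (𝓝 0) := by
  obtain ⟨ph, ε, h0, h⟩ := seq_ex hΨ
  have hP : ∀ n, Phi0 (ph n) := fun n => (h n).2.2.2.1
  have hF : ∀ n, Flat (sK n) (ph n) := fun n => (h n).2.2.2.2.1
  have hlim : ∀ y, ∃ l, Tendsto (fun n => ph n y) atTop (𝓝 l) := by
    intro y
    apply cauchySeq_tendsto_of_complete
    apply cauchySeq_of_le_geometric (1/2) 1 (by norm_num)
    intro n
    have := (h n).2.2.2.2.2.2.2 0 (Nat.zero_le _) (0, y)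
    rw [norm_iteratedFDeriv_zero] at this
    rw [one_mul, dist_comm, dist_eq_norm]
    refine le_trans ?_ this
    simpa [emb] using norm_snd_le (emb (ph (n+1)) (0, y) - emb (ph n) (0, y))
  choose φ hφ using hlim
  have embl := lim_smooth (H := fun n => emb (ph n)) (h := emb φ)
    (fun n => contDiff_const.prodMk ((hP n).smooth.comp contDiff_snd))
    (fun n => (h n).2.2.2.2.2.2.2) (fun w => tendsto_const_nhds.prodMk_nhds (hφ w.2))
  have hs : ContDiff ℝ (⊤ : ℕ∞) φ := by
    have := embl.1.snd.comp (f := fun y : ℝ => ((0:ℝ), y)) (contDiff_const.prodMk contDiff_id)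
    exact this
  have hu : ∀ n y, |φ y - ph n y| ≤ 2 * (1/2)^n := by
    intro n y
    refine le_trans ?_ (embl.2 n (0, y))
    simpa [emb] using norm_snd_le (emb φ (0, y) - emb (ph n) (0, y))
  have hD : PhiD φ := phi_lim h0 (fun n => ⟨(h n).1, (h n).2.1⟩) (fun n => (h n).2.2.1) hP hs hφ
  have sm_fw : ∀ n, ContDiff ℝ (⊤ : ℕ∞) (FF Ψ (fw (ph n))) := by
    intro n
    have := FF_smooth hΨ (fam := fun _ => fw (ph n))
      (fwfam_smooth (φ := fun _ => ph n) ((hP n).smooth.comp contDiff_snd))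
      (fun _ => adm_fw (hP n)) (sK_pos n) (fun _ w hw => FF_fw_id hΨ (hP n) (hF n) hw)
    exact this.comp (f := fun w : ℝ × ℝ => ((0:ℝ), w)) (contDiff_const.prodMk contDiff_id)
  have sm_bw : ∀ n, ContDiff ℝ (⊤ : ℕ∞) (FF Ψ (bw (ph n))) := by
    intro n
    have := FF_smooth hΨ (fam := fun _ => bw (ph n))
      (bwfam_smooth (φ := fun _ => ph n) ((hP n).smooth.comp contDiff_snd))
      (fun _ => adm_bw (hP n)) (sK_pos n) (fun _ w hw => FF_bw_id hΨ (hP n) (hF n) hw)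
    exact this.comp (f := fun w : ℝ × ℝ => ((0:ℝ), w)) (contDiff_const.prodMk contDiff_id)
  have l1 : ∀ z, Tendsto (fun n => fw (ph n) z) atTop (𝓝 (fw φ z)) := fun z => gm_lim hs.continuous hu 1 6 z
  have l2 : ∀ z, Tendsto (fun n => bw (ph n) z) atTop (𝓝 (bw φ z)) := fun z =>
    (continuous_swap.tendsto _).comp (gm_lim hs.continuous hu (-1) 6 z.swap)
  have L1 := lim_smooth sm_fw (fun n => (h n).2.2.2.2.2.1)
    (FF_lim hΨ (fun n => adm_fw (hP n)) (adm_fw hD.phi0) l1)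
  have L2 := lim_smooth sm_bw (fun n => (h n).2.2.2.2.2.2.1)
    (FF_lim hΨ (fun n => adm_bw (hP n)) (adm_bw hD.phi0) l2)
  refine ⟨φ, hD, L1.1, L2.1, irrot hΨ (adm_fw hD.phi0) L1.1.continuous ?_⟩
  intro n w hw
  have := L1.2 n w
  rwa [FF_fw_id hΨ (hP n) (hF n) hw] at this

end

end

/-! ## Part 22 -/
open Filter Topology Set Function MeasureTheory
noncomputable section
set_option linter.unusedSectionVars false

/-! ### tiling of the plane -/
lemma tile_lint {g : ℝ × ℝ → ENNReal} (hg : Measurable g) :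
    ∫⁻ z, g z = ∫⁻ z, ∑' v : ℤ × ℤ, g (z.1 + v.1, z.2 + v.2) ∂muQ := by
  set S : ℤ × ℤ → Set (ℝ × ℝ) := fun v => Ioc (v.1:ℝ) (v.1 + 1) ×ˢ Ioc (v.2:ℝ) (v.2 + 1) with hS
  have hm : ∀ v, MeasurableSet (S v) := fun v => measurableSet_Ioc.prod measurableSet_Ioc
  have hu : ⋃ v, S v = univ := by
    rw [eq_univ_iff_forall]
    intro z
    rw [mem_iUnion]
    refine ⟨(⌈z.1⌉ - 1, ⌈z.2⌉ - 1), ?_⟩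
    have a1 := Int.le_ceil z.1
    have a2 := Int.ceil_lt_add_one z.1
    have b1 := Int.le_ceil z.2
    have b2 := Int.ceil_lt_add_one z.2
    simp only [hS, mem_prod, mem_Ioc]
    push_cast
    refine ⟨⟨?_, ?_⟩, ?_, ?_⟩ <;> linarith
  have aux : ∀ (x : ℝ) (m n : ℤ), x ∈ Ioc (m:ℝ) (m + 1) → x ∈ Ioc (n:ℝ) (n + 1) → m = n := by
    intro x m n h1 h2
    have e1 : (m:ℝ) < n + 1 := h1.1.trans_le h2.2
    have e2 : (n:ℝ) < m + 1 := h2.1.trans_le h1.2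
    have e1' : m < n + 1 := by exact_mod_cast e1
    have e2' : n < m + 1 := by exact_mod_cast e2
    omega
  have hd : Pairwise (Disjoint on S) := by
    intro v w hvw
    rw [onFun, Set.disjoint_left]
    intro z h1 h2
    exact hvw (Prod.ext (aux _ _ _ h1.1 h2.1) (aux _ _ _ h1.2 h2.2))
  have hgm : ∀ v : ℤ × ℤ, Measurable (fun z : ℝ × ℝ => g (z.1 + v.1, z.2 + v.2)) := fun v =>
    hg.comp (by fun_prop)
  rw [lintegral_tsum (fun v => (hgm v).aemeasurable), ← setLIntegral_univ, ← hu,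
    lintegral_iUnion hm hd]
  refine tsum_congr fun v => ?_
  have hmp := measurePreserving_add_right (volume : Measure (ℝ × ℝ)) ((v.1:ℝ), (v.2:ℝ))
  have := hmp.setLIntegral_comp_preimage (hm v) hg
  rw [← this, muQ_eq]
  have e : (fun x : ℝ × ℝ => x + ((v.1:ℝ), (v.2:ℝ))) ⁻¹' S v = Ioc 0 1 ×ˢ Ioc 0 1 := by
    ext z
    simp only [hS, mem_preimage, mem_prod, mem_Ioc, Prod.fst_add, Prod.snd_add]
    constructor
    · rintro ⟨⟨h1, h2⟩, h3, h4⟩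
      refine ⟨⟨?_, ?_⟩, ?_, ?_⟩ <;> linarith
    · rintro ⟨⟨h1, h2⟩, h3, h4⟩
      refine ⟨⟨?_, ?_⟩, ?_, ?_⟩ <;> linarith
  rw [e]
  rfl

lemma proj_int (z : ℝ × ℝ) (m n : ℤ) : proj (z.1 + m, z.2 + n) = proj z :=
  (proj_eq_iff.2 ⟨m, n, rfl⟩).symm

lemma proj_qmp : Measure.QuasiMeasurePreserving proj volume volume := by
  refine ⟨proj_cont.measurable, ?_⟩
  refine Measure.AbsolutelyContinuous.mk fun B hB h0 => ?_
  rw [Measure.map_apply proj_cont.measurable hB]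
  have hB' := proj_cont.measurable hB
  rw [← lintegral_indicator_one hB', tile_lint (measurable_one.indicator hB')]
  have e : ∀ (z : ℝ × ℝ) (v : ℤ × ℤ), (proj ⁻¹' B).indicator (1 : ℝ × ℝ → ENNReal) (z.1 + v.1, z.2 + v.2) =
      (proj ⁻¹' B).indicator 1 z := by
    intro z v
    have h := proj_int z v.1 v.2
    by_cases hz : z ∈ proj ⁻¹' B
    · rw [indicator_of_mem hz, indicator_of_mem (by rw [mem_preimage, h]; exact hz)]; rfl
    · rw [indicator_of_notMem hz, indicator_of_notMem (by rw [mem_preimage, h]; exact hz)]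
  simp only [e]
  rw [lintegral_tsum (fun v => (measurable_one.indicator hB').aemeasurable)]
  simp only [lintegral_indicator_one hB', proj_mp.measure_preimage hB.nullMeasurableSet, h0, tsum_zero]

/-- measurable section of the projection -/
def sect (t : T2) : ℝ × ℝ :=
  ((AddCircle.measurableEquivIoc (1:ℝ) 0 t.1 : ℝ), (AddCircle.measurableEquivIoc (1:ℝ) 0 t.2 : ℝ))

lemma sect_meas : Measurable sect := by
  unfold sect
  exact (measurable_subtype_coe.comp ((AddCircle.measurableEquivIoc (1:ℝ) 0).measurable.comp measurable_fst)).prodMk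
    (measurable_subtype_coe.comp ((AddCircle.measurableEquivIoc (1:ℝ) 0).measurable.comp measurable_snd))

lemma proj_sect (t : T2) : proj (sect t) = t := by
  have h : ∀ a : AddCircle (1:ℝ), (((AddCircle.measurableEquivIoc (1:ℝ) 0 a : ℝ)) : AddCircle (1:ℝ)) = a := fun a =>
    (AddCircle.measurableEquivIoc (1:ℝ) 0).symm_apply_apply a
  unfold proj sect
  ext
  · exact h t.1
  · exact h t.2

lemma Per.sect {α : Type*} {u : ℝ × ℝ → α} (hu : Per u) (z : ℝ × ℝ) : u (sect (proj z)) = u z := by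
  obtain ⟨m, n, e⟩ := proj_eq_iff.1 (proj_sect (proj z))
  conv_rhs => rw [e]
  exact (hu.int m n _ _).symm

/-- the induced torus map -/
def tor (F : ℝ × ℝ → ℝ × ℝ) (t : T2) : T2 := proj (F (sect t))

lemma tor_proj {F} (hF : Eqv F) (x : ℝ × ℝ) : proj (F x) = tor F (proj x) :=
  ((proj_per.eqv hF).sect x).symm

lemma proj_oq : IsOpenQuotientMap proj := by
  have h : IsOpenQuotientMap (fun x : ℝ => (x : AddCircle (1:ℝ))) := QuotientAddGroup.isOpenQuotientMap_mk
  exact h.prodMap h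

lemma mp_of_tor {F} (hF : Eqv F) (hc : Continuous F) (ht : MeasurePreserving (tor F) volume volume) :
    MeasurePreserving F volume volume := by
  refine ⟨hc.measurable, ?_⟩
  ext B hB
  rw [Measure.map_apply hc.measurable hB]
  have hB' := hc.measurable hB
  rw [← lintegral_indicator_one hB', tile_lint (measurable_one.indicator hB'),
    ← lintegral_indicator_one hB, tile_lint (measurable_one.indicator hB)]
  set u : ℝ × ℝ → ENNReal := fun z => ∑' v : ℤ × ℤ, B.indicator 1 (z.1 + v.1, z.2 + v.2) with hu
  have hum : Measurable u := by
    refine Measurable.tsum fun v => (measurable_one.indicator hB).comp ?_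
    fun_prop
  have hup : Per u := by
    constructor
    · intro x y
      simp only [hu]
      rw [← (Equiv.addRight ((1:ℤ), (0:ℤ))).tsum_eq (fun v : ℤ × ℤ => B.indicator (1 : ℝ × ℝ → ENNReal) (x + v.1, y + v.2))]
      refine tsum_congr fun v => ?_
      congr 1
      simp; ring
    · intro x y
      simp only [hu]
      rw [← (Equiv.addRight ((0:ℤ), (1:ℤ))).tsum_eq (fun v : ℤ × ℤ => B.indicator (1 : ℝ × ℝ → ENNReal) (x + v.1, y + v.2))]
      refine tsum_congr fun v => ?_
      congr 1
      simp; ring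
  have e1 : ∀ z : ℝ × ℝ, ∑' v : ℤ × ℤ, (F ⁻¹' B).indicator (1 : ℝ × ℝ → ENNReal) (z.1 + v.1, z.2 + v.2) = u (F z) := by
    intro z
    refine tsum_congr fun v => ?_
    have := hF z v.1 v.2
    rw [← this]; rfl
  simp only [e1]
  have e2 : ∀ z, u (F z) = u (sect (tor F (proj z))) := fun z => by
    rw [← tor_proj hF, hup.sect]
  have e3 : ∫⁻ z, u z ∂muQ = ∫⁻ z, u (sect (proj z)) ∂muQ := lintegral_congr fun z => (hup.sect z).symm
  have hus := hum.comp sect_meas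
  simp only [e2]
  rw [e3, proj_mp.lintegral_comp (f := fun t => u (sect t)) hus,
    proj_mp.lintegral_comp (f := fun t => u (sect (tor F t))) (hus.comp ht.measurable),
    ht.lintegral_comp (f := fun t => u (sect t)) hus]

lemma HLat_ae : ∀ᵐ z ∂muQ, z ∉ HLat := by
  have h1 : volume HLat = 0 := measure_mono_null (fun z hz => hz.2) line_null
  have : ∀ᵐ z ∂(volume : Measure (ℝ × ℝ)), z ∉ HLat := measure_eq_zero_iff_ae_notMem.1 h1
  rw [muQ_eq]
  exact ae_restrict_of_ae this

section
variable {Ψ : ℝ × ℝ → ℝ × ℝ} (hΨ : PsiD Ψ) {φ : ℝ → ℝ} (hφ : PhiD φ)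
include hΨ hφ

lemma tor_fw {z : ℝ × ℝ} (hz : z ∉ HLat) :
    tor (FF Ψ (fw φ)) (proj (Ψ z)) = proj (Ψ (fw φ z)) := by
  rw [← tor_proj (FF_eqv hΨ (adm_fw hφ.phi0))]
  have := FF_eq hΨ (adm_fw hφ.phi0) hz 0 0
  simp only [Int.cast_zero, add_zero] at this
  rw [this]

lemma tor_mp (hc : Continuous (FF Ψ (fw φ))) :
    MeasurePreserving (tor (FF Ψ (fw φ))) volume volume := by
  have hm : Measurable (tor (FF Ψ (fw φ))) := proj_cont.measurable.comp (hc.measurable.comp sect_meas)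
  refine ⟨hm, ?_⟩
  have hpm : Measurable (fun z => proj (Ψ z)) := proj_cont.measurable.comp hΨ.meas
  ext B hB
  rw [Measure.map_apply hm hB, ← hΨ.map, Measure.map_apply hpm (hm hB), Measure.map_apply hpm hB]
  have hB' := hpm hB
  rw [← lintegral_indicator_one (hpm (hm hB)), ← lintegral_indicator_one hB']
  have hper : Per ((fun z => proj (Ψ z)) ⁻¹' B |>.indicator (1 : ℝ × ℝ → ENNReal)) := by
    have : Per (fun z => B.indicator (1 : T2 → ENNReal) (proj (Ψ z))) := hΨ.per.comp (fun w => B.indicator (1 : T2 → ENNReal) (proj w))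
    exact this
  rw [← lint_gm_iter hφ (measurable_one.indicator hB') hper (Or.inl rfl) 6]
  refine lintegral_congr_ae ?_
  filter_upwards [HLat_ae] with z hz
  have := tor_fw hΨ hφ hz
  have e : z ∈ (fun z => proj (Ψ z)) ⁻¹' (tor (FF Ψ (fw φ)) ⁻¹' B) ↔
      (gm φ 1)^[6] z ∈ (fun z => proj (Ψ z)) ⁻¹' B := by
    simp only [mem_preimage, this]; rfl
  by_cases h : z ∈ (fun z => proj (Ψ z)) ⁻¹' (tor (FF Ψ (fw φ)) ⁻¹' B)
  · rw [indicator_of_mem h, indicator_of_mem (e.1 h)]; rfl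
  · rw [indicator_of_notMem h, indicator_of_notMem (fun h' => h (e.2 h'))]

lemma tor_erg (hc : Continuous (FF Ψ (fw φ))) : Ergodic (tor (FF Ψ (fw φ))) volume := by
  refine ⟨tor_mp hΨ hφ hc, ⟨?_⟩⟩
  intro B hB hinv
  have hpm : Measurable (fun z => proj (Ψ z)) := proj_cont.measurable.comp hΨ.meas
  set A : Set (ℝ × ℝ) := {z | z ∉ HLat ∧ proj (Ψ z) ∈ B} with hA
  have hAm : MeasurableSet A := HLat_closed.measurableSet.compl.inter (hpm hB)
  have hfw := adm_fw hφ.phi0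
  have hbw := adm_bw hφ.phi0
  have hAp : Per (fun z => z ∈ A) := by
    have h1 : Per (fun z => z ∈ HLat) := by
      have : ∀ x : ℝ, (∃ k : ℤ, x + 1 = k / 2) ↔ ∃ k : ℤ, x = k / 2 := by
        intro x
        constructor
        · rintro ⟨k, hk⟩; exact ⟨k - 2, by push_cast; linarith⟩
        · rintro ⟨k, hk⟩; exact ⟨k + 2, by push_cast; linarith⟩
      constructor
      · intro x y
        simp only [HLat, Set.mem_ofPred_eq, this]
      · intro x y
        simp only [HLat, Set.mem_ofPred_eq, this]
    have h2 : Per (fun z => proj (Ψ z) ∈ B) := hΨ.per.comp (fun w => proj w ∈ B)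
    constructor
    · intro x y
      have a := h1.l x y
      have b := h2.l x y
      simp only [hA, Set.mem_ofPred_eq] at a b ⊢
      rw [a, b]
    · intro x y
      have a := h1.r x y
      have b := h2.r x y
      simp only [hA, Set.mem_ofPred_eq] at a b ⊢
      rw [a, b]
  have hAi : ∀ z, (gm φ 1)^[6] z ∈ A ↔ z ∈ A := by
    intro z
    change fw φ z ∈ A ↔ z ∈ A
    by_cases hz : z ∈ HLat
    · have : fw φ z ∈ HLat := by
        by_contra h
        have := hbw.lat _ h
        rw [bw_fw] at this
        exact this hz
      simp [hA, hz, this]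
    · have h1 := hfw.lat z hz
      have h2 : proj (Ψ (fw φ z)) ∈ B ↔ proj (Ψ z) ∈ B := by
        rw [← tor_fw hΨ hφ hz]
        change proj (Ψ z) ∈ tor (FF Ψ (fw φ)) ⁻¹' B ↔ _
        rw [hinv]
      simp [hA, hz, h1, h2]
  have hBA : volume B = muQ A := by
    rw [← hΨ.map, Measure.map_apply hpm hB]
    apply measure_congr
    filter_upwards [HLat_ae] with z hz
    apply propext
    change proj (Ψ z) ∈ B ↔ z ∉ HLat ∧ proj (Ψ z) ∈ B
    simp [hz]
  rw [eventuallyConst_set']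
  rcases PhiErg hφ (Or.inl rfl) hAm hAp hAi with h | h
  · left; rw [← hBA] at h; exact ae_eq_empty.2 h
  · right
    rw [← hBA] at h
    have : IsProbabilityMeasure (volume : Measure T2) := by
      rw [← hΨ.map]
      have : IsProbabilityMeasure muQ := by unfold muQ; infer_instance
      exact Measure.isProbabilityMeasure_map hpm.aemeasurable
    rw [ae_eq_univ, prob_compl_eq_zero_iff hB]; exact h

/-- target sets -/
def OO (Ψ : ℝ × ℝ → ℝ × ℝ) (q : ℝ × ℝ) (k : ℕ) : Set (ℝ × ℝ) :=
  {w | (∃ z, z ∉ HLat ∧ Ψ z = w) ∧ (k:ℝ) + 1 < ‖w‖ ∧ ‖‖w‖⁻¹ • w - q‖ < 2 / ((k:ℝ) + 1)}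

omit hφ in
lemma OO_open (q : ℝ × ℝ) (k : ℕ) : IsOpen (OO Ψ q k) := by
  rw [isOpen_iff_mem_nhds]
  rintro w ⟨⟨z, hz, rfl⟩, h1, h2⟩
  obtain ⟨G, -, -, hG⟩ := hΨ.LI z hz
  have hk : (0:ℝ) ≤ k := by positivity
  have hne : ‖Ψ z‖ ≠ 0 := by linarith
  have hcont : ContinuousAt (fun w : ℝ × ℝ => ‖‖w‖⁻¹ • w - q‖) (Ψ z) :=
    (((continuous_norm.continuousAt.inv₀ hne).smul continuousAt_id).sub continuousAt_const).norm
  have e2 := hcont.eventually_lt continuousAt_const h2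
  have e1 := continuousAt_const.eventually_lt continuous_norm.continuousAt h1
  filter_upwards [hG, e1, e2] with w a b c
  exact ⟨⟨G w, a.1, a.2⟩, b, c⟩

lemma hit (hc : Continuous (FF Ψ (fw φ))) {q : ℝ × ℝ} {k : ℕ} (hne : (OO Ψ q k).Nonempty) :
    ∀ᵐ t ∂(volume : Measure T2), ∃ N : ℕ, (tor (FF Ψ (fw φ)))^[N] t ∈ proj '' OO Ψ q k := by
  set f := tor (FF Ψ (fw φ)) with hf
  have herg := tor_erg hΨ hφ hc
  have hO : IsOpen (proj '' OO Ψ q k) := proj_oq.isOpenMap _ (OO_open hΨ q k)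
  set E : Set T2 := {t | ∃ N : ℕ, f^[N] t ∈ proj '' OO Ψ q k} with hE
  have hEm : MeasurableSet E := by
    have : E = ⋃ N : ℕ, f^[N] ⁻¹' (proj '' OO Ψ q k) := by ext t; simp [hE]
    rw [this]
    exact MeasurableSet.iUnion fun N => (herg.measurable.iterate N) hO.measurableSet
  have hsub : f ⁻¹' E ⊆ E := by
    rintro t ⟨N, hN⟩
    exact ⟨N + 1, by rwa [iterate_succ_apply]⟩
  have hpos : volume E ≠ 0 := by
    have h1 : proj '' OO Ψ q k ⊆ E := fun t ht => ⟨0, ht⟩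
    have h2 := hO.measure_pos volume (hne.image proj)
    exact (h2.trans_le (measure_mono h1)).ne'
  have hprob : IsFiniteMeasure (volume : Measure T2) := inferInstance
  rcases herg.ae_empty_or_univ_of_preimage_ae_le hEm.nullMeasurableSet hsub.eventuallyLE with h | h
  · exact absurd (ae_eq_empty.1 h) hpos
  · filter_upwards [h] with t ht
    have : E t ↔ True := by rw [ht]; rfl
    exact this.2 trivial

omit hφ in
lemma OO_ne {u q : ℝ × ℝ} (hu : ‖u‖ = 1) {k : ℕ} (hq : ‖q - u‖ < 1 / ((k:ℝ) + 1)) : (OO Ψ q k).Nonempty := by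
  obtain ⟨z, hz, h1, h2⟩ := hΨ.dir u hu (1 / ((k:ℝ) + 1)) (by positivity) ((k:ℝ) + 1)
  refine ⟨Ψ z, ⟨z, hz, rfl⟩, h1, ?_⟩
  have : ‖‖Ψ z‖⁻¹ • Ψ z - q‖ ≤ ‖‖Ψ z‖⁻¹ • Ψ z - u‖ + ‖q - u‖ := by
    rw [show ‖Ψ z‖⁻¹ • Ψ z - q = (‖Ψ z‖⁻¹ • Ψ z - u) - (q - u) by abel]; exact norm_sub_le _ _
  have e : 2 / ((k:ℝ) + 1) = 1 / ((k:ℝ) + 1) + 1 / ((k:ℝ) + 1) := by ring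
  linarith

lemma dirs (hc : Continuous (FF Ψ (fw φ))) : ∀ᵐ x ∂(volume : Measure (ℝ × ℝ)),
    ∀ u : ℝ × ℝ, ‖u‖ = 1 → ∃ n : ℕ → ℕ,
      Tendsto (fun k => ‖(FF Ψ (fw φ))^[n k] x‖) atTop atTop ∧
      Tendsto (fun k => ‖(FF Ψ (fw φ))^[n k] x - x‖⁻¹ • ((FF Ψ (fw φ))^[n k] x - x)) atTop (𝓝 u) := by
  have hfw := adm_fw hφ.phi0
  have hbw := adm_bw hφ.phi0
  set F := FF Ψ (fw φ) with hF
  have h1 : ∀ᵐ t ∂(volume : Measure T2), ∀ i k : ℕ, (OO Ψ (TopologicalSpace.denseSeq (ℝ × ℝ) i) k).Nonempty →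
      ∃ N : ℕ, (tor F)^[N] t ∈ proj '' OO Ψ (TopologicalSpace.denseSeq (ℝ × ℝ) i) k := by
    rw [ae_all_iff]; intro i
    rw [ae_all_iff]; intro k
    by_cases hne : (OO Ψ (TopologicalSpace.denseSeq (ℝ × ℝ) i) k).Nonempty
    · filter_upwards [hit hΨ hφ hc hne] with t ht _ using ht
    · exact Eventually.of_forall fun t h => absurd h hne
  filter_upwards [proj_qmp.ae h1] with x hx
  intro u hu
  have hiter : ∀ N, proj (F^[N] x) = (tor F)^[N] (proj x) := by
    intro N
    have : Semiconj proj F (tor F) := fun x => tor_proj (FF_eqv hΨ hfw) x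
    exact (this.iterate_right N) x
  have h2 : ∀ k : ℕ, ∃ N : ℕ, ∃ z, z ∉ HLat ∧ ∃ m n : ℤ, F^[N] x = ((Ψ z).1 + m, (Ψ z).2 + n) ∧
      (k:ℝ) + 1 < ‖Ψ z‖ ∧ ‖‖Ψ z‖⁻¹ • Ψ z - u‖ < 3 / ((k:ℝ) + 1) := by
    intro k
    have hd := TopologicalSpace.denseRange_denseSeq (ℝ × ℝ)
    obtain ⟨i, hi⟩ := hd.exists_dist_lt u (by positivity : 0 < 1 / ((k:ℝ) + 1))
    rw [dist_comm, dist_eq_norm] at hi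
    obtain ⟨N, w, ⟨⟨z, hz, rfl⟩, a, b⟩, hN⟩ := hx i k (OO_ne hΨ hu hi)
    rw [← hiter] at hN
    obtain ⟨m, n, e⟩ := proj_eq_iff.1 hN
    refine ⟨N, z, hz, m, n, e, a, ?_⟩
    set q := TopologicalSpace.denseSeq (ℝ × ℝ) i
    have : ‖‖Ψ z‖⁻¹ • Ψ z - u‖ ≤ ‖‖Ψ z‖⁻¹ • Ψ z - q‖ + ‖q - u‖ := by
      rw [show ‖Ψ z‖⁻¹ • Ψ z - u = (‖Ψ z‖⁻¹ • Ψ z - q) + (q - u) by abel]; exact norm_add_le _ _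
    have e : 3 / ((k:ℝ) + 1) = 2 / ((k:ℝ) + 1) + 1 / ((k:ℝ) + 1) := by ring
    linarith
  have hV : x ∈ VV Ψ := by
    by_contra hV
    obtain ⟨N, z, hz, m, n, e, -⟩ := h2 0
    apply hV
    rw [iterate_fixed (FF_off hV) N] at e
    exact ⟨z, hz, m, n, e⟩
  obtain ⟨z0, hz0, a, b, hx0⟩ := hV
  set v : ℝ × ℝ := ((a:ℝ), (b:ℝ)) with hv
  have h3 : ∀ k : ℕ, ∃ N : ℕ, ∃ w : ℝ × ℝ, F^[N] x = w + v ∧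
      (k:ℝ) + 1 < ‖w‖ ∧ ‖‖w‖⁻¹ • w - u‖ < 3 / ((k:ℝ) + 1) := by
    intro k
    obtain ⟨N, z, hz, m, n, e, h4, h5⟩ := h2 k
    refine ⟨N, Ψ z, ?_, h4, h5⟩
    have e' : F^[N] x = ((Ψ ((fw φ)^[N] z0)).1 + a, (Ψ ((fw φ)^[N] z0)).2 + b) := by
      rw [hx0, hF, FF_iter hΨ hfw hz0]
    have e1 := congrArg Prod.fst (e.symm.trans e')
    have e2 := congrArg Prod.snd (e.symm.trans e')
    simp only at e1 e2
    obtain ⟨q1, q2, -⟩ := hΨ.inj z hz _ ((adm_iter hfw N).lat z0 hz0)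
      (a - m) (b - n) (by ext <;> push_cast <;> linarith)
    rw [sub_eq_zero] at q1 q2
    rw [e, hv, q1, q2]; rfl
  choose N w hw1 hw2 hw3 using h3
  refine ⟨N, ?_, ?_⟩
  · have hlow : ∀ k : ℕ, (k:ℝ) + (1 - ‖v‖) ≤ ‖F^[N k] x‖ := by
      intro k
      rw [hw1]
      have := norm_sub_le (w k + v) v
      rw [add_sub_cancel_right] at this
      have := hw2 k
      linarith
    exact tendsto_atTop_mono hlow (tendsto_atTop_add_const_right _ _ tendsto_natCast_atTop_atTop)
  · rw [tendsto_iff_norm_sub_tendsto_zero]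
    set c := ‖v - x‖
    have hb : ∀ k : ℕ, ‖‖F^[N k] x - x‖⁻¹ • (F^[N k] x - x) - u‖ ≤ (6 + 2 * c) * (1 / ((k:ℝ) + 1)) := by
      intro k
      have hk : (0:ℝ) < (k:ℝ) + 1 := by positivity
      have ht : 0 < ‖w k‖ := hk.trans (hw2 k)
      refine (dir_norm hu ht).trans ?_
      have e1 : ‖F^[N k] x - x - ‖w k‖ • u‖ ≤ ‖w k‖ * ‖‖w k‖⁻¹ • w k - u‖ + c := by
        rw [← Real.norm_of_nonneg ht.le, norm_norm, ← norm_norm (w k), ← norm_smul, smul_sub, norm_norm,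
          smul_smul, mul_inv_cancel₀ ht.ne', one_smul, hw1]
        rw [show w k + v - x - ‖w k‖ • u = (w k - ‖w k‖ • u) + (v - x) by abel]
        exact norm_add_le _ _
      have e2 : ‖w k‖ * ‖‖w k‖⁻¹ • w k - u‖ ≤ ‖w k‖ * (3 / ((k:ℝ) + 1)) :=
        mul_le_mul_of_nonneg_left (hw3 k).le ht.le
      have hc0 : 0 ≤ c := norm_nonneg _
      have e3 : c ≤ c * (‖w k‖ * (1 / ((k:ℝ) + 1))) := by
        apply le_mul_of_one_le_right hc0
        rw [mul_one_div, le_div_iff₀ hk]; linarith [hw2 k]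
      rw [div_le_iff₀ ht]
      have e4 : (6 + 2 * c) * (1 / ((k:ℝ) + 1)) * ‖w k‖ =
        2 * (‖w k‖ * (3 / ((k:ℝ) + 1)) + c * (‖w k‖ * (1 / ((k:ℝ) + 1)))) := by ring
      rw [e4]
      linarith
    refine squeeze_zero (fun k => norm_nonneg _) hb ?_
    have := (tendsto_one_div_add_atTop_nhds_zero_nat (𝕜 := ℝ)).const_mul (6 + 2 * c)
    simpa using this

end

/-- the final statement, in the form needed -/
theorem main_final :
    ∃ F : (ℝ × ℝ) ≃ₜ (ℝ × ℝ),
      ContDiff ℝ (⊤ : ℕ∞) ⇑F ∧ ContDiff ℝ (⊤ : ℕ∞) ⇑F.symm ∧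
      (∀ (x : ℝ × ℝ) (v : ℤ × ℤ),
        F (x + ((v.1 : ℝ), (v.2 : ℝ))) = F x + ((v.1 : ℝ), (v.2 : ℝ))) ∧
      MeasurePreserving ⇑F (volume : Measure (ℝ × ℝ)) volume ∧
      (∀ x : ℝ × ℝ,
        Tendsto (fun n : ℕ => ((n : ℝ))⁻¹ • ((⇑F)^[n] x - x)) atTop (𝓝 0)) ∧
      (∃ f : T2 → T2, (∀ x : ℝ × ℝ, proj (F x) = f (proj x)) ∧
        Ergodic f (volume : Measure T2)) ∧
      (∀ᵐ x ∂(volume : Measure (ℝ × ℝ)),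
        ∀ u : ℝ × ℝ, ‖u‖ = 1 →
          ∃ n : ℕ → ℕ,
            Tendsto (fun k => ‖(⇑F)^[n k] x‖) atTop atTop ∧
            Tendsto (fun k =>
              ‖(⇑F)^[n k] x - x‖⁻¹ • ((⇑F)^[n k] x - x)) atTop (𝓝 u)) := by
  obtain ⟨Ψ, hΨ⟩ := psiD_exists
  obtain ⟨φ, hφ, h1, h2, h3⟩ := main2 hΨ
  have hfw := adm_fw hφ.phi0
  have hbw := adm_bw hφ.phi0
  let F : (ℝ × ℝ) ≃ₜ (ℝ × ℝ) :=
    { toFun := FF Ψ (fw φ)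
      invFun := FF Ψ (bw φ)
      left_inv := FF_inv hΨ hbw hfw (bw_fw φ)
      right_inv := FF_inv hΨ hfw hbw (fw_bw φ)
      continuous_toFun := h1.continuous
      continuous_invFun := h2.continuous }
  have he := FF_eqv hΨ hfw
  refine ⟨F, h1, h2, fun x v => he x v.1 v.2, ?_, h3, ⟨tor (FF Ψ (fw φ)), tor_proj he, ?_⟩, ?_⟩
  · exact mp_of_tor he h1.continuous (tor_mp hΨ hφ h1.continuous)
  · exact tor_erg hΨ hφ h1.continuous
  · exact dirs hΨ hφ h1.continuous

end

/-- **Koropecki–Tal.**  There is a `C^∞`, Lebesgue-measure-preserving diffeomorphism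
`F : ℝ² → ℝ²` commuting with integer translations whose induced torus map is an
irrotational pseudo-rotation, ergodic for Lebesgue measure, and such that almost every
forward `F`-orbit accumulates at infinity in every direction. -/
theorem exists_ergodic_irrotational_pseudo_rotation_accumulating_everywhere :
    ∃ F : (ℝ × ℝ) ≃ₜ (ℝ × ℝ),
      ContDiff ℝ (⊤ : ℕ∞) ⇑F ∧ ContDiff ℝ (⊤ : ℕ∞) ⇑F.symm ∧
      (∀ (x : ℝ × ℝ) (v : ℤ × ℤ),
        F (x + ((v.1 : ℝ), (v.2 : ℝ))) = F x + ((v.1 : ℝ), (v.2 : ℝ))) ∧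
      MeasurePreserving ⇑F (volume : Measure (ℝ × ℝ)) volume ∧
      (∀ x : ℝ × ℝ,
        Tendsto (fun n : ℕ => ((n : ℝ))⁻¹ • ((⇑F)^[n] x - x)) atTop (𝓝 0)) ∧
      (∃ f : T2 → T2, (∀ x : ℝ × ℝ, proj (F x) = f (proj x)) ∧
        Ergodic f (volume : Measure T2)) ∧
      (∀ᵐ x ∂(volume : Measure (ℝ × ℝ)),
        ∀ u : ℝ × ℝ, ‖u‖ = 1 →
          ∃ n : ℕ → ℕ,
            Tendsto (fun k => ‖(⇑F)^[n k] x‖) atTop atTop ∧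
            Tendsto (fun k =>
              ‖(⇑F)^[n k] x - x‖⁻¹ • ((⇑F)^[n k] x - x)) atTop (𝓝 u)) := by
  exact main_final
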